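/- Let p ∈ [2,∞), T ∈ (0,∞), and assume ∫_0^T |a(t)| dt < ∞ and that δ(t) > 0 for a.e. t ∈ (0,T), where δ(t) is the smallest eigenvalue of A(t). Let f be strongly measurable with ∫_0^T ‖f(t,·)‖_{L_p}^p δ(t)^{1-p} dt < ∞, and let u : [0,T] → L_p(ℝ^d) be a weak solution of ∂_t u = a^{ij}(t) u_{x^i x^j} + f with u(0) = 0, continuous from [0,T] into L_p(ℝ^d). Then for a.e. t ∈ (0,T) the distributional second derivatives of u(t,·) are represented by functions u_{x^i x^j}(t,·) ∈ L_p(ℝ^d), and ∫_0^T Σ_{i,j} ‖u_{x^i x^j}(t,·)‖_{L_p}^p δ(t) dt ≤ N ∫_0^T ‖f(t,·)‖_{L_p}^p δ(t)^{1-p} dt, where N depends only on d and p. -/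

import Mathlib

open MeasureTheory Set ENNReal

noncomputable section

/-- The partial derivative `∂_{x^i} φ` of a function on `ℝ^d`. -/
def pd {d : ℕ} (i : Fin d) (φ : (Fin d → ℝ) → ℝ) : (Fin d → ℝ) → ℝ :=
  fun x => fderiv ℝ φ x (Pi.single i 1)

/-- `|a(t)| = max_{i,j} |a^{ij}(t)|`. -/
def aMax {d : ℕ} (a : ℝ → Fin d → Fin d → ℝ) (t : ℝ) : ℝ :=
  ⨆ i, ⨆ j, |a t i j|

/-- `u` is a weak solution of `∂_t u = a^{ij}(t) u_{x^i x^j} + f`, `u(0) = u₀`, on `[0,T]`. -/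
def IsWeakSolution {d : ℕ} (p : ℝ≥0∞) (T : ℝ) (a : ℝ → Fin d → Fin d → ℝ)
    (u0 : Lp ℝ p (volume : Measure (Fin d → ℝ)))
    (f u : ℝ → Lp ℝ p (volume : Measure (Fin d → ℝ))) : Prop :=
  ∀ φ : (Fin d → ℝ) → ℝ, ContDiff ℝ (⊤ : ℕ∞) φ → HasCompactSupport φ →
    ∀ t ∈ Icc (0:ℝ) T,
      (∫ x, u t x * φ x) =
        (∫ x, u0 x * φ x) +
        ∫ s in Ioc (0:ℝ) t,
          ((∑ i, ∑ j, a s i j * ∫ x, u s x * pd i (pd j φ) x)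
            + ∫ x, f s x * φ x)

section

/-- Parabolic dyadic index of a point at level `n`. -/
def dIdx {d : ℕ} (n : ℤ) (z : ℝ × (Fin d → ℝ)) : ℤ × (Fin d → ℤ) :=
  (⌊z.1 * (4:ℝ) ^ n⌋, fun i => ⌊z.2 i * (2:ℝ) ^ n⌋)

/-- Parabolic dyadic cube. -/
def dCube {d : ℕ} (n : ℤ) (k : ℤ × (Fin d → ℤ)) : Set (ℝ × (Fin d → ℝ)) :=
  {z | dIdx n z = k}

/-- Volume of a parabolic dyadic cube of level `n`. -/
def dVol (d : ℕ) (n : ℤ) : ℝ := (4:ℝ) ^ (-n) * ((2:ℝ) ^ (-n)) ^ d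

lemma dVol_pos (d : ℕ) (n : ℤ) : 0 < dVol d n := by unfold dVol; positivity

lemma measurable_dIdx {d : ℕ} (n : ℤ) : Measurable (dIdx (d := d) n) := by
  unfold dIdx
  refine Measurable.prodMk ?_ ?_
  · exact Int.measurable_floor.comp (by fun_prop)
  · exact measurable_pi_lambda _ fun i => Int.measurable_floor.comp (by fun_prop)

lemma measurableSet_dCube {d : ℕ} (n : ℤ) (k : ℤ × (Fin d → ℤ)) : MeasurableSet (dCube n k) :=
  measurable_dIdx n (measurableSet_singleton k)

lemma floor_mul_iff {x c : ℝ} (hc : 0 < c) (k : ℤ) :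
    ⌊x * c⌋ = k ↔ x ∈ Ico ((k:ℝ) * c⁻¹) ((k + 1) * c⁻¹) := by
  rw [Int.floor_eq_iff, mem_Ico, ← div_eq_mul_inv, ← div_eq_mul_inv, div_le_iff₀ hc, lt_div_iff₀ hc]

lemma dCube_eq {d : ℕ} (n : ℤ) (k : ℤ × (Fin d → ℤ)) :
    dCube n k = Ico ((k.1:ℝ) * ((4:ℝ)^n)⁻¹) ((k.1 + 1) * ((4:ℝ)^n)⁻¹) ×ˢ
      Set.pi univ (fun i => Ico ((k.2 i:ℝ) * ((2:ℝ)^n)⁻¹) ((k.2 i + 1) * ((2:ℝ)^n)⁻¹)) := by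
  ext z
  simp only [dCube, dIdx, mem_setOf_eq, mem_prod, mem_pi, mem_univ, true_imp_iff]
  rw [Prod.ext_iff, funext_iff]
  simp only
  rw [floor_mul_iff (by positivity)]
  refine and_congr Iff.rfl (forall_congr' fun i => ?_)
  rw [floor_mul_iff (by positivity)]

lemma volume_dCube {d : ℕ} (n : ℤ) (k : ℤ × (Fin d → ℤ)) :
    volume (dCube n k) = ENNReal.ofReal (dVol d n) := by
  rw [dCube_eq, Measure.volume_eq_prod, Measure.prod_prod, Real.volume_Ico, Real.volume_pi_Ico]
  unfold dVol
  rw [ENNReal.ofReal_mul (by positivity), ENNReal.ofReal_pow (by positivity)]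
  congr 1
  · congr 1; rw [zpow_neg]; ring
  · rw [Finset.prod_congr rfl (g := fun _ => ENNReal.ofReal ((2:ℝ) ^ (-n)))]
    · simp
    · intro i _; congr 1; rw [zpow_neg]; ring

lemma floor_nest {c x y : ℝ} (N : ℕ) (hN : 0 < N) (h : ⌊x * (c * N)⌋ = ⌊y * (c * N)⌋) :
    ⌊x * c⌋ = ⌊y * c⌋ := by
  have key : ∀ r : ℝ, ⌊r * c⌋ = ⌊r * (c * N)⌋ / (N:ℤ) := by
    intro r
    have hN' : (0:ℝ) < N := by exact_mod_cast hN
    have := Int.floor_div_natCast (r * (c * N)) N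
    rw [← this]
    congr 1
    field_simp
  rw [key, key, h]

lemma dIdx_nest {d : ℕ} {m n : ℤ} (hmn : m ≤ n) {z w : ℝ × (Fin d → ℝ)} (h : dIdx n z = dIdx n w) :
    dIdx m z = dIdx m w := by
  obtain ⟨j, rfl⟩ := Int.le.dest hmn
  simp only [dIdx, Prod.mk.injEq] at h ⊢
  refine ⟨?_, ?_⟩
  · apply floor_nest (4 ^ j) (by positivity)
    have e : (4:ℝ) ^ m * ((4 ^ j : ℕ):ℝ) = (4:ℝ) ^ (m + (j:ℤ)) := by
      rw [zpow_add₀ (by norm_num)]; push_cast; simp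
    rw [e]; exact h.1
  · funext i
    apply floor_nest (2 ^ j) (by positivity)
    have e : (2:ℝ) ^ m * ((2 ^ j : ℕ):ℝ) = (2:ℝ) ^ (m + (j:ℤ)) := by
      rw [zpow_add₀ (by norm_num)]; push_cast; simp
    rw [e]; exact congrFun h.2 i

lemma dIdx_close {d : ℕ} (n : ℤ) {z w : ℝ × (Fin d → ℝ)} (h : dIdx n z = dIdx n w) :
    |z.1 - w.1| ≤ (4:ℝ) ^ (-n) ∧ ‖z.2 - w.2‖ ≤ (2:ℝ) ^ (-n) := by
  have key : ∀ c x y : ℝ, 0 < c → ⌊x * c⌋ = ⌊y * c⌋ → |x - y| ≤ c⁻¹ := by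
    intro c x y hc h
    have h1 := Int.abs_sub_lt_one_of_floor_eq_floor h
    rw [← sub_mul, abs_mul, abs_of_pos hc] at h1
    rw [← one_div, le_div_iff₀ hc]; exact h1.le
  simp only [dIdx, Prod.mk.injEq] at h
  refine ⟨?_, ?_⟩
  · rw [zpow_neg]; exact key _ _ _ (by positivity) h.1
  · rw [pi_norm_le_iff_of_nonneg (by positivity)]
    intro i
    rw [zpow_neg]; exact key _ _ _ (by positivity) (congrFun h.2 i)

lemma dVol_pred (d : ℕ) (n : ℤ) : dVol d (n - 1) = 2 ^ (d + 2) * dVol d n := by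
  unfold dVol
  have e1 : (4:ℝ) ^ (-(n-1)) = 4 * 4 ^ (-n) := by
    rw [show -(n-1) = 1 + -n by ring, zpow_add₀ (by norm_num)]; simp
  have e2 : (2:ℝ) ^ (-(n-1)) = 2 * 2 ^ (-n) := by
    rw [show -(n-1) = 1 + -n by ring, zpow_add₀ (by norm_num)]; simp
  rw [e1, e2, mul_pow]; ring

end

section

/-- A cube is bad if the average of `|F|` is larger than `α`. -/
def dBad {d : ℕ} (F : ℝ × (Fin d → ℝ) → ℝ) (α : ℝ) (n : ℤ) (k : ℤ × (Fin d → ℤ)) : Prop :=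
  ENNReal.ofReal (α * dVol d n) < ∫⁻ z in dCube n k, ‖F z‖ₑ

/-- The maximal bad cubes. -/
def dStop {d : ℕ} (F : ℝ × (Fin d → ℝ) → ℝ) (α : ℝ) : Set (ℤ × (ℤ × (Fin d → ℤ))) :=
  {j | dBad F α j.1 j.2 ∧ ∀ m < j.1, ∀ z ∈ dCube j.1 j.2, ¬ dBad F α m (dIdx m z)}

lemma dStop_uniq {d : ℕ} {F : ℝ × (Fin d → ℝ) → ℝ} {α : ℝ} {n m : ℤ} {z : ℝ × (Fin d → ℝ)}
    (hn : (n, dIdx n z) ∈ dStop F α) (hm : (m, dIdx m z) ∈ dStop F α) : n = m := by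
  rcases lt_trichotomy n m with h | h | h
  · exact absurd hn.1 (hm.2 n h z rfl)
  · exact h
  · exact absurd hm.1 (hn.2 m h z rfl)

lemma dStop_disj {d : ℕ} {F : ℝ × (Fin d → ℝ) → ℝ} {α : ℝ} :
    (dStop F α).PairwiseDisjoint (fun j => dCube j.1 j.2) := by
  rintro ⟨n, k⟩ hn ⟨m, l⟩ hm hne
  rw [Function.onFun, Set.disjoint_left]
  intro z hz hz'
  apply hne
  have e1 : dIdx n z = k := hz
  have e2 : dIdx m z = l := hz'
  subst e1; subst e2
  have := dStop_uniq hn hm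
  subst this; rfl

/-- The union of maximal bad cubes. -/
def dOm {d : ℕ} (F : ℝ × (Fin d → ℝ) → ℝ) (α : ℝ) : Set (ℝ × (Fin d → ℝ)) :=
  ⋃ j ∈ dStop F α, dCube j.1 j.2

lemma mem_dOm {d : ℕ} {F : ℝ × (Fin d → ℝ) → ℝ} {α : ℝ} {z : ℝ × (Fin d → ℝ)} :
    z ∈ dOm F α ↔ ∃ n, (n, dIdx n z) ∈ dStop F α := by
  simp only [dOm, mem_iUnion]
  constructor
  · rintro ⟨⟨n, k⟩, hj, hz⟩
    have e : dIdx n z = k := hz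
    subst e; exact ⟨n, hj⟩
  · rintro ⟨n, hn⟩
    exact ⟨_, hn, rfl⟩

lemma measurableSet_dOm {d : ℕ} (F : ℝ × (Fin d → ℝ) → ℝ) (α : ℝ) : MeasurableSet (dOm F α) :=
  MeasurableSet.biUnion (to_countable _) fun j _ => measurableSet_dCube _ _

lemma dStop_tsum_vol {d : ℕ} (F : ℝ × (Fin d → ℝ) → ℝ) {α : ℝ} (hα : 0 < α) :
    ENNReal.ofReal α * ∑' j : dStop F α, ENNReal.ofReal (dVol d j.1.1) ≤ ∫⁻ z, ‖F z‖ₑ := by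
  rw [← ENNReal.tsum_mul_left]
  calc _ ≤ ∑' j : dStop F α, ∫⁻ z in dCube j.1.1 j.1.2, ‖F z‖ₑ := by
        refine ENNReal.tsum_le_tsum fun j => ?_
        rw [← ENNReal.ofReal_mul hα.le]
        exact j.2.1.le
    _ = ∫⁻ z in dOm F α, ‖F z‖ₑ := by
        rw [dOm, lintegral_biUnion (to_countable _) (fun j _ => measurableSet_dCube _ _) dStop_disj]
    _ ≤ _ := setLIntegral_le_lintegral _ _

lemma dStop_avg {d : ℕ} {F : ℝ × (Fin d → ℝ) → ℝ} {α : ℝ} {j : ℤ × (ℤ × (Fin d → ℤ))}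
    (hj : j ∈ dStop F α) :
    ∫⁻ z in dCube j.1 j.2, ‖F z‖ₑ ≤ ENNReal.ofReal (α * (2 ^ (d + 2) * dVol d j.1)) := by
  have hne : (dCube j.1 j.2).Nonempty := by
    by_contra h
    rw [not_nonempty_iff_eq_empty] at h
    have := hj.1
    rw [dBad, h] at this
    simp at this
  obtain ⟨z, hz⟩ := hne
  have h1 := hj.2 (j.1 - 1) (by omega) z hz
  rw [dBad, not_lt, dVol_pred] at h1
  refine le_trans (lintegral_mono_set ?_) h1
  intro w hw
  exact dIdx_nest (by omega) ((show dIdx j.1 w = j.2 from hw).trans (show dIdx j.1 z = j.2 from hz).symm)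

lemma dOm_compl_le {d : ℕ} {F : ℝ × (Fin d → ℝ) → ℝ} (hF : Continuous F) (hFi : Integrable F)
    {α : ℝ} (hα : 0 < α) {z : ℝ × (Fin d → ℝ)} (hz : z ∉ dOm F α) : |F z| ≤ α := by
  by_contra hcon
  push Not at hcon
  -- some small cube is bad
  have h1 : ∃ n, dBad F α n (dIdx n z) := by
    obtain ⟨r, hr, hball⟩ := Metric.isOpen_iff.1 (isOpen_lt continuous_const hF.abs) z hcon
    have t4 : Filter.Tendsto (fun n : ℕ => ((4:ℝ)⁻¹) ^ n) Filter.atTop (nhds 0) :=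
      tendsto_pow_atTop_nhds_zero_of_lt_one (by norm_num) (by norm_num)
    have t2 : Filter.Tendsto (fun n : ℕ => ((2:ℝ)⁻¹) ^ n) Filter.atTop (nhds 0) :=
      tendsto_pow_atTop_nhds_zero_of_lt_one (by norm_num) (by norm_num)
    obtain ⟨n, hn4, hn2⟩ := ((t4.eventually_lt_const hr).and (t2.eventually_lt_const hr)).exists
    refine ⟨n, ?_⟩
    have hsub : ∀ w ∈ dCube (n:ℤ) (dIdx (n:ℤ) z), α < |F w| := by
      intro w hw
      apply hball
      have := dIdx_close (n:ℤ) (show dIdx (n:ℤ) w = dIdx (n:ℤ) z from hw)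
      rw [Metric.mem_ball, dist_eq_norm, Prod.norm_def, max_lt_iff]
      refine ⟨lt_of_le_of_lt this.1 ?_, lt_of_le_of_lt this.2 ?_⟩
      · simpa using hn4
      · simpa using hn2
    rw [dBad, ENNReal.ofReal_mul hα.le, ← volume_dCube n (dIdx n z), ← setLIntegral_const]
    refine setLIntegral_strict_mono (measurableSet_dCube _ _) ?_ (by fun_prop) ?_ ?_
    · rw [volume_dCube]; simpa using dVol_pos d n
    · rw [setLIntegral_const, volume_dCube]; exact ENNReal.mul_ne_top ofReal_ne_top ofReal_ne_top
    · refine Filter.Eventually.of_forall fun w hw => ?_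
      rw [← ofReal_norm, Real.norm_eq_abs]
      exact (ENNReal.ofReal_lt_ofReal_iff (hα.trans (hsub w hw))).2 (hsub w hw)
  -- large cubes are good
  have hFfin : ∫⁻ z, ‖F z‖ₑ ≠ ⊤ := hFi.2.ne
  have h2 : ∃ b : ℤ, ∀ n, dBad F α n (dIdx n z) → b ≤ n := by
    obtain ⟨N, hN⟩ := exists_nat_gt ((∫⁻ z, ‖F z‖ₑ).toReal / α)
    refine ⟨-(N:ℤ), fun n hn => ?_⟩
    by_contra hlt
    push Not at hlt
    have hlt' : (N:ℤ) ≤ -n := by omega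
    rw [dBad] at hn
    have := hn.trans_le (setLIntegral_le_lintegral _ _)
    rw [ENNReal.ofReal_lt_iff_lt_toReal (by have := dVol_pos d n; positivity) hFfin] at this
    rw [div_lt_iff₀ hα] at hN
    have hV : (N:ℝ) ≤ dVol d n := by
      unfold dVol
      have a1 : (N:ℝ) ≤ (4:ℝ) ^ (-n) := by
        calc (N:ℝ) ≤ (4:ℝ) ^ N := by exact_mod_cast (Nat.lt_pow_self (by norm_num)).le
          _ = (4:ℝ) ^ (N:ℤ) := by simp
          _ ≤ _ := zpow_le_zpow_right₀ (by norm_num) hlt'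
      have a2 : 1 ≤ ((2:ℝ) ^ (-n)) ^ d := one_le_pow₀ (one_le_zpow₀ (by norm_num) (by omega))
      nlinarith [zpow_pos (show (0:ℝ) < 4 by norm_num) (-n)]
    nlinarith
  obtain ⟨n, hn, hmin⟩ := Int.exists_least_of_bdd h2 h1
  apply hz
  rw [mem_dOm]
  refine ⟨n, hn, fun m hm w hw => ?_⟩
  have : dIdx m w = dIdx m z := dIdx_nest hm.le hw
  rw [this]
  intro hb
  exact absurd (hmin m hb) (by simpa using hm)

/-- Enlarged cube around a base point. -/
def dStar {d : ℕ} (n : ℤ) (c : ℝ × (Fin d → ℝ)) : Set (ℝ × (Fin d → ℝ)) :=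
  {z | |z.1 - c.1| < 4 * (4:ℝ) ^ (-n) ∧ ‖z.2 - c.2‖ < 2 * (2:ℝ) ^ (-n)}

lemma volume_dStar {d : ℕ} (n : ℤ) (c : ℝ × (Fin d → ℝ)) :
    volume (dStar n c) = ENNReal.ofReal (8 * 4 ^ d) * ENNReal.ofReal (dVol d n) := by
  have : dStar n c = Metric.ball c.1 (4 * (4:ℝ) ^ (-n)) ×ˢ Metric.ball c.2 (2 * (2:ℝ) ^ (-n)) := by
    ext z; simp [dStar, dist_eq_norm]
  rw [this, Measure.volume_eq_prod, Measure.prod_prod, Real.volume_ball, Real.volume_pi_ball _ (by positivity),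
    ← ENNReal.ofReal_mul (by positivity), ← ENNReal.ofReal_mul (by positivity)]
  congr 1
  unfold dVol
  simp only [Fintype.card_fin, mul_pow]
  rw [show (4:ℝ) ^ d = 2 ^ d * 2 ^ d by rw [← mul_pow]; norm_num]
  ring

lemma measurableSet_dStar {d : ℕ} (n : ℤ) (c : ℝ × (Fin d → ℝ)) : MeasurableSet (dStar n c) := by
  have : dStar n c = Metric.ball c.1 (4 * (4:ℝ) ^ (-n)) ×ˢ Metric.ball c.2 (2 * (2:ℝ) ^ (-n)) := by
    ext z; simp [dStar, dist_eq_norm]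
  rw [this]
  exact measurableSet_ball.prod measurableSet_ball

end

section

/-- Convolution operator. -/
def Tc {d : ℕ} (K F : ℝ × (Fin d → ℝ) → ℝ) (z : ℝ × (Fin d → ℝ)) : ℝ := ∫ w, K (z - w) * F w

/-- Average over a cube. -/
def dAv {d : ℕ} (F : ℝ × (Fin d → ℝ) → ℝ) (n : ℤ) (k : ℤ × (Fin d → ℤ)) : ℝ :=
  (∫ z in dCube n k, F z) / dVol d n

open Classical in
/-- Good part of the Calderon-Zygmund decomposition. -/
def dG {d : ℕ} (F : ℝ × (Fin d → ℝ) → ℝ) (α : ℝ) (z : ℝ × (Fin d → ℝ)) : ℝ :=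
  if h : ∃ n, (n, dIdx n z) ∈ dStop F α then dAv F h.choose (dIdx h.choose z) else F z

lemma dG_of_mem {d : ℕ} {F : ℝ × (Fin d → ℝ) → ℝ} {α : ℝ} {j : ℤ × (ℤ × (Fin d → ℤ))}
    (hj : j ∈ dStop F α) {z : ℝ × (Fin d → ℝ)} (hz : z ∈ dCube j.1 j.2) :
    dG F α z = dAv F j.1 j.2 := by
  obtain ⟨n, k⟩ := j
  have e : dIdx n z = k := hz
  subst e
  have h : ∃ n, (n, dIdx n z) ∈ dStop F α := ⟨n, hj⟩
  rw [dG, dif_pos h]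
  have := dStop_uniq h.choose_spec hj
  rw [this]

lemma dG_of_notMem {d : ℕ} {F : ℝ × (Fin d → ℝ) → ℝ} {α : ℝ}
    {z : ℝ × (Fin d → ℝ)} (hz : z ∉ dOm F α) : dG F α z = F z := by
  rw [mem_dOm] at hz
  rw [dG, dif_neg hz]

lemma measurable_dG {d : ℕ} {F : ℝ × (Fin d → ℝ) → ℝ} (hF : Measurable F) (α : ℝ) :
    Measurable (dG F α) := by
  intro s hs
  have : dG F α ⁻¹' s = ((dOm F α)ᶜ ∩ F ⁻¹' s) ∪
      ⋃ j ∈ {j ∈ dStop F α | dAv F j.1 j.2 ∈ s}, dCube j.1 j.2 := by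
    ext z
    simp only [mem_union, mem_inter_iff, mem_preimage, mem_compl_iff, mem_iUnion]
    by_cases hz : z ∈ dOm F α
    · simp only [hz, not_true, false_and, false_or]
      obtain ⟨j, hj, hzj⟩ := mem_iUnion₂.1 hz
      constructor
      · intro h
        rw [dG_of_mem hj hzj] at h
        exact ⟨j, ⟨hj, h⟩, hzj⟩
      · rintro ⟨i, ⟨hi, h⟩, hzi⟩
        rw [dG_of_mem hi hzi]; exact h
    · simp only [hz, not_false_iff, true_and]
      rw [dG_of_notMem hz]
      constructor
      · exact Or.inl
      · rintro (h | ⟨i, ⟨hi, h⟩, hzi⟩)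
        · exact h
        · exact absurd (mem_iUnion₂.2 ⟨i, hi, hzi⟩) hz
  rw [this]
  exact ((measurableSet_dOm F α).compl.inter (hF hs)).union
    (MeasurableSet.biUnion (to_countable _) fun j _ => measurableSet_dCube _ _)

lemma dAv_enorm_le {d : ℕ} (F : ℝ × (Fin d → ℝ) → ℝ) (n : ℤ) (k : ℤ × (Fin d → ℤ)) :
    ‖dAv F n k‖ₑ * ENNReal.ofReal (dVol d n) ≤ ∫⁻ z in dCube n k, ‖F z‖ₑ := by
  have hv := dVol_pos d n
  calc _ = ‖dAv F n k‖ₑ * ‖dVol d n‖ₑ := by rw [Real.enorm_of_nonneg hv.le]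
    _ = ‖∫ z in dCube n k, F z‖ₑ := by
        rw [← enorm_mul, dAv, div_mul_cancel₀ _ hv.ne']
    _ ≤ _ := enorm_integral_le_lintegral_enorm _

lemma dG_abs_le {d : ℕ} {F : ℝ × (Fin d → ℝ) → ℝ} (hF : Continuous F) (hFi : Integrable F)
    {α : ℝ} (hα : 0 < α) (z : ℝ × (Fin d → ℝ)) : ‖dG F α z‖ₑ ≤ ENNReal.ofReal (2 ^ (d + 2) * α) := by
  by_cases hz : z ∈ dOm F α
  · obtain ⟨j, hj, hzj⟩ := mem_iUnion₂.1 hz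
    rw [dG_of_mem hj hzj]
    have h1 := (dAv_enorm_le F j.1 j.2).trans (dStop_avg hj)
    have hv := dVol_pos d j.1
    rw [← mul_assoc, ENNReal.ofReal_mul (by positivity)] at h1
    have := (ENNReal.mul_le_mul_iff_left (by simpa using hv) ofReal_ne_top).1 h1
    rwa [mul_comm α] at this
  · rw [dG_of_notMem hz, ← ofReal_norm]
    refine ENNReal.ofReal_le_ofReal ((dOm_compl_le hF hFi hα hz).trans ?_)
    have : (1:ℝ) ≤ 2 ^ (d + 2) := one_le_pow₀ (by norm_num)
    nlinarith

lemma lintegral_dOm {d : ℕ} (F : ℝ × (Fin d → ℝ) → ℝ) (α : ℝ) (φ : ℝ × (Fin d → ℝ) → ℝ≥0∞) :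
    ∫⁻ z in dOm F α, φ z = ∑' j : dStop F α, ∫⁻ z in dCube j.1.1 j.1.2, φ z := by
  rw [dOm, lintegral_biUnion (to_countable _) (fun j _ => measurableSet_dCube _ _) dStop_disj]

lemma dG_l1 {d : ℕ} (F : ℝ × (Fin d → ℝ) → ℝ) (α : ℝ) :
    ∫⁻ z, ‖dG F α z‖ₑ ≤ ∫⁻ z, ‖F z‖ₑ := by
  rw [← lintegral_add_compl _ (measurableSet_dOm F α),
    ← lintegral_add_compl (fun z => ‖F z‖ₑ) (measurableSet_dOm F α)]
  gcongr ?_ + ?_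
  · rw [lintegral_dOm, lintegral_dOm]
    refine ENNReal.tsum_le_tsum fun j => ?_
    rw [setLIntegral_congr_fun (g := fun _ => ‖dAv F j.1.1 j.1.2‖ₑ) (measurableSet_dCube _ _)
      (fun z hz => by simp only [dG_of_mem j.2 hz]), setLIntegral_const, volume_dCube]
    exact dAv_enorm_le F _ _
  · rw [setLIntegral_congr_fun (g := fun z => ‖F z‖ₑ) (measurableSet_dOm F α).compl
      (fun z hz => by simp only [dG_of_notMem hz])]

lemma dB_l1 {d : ℕ} {F : ℝ × (Fin d → ℝ) → ℝ} (hF : Measurable F) (α : ℝ) :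
    ∫⁻ z, ‖F z - dG F α z‖ₑ ≤ 2 * ∫⁻ z, ‖F z‖ₑ := by
  calc _ ≤ ∫⁻ z, (‖F z‖ₑ + ‖dG F α z‖ₑ) := lintegral_mono fun z => enorm_sub_le
    _ = (∫⁻ z, ‖F z‖ₑ) + ∫⁻ z, ‖dG F α z‖ₑ := lintegral_add_left hF.enorm _
    _ ≤ _ := by rw [two_mul]; exact add_le_add le_rfl (dG_l1 F α)

lemma dG_integrable {d : ℕ} {F : ℝ × (Fin d → ℝ) → ℝ} (hF : Measurable F) (hFi : Integrable F) (α : ℝ) :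
    Integrable (dG F α) :=
  ⟨(measurable_dG hF α).aestronglyMeasurable, (dG_l1 F α).trans_lt hFi.2⟩

lemma dB_mean {d : ℕ} {F : ℝ × (Fin d → ℝ) → ℝ} (hFi : Integrable F)
    {α : ℝ} {j : ℤ × (ℤ × (Fin d → ℤ))} (hj : j ∈ dStop F α) :
    ∫ z in dCube j.1 j.2, (F z - dG F α z) = 0 := by
  have hv := dVol_pos d j.1
  rw [setIntegral_congr_fun (g := fun z => F z - dAv F j.1 j.2) (measurableSet_dCube _ _)
      (fun z hz => by simp only [dG_of_mem hj hz])]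
  rw [integral_sub hFi.integrableOn
    (integrableOn_const (by rw [volume_dCube]; exact ofReal_ne_top))]
  rw [setIntegral_const, measureReal_def, volume_dCube, ENNReal.toReal_ofReal hv.le, smul_eq_mul, dAv,
    mul_div_cancel₀ _ hv.ne', sub_self]

end

section

instance instHaarZ {d : ℕ} : (volume : Measure (ℝ × (Fin d → ℝ))).IsAddHaarMeasure :=
  inferInstanceAs (((volume : Measure ℝ).prod (volume : Measure (Fin d → ℝ))).IsAddHaarMeasure)

/-- Calderon-Zygmund kernels (qualitatively nice, with quantitative constant `A`). -/
structure CZK {d : ℕ} (K : ℝ × (Fin d → ℝ) → ℝ) (A : ℝ) : Prop where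
  meas : Measurable K
  bdd : ∃ B, ∀ z, |K z| ≤ B
  int : Integrable K
  l2 : ∀ F : ℝ × (Fin d → ℝ) → ℝ, Measurable F → Integrable F → (∃ B, ∀ z, |F z| ≤ B) →
    ∫⁻ z, ‖Tc K F z‖ₑ ^ 2 ≤ ∫⁻ z, ‖F z‖ₑ ^ 2
  nonneg : 0 ≤ A
  hor : ∀ h : ℝ, 0 < h → ∀ w : ℝ × (Fin d → ℝ), |w.1| ≤ h ^ 2 → ‖w.2‖ ≤ h →
    ∫⁻ z in {z | |z.1| < 4 * h ^ 2 ∧ ‖z.2‖ < 2 * h}ᶜ, ‖K (z - w) - K z‖ₑ ≤ ENNReal.ofReal A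

lemma Tc_integrand {d : ℕ} {K F : ℝ × (Fin d → ℝ) → ℝ} {A : ℝ} (hK : CZK K A) (hFi : Integrable F)
    (z : ℝ × (Fin d → ℝ)) : Integrable (fun w => K (z - w) * F w) := by
  obtain ⟨B, hB⟩ := hK.bdd
  have hm := hK.meas
  refine hFi.bdd_mul (c := B) (Measurable.aestronglyMeasurable (by fun_prop)) (Filter.Eventually.of_forall fun w => hB _)

lemma Tc_add {d : ℕ} {K F G : ℝ × (Fin d → ℝ) → ℝ} {A : ℝ} (hK : CZK K A) (hF : Integrable F)
    (hG : Integrable G) (z : ℝ × (Fin d → ℝ)) :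
    Tc K (fun w => F w + G w) z = Tc K F z + Tc K G z := by
  unfold Tc
  rw [← integral_add (Tc_integrand hK hF z) (Tc_integrand hK hG z)]
  congr 1; ext w; ring

lemma Tc_sm {d : ℕ} {K F : ℝ × (Fin d → ℝ) → ℝ} (hK : Measurable K) (hF : Measurable F) :
    StronglyMeasurable (Tc K F) := by
  unfold Tc
  refine StronglyMeasurable.integral_prod_right (f := fun z w => K (z - w) * F w) ?_
  apply Measurable.stronglyMeasurable
  simp only [Function.uncurry_def]
  fun_prop

/-- Base point of a cube. -/
def dBase {d : ℕ} (j : ℤ × (ℤ × (Fin d → ℤ))) : ℝ × (Fin d → ℝ) :=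
  open Classical in if h : (dCube j.1 j.2).Nonempty then h.choose else 0

lemma dBase_close {d : ℕ} {j : ℤ × (ℤ × (Fin d → ℤ))} {w : ℝ × (Fin d → ℝ)} (hw : w ∈ dCube j.1 j.2) :
    |w.1 - (dBase j).1| ≤ (4:ℝ) ^ (-j.1) ∧ ‖w.2 - (dBase j).2‖ ≤ (2:ℝ) ^ (-j.1) := by
  have h : (dCube j.1 j.2).Nonempty := ⟨w, hw⟩
  have h2 : dBase j ∈ dCube j.1 j.2 := by
    rw [dBase, dif_pos h]; exact h.choose_spec
  exact dIdx_close _ ((show dIdx j.1 w = j.2 from hw).trans (show dIdx j.1 _ = j.2 from h2).symm)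

/-- Enlarged bad set. -/
def dOmS {d : ℕ} (F : ℝ × (Fin d → ℝ) → ℝ) (α : ℝ) : Set (ℝ × (Fin d → ℝ)) :=
  ⋃ j ∈ dStop F α, dStar j.1 (dBase j)

lemma measurableSet_dOmS {d : ℕ} (F : ℝ × (Fin d → ℝ) → ℝ) (α : ℝ) : MeasurableSet (dOmS F α) :=
  MeasurableSet.biUnion (to_countable _) fun j _ => measurableSet_dStar _ _

lemma volume_dOmS {d : ℕ} (F : ℝ × (Fin d → ℝ) → ℝ) {α : ℝ} (hα : 0 < α) :
    ENNReal.ofReal α * volume (dOmS F α) ≤ ENNReal.ofReal (8 * 4 ^ d) * ∫⁻ z, ‖F z‖ₑ := by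
  calc _ ≤ ENNReal.ofReal α * ∑' j : dStop F α, volume (dStar j.1.1 (dBase j.1)) := by
        gcongr
        exact measure_biUnion_le _ (to_countable _) _
    _ = ENNReal.ofReal (8 * 4 ^ d) * (ENNReal.ofReal α * ∑' j : dStop F α, ENNReal.ofReal (dVol d j.1.1)) := by
        simp_rw [volume_dStar]
        rw [ENNReal.tsum_mul_left]; ring
    _ ≤ _ := by gcongr; exact dStop_tsum_vol F hα

lemma hor_cube {d : ℕ} {K : ℝ × (Fin d → ℝ) → ℝ} {A : ℝ} (hK : CZK K A)
    {j : ℤ × (ℤ × (Fin d → ℤ))} {w : ℝ × (Fin d → ℝ)} (hw : w ∈ dCube j.1 j.2) :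
    ∫⁻ z in (dStar j.1 (dBase j))ᶜ, ‖K (z - w) - K (z - dBase j)‖ₑ ≤ ENNReal.ofReal A := by
  obtain ⟨h1, h2⟩ := dBase_close hw
  have e4 : (4:ℝ) ^ (-j.1) = ((2:ℝ) ^ (-j.1)) ^ 2 := by
    rw [← zpow_natCast, zpow_comm, ]; norm_num
  rw [e4] at h1
  have := hK.hor ((2:ℝ) ^ (-j.1)) (by positivity) (w - dBase j) h1 h2
  refine le_trans (le_of_eq ?_) this
  have hs1 := (measurableSet_dStar j.1 (dBase j)).compl
  have hs2 : MeasurableSet {z : ℝ × (Fin d → ℝ) | |z.1| < 4 * ((2:ℝ) ^ (-j.1)) ^ 2 ∧ ‖z.2‖ < 2 * (2:ℝ) ^ (-j.1)}ᶜ := by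
    have := measurableSet_dStar (d := d) j.1 0
    rw [dStar, e4] at this
    simpa using this.compl
  rw [← lintegral_indicator hs1, ← lintegral_indicator hs2,
    ← lintegral_sub_right_eq_self ({z : ℝ × (Fin d → ℝ) | |z.1| < 4 * ((2:ℝ) ^ (-j.1)) ^ 2 ∧ ‖z.2‖ < 2 * (2:ℝ) ^ (-j.1)}ᶜ.indicator _) (dBase j)]
  congr 1; ext z
  have hiff : z ∈ (dStar j.1 (dBase j))ᶜ ↔ z - dBase j ∈ {z : ℝ × (Fin d → ℝ) | |z.1| < 4 * ((2:ℝ) ^ (-j.1)) ^ 2 ∧ ‖z.2‖ < 2 * (2:ℝ) ^ (-j.1)}ᶜ := by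
    rw [dStar, e4]; rfl
  by_cases hz : z ∈ (dStar j.1 (dBase j))ᶜ
  · rw [indicator_of_mem hz, indicator_of_mem (hiff.1 hz)]
    congr 3; abel
  · rw [indicator_of_notMem hz, indicator_of_notMem (fun h => hz (hiff.2 h))]

lemma Tb_pt {d : ℕ} {K : ℝ × (Fin d → ℝ) → ℝ} {A : ℝ} (hK : CZK K A)
    {F : ℝ × (Fin d → ℝ) → ℝ} (hF : Measurable F) (hFi : Integrable F) (α : ℝ) (z : ℝ × (Fin d → ℝ)) :
    ‖Tc K (fun w => F w - dG F α w) z‖ₑ ≤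
      ∑' j : dStop F α, ∫⁻ w in dCube j.1.1 j.1.2, ‖K (z - w) - K (z - dBase j.1)‖ₑ * ‖F w - dG F α w‖ₑ := by
  have hb : Integrable (fun w => F w - dG F α w) := hFi.sub (dG_integrable hF hFi α)
  have hi := Tc_integrand hK hb z
  have e1 : Tc K (fun w => F w - dG F α w) z = ∫ w in ⋃ j : dStop F α, dCube j.1.1 j.1.2, K (z - w) * (F w - dG F α w) := by
    rw [Tc, ← setIntegral_eq_integral_of_forall_compl_eq_zero]
    intro w hw
    have : w ∉ dOm F α := by
      rw [dOm, biUnion_eq_iUnion]; exact hw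
    rw [dG_of_notMem this]; ring
  have hdis : Pairwise (Function.onFun Disjoint fun j : dStop F α => dCube j.1.1 j.1.2) := by
    intro i j hij
    exact dStop_disj i.2 j.2 (fun h => hij (Subtype.ext h))
  have hs := hasSum_integral_iUnion (fun j : dStop F α => measurableSet_dCube j.1.1 j.1.2) hdis hi.integrableOn
  rw [e1, ← hs.tsum_eq]
  refine (enorm_tsum_le_tsum_enorm).trans (ENNReal.tsum_le_tsum fun j => ?_)
  have e2 : ∫ w in dCube j.1.1 j.1.2, K (z - w) * (F w - dG F α w) =
      ∫ w in dCube j.1.1 j.1.2, (K (z - w) - K (z - dBase j.1)) * (F w - dG F α w) := by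
    simp_rw [sub_mul (K _)]
    rw [integral_sub hi.integrableOn (hb.const_mul _).integrableOn, integral_const_mul, dB_mean hFi j.2]
    simp
  rw [e2]
  refine (enorm_integral_le_lintegral_enorm _).trans (le_of_eq ?_)
  simp_rw [enorm_mul]

lemma Tb_l1 {d : ℕ} {K : ℝ × (Fin d → ℝ) → ℝ} {A : ℝ} (hK : CZK K A)
    {F : ℝ × (Fin d → ℝ) → ℝ} (hF : Measurable F) (hFi : Integrable F) (α : ℝ) :
    ∫⁻ z in (dOmS F α)ᶜ, ‖Tc K (fun w => F w - dG F α w) z‖ₑ ≤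
      ENNReal.ofReal A * (2 * ∫⁻ z, ‖F z‖ₑ) := by
  have hm := hK.meas
  have hg := measurable_dG hF α
  calc _ ≤ ∫⁻ z in (dOmS F α)ᶜ, ∑' j : dStop F α, ∫⁻ w in dCube j.1.1 j.1.2, ‖K (z - w) - K (z - dBase j.1)‖ₑ * ‖F w - dG F α w‖ₑ :=
        lintegral_mono fun z => Tb_pt hK hF hFi α z
    _ = ∑' j : dStop F α, ∫⁻ z in (dOmS F α)ᶜ, ∫⁻ w in dCube j.1.1 j.1.2, ‖K (z - w) - K (z - dBase j.1)‖ₑ * ‖F w - dG F α w‖ₑ := by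
        refine lintegral_tsum fun j => ?_
        refine (Measurable.lintegral_prod_right' (f := fun q : (ℝ × (Fin d → ℝ)) × (ℝ × (Fin d → ℝ)) => ‖K (q.1 - q.2) - K (q.1 - dBase j.1)‖ₑ * ‖F q.2 - dG F α q.2‖ₑ) ?_).aemeasurable
        fun_prop
    _ = ∑' j : dStop F α, ∫⁻ w in dCube j.1.1 j.1.2, ∫⁻ z in (dOmS F α)ᶜ, ‖K (z - w) - K (z - dBase j.1)‖ₑ * ‖F w - dG F α w‖ₑ := by
        congr 1; ext j
        rw [lintegral_lintegral_swap]
        apply Measurable.aemeasurable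
        simp only [Function.uncurry_def]
        fun_prop
    _ ≤ ∑' j : dStop F α, ∫⁻ w in dCube j.1.1 j.1.2, ENNReal.ofReal A * ‖F w - dG F α w‖ₑ := by
        refine ENNReal.tsum_le_tsum fun j => ?_
        refine setLIntegral_mono (by fun_prop) fun w hw => ?_
        rw [lintegral_mul_const _ (by fun_prop)]
        gcongr
        refine (lintegral_mono_set ?_).trans (hor_cube hK hw)
        exact compl_subset_compl.2 (subset_biUnion_of_mem (u := fun j : ℤ × (ℤ × (Fin d → ℤ)) => dStar j.1 (dBase j)) j.2)
    _ = ∫⁻ w in dOm F α, ENNReal.ofReal A * ‖F w - dG F α w‖ₑ := (lintegral_dOm F α _).symm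
    _ ≤ ∫⁻ w, ENNReal.ofReal A * ‖F w - dG F α w‖ₑ := setLIntegral_le_lintegral _ _
    _ = ENNReal.ofReal A * ∫⁻ w, ‖F w - dG F α w‖ₑ := lintegral_const_mul _ (by fun_prop)
    _ ≤ _ := mul_le_mul_right (dB_l1 hF α) _

end

section

lemma cheb_lt {X : Type*} [MeasurableSpace X] {μ : Measure X} {f : X → ℝ} (hf : Measurable f)
    {α : ℝ} (hα : 0 ≤ α) (q : ℝ) (hq : 0 ≤ q) :
    ENNReal.ofReal (α ^ q) * μ {z | α < |f z|} ≤ ∫⁻ z, ‖f z‖ₑ ^ q ∂μ := by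
  refine le_trans ?_ (mul_meas_ge_le_lintegral (μ := μ) (f := fun z => ‖f z‖ₑ ^ q) (by fun_prop) (ENNReal.ofReal (α ^ q)))
  gcongr
  intro hz
  rw [← ofReal_norm, Real.norm_eq_abs, ENNReal.ofReal_rpow_of_nonneg (abs_nonneg _) hq]
  exact ENNReal.ofReal_le_ofReal (Real.rpow_le_rpow hα (le_of_lt hz) hq)

lemma weak11 {d : ℕ} {K : ℝ × (Fin d → ℝ) → ℝ} {A : ℝ} (hK : CZK K A)
    {F : ℝ × (Fin d → ℝ) → ℝ} (hF : Continuous F) (hFi : Integrable F) {α : ℝ} (hα : 0 < α) :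
    ENNReal.ofReal α * volume {z | α < |Tc K F z|} ≤
      ENNReal.ofReal (2 ^ (d + 4) + 8 * 4 ^ d + 4 * A) * ∫⁻ z, ‖F z‖ₑ := by
  have hA := hK.nonneg
  have hgm := measurable_dG hF.measurable α
  have hgi := dG_integrable hF.measurable hFi α
  have hbi : Integrable (fun w => F w - dG F α w) := hFi.sub hgi
  have hTg := (Tc_sm hK.meas hgm).measurable
  have hTb := (Tc_sm hK.meas (hF.measurable.sub hgm)).measurable
  have hsub : {z | α < |Tc K F z|} ⊆ ({z | α / 2 < |Tc K (dG F α) z|} ∪ dOmS F α) ∪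
      ((dOmS F α)ᶜ ∩ {z | α / 2 < |Tc K (fun w => F w - dG F α w) z|}) := by
    intro z hz
    by_contra hcon
    simp only [mem_union, mem_inter_iff, mem_compl_iff, not_or, not_and] at hcon
    obtain ⟨⟨h1, h2⟩, h3⟩ := hcon
    have h3 := h3 h2
    have e : Tc K F z = Tc K (dG F α) z + Tc K (fun w => F w - dG F α w) z := by
      rw [← Tc_add hK hgi hbi]; congr 1; ext w; ring
    have hz' : α < |Tc K F z| := hz
    have h1' : ¬ (α / 2 < |Tc K (dG F α) z|) := h1
    have h3' : ¬ (α / 2 < |Tc K (fun w => F w - dG F α w) z|) := h3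
    rw [e] at hz'
    have := abs_add_le (Tc K (dG F α) z) (Tc K (fun w => F w - dG F α w) z)
    linarith
  have p1 : ENNReal.ofReal α * volume {z | α / 2 < |Tc K (dG F α) z|} ≤ ENNReal.ofReal (2 ^ (d + 4)) * ∫⁻ z, ‖F z‖ₑ := by
    have c1 := cheb_lt (μ := volume) hTg (half_pos hα).le 2 (by norm_num)
    have c2 : ∫⁻ z, ‖Tc K (dG F α) z‖ₑ ^ (2:ℝ) ≤ ENNReal.ofReal (2 ^ (d + 2) * α) * ∫⁻ z, ‖F z‖ₑ := by
      calc _ = ∫⁻ z, ‖Tc K (dG F α) z‖ₑ ^ 2 := by norm_cast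
        _ ≤ ∫⁻ z, ‖dG F α z‖ₑ ^ 2 := by
            refine hK.l2 _ hgm hgi ⟨2 ^ (d + 2) * α, fun z => ?_⟩
            have := dG_abs_le hF hFi hα z
            rwa [← ofReal_norm, ENNReal.ofReal_le_ofReal_iff (by positivity)] at this
        _ ≤ ∫⁻ z, ENNReal.ofReal (2 ^ (d + 2) * α) * ‖dG F α z‖ₑ := by
            refine lintegral_mono fun z => ?_
            rw [pow_two]
            exact mul_le_mul_left (dG_abs_le hF hFi hα z) _
        _ = ENNReal.ofReal (2 ^ (d + 2) * α) * ∫⁻ z, ‖dG F α z‖ₑ := lintegral_const_mul _ (by fun_prop)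
        _ ≤ _ := mul_le_mul_right (dG_l1 F α) _
    calc _ = ENNReal.ofReal (4 / α) * (ENNReal.ofReal ((α / 2) ^ (2:ℝ)) * volume {z | α / 2 < |Tc K (dG F α) z|}) := by
          rw [← mul_assoc, ← ENNReal.ofReal_mul (by positivity)]
          congr 2
          rw [Real.rpow_two]; field_simp; norm_num
      _ ≤ ENNReal.ofReal (4 / α) * (ENNReal.ofReal (2 ^ (d + 2) * α) * ∫⁻ z, ‖F z‖ₑ) :=
          mul_le_mul_right (c1.trans c2) _
      _ = _ := by
          rw [← mul_assoc, ← ENNReal.ofReal_mul (by positivity)]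
          congr 2
          field_simp; ring
  have p2 := volume_dOmS F hα
  have p3 : ENNReal.ofReal α * volume ((dOmS F α)ᶜ ∩ {z | α / 2 < |Tc K (fun w => F w - dG F α w) z|}) ≤
      ENNReal.ofReal (4 * A) * ∫⁻ z, ‖F z‖ₑ := by
    have c1 := cheb_lt (μ := volume.restrict (dOmS F α)ᶜ) hTb (half_pos hα).le 1 (by norm_num)
    simp only [ENNReal.rpow_one, Real.rpow_one] at c1
    have c2 := c1.trans (Tb_l1 hK hF.measurable hFi α)
    rw [Measure.restrict_apply (measurableSet_lt measurable_const (by fun_prop)), inter_comm] at c2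
    calc _ = ENNReal.ofReal 2 * (ENNReal.ofReal (α / 2) * volume ((dOmS F α)ᶜ ∩ {z | α / 2 < |Tc K (fun w => F w - dG F α w) z|})) := by
          rw [← mul_assoc, ← ENNReal.ofReal_mul (by positivity)]
          congr 2
          field_simp
      _ ≤ ENNReal.ofReal 2 * (ENNReal.ofReal A * (2 * ∫⁻ z, ‖F z‖ₑ)) := mul_le_mul_right c2 _
      _ = _ := by
          rw [ENNReal.ofReal_mul (by norm_num), show ENNReal.ofReal 4 = 2 * 2 by norm_num, show ENNReal.ofReal 2 = 2 by norm_num]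
          ring
  calc _ ≤ ENNReal.ofReal α * ((volume {z | α / 2 < |Tc K (dG F α) z|} + volume (dOmS F α)) +
        volume ((dOmS F α)ᶜ ∩ {z | α / 2 < |Tc K (fun w => F w - dG F α w) z|})) := by
        refine mul_le_mul_right ((measure_mono hsub).trans ((measure_union_le _ _).trans ?_)) _
        exact add_le_add (measure_union_le _ _) le_rfl
    _ ≤ _ := by
        rw [mul_add, mul_add, ENNReal.ofReal_add (by positivity) (by positivity), ENNReal.ofReal_add (by positivity) (by positivity), add_mul, add_mul]
        exact add_le_add (add_le_add p1 p2) p3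

lemma lint_rpow_Ioc {c a : ℝ} (hc : -1 < c) (ha : 0 ≤ a) :
    ∫⁻ t in Ioc 0 a, ENNReal.ofReal (t ^ c) = ENNReal.ofReal (a ^ (c + 1) / (c + 1)) := by
  rw [← ofReal_integral_eq_lintegral_ofReal]
  · rw [← intervalIntegral.integral_of_le ha, integral_rpow (Or.inl hc), Real.zero_rpow (by linarith), sub_zero]
  · exact (intervalIntegrable_iff_integrableOn_Ioc_of_le ha).1 (intervalIntegral.intervalIntegrable_rpow' hc)
  · filter_upwards [ae_restrict_mem measurableSet_Ioc] with t ht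
    exact Real.rpow_nonneg ht.1.le _

lemma lint_rpow_Ioi {c a : ℝ} (hc : c < -1) (ha : 0 < a) :
    ∫⁻ t in Ioi a, ENNReal.ofReal (t ^ c) = ENNReal.ofReal (-a ^ (c + 1) / (c + 1)) := by
  rw [← ofReal_integral_eq_lintegral_ofReal]
  · rw [integral_Ioi_rpow_of_lt hc ha]
  · exact integrableOn_Ioi_rpow_of_lt hc ha
  · filter_upwards [ae_restrict_mem measurableSet_Ioi] with t ht
    exact Real.rpow_nonneg (ha.trans ht).le _

lemma marc_int1 {q a : ℝ} (hq : 1 < q) (hq2 : q < 2) (ha : 0 ≤ a) :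
    ∫⁻ t in Ioi (0:ℝ), ENNReal.ofReal (t ^ (q - 3) * min a t ^ 2) ≤ ENNReal.ofReal ((1 / q + 1 / (2 - q)) * a ^ q) := by
  rcases ha.eq_or_lt with rfl | ha
  · rw [setLIntegral_congr_fun (g := fun _ => 0) measurableSet_Ioi]
    · simp
    · intro t ht
      simp [min_eq_left (le_of_lt (show (0:ℝ) < t from ht))]
  rw [← Ioc_union_Ioi_eq_Ioi ha.le, lintegral_union measurableSet_Ioi (Ioc_disjoint_Ioi le_rfl)]
  have e1 : ∫⁻ t in Ioc 0 a, ENNReal.ofReal (t ^ (q - 3) * min a t ^ 2) = ENNReal.ofReal (a ^ q / q) := by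
    rw [setLIntegral_congr_fun (g := fun t => ENNReal.ofReal (t ^ (q-1))) measurableSet_Ioc]
    · rw [lint_rpow_Ioc (by linarith) ha.le]; simp
    · intro t ht
      simp only [min_eq_right ht.2]
      rw [← Real.rpow_natCast, ← Real.rpow_add ht.1]; congr 2; push_cast; ring
  have e2 : ∫⁻ t in Ioi a, ENNReal.ofReal (t ^ (q - 3) * min a t ^ 2) = ENNReal.ofReal (a ^ q / (2 - q)) := by
    rw [setLIntegral_congr_fun (g := fun t => ENNReal.ofReal (a ^ 2) * ENNReal.ofReal (t ^ (q-3))) measurableSet_Ioi]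
    · rw [lintegral_const_mul _ (by fun_prop), lint_rpow_Ioi (by linarith) ha, ← ENNReal.ofReal_mul (by positivity)]
      congr 1
      have : a ^ q = a ^ 2 * a ^ (q - 3 + 1) := by
        rw [← Real.rpow_natCast a 2, ← Real.rpow_add ha]; congr 1; push_cast; ring
      rw [this]
      have h1 : 2 - q ≠ 0 := by linarith
      have h2 : q - 3 + 1 ≠ 0 := by linarith
      field_simp; ring
    · intro t ht
      simp only [min_eq_left (le_of_lt (show a < t from ht))]
      rw [← ENNReal.ofReal_mul (by positivity), mul_comm]
  rw [e1, e2, ← ENNReal.ofReal_add (by positivity) (by apply div_nonneg <;> [positivity; linarith])]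
  apply le_of_eq; congr 1; ring

lemma marc_int2 {q a : ℝ} (hq : 1 < q) (ha : 0 ≤ a) :
    ∫⁻ t in Ioi (0:ℝ), ENNReal.ofReal (t ^ (q - 2) * max (a - t) 0) ≤ ENNReal.ofReal (1 / (q - 1) * a ^ q) := by
  rcases ha.eq_or_lt with rfl | ha
  · rw [setLIntegral_congr_fun (g := fun _ => 0) measurableSet_Ioi]
    · simp
    · intro t ht
      simp only [max_eq_right (show (0:ℝ) - t ≤ 0 by linarith [show (0:ℝ) < t from ht]), mul_zero, ENNReal.ofReal_zero]
  rw [← Ioc_union_Ioi_eq_Ioi ha.le, lintegral_union measurableSet_Ioi (Ioc_disjoint_Ioi le_rfl)]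
  have e2 : ∫⁻ t in Ioi a, ENNReal.ofReal (t ^ (q - 2) * max (a - t) 0) = 0 := by
    rw [setLIntegral_congr_fun (g := fun _ => 0) measurableSet_Ioi]
    · simp
    · intro t ht
      simp [max_eq_right (show a - t ≤ 0 by linarith [show a < t from ht])]
  have e1 : ∫⁻ t in Ioc 0 a, ENNReal.ofReal (t ^ (q - 2) * max (a - t) 0) ≤ ENNReal.ofReal (1 / (q - 1) * a ^ q) := by
    calc _ ≤ ∫⁻ t in Ioc 0 a, ENNReal.ofReal a * ENNReal.ofReal (t ^ (q - 2)) := by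
          refine setLIntegral_mono (by fun_prop) fun t ht => ?_
          rw [← ENNReal.ofReal_mul (by positivity), mul_comm]
          apply ENNReal.ofReal_le_ofReal
          have := Real.rpow_nonneg ht.1.le (q-2)
          gcongr
          exact max_le (by linarith [ht.1]) ha.le
      _ = _ := by
          rw [lintegral_const_mul _ (by fun_prop), lint_rpow_Ioc (by linarith) ha.le, ← ENNReal.ofReal_mul (by positivity)]
          congr 1
          have : a ^ q = a * a ^ (q - 2 + 1) := by
            nth_rewrite 2 [← Real.rpow_one a]
            rw [← Real.rpow_add ha]; congr 1; ring
          rw [this, show q - 2 + 1 = q - 1 by ring]; ring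
  rw [e2, add_zero]; exact e1

end

section

/-- Truncation. -/
def trc (α x : ℝ) : ℝ := max (-α) (min x α)

lemma abs_trc {α : ℝ} (hα : 0 < α) (x : ℝ) : |trc α x| = min |x| α := by
  unfold trc
  rcases le_total 0 x with hx | hx
  · rw [abs_of_nonneg hx, max_eq_right (by have := le_min hx hα.le; linarith), abs_of_nonneg (le_min hx hα.le)]
  · rw [min_eq_left (hx.trans hα.le), abs_of_nonpos hx, abs_of_nonpos (max_le (by linarith) hx)]
    rw [← min_neg_neg, neg_neg, min_comm]

lemma abs_sub_trc {α : ℝ} (hα : 0 < α) (x : ℝ) : |x - trc α x| = max (|x| - α) 0 := by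
  unfold trc
  rcases le_total 0 x with hx | hx
  · rw [abs_of_nonneg hx, max_eq_right (by have := le_min hx hα.le; linarith)]
    rcases le_total x α with h | h
    · rw [min_eq_left h, max_eq_right (by linarith)]; simp
    · rw [min_eq_right h, max_eq_left (by linarith), abs_of_nonneg (by linarith)]
  · rw [min_eq_left (hx.trans hα.le), abs_of_nonpos hx]
    rcases le_total x (-α) with h | h
    · rw [max_eq_left h, max_eq_left (by linarith), abs_of_nonpos (by linarith)]; ring
    · rw [max_eq_right h, max_eq_right (by linarith)]; simp

lemma continuous_trc (α : ℝ) : Continuous (trc α) := by unfold trc; fun_prop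

lemma weak_level {d : ℕ} {K : ℝ × (Fin d → ℝ) → ℝ} {A : ℝ} (hK : CZK K A)
    {F : ℝ × (Fin d → ℝ) → ℝ} (hF : Continuous F) (hFc : HasCompactSupport F) {α : ℝ} (hα : 0 < α) :
    volume {z | α < |Tc K F z| / 2} ≤ ENNReal.ofReal (α ^ (-2:ℝ)) * (∫⁻ z, ENNReal.ofReal (min |F z| α ^ 2)) +
      ENNReal.ofReal (α⁻¹) * (ENNReal.ofReal (2 ^ (d + 4) + 8 * 4 ^ d + 4 * A) *
        ∫⁻ z, ENNReal.ofReal (max (|F z| - α) 0)) := by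
  have hc1 : Continuous fun z => trc α (F z) := (continuous_trc α).comp hF
  have h0 : trc α 0 = 0 := by unfold trc; rw [min_eq_left hα.le, max_eq_right (by linarith)]
  have hs1 : HasCompactSupport fun z => trc α (F z) := hFc.comp_left h0
  have hi1 := hc1.integrable_of_hasCompactSupport (μ := volume) hs1
  have hi := hF.integrable_of_hasCompactSupport (μ := volume) hFc
  have hi2 : Integrable fun z => F z - trc α (F z) := hi.sub hi1
  have hc2 : Continuous fun z => F z - trc α (F z) := hF.sub hc1
  have hT1 := (Tc_sm hK.meas hc1.measurable).measurable
  have p1 := cheb_lt (μ := volume) hT1 hα.le 2 (by norm_num)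
  have p1' : ∫⁻ z, ‖Tc K (fun z => trc α (F z)) z‖ₑ ^ (2:ℝ) ≤ ∫⁻ z, ENNReal.ofReal (min |F z| α ^ 2) := by
    calc _ = ∫⁻ z, ‖Tc K (fun z => trc α (F z)) z‖ₑ ^ 2 := by norm_cast
      _ ≤ ∫⁻ z, ‖trc α (F z)‖ₑ ^ 2 := hK.l2 _ hc1.measurable hi1 ⟨α, fun z => by rw [abs_trc hα]; exact min_le_right _ _⟩
      _ = _ := by
        congr 1; ext z
        rw [← ofReal_norm, Real.norm_eq_abs, abs_trc hα, ENNReal.ofReal_pow (le_min (abs_nonneg _) hα.le)]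
  have p2 := weak11 hK hc2 hi2 hα
  have e2 : ∫⁻ z, ‖F z - trc α (F z)‖ₑ = ∫⁻ z, ENNReal.ofReal (max (|F z| - α) 0) := by
    congr 1; ext z
    rw [← ofReal_norm, Real.norm_eq_abs, abs_sub_trc hα]
  rw [e2] at p2
  have hsub : {z | α < |Tc K F z| / 2} ⊆ {z | α < |Tc K (fun z => trc α (F z)) z|} ∪
      {z | α < |Tc K (fun z => F z - trc α (F z)) z|} := by
    intro z hz
    by_contra hcon
    simp only [mem_union, not_or] at hcon
    have h1 : ¬ (α < |Tc K (fun z => trc α (F z)) z|) := hcon.1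
    have h2 : ¬ (α < |Tc K (fun z => F z - trc α (F z)) z|) := hcon.2
    have e : Tc K F z = Tc K (fun z => trc α (F z)) z + Tc K (fun z => F z - trc α (F z)) z := by
      rw [← Tc_add hK hi1 hi2]; congr 1; ext w; ring
    have hz' : α < |Tc K F z| / 2 := hz
    rw [e] at hz'
    have := abs_add_le (Tc K (fun z => trc α (F z)) z) (Tc K (fun z => F z - trc α (F z)) z)
    linarith
  refine (measure_mono hsub).trans ((measure_union_le _ _).trans (add_le_add ?_ ?_))
  · calc _ = ENNReal.ofReal (α ^ (-2:ℝ)) * (ENNReal.ofReal (α ^ (2:ℝ)) * volume {z | α < |Tc K (fun z => trc α (F z)) z|}) := by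
          rw [← mul_assoc, ← ENNReal.ofReal_mul (by positivity), ← Real.rpow_add hα]; norm_num
      _ ≤ _ := mul_le_mul_right (p1.trans p1') _
  · calc _ = ENNReal.ofReal (α⁻¹) * (ENNReal.ofReal α * volume {z | α < |Tc K (fun z => F z - trc α (F z)) z|}) := by
          rw [← mul_assoc, ← ENNReal.ofReal_mul (by positivity), inv_mul_cancel₀ hα.ne']; norm_num
      _ ≤ _ := mul_le_mul_right p2 _

lemma swap_marc {X : Type*} [MeasurableSpace X] {μ : Measure X} [SFinite μ] {f : X → ℝ} (hf : Measurable f)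
    {ψ : ℝ → ℝ} {h : ℝ → ℝ → ℝ} (hψ : Measurable ψ) (hψ0 : ∀ t, 0 < t → 0 ≤ ψ t) (hh : Measurable fun q : ℝ × ℝ => h q.1 q.2)
    {D q : ℝ} (hD : 0 ≤ D)
    (hb : ∀ a, 0 ≤ a → ∫⁻ t in Ioi (0:ℝ), ENNReal.ofReal (ψ t * h a t) ≤ ENNReal.ofReal (D * a ^ q)) :
    ∫⁻ t in Ioi (0:ℝ), ENNReal.ofReal (ψ t) * ∫⁻ z, ENNReal.ofReal (h |f z| t) ∂μ ≤
      ENNReal.ofReal D * ∫⁻ z, ENNReal.ofReal (|f z| ^ q) ∂μ := by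
  calc _ = ∫⁻ t in Ioi (0:ℝ), ∫⁻ z, ENNReal.ofReal (ψ t * h |f z| t) ∂μ := by
        refine setLIntegral_congr_fun measurableSet_Ioi fun t ht => ?_
        have hm : Measurable fun z => h |f z| t := hh.comp (by fun_prop : Measurable fun z => (|f z|, t))
        rw [← lintegral_const_mul _ (by fun_prop)]
        congr 1; ext z
        rw [ENNReal.ofReal_mul (hψ0 t ht)]
    _ = ∫⁻ z, (∫⁻ t in Ioi (0:ℝ), ENNReal.ofReal (ψ t * h |f z| t)) ∂μ := by
        rw [lintegral_lintegral_swap]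
        apply Measurable.aemeasurable
        have hm : Measurable fun y : ℝ × X => h |f y.2| y.1 := hh.comp (by fun_prop : Measurable fun y : ℝ × X => (|f y.2|, y.1))
        simp only [Function.uncurry_def]
        fun_prop
    _ ≤ ∫⁻ z, ENNReal.ofReal (D * |f z| ^ q) ∂μ := lintegral_mono fun z => hb _ (abs_nonneg _)
    _ = _ := by
        simp_rw [ENNReal.ofReal_mul hD]
        rw [lintegral_const_mul _ (by fun_prop)]

/-- Constant in the Marcinkiewicz interpolation. -/
def czC (d : ℕ) (A q : ℝ) : ℝ := if q = 2 then 1 else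
  2 ^ q * (q * ((1 / q + 1 / (2 - q)) + (2 ^ (d + 4) + 8 * 4 ^ d + 4 * A) * (1 / (q - 1))))

lemma czC_nonneg {d : ℕ} {A q : ℝ} (hA : 0 ≤ A) (hq : 1 < q) (hq2 : q ≤ 2) : 0 ≤ czC d A q := by
  unfold czC
  split_ifs with h
  · norm_num
  · have h1 : 0 < 2 - q := by have := lt_of_le_of_ne hq2 h; linarith
    have h2 : 0 < q - 1 := by linarith
    positivity

theorem cz_main {d : ℕ} {K : ℝ × (Fin d → ℝ) → ℝ} {A : ℝ} (hK : CZK K A) {q : ℝ} (hq : 1 < q) (hq2 : q ≤ 2)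
    {F : ℝ × (Fin d → ℝ) → ℝ} (hF : Continuous F) (hFc : HasCompactSupport F) :
    ∫⁻ z, ‖Tc K F z‖ₑ ^ q ≤ ENNReal.ofReal (czC d A q) * ∫⁻ z, ‖F z‖ₑ ^ q := by
  have hA := hK.nonneg
  by_cases h2 : q = 2
  · subst h2
    have := hK.l2 F hF.measurable (hF.integrable_of_hasCompactSupport hFc) (by
      obtain ⟨C, hC⟩ := hFc.exists_bound_of_continuous hF
      exact ⟨C, hC⟩)
    simp only [czC, if_true, ENNReal.ofReal_one, one_mul]
    exact_mod_cast this
  have hlt : q < 2 := lt_of_le_of_ne hq2 h2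
  have h1' : 0 < 2 - q := by linarith
  have h2' : 0 < q - 1 := by linarith
  set C := 2 ^ (d + 4) + 8 * 4 ^ d + 4 * A with hCdef
  have hC0 : 0 ≤ C := by positivity
  have hT := (Tc_sm hK.meas hF.measurable).measurable
  have eF : ∀ (f : ℝ × (Fin d → ℝ) → ℝ), ∫⁻ z, ‖f z‖ₑ ^ q = ∫⁻ z, ENNReal.ofReal (|f z| ^ q) := by
    intro f; congr 1; ext z
    rw [← ofReal_norm, Real.norm_eq_abs, ENNReal.ofReal_rpow_of_nonneg (abs_nonneg _) (by linarith)]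
  have eT : ∫⁻ z, ‖Tc K F z‖ₑ ^ q = ENNReal.ofReal (2 ^ q) * ∫⁻ z, ENNReal.ofReal ((|Tc K F z| / 2) ^ q) := by
    rw [eF, ← lintegral_const_mul _ (by fun_prop)]
    congr 1; ext z
    rw [← ENNReal.ofReal_mul (by positivity), ← Real.mul_rpow (by positivity) (by positivity)]
    congr 2; ring
  rw [eT, lintegral_rpow_eq_lintegral_meas_lt_mul _ (Filter.Eventually.of_forall fun z => by positivity) (by fun_prop) (by linarith)]
  have main : ∫⁻ t in Ioi (0:ℝ), volume {z | t < |Tc K F z| / 2} * ENNReal.ofReal (t ^ (q - 1)) ≤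
      ENNReal.ofReal ((1 / q + 1 / (2 - q)) + C * (1 / (q - 1))) * ∫⁻ z, ENNReal.ofReal (|F z| ^ q) := by
    calc _ ≤ ∫⁻ t in Ioi (0:ℝ), (ENNReal.ofReal (t ^ (q - 3)) * (∫⁻ z, ENNReal.ofReal (min |F z| t ^ 2)) +
          ENNReal.ofReal C * (ENNReal.ofReal (t ^ (q - 2)) * ∫⁻ z, ENNReal.ofReal (max (|F z| - t) 0))) := by
          refine setLIntegral_mono' measurableSet_Ioi fun t ht => ?_
          have ht : 0 < t := ht
          refine (mul_le_mul_left (weak_level hK hF hFc ht) _).trans (le_of_eq ?_)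
          rw [show t ^ (q - 3) = t ^ (-2:ℝ) * t ^ (q - 1) by rw [← Real.rpow_add ht]; congr 1; ring,
            show t ^ (q - 2) = t⁻¹ * t ^ (q - 1) by rw [← Real.rpow_neg_one, ← Real.rpow_add ht]; congr 1; ring,
            ENNReal.ofReal_mul (by positivity), ENNReal.ofReal_mul (by positivity)]
          ring
      _ = (∫⁻ t in Ioi (0:ℝ), ENNReal.ofReal (t ^ (q - 3)) * (∫⁻ z, ENNReal.ofReal (min |F z| t ^ 2))) +
          ENNReal.ofReal C * ∫⁻ t in Ioi (0:ℝ), ENNReal.ofReal (t ^ (q - 2)) * ∫⁻ z, ENNReal.ofReal (max (|F z| - t) 0) := by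
          have hm1 : Measurable fun t : ℝ => ∫⁻ z, ENNReal.ofReal (min |F z| t ^ 2) :=
            Measurable.lintegral_prod_right' (f := fun y : ℝ × (ℝ × (Fin d → ℝ)) => ENNReal.ofReal (min |F y.2| y.1 ^ 2)) (by fun_prop)
          have hm2 : Measurable fun t : ℝ => ∫⁻ z, ENNReal.ofReal (max (|F z| - t) 0) :=
            Measurable.lintegral_prod_right' (f := fun y : ℝ × (ℝ × (Fin d → ℝ)) => ENNReal.ofReal (max (|F y.2| - y.1) 0)) (by fun_prop)
          rw [lintegral_add_left (by fun_prop), lintegral_const_mul _ (by fun_prop)]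
      _ ≤ ENNReal.ofReal (1 / q + 1 / (2 - q)) * (∫⁻ z, ENNReal.ofReal (|F z| ^ q)) +
          ENNReal.ofReal C * (ENNReal.ofReal (1 / (q - 1)) * ∫⁻ z, ENNReal.ofReal (|F z| ^ q)) := by
          refine add_le_add ?_ (mul_le_mul_right ?_ _)
          · exact swap_marc (h := fun a t => min a t ^ 2) hF.measurable (by fun_prop) (fun t ht => by positivity) (by fun_prop) (by positivity)
              (fun a ha => marc_int1 hq hlt ha)
          · exact swap_marc (h := fun a t => max (a - t) 0) hF.measurable (by fun_prop) (fun t ht => by positivity) (by fun_prop) (by positivity)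
              (fun a ha => marc_int2 hq ha)
      _ = _ := by
          rw [ENNReal.ofReal_add (p := 1 / q + 1 / (2 - q)) (q := C * (1 / (q - 1))) (by positivity) (by positivity), ENNReal.ofReal_mul hC0]; ring
  refine (mul_le_mul_right (mul_le_mul_right main _) _).trans (le_of_eq ?_)
  rw [eF, czC, if_neg h2, ENNReal.ofReal_mul (by positivity), ENNReal.ofReal_mul (by linarith)]
  ring

end

section

/-- The `L_p` norm as an extended nonnegative real. -/
def nrm {X : Type*} [MeasurableSpace X] (p : ℝ) (F : X → ℝ) (μ : Measure X) : ℝ≥0∞ :=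
  (∫⁻ z, ‖F z‖ₑ ^ p ∂μ) ^ (1 / p)

lemma nrm_eq {X : Type*} [MeasurableSpace X] {p : ℝ} (hp : 0 < p) (F : X → ℝ) (μ : Measure X) :
    nrm p F μ = eLpNorm F (ENNReal.ofReal p) μ := by
  rw [eLpNorm_eq_lintegral_rpow_enorm_toReal (by simpa using hp) ofReal_ne_top, ENNReal.toReal_ofReal hp.le, nrm]

lemma nrm_rpow {X : Type*} [MeasurableSpace X] {p : ℝ} (hp : 0 < p) (F : X → ℝ) (μ : Measure X) :
    nrm p F μ ^ p = ∫⁻ z, ‖F z‖ₑ ^ p ∂μ := by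
  rw [nrm, ← ENNReal.rpow_mul, one_div, inv_mul_cancel₀ hp.ne', ENNReal.rpow_one]

lemma holder_enorm {X : Type*} [MeasurableSpace X] {p q : ℝ} (hpq : p.HolderConjugate q)
    {F G : X → ℝ} {μ : Measure X} (hF : AEStronglyMeasurable F μ) (hG : AEStronglyMeasurable G μ) :
    ‖∫ z, F z * G z ∂μ‖ₑ ≤ nrm p F μ * nrm q G μ := by
  refine (enorm_integral_le_lintegral_enorm _).trans ?_
  simp_rw [enorm_mul]
  exact ENNReal.lintegral_mul_le_Lp_mul_Lq μ hpq hF.enorm hG.enorm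

/-- Measurable, bounded, integrable functions. -/
structure Nice {X : Type*} [MeasurableSpace X] (μ : Measure X) (F : X → ℝ) : Prop where
  meas : Measurable F
  int : Integrable F μ
  bdd : ∃ B, ∀ z, |F z| ≤ B

lemma Nice.lt_top {X : Type*} [MeasurableSpace X] {μ : Measure X} {F : X → ℝ} (h : Nice μ F) {p : ℝ} (hp : 1 ≤ p) :
    ∫⁻ z, ‖F z‖ₑ ^ p ∂μ < ⊤ := by
  obtain ⟨B, hB⟩ := h.bdd
  have hm := h.meas
  have h1 : ∀ z, ‖F z‖ₑ ^ p ≤ ENNReal.ofReal B ^ (p - 1) * ‖F z‖ₑ := by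
    intro z
    have e : ‖F z‖ₑ ^ p = ‖F z‖ₑ ^ (p - 1) * ‖F z‖ₑ := by
      nth_rewrite 3 [← ENNReal.rpow_one ‖F z‖ₑ]
      rw [← ENNReal.rpow_add_of_nonneg _ _ (by linarith) (by norm_num)]; congr 1; ring
    rw [e]
    refine mul_le_mul_left (ENNReal.rpow_le_rpow ?_ (by linarith)) _
    rw [← ofReal_norm]
    exact ENNReal.ofReal_le_ofReal (hB z)
  refine (lintegral_mono h1).trans_lt ?_
  rw [lintegral_const_mul _ (by fun_prop)]
  exact ENNReal.mul_lt_top (ENNReal.rpow_lt_top_of_nonneg (by linarith) ofReal_ne_top) h.int.2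

lemma Nice.nrm_lt {X : Type*} [MeasurableSpace X] {μ : Measure X} {F : X → ℝ} (h : Nice μ F) {p : ℝ} (hp : 1 ≤ p) :
    nrm p F μ < ⊤ := ENNReal.rpow_lt_top_of_nonneg (by positivity) (h.lt_top hp).ne

lemma Nice.memLp {X : Type*} [MeasurableSpace X] {μ : Measure X} {F : X → ℝ} (h : Nice μ F) {p : ℝ} (hp : 1 ≤ p) :
    MemLp F (ENNReal.ofReal p) μ :=
  ⟨h.meas.aestronglyMeasurable, by rw [← nrm_eq (by linarith)]; exact h.nrm_lt hp⟩

lemma cz_nice {d : ℕ} {K : ℝ × (Fin d → ℝ) → ℝ} {A : ℝ} (hK : CZK K A) {p q : ℝ} (hpq : p.HolderConjugate q) (hq2 : q ≤ 2)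
    {G : ℝ × (Fin d → ℝ) → ℝ} (hG : Nice volume G) :
    nrm q (Tc K G) volume ≤ ENNReal.ofReal (czC d A q) ^ (1 / q) * nrm q G volume := by
  have hq1 : 1 < q := hpq.symm.lt
  have hq0 : 0 < q := by linarith
  have hqi : Fact (1 ≤ ENNReal.ofReal q) := ⟨by rw [← ENNReal.ofReal_one]; exact ENNReal.ofReal_le_ofReal hq1.le⟩
  have hGm := hG.memLp hq1.le
  have hex : ∀ n : ℕ, ∃ g : ℝ × (Fin d → ℝ) → ℝ, HasCompactSupport g ∧
      eLpNorm (G - g) (ENNReal.ofReal q) volume ≤ ENNReal.ofReal (1 / ((n:ℝ) + 1)) ∧ Continuous g ∧ MemLp g (ENNReal.ofReal q) volume :=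
    fun n => hGm.exists_hasCompactSupport_eLpNorm_sub_le ofReal_ne_top (by simp; positivity)
  choose g hgc hge hgC hgm using hex
  have ht0 : Filter.Tendsto (fun n : ℕ => ENNReal.ofReal (1 / ((n:ℝ) + 1))) Filter.atTop (nhds 0) := by
    have := ENNReal.tendsto_ofReal (tendsto_one_div_add_atTop_nhds_zero_nat (𝕜 := ℝ))
    simpa using this
  have hgi : ∀ n, Integrable (g n) := fun n => (hgC n).integrable_of_hasCompactSupport (hgc n)
  have hlim : ∀ z, Filter.Tendsto (fun n => Tc K (g n) z) Filter.atTop (nhds (Tc K G z)) := by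
    intro z
    have hKz : Nice volume (fun w => K (z - w)) :=
      ⟨hK.meas.comp (measurable_const.sub measurable_id), hK.int.comp_sub_left z, by obtain ⟨B, hB⟩ := hK.bdd; exact ⟨B, fun w => hB _⟩⟩
    rw [tendsto_iff_edist_tendsto_0]
    have hb : ∀ n, edist (Tc K (g n) z) (Tc K G z) ≤ nrm p (fun w => K (z - w)) volume * ENNReal.ofReal (1 / ((n:ℝ) + 1)) := by
      intro n
      rw [edist_comm, edist_eq_enorm_sub, Tc, Tc, ← integral_sub (Tc_integrand hK hG.int z) (Tc_integrand hK (hgi n) z)]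
      simp_rw [← mul_sub]
      refine (holder_enorm hpq hKz.meas.aestronglyMeasurable (hG.int.sub (hgi n)).1).trans ?_
      refine mul_le_mul_right ?_ _
      rw [nrm_eq hq0]; exact hge n
    refine tendsto_of_tendsto_of_tendsto_of_le_of_le tendsto_const_nhds ?_ (fun _ => zero_le) hb
    have := ENNReal.Tendsto.const_mul (a := nrm p (fun w => K (z - w)) volume) ht0 (Or.inr (hKz.nrm_lt hpq.lt.le).ne)
    simpa using this
  rw [nrm_eq hq0]
  refine (Lp.eLpNorm_lim_le_liminf_eLpNorm (fun n => (Tc_sm hK.meas (hgC n).measurable).aestronglyMeasurable) _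
    (Filter.Eventually.of_forall hlim)).trans ?_
  have hb : ∀ n, eLpNorm (Tc K (g n)) (ENNReal.ofReal q) volume ≤
      ENNReal.ofReal (czC d A q) ^ (1 / q) * (nrm q G volume + ENNReal.ofReal (1 / ((n:ℝ) + 1))) := by
    intro n
    calc _ = nrm q (Tc K (g n)) volume := (nrm_eq hq0 _ _).symm
      _ ≤ ENNReal.ofReal (czC d A q) ^ (1 / q) * nrm q (g n) volume := by
          unfold nrm
          rw [← ENNReal.mul_rpow_of_nonneg _ _ (by positivity)]
          exact ENNReal.rpow_le_rpow (cz_main hK hq1 hq2 (hgC n) (hgc n)) (by positivity)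
      _ ≤ _ := by
          refine mul_le_mul_right ?_ _
          rw [nrm_eq hq0, nrm_eq hq0]
          have e : g n = G - (G - g n) := by ext w; simp
          rw [e]
          refine (eLpNorm_sub_le hGm.1 (hGm.1.sub (hgm n).1) hqi.out).trans (add_le_add le_rfl ?_)
          exact hge n
  have hT : Filter.Tendsto (fun n : ℕ => ENNReal.ofReal (czC d A q) ^ (1 / q) * (nrm q G volume + ENNReal.ofReal (1 / ((n:ℝ) + 1)))) Filter.atTop
      (nhds (ENNReal.ofReal (czC d A q) ^ (1 / q) * (nrm q G volume + 0))) :=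
    ENNReal.Tendsto.const_mul (tendsto_const_nhds.add ht0) (Or.inr (ENNReal.rpow_ne_top_of_nonneg (by positivity) ofReal_ne_top))
  rw [add_zero] at hT
  rw [← hT.liminf_eq]
  exact Filter.liminf_le_liminf (Filter.Eventually.of_forall hb)

/-- Bilinear form of a space-time kernel `κ s t x`. -/
def BLF {d : ℕ} (κ : ℝ → ℝ → (Fin d → ℝ) → ℝ) (F G : ℝ × (Fin d → ℝ) → ℝ) : ℝ :=
  ∫ y : (ℝ × (Fin d → ℝ)) × (ℝ × (Fin d → ℝ)), κ y.1.1 y.2.1 (y.2.2 - y.1.2) * (F y.1 * G y.2)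

/-- Boundedness of the bilinear form. -/
def BLB {d : ℕ} (p q : ℝ) (C : ℝ≥0∞) (κ : ℝ → ℝ → (Fin d → ℝ) → ℝ) : Prop :=
  ∀ F G : ℝ × (Fin d → ℝ) → ℝ, Nice volume F → Nice volume G →
    ‖BLF κ F G‖ₑ ≤ C * (nrm p F volume * nrm q G volume)

lemma cz_dual {d : ℕ} {K : ℝ × (Fin d → ℝ) → ℝ} {A : ℝ} (hK : CZK (fun z => K (-z)) A) {p q : ℝ} (hpq : p.HolderConjugate q) (hq2 : q ≤ 2) :
    BLB p q (ENNReal.ofReal (czC d A q) ^ (1 / q)) (fun s t x => K (t - s, x)) := by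
  intro F G hF hG
  have hKm : Measurable K := by
    have := hK.meas.comp measurable_neg
    simpa [Function.comp_def] using this
  have e : BLF (fun s t x => K (t - s, x)) F G = ∫ w, F w * Tc (fun z => K (-z)) G w := by
    unfold BLF
    rw [Measure.volume_eq_prod, integral_prod]
    · congr 1; ext w
      rw [Tc, ← integral_const_mul]
      congr 1; ext z
      simp only [neg_sub]
      rw [show (z.1 - w.1, z.2 - w.2) = z - w from rfl]; ring
    · obtain ⟨B, hB⟩ := hK.bdd
      refine (hF.int.mul_prod hG.int).bdd_mul (c := B) (Measurable.aestronglyMeasurable (by fun_prop)) (Filter.Eventually.of_forall fun w => ?_)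
      simpa using hB (-(w.2.1 - w.1.1, w.2.2 - w.1.2))
  rw [e]
  refine (holder_enorm hpq hF.int.1 (Tc_sm hK.meas hG.meas).aestronglyMeasurable).trans ?_
  rw [mul_left_comm]
  exact mul_le_mul_right (cz_nice hK hpq hq2 hG) _

end

section

/-- Squared Euclidean norm. -/
def n2 {d : ℕ} (x : Fin d → ℝ) : ℝ := ∑ k, x k ^ 2

lemma n2_nonneg {d : ℕ} (x : Fin d → ℝ) : 0 ≤ n2 x := Finset.sum_nonneg fun _ _ => sq_nonneg _

lemma continuous_n2 {d : ℕ} : Continuous (n2 (d := d)) := by unfold n2; fun_prop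

@[fun_prop] lemma measurable_n2 {d : ℕ} : Measurable (n2 (d := d)) := continuous_n2.measurable

lemma sq_le_n2 {d : ℕ} (x : Fin d → ℝ) (i : Fin d) : x i ^ 2 ≤ n2 x :=
  Finset.single_le_sum (f := fun k => x k ^ 2) (fun _ _ => sq_nonneg _) (Finset.mem_univ i)

lemma abs_mul_le_n2 {d : ℕ} (x : Fin d → ℝ) (i j : Fin d) : |x i * x j| ≤ n2 x := by
  rw [abs_mul]
  nlinarith [sq_le_n2 x i, sq_le_n2 x j, sq_nonneg (|x i| - |x j|), sq_abs (x i), sq_abs (x j)]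

lemma abs_le_n2 {d : ℕ} (x : Fin d → ℝ) (i : Fin d) : |x i| ≤ 1 + n2 x := by
  nlinarith [sq_le_n2 x i, sq_abs (x i), sq_nonneg (|x i| - 1)]

/-- Multiplier integral with cosine. -/
def kf {d : ℕ} (i j : Fin d) (Q : (Fin d → ℝ) → ℝ) (x : Fin d → ℝ) : ℝ :=
  ∫ ξ : Fin d → ℝ, (-(4 * Real.pi ^ 2) * (ξ i * ξ j) * Real.exp (-(4 * Real.pi ^ 2) * Q ξ)) * Real.cos (2 * Real.pi * (x ⬝ᵥ ξ))

/-- Heat kernel as a cosine transform. -/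
def gf {d : ℕ} (Q : (Fin d → ℝ) → ℝ) (x : Fin d → ℝ) : ℝ :=
  ∫ ξ : Fin d → ℝ, Real.exp (-(4 * Real.pi ^ 2) * Q ξ) * Real.cos (2 * Real.pi * (x ⬝ᵥ ξ))

@[fun_prop] lemma measurable_dotP {d : ℕ} {X : Type*} [MeasurableSpace X] {f g : X → Fin d → ℝ} (hf : Measurable f) (hg : Measurable g) :
    Measurable fun x => f x ⬝ᵥ g x := by
  unfold dotProduct; fun_prop

@[fun_prop] lemma continuous_dotP {d : ℕ} {X : Type*} [TopologicalSpace X] {f g : X → Fin d → ℝ} (hf : Continuous f) (hg : Continuous g) :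
    Continuous fun x => f x ⬝ᵥ g x := by
  unfold dotProduct; fun_prop

lemma integrable_exp_n2 {d : ℕ} {c : ℝ} (hc : 0 < c) : Integrable fun ξ : Fin d → ℝ => Real.exp (-c * n2 ξ) := by
  have := Integrable.fintype_prod (ι := Fin d) (f := fun _ (v : ℝ) => Real.exp (-c * v ^ 2)) (μ := fun _ => volume) (fun _ => integrable_exp_neg_mul_sq hc)
  refine this.congr (Filter.Eventually.of_forall fun ξ => ?_)
  simp only [n2, Finset.mul_sum, Real.exp_sum]

/-- Polynomial times exponential. -/
lemma poly_exp_le {c : ℝ} (hc : 0 < c) (m : ℕ) :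
    ∃ C, 0 < C ∧ ∀ u, 0 ≤ u → (1 + u) ^ m * Real.exp (-c * u) ≤ C * Real.exp (-(c / 2) * u) := by
  rcases Nat.eq_zero_or_pos m with rfl | hm
  · refine ⟨1, one_pos, fun u hu => ?_⟩
    rw [pow_zero, one_mul, one_mul]
    exact Real.exp_le_exp.2 (by nlinarith)
  have hm' : (0:ℝ) < m := by exact_mod_cast hm
  set M : ℝ := 1 + 2 * m / c with hM
  have hM0 : 0 < M := by positivity
  refine ⟨M ^ m, by positivity, fun u hu => ?_⟩
  have h1 : 1 + u ≤ M * Real.exp (c * u / (2 * m)) := by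
    have h2 := Real.add_one_le_exp (c * u / (2 * m))
    have h3 : (0:ℝ) ≤ c * u / (2 * m) := by positivity
    calc 1 + u ≤ M * (c * u / (2 * m) + 1) := by
          rw [hM]; have : (1 + 2 * m / c) * (c * u / (2 * m) + 1) = 1 + u + c * u / (2 * m) + 2 * m / c := by
            field_simp; ring
          rw [this]; have : 0 ≤ 2 * m / c := by positivity
          linarith
      _ ≤ _ := mul_le_mul_of_nonneg_left h2 hM0.le
  calc (1 + u) ^ m * Real.exp (-c * u) ≤ (M * Real.exp (c * u / (2 * m))) ^ m * Real.exp (-c * u) :=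
        mul_le_mul_of_nonneg_right (pow_le_pow_left₀ (by linarith) h1 m) (Real.exp_pos _).le
    _ = M ^ m * Real.exp (-(c / 2) * u) := by
        rw [mul_pow, ← Real.exp_nat_mul, mul_assoc, ← Real.exp_add]
        congr 2; field_simp; ring

lemma integrable_poly_exp {d : ℕ} {c : ℝ} (hc : 0 < c) (m : ℕ) :
    Integrable fun ξ : Fin d → ℝ => (1 + n2 ξ) ^ m * Real.exp (-c * n2 ξ) := by
  obtain ⟨C, hC, h⟩ := poly_exp_le hc m
  refine ((integrable_exp_n2 (half_pos hc)).const_mul C).mono' (Measurable.aestronglyMeasurable (by fun_prop)) (Filter.Eventually.of_forall fun ξ => ?_)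
  have := n2_nonneg ξ
  rw [Real.norm_of_nonneg (by positivity)]
  exact h _ this

lemma gauss_cos {d : ℕ} {b : ℝ} (hb : 0 < b) (x : Fin d → ℝ) :
    ∫ v : Fin d → ℝ, Real.exp (-b * n2 v) * Real.cos (x ⬝ᵥ v) = (Real.pi / b) ^ ((d:ℝ) / 2) * Real.exp (-n2 x / (4 * b)) := by
  have h1 := GaussianFourier.integral_cexp_neg_mul_sum_add (ι := Fin d) (b := (b:ℂ)) (by simpa using hb) (fun i => (x i : ℂ) * Complex.I)
  have h2 := GaussianFourier.integrable_cexp_neg_mul_sum_add (ι := Fin d) (b := (b:ℂ)) (by simpa using hb) (fun i => (x i : ℂ) * Complex.I)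
  have h3 := Complex.reCLM.integral_comp_comm h2
  rw [h1] at h3
  have e1 : ∀ v : Fin d → ℝ, Complex.reCLM (Complex.exp (-(b:ℂ) * ∑ i, (v i : ℂ) ^ 2 + ∑ i, (x i : ℂ) * Complex.I * (v i : ℂ))) = Real.exp (-b * n2 v) * Real.cos (x ⬝ᵥ v) := by
    intro v
    have : -(b:ℂ) * ∑ i, (v i : ℂ) ^ 2 + ∑ i, (x i : ℂ) * Complex.I * (v i : ℂ) = ((-b * n2 v : ℝ) : ℂ) + ((x ⬝ᵥ v : ℝ) : ℂ) * Complex.I := by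
      simp only [n2, dotProduct]; push_cast; rw [Finset.sum_mul]
      congr 1; exact Finset.sum_congr rfl fun i _ => by ring
    rw [this]
    simp [Complex.exp_re]
  simp_rw [e1] at h3
  rw [h3]
  have e2 : (∑ i, ((x i : ℂ) * Complex.I) ^ 2) / (4 * (b:ℂ)) = ((-n2 x / (4 * b) : ℝ) : ℂ) := by
    simp only [n2, mul_pow, Complex.I_sq]; push_cast; rw [← Finset.sum_neg_distrib]; simp
  have e3 : ((Real.pi : ℂ) / (b:ℂ)) ^ (((Fintype.card (Fin d) : ℕ) : ℂ) / 2) = (((Real.pi / b) ^ ((d:ℝ) / 2) : ℝ) : ℂ) := by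
    rw [Complex.ofReal_cpow (by positivity)]; simp
  rw [e2, e3, ← Complex.ofReal_exp, ← Complex.ofReal_mul]
  exact Complex.ofReal_re _

/-- differentiate a cosine transform along a line -/
lemma hasDerivAt_cosT {d : ℕ} {m : (Fin d → ℝ) → ℝ} (hm : Measurable m) (hmi : Integrable m) (e x : Fin d → ℝ)
    (hme : Integrable fun ξ => m ξ * (e ⬝ᵥ ξ)) (c : ℝ) :
    HasDerivAt (fun s : ℝ => ∫ ξ, m ξ * Real.cos ((x + s • e) ⬝ᵥ ξ + c)) (∫ ξ, m ξ * (e ⬝ᵥ ξ) * (-Real.sin (x ⬝ᵥ ξ + c))) 0 := by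
  have := hasDerivAt_integral_of_dominated_loc_of_deriv_le (μ := (volume : Measure (Fin d → ℝ))) (x₀ := (0:ℝ)) (s := univ) Filter.univ_mem
    (F := fun s ξ => m ξ * Real.cos ((x + s • e) ⬝ᵥ ξ + c)) (F' := fun s ξ => m ξ * (e ⬝ᵥ ξ) * (-Real.sin ((x + s • e) ⬝ᵥ ξ + c)))
    (bound := fun ξ => ‖m ξ * (e ⬝ᵥ ξ)‖) (Filter.Eventually.of_forall fun s => Measurable.aestronglyMeasurable (by fun_prop))
    (hmi.mono (Measurable.aestronglyMeasurable (by fun_prop)) (Filter.Eventually.of_forall fun ξ => by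
      rw [norm_mul]; exact mul_le_of_le_one_right (norm_nonneg _) (Real.abs_cos_le_one _)))
    (Measurable.aestronglyMeasurable (by fun_prop))
    (Filter.Eventually.of_forall fun ξ s _ => by
      rw [norm_mul]; refine mul_le_of_le_one_right (norm_nonneg _) ?_
      rw [norm_neg]; exact Real.abs_sin_le_one _)
    hme.norm
    (Filter.Eventually.of_forall fun ξ s _ => by
      have h1 : HasDerivAt (fun s : ℝ => (x + s • e) ⬝ᵥ ξ + c) (e ⬝ᵥ ξ) s := by
        simp only [add_dotProduct, smul_dotProduct, smul_eq_mul]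
        simpa using (((hasDerivAt_id s).mul_const (e ⬝ᵥ ξ)).const_add (x ⬝ᵥ ξ)).add_const c
      exact ((h1.cos).const_mul (m ξ)).congr_deriv (by ring))
  simpa using this.2


lemma single_dot {d : ℕ} (i : Fin d) (ξ : Fin d → ℝ) : (Pi.single i (1:ℝ)) ⬝ᵥ ξ = ξ i := by simp

lemma integrable_mono_exp {d : ℕ} {c : ℝ} (hc : 0 < c) (i : Fin d) :
    Integrable fun ξ : Fin d → ℝ => Real.exp (-c * n2 ξ) * ξ i := by
  refine (integrable_poly_exp hc 1).mono' (Measurable.aestronglyMeasurable (by fun_prop)) (Filter.Eventually.of_forall fun ξ => ?_)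
  rw [norm_mul, Real.norm_of_nonneg (Real.exp_pos _).le, pow_one, mul_comm]
  exact mul_le_mul_of_nonneg_right (abs_le_n2 ξ i) (Real.exp_pos _).le

lemma integrable_mono2_exp {d : ℕ} {c : ℝ} (hc : 0 < c) (i j : Fin d) :
    Integrable fun ξ : Fin d → ℝ => Real.exp (-c * n2 ξ) * ξ i * ξ j := by
  refine (integrable_poly_exp hc 1).mono' (Measurable.aestronglyMeasurable (by fun_prop)) (Filter.Eventually.of_forall fun ξ => ?_)
  rw [mul_assoc, norm_mul, Real.norm_of_nonneg (Real.exp_pos _).le, pow_one, mul_comm]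
  exact mul_le_mul_of_nonneg_right ((abs_mul_le_n2 ξ i j).trans (by linarith)) (Real.exp_pos _).le

lemma n2_line {d : ℕ} (x : Fin d → ℝ) (i : Fin d) : HasDerivAt (fun s : ℝ => n2 (x + s • Pi.single i (1:ℝ))) (2 * x i) 0 := by
  have : (fun s : ℝ => n2 (x + s • Pi.single i (1:ℝ))) = fun s => n2 x + 2 * s * x i + s ^ 2 := by
    funext s
    simp only [n2, Pi.add_apply, Pi.smul_apply, smul_eq_mul, Pi.single_apply, mul_ite, mul_one, mul_zero]
    have : ∀ k, (x k + if k = i then s else 0) ^ 2 = x k ^ 2 + if k = i then 2 * s * x i + s ^ 2 else 0 := by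
      intro k; split_ifs with h
      · subst h; ring
      · ring
    simp only [this, Finset.sum_add_distrib, Finset.sum_ite_eq', Finset.mem_univ, if_true]
    ring
  rw [this]
  have h := ((((hasDerivAt_id (0:ℝ)).const_mul 2).mul_const (x i)).const_add (n2 x)).add ((hasDerivAt_id (0:ℝ)).pow 2)
  exact h.congr_deriv (by simp)

lemma gexp_line {d : ℕ} (A b : ℝ) (x : Fin d → ℝ) (i : Fin d) : HasDerivAt (fun s : ℝ => A * Real.exp (-n2 (x + s • Pi.single i (1:ℝ)) / (4 * b)))
    (A * Real.exp (-n2 x / (4 * b)) * (-(2 * x i) / (4 * b))) 0 := by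
  have h := ((((n2_line x i).neg).div_const (4 * b)).exp).const_mul A
  exact h.congr_deriv (by simp; ring)

lemma gauss_sin {d : ℕ} {b : ℝ} (hb : 0 < b) (i : Fin d) (x : Fin d → ℝ) :
    ∫ v : Fin d → ℝ, Real.exp (-b * n2 v) * v i * Real.cos (x ⬝ᵥ v + (-(Real.pi / 2))) = (x i / (2 * b)) * ((Real.pi / b) ^ ((d:ℝ) / 2) * Real.exp (-n2 x / (4 * b))) := by
  have h1 := hasDerivAt_cosT (m := fun v : Fin d → ℝ => Real.exp (-b * n2 v)) (by fun_prop) (integrable_exp_n2 hb) (Pi.single i 1) x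
    (by simp only [single_dot]; exact integrable_mono_exp hb i) 0
  simp only [add_zero, gauss_cos hb, single_dot] at h1
  have h2 := h1.unique (gexp_line _ b x i)
  simp only [← sub_eq_add_neg, Real.cos_sub_pi_div_two]
  simp only [mul_neg, integral_neg] at h2
  rw [neg_eq_iff_eq_neg] at h2
  rw [h2]; field_simp; ring

lemma gauss_cos2 {d : ℕ} {b : ℝ} (hb : 0 < b) (i j : Fin d) (x : Fin d → ℝ) :
    ∫ v : Fin d → ℝ, Real.exp (-b * n2 v) * v i * v j * Real.cos (x ⬝ᵥ v) =
      ((if i = j then 1 else 0) / (2 * b) - x i * x j / (4 * b ^ 2)) * ((Real.pi / b) ^ ((d:ℝ) / 2) * Real.exp (-n2 x / (4 * b))) := by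
  have h1 := hasDerivAt_cosT (m := fun v : Fin d → ℝ => Real.exp (-b * n2 v) * v i) (by fun_prop) (integrable_mono_exp hb i) (Pi.single j 1) x
    (by simp only [single_dot]; exact integrable_mono2_exp hb i j) (-(Real.pi / 2))
  simp only [gauss_sin hb, single_dot] at h1
  have h3 : HasDerivAt (fun s : ℝ => (x + s • (Pi.single j (1:ℝ) : Fin d → ℝ)) i / (2 * b)) ((if i = j then 1 else 0) / (2 * b)) 0 := by
    simp only [Pi.add_apply, Pi.smul_apply, smul_eq_mul, Pi.single_apply]
    have h := (((hasDerivAt_id (0:ℝ)).mul_const (if i = j then (1:ℝ) else 0)).const_add (x i)).div_const (2 * b)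
    exact h.congr_deriv (by simp)
  have h2 := h1.unique (h3.mul (gexp_line _ b x j))
  simp only [← sub_eq_add_neg, Real.sin_sub_pi_div_two, neg_neg] at h2
  rw [h2]
  simp only [zero_smul, add_zero]
  field_simp
  ring

/-- Explicit heat kernel. -/
lemma gf_n2 {d : ℕ} {t : ℝ} (ht : 0 < t) (x : Fin d → ℝ) :
    gf (fun ξ => t * n2 ξ) x = (4 * Real.pi * t) ^ (-((d:ℝ) / 2)) * Real.exp (-n2 x / (4 * t)) := by
  have hpi := Real.pi_pos
  have h := gauss_cos (b := 4 * Real.pi ^ 2 * t) (by positivity) ((2 * Real.pi) • x)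
  unfold gf
  simp only [smul_dotProduct, smul_eq_mul] at h
  have e : ∀ ξ : Fin d → ℝ, -(4 * Real.pi ^ 2) * (t * n2 ξ) = -(4 * Real.pi ^ 2 * t) * n2 ξ := fun ξ => by ring
  simp only [e]
  rw [h, Real.rpow_neg (by positivity), ← Real.inv_rpow (by positivity)]
  congr 2
  · field_simp
  · simp only [n2, Pi.smul_apply, smul_eq_mul, mul_pow, ← Finset.mul_sum]; field_simp; ring

lemma kf_n2 {d : ℕ} {t : ℝ} (ht : 0 < t) (i j : Fin d) (x : Fin d → ℝ) :
    kf i j (fun ξ => t * n2 ξ) x = (x i * x j / (4 * t ^ 2) - (if i = j then 1 else 0) / (2 * t)) *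
      ((4 * Real.pi * t) ^ (-((d:ℝ) / 2)) * Real.exp (-n2 x / (4 * t))) := by
  have hpi := Real.pi_pos
  rw [← gf_n2 ht x]
  have h := gauss_cos2 (b := 4 * Real.pi ^ 2 * t) (by positivity) i j ((2 * Real.pi) • x)
  rw [← gauss_cos (b := 4 * Real.pi ^ 2 * t) (by positivity) ((2 * Real.pi) • x)] at h
  unfold gf kf
  simp only [smul_dotProduct, smul_eq_mul, Pi.smul_apply] at h
  have e : ∀ ξ : Fin d → ℝ, -(4 * Real.pi ^ 2) * (t * n2 ξ) = -(4 * Real.pi ^ 2 * t) * n2 ξ := fun ξ => by ring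
  simp only [e]
  have e2 : ∀ ξ : Fin d → ℝ, -(4 * Real.pi ^ 2) * (ξ i * ξ j) * Real.exp (-(4 * Real.pi ^ 2 * t) * n2 ξ) * Real.cos (2 * Real.pi * (x ⬝ᵥ ξ))
    = -(4 * Real.pi ^ 2) * (Real.exp (-(4 * Real.pi ^ 2 * t) * n2 ξ) * ξ i * ξ j * Real.cos (2 * Real.pi * (x ⬝ᵥ ξ))) := fun ξ => by ring
  simp only [e2, integral_const_mul]
  rw [h, ← mul_assoc]
  congr 1
  field_simp
  ring

end

section

/-- Second derivatives of the heat kernel. -/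
def hk {d : ℕ} (i j : Fin d) (t : ℝ) (x : Fin d → ℝ) : ℝ :=
  (x i * x j / (4 * t ^ 2) - (if i = j then 1 else 0) / (2 * t)) *
      ((4 * Real.pi * t) ^ (-((d:ℝ) / 2)) * Real.exp (-n2 x / (4 * t)))

/-- Majorant profile. -/
def hps {d : ℕ} (t : ℝ) (x : Fin d → ℝ) : ℝ := (4 * Real.pi * t) ^ (-((d:ℝ) / 2)) * Real.exp (-n2 x / (8 * t))

lemma hps_nonneg {d : ℕ} {t : ℝ} (ht : 0 < t) (x : Fin d → ℝ) : 0 ≤ hps t x := by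
  have := Real.pi_pos
  unfold hps; positivity

@[fun_prop] lemma measurable_hk {d : ℕ} (i j : Fin d) {X : Type*} [MeasurableSpace X] {f : X → ℝ} {g : X → Fin d → ℝ}
    (hf : Measurable f) (hg : Measurable g) : Measurable fun z => hk i j (f z) (g z) := by
  unfold hk
  have : Measurable fun z => n2 (g z) := measurable_n2.comp hg
  fun_prop

@[fun_prop] lemma measurable_hps {d : ℕ} {X : Type*} [MeasurableSpace X] {f : X → ℝ} {g : X → Fin d → ℝ}
    (hf : Measurable f) (hg : Measurable g) : Measurable fun z => hps (f z) (g z) := by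
  unfold hps
  have : Measurable fun z => n2 (g z) := measurable_n2.comp hg
  fun_prop

lemma lint_hps {d : ℕ} {t : ℝ} (ht : 0 < t) (c : Fin d → ℝ) : ∫⁻ x : Fin d → ℝ, ENNReal.ofReal (hps t (x - c)) = ENNReal.ofReal (2 ^ ((d:ℝ) / 2)) := by
  have hpi := Real.pi_pos
  rw [lintegral_sub_right_eq_self (fun x => ENNReal.ofReal (hps t x)) c]
  have e : ∀ x : Fin d → ℝ, -n2 x / (8 * t) = -(1 / (8 * t)) * n2 x := fun x => by ring
  rw [← ofReal_integral_eq_lintegral_ofReal]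
  · congr 1
    have h := gauss_cos (d := d) (b := 1 / (8 * t)) (by positivity) 0
    simp only [zero_dotProduct, Real.cos_zero, mul_one] at h
    unfold hps
    simp only [e, integral_const_mul]
    rw [h]
    have : n2 (0 : Fin d → ℝ) = 0 := by simp [n2]
    rw [this]; simp only [neg_zero, zero_div, Real.exp_zero, mul_one]
    rw [Real.rpow_neg (by positivity), ← Real.inv_rpow (by positivity), ← Real.mul_rpow (by positivity) (by positivity)]
    congr 1; field_simp; norm_num
  · unfold hps
    simp only [e]
    exact (integrable_exp_n2 (by positivity)).const_mul _
  · exact Filter.Eventually.of_forall fun x => hps_nonneg ht x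

lemma hk_pre {d : ℕ} (i j : Fin d) {t : ℝ} (ht : 0 < t) (x : Fin d → ℝ) :
    |x i * x j / (4 * t ^ 2) - (if i = j then 1 else 0) / (2 * t)| ≤ (1 / t) * (1 + n2 x / t) := by
  have h1 := abs_mul_le_n2 x i j
  have h2 := n2_nonneg x
  have h3 : |(if i = j then (1:ℝ) else 0)| ≤ 1 := by split_ifs <;> simp
  calc _ ≤ |x i * x j / (4 * t ^ 2)| + |(if i = j then 1 else 0) / (2 * t)| := abs_sub _ _
    _ = |x i * x j| / (4 * t ^ 2) + |(if i = j then 1 else 0)| / (2 * t) := by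
        rw [abs_div, abs_div, abs_of_pos (show 0 < 4 * t ^ 2 by positivity), abs_of_pos (show 0 < 2 * t by positivity)]
    _ ≤ n2 x / (4 * t ^ 2) + 1 / (2 * t) := by gcongr
    _ ≤ n2 x / (t ^ 2) + 1 / t := by
        have a1 : n2 x / (4 * t ^ 2) ≤ n2 x / t ^ 2 := div_le_div_of_nonneg_left h2 (by positivity) (by nlinarith [sq_nonneg t])
        have a2 : 1 / (2 * t) ≤ 1 / t := div_le_div_of_nonneg_left zero_le_one ht (by linarith)
        linarith
    _ = _ := by field_simp; ring

/-- constant in Gaussian absorptions -/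
lemma gabs : ∃ C, 0 < C ∧ ∀ (d : ℕ) (t : ℝ), 0 < t → ∀ x : Fin d → ℝ,
    (1 + n2 x / t) ^ 2 * ((4 * Real.pi * t) ^ (-((d:ℝ) / 2)) * Real.exp (-n2 x / (4 * t))) ≤ C * hps t x := by
  obtain ⟨C, hC, h⟩ := poly_exp_le (c := 1 / 4) (by norm_num) 2
  refine ⟨C, hC, fun d t ht x => ?_⟩
  have hpi := Real.pi_pos
  have h1 := h (n2 x / t) (div_nonneg (n2_nonneg x) ht.le)
  have e1 : -(1 / 4) * (n2 x / t) = -n2 x / (4 * t) := by field_simp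
  have e2 : -(1 / 4 / 2) * (n2 x / t) = -n2 x / (8 * t) := by field_simp; ring
  rw [e1, e2] at h1
  unfold hps
  have h0 : 0 ≤ (4 * Real.pi * t) ^ (-((d:ℝ) / 2)) := by positivity
  nlinarith [mul_le_mul_of_nonneg_left h1 h0]

/-- chosen constant -/
def gaC : ℝ := gabs.choose
lemma gaC_pos : 0 < gaC := gabs.choose_spec.1
lemma gaC_le {d : ℕ} {t : ℝ} (ht : 0 < t) (x : Fin d → ℝ) :
    (1 + n2 x / t) ^ 2 * ((4 * Real.pi * t) ^ (-((d:ℝ) / 2)) * Real.exp (-n2 x / (4 * t))) ≤ gaC * hps t x := gabs.choose_spec.2 d t ht x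

lemma hk_bound {d : ℕ} (i j : Fin d) {t : ℝ} (ht : 0 < t) (x : Fin d → ℝ) :
    |hk i j t x| * (1 + n2 x / t) ≤ gaC / t * hps t x := by
  have hpi := Real.pi_pos
  have h0 : 0 ≤ n2 x / t := div_nonneg (n2_nonneg x) ht.le
  unfold hk
  rw [abs_mul, abs_of_nonneg (show 0 ≤ (4 * Real.pi * t) ^ (-((d:ℝ) / 2)) * Real.exp (-n2 x / (4 * t)) by positivity)]
  have hE : 0 ≤ (4 * Real.pi * t) ^ (-((d:ℝ) / 2)) * Real.exp (-n2 x / (4 * t)) := by positivity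
  calc _ ≤ (1 / t) * (1 + n2 x / t) * ((4 * Real.pi * t) ^ (-((d:ℝ) / 2)) * Real.exp (-n2 x / (4 * t))) * (1 + n2 x / t) := by
        gcongr; exact hk_pre i j ht x
    _ = (1 / t) * ((1 + n2 x / t) ^ 2 * ((4 * Real.pi * t) ^ (-((d:ℝ) / 2)) * Real.exp (-n2 x / (4 * t)))) := by ring
    _ ≤ (1 / t) * (gaC * hps t x) := mul_le_mul_of_nonneg_left (gaC_le ht x) (by positivity)
    _ = _ := by ring

set_option maxHeartbeats 1000000 in
lemma hk_deriv {d : ℕ} (i j : Fin d) (t τ : ℝ) (x y : Fin d → ℝ) (r : ℝ) (hs : 0 < t - r * τ) :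
    ∃ D, HasDerivAt (fun r => hk i j (t - r * τ) (x - r • y)) D r ∧
      |D| ≤ (d + 2) * gaC * (|τ| / (t - r * τ) ^ 2 + ‖y‖ / ((t - r * τ) * √(t - r * τ))) * hps (t - r * τ) (x - r • y) := by
  have hpi := Real.pi_pos
  set s := t - r * τ with hsd
  set X := x - r • y with hX
  have ds : HasDerivAt (fun r => t - r * τ) (-τ) r := by
    exact (((hasDerivAt_id r).mul_const τ).const_sub t).congr_deriv (by simp)
  have dX : ∀ k, HasDerivAt (fun r : ℝ => (x - r • y) k) (-y k) r := fun k => by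
    simp only [Pi.sub_apply, Pi.smul_apply, smul_eq_mul]
    exact (((hasDerivAt_id r).mul_const (y k)).const_sub (x k)).congr_deriv (by simp)
  have dn : HasDerivAt (fun r : ℝ => n2 (x - r • y)) (-(2 * (X ⬝ᵥ y))) r := by
    unfold n2
    have := HasDerivAt.fun_sum (u := Finset.univ) (fun k _ => (dX k).pow 2)
    refine this.congr_deriv ?_
    rw [dotProduct, Finset.mul_sum, ← Finset.sum_neg_distrib]
    exact Finset.sum_congr rfl fun k _ => by rw [hX]; push_cast; ring
  have dP : HasDerivAt (fun r : ℝ => (x - r • y) i * (x - r • y) j / (4 * (t - r * τ) ^ 2) - (if i = j then 1 else 0) / (2 * (t - r * τ)))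
      ((-y i * X j + X i * (-y j)) / (4 * s ^ 2) + X i * X j * τ / (2 * s ^ 3) - (if i = j then 1 else 0) * τ / (2 * s ^ 2)) r := by
    have h1 := ((dX i).mul (dX j)).div ((ds.pow 2).const_mul 4) (by simp only [Pi.pow_apply]; positivity)
    have h2 := (hasDerivAt_const r (if i = j then (1:ℝ) else 0)).div (ds.const_mul 2) (by positivity)
    refine (h1.sub h2).congr_deriv ?_
    simp only [Pi.pow_apply, Pi.mul_apply]
    rw [← hsd, ← hX]
    field_simp
    push_cast
    ring
  have dc : HasDerivAt (fun r : ℝ => (4 * Real.pi * (t - r * τ)) ^ (-((d:ℝ) / 2))) ((4 * Real.pi * s) ^ (-((d:ℝ) / 2)) * (d / 2 * τ / s)) r := by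
    have h1 := (ds.const_mul (4 * Real.pi)).rpow_const (p := -((d:ℝ) / 2)) (Or.inl (by positivity))
    refine h1.congr_deriv ?_
    rw [← hsd, Real.rpow_sub_one (by positivity)]
    field_simp
  have de : HasDerivAt (fun r : ℝ => Real.exp (-n2 (x - r • y) / (4 * (t - r * τ)))) (Real.exp (-n2 X / (4 * s)) * ((X ⬝ᵥ y) / (2 * s) - n2 X * τ / (4 * s ^ 2))) r := by
    have h1 := (dn.neg.div (ds.const_mul 4) (by positivity)).exp
    refine h1.congr_deriv ?_
    simp only [Pi.neg_apply]
    rw [← hsd, ← hX]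
    simp only [Pi.div_apply, Pi.neg_apply]
    rw [← hsd, ← hX]
    congr 1
    field_simp
    ring
  refine ⟨_, dP.mul (dc.mul de), ?_⟩
  try simp only [Pi.mul_apply]
  try rw [← hsd, ← hX]
  set c := (4 * Real.pi * s) ^ (-((d:ℝ) / 2)) with hc
  set e := Real.exp (-n2 X / (4 * s)) with he
  have hc0 : 0 ≤ c := by positivity
  have he0 : 0 ≤ e := by positivity
  set P' := ((-y i * X j + X i * (-y j)) / (4 * s ^ 2) + X i * X j * τ / (2 * s ^ 3) - (if i = j then 1 else 0) * τ / (2 * s ^ 2)) with hP'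
  set P := (X i * X j / (4 * s ^ 2) - (if i = j then 1 else 0) / (2 * s)) with hP
  have e0 : P' * (c * e) + P * (c * (d / 2 * τ / s) * e + c * (e * ((X ⬝ᵥ y) / (2 * s) - n2 X * τ / (4 * s ^ 2))))
    = (P' + P * (d / 2 * τ / s + (X ⬝ᵥ y) / (2 * s) - n2 X * τ / (4 * s ^ 2))) * (c * e) := by ring
  rw [e0, abs_mul, abs_of_nonneg (mul_nonneg hc0 he0)]
  set u := n2 X / s with hu
  have hu0 : 0 ≤ u := div_nonneg (n2_nonneg X) hs.le
  set σ := √s with hσ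
  have hσ0 : 0 < σ := Real.sqrt_pos.2 hs
  have hσ2 : s = σ ^ 2 := (Real.sq_sqrt hs.le).symm
  have hn : n2 X = σ ^ 2 * u := by rw [hu, ← hσ2]; field_simp
  have hXk : ∀ k, |X k| ≤ σ * (1 + u) := fun k => by
    refine abs_le_of_sq_le_sq ?_ (by positivity)
    have := sq_le_n2 X k
    rw [hn] at this
    nlinarith [sq_nonneg σ, mul_nonneg (sq_nonneg σ) hu0, mul_nonneg (mul_nonneg (sq_nonneg σ) hu0) hu0]
  have hyk : ∀ k, |y k| ≤ ‖y‖ := fun k => norm_le_pi_norm y k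
  set A := |τ| / s ^ 2 + ‖y‖ / (s * σ) with hA
  have hA0 : 0 ≤ A := by positivity
  have hsd2 : |(if i = j then (1:ℝ) else 0)| ≤ 1 := by split_ifs <;> simp
  have bP : |P| ≤ (1 / s) * (1 + u) := hk_pre i j hs X
  have bP' : |P'| ≤ A * (1 + u) := by
    have b1 : |(-y i * X j + X i * (-y j)) / (4 * s ^ 2)| ≤ ‖y‖ / (s * σ) * (1 + u) := by
      rw [abs_div, abs_of_pos (show 0 < 4 * s ^ 2 by positivity), div_le_iff₀ (by positivity)]
      calc _ ≤ |-y i * X j| + |X i * (-y j)| := abs_add_le _ _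
        _ = |y i| * |X j| + |X i| * |y j| := by rw [abs_mul, abs_mul, abs_neg, abs_neg]
        _ ≤ ‖y‖ * (σ * (1 + u)) + σ * (1 + u) * ‖y‖ := by
            gcongr
            exacts [hyk i, hXk j, hXk i, hyk j]
        _ ≤ 4 * (‖y‖ * (σ * (1 + u))) := by
            have : 0 ≤ ‖y‖ * (σ * (1 + u)) := by positivity
            linarith
        _ = _ := by rw [hσ2]; field_simp
    have b2 : |X i * X j * τ / (2 * s ^ 3)| ≤ |τ| / s ^ 2 * u / 2 := by
      rw [abs_div, abs_mul, abs_of_pos (show 0 < 2 * s ^ 3 by positivity), div_le_iff₀ (by positivity)]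
      calc _ ≤ n2 X * |τ| := by gcongr; exact abs_mul_le_n2 X i j
        _ = _ := by rw [hu]; field_simp
    have b3 : |(if i = j then 1 else 0) * τ / (2 * s ^ 2)| ≤ |τ| / s ^ 2 / 2 := by
      rw [abs_div, abs_mul, abs_of_pos (show 0 < 2 * s ^ 2 by positivity), div_le_iff₀ (by positivity)]
      calc _ ≤ 1 * |τ| := by gcongr
        _ = _ := by field_simp
    have h0 : 0 ≤ |τ| / s ^ 2 := by positivity
    have h00 : 0 ≤ |τ| / s ^ 2 * u := by positivity
    calc |P'| ≤ _ + _ + _ := (abs_sub _ _).trans (by gcongr; exact abs_add_le _ _)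
      _ ≤ ‖y‖ / (s * σ) * (1 + u) + |τ| / s ^ 2 * u / 2 + |τ| / s ^ 2 / 2 := by gcongr
      _ ≤ _ := by rw [hA]; linarith
  have bB : |(d / 2 * τ / s + (X ⬝ᵥ y) / (2 * s) - n2 X * τ / (4 * s ^ 2))| ≤ (d + 1) * (1 + u) * (s * A) := by
    have b1 : |d / 2 * τ / s| ≤ d * (|τ| / s) := by
      rw [abs_div, abs_mul, abs_of_pos hs, abs_of_nonneg (show (0:ℝ) ≤ d / 2 by positivity), mul_div_assoc]
      gcongr; linarith [show (0:ℝ) ≤ d by positivity]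
    have b2 : |(X ⬝ᵥ y) / (2 * s)| ≤ d * ((1 + u) * (‖y‖ / σ)) := by
      rw [abs_div, abs_of_pos (show 0 < 2 * s by positivity), div_le_iff₀ (by positivity)]
      calc _ ≤ ∑ k, |X k * y k| := Finset.abs_sum_le_sum_abs _ _
        _ ≤ ∑ _k : Fin d, σ * (1 + u) * ‖y‖ := Finset.sum_le_sum fun k _ => by
            rw [abs_mul]; exact mul_le_mul (hXk k) (hyk k) (abs_nonneg _) (by positivity)
        _ = d * (σ * (1 + u) * ‖y‖) := by simp
        _ ≤ 2 * (d * (σ * (1 + u) * ‖y‖)) := by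
            have : 0 ≤ d * (σ * (1 + u) * ‖y‖) := by positivity
            linarith
        _ = _ := by rw [hσ2]; field_simp
    have b3 : |n2 X * τ / (4 * s ^ 2)| ≤ u * (|τ| / s) := by
      rw [abs_div, abs_mul, abs_of_pos (show 0 < 4 * s ^ 2 by positivity), div_le_iff₀ (by positivity), abs_of_nonneg (n2_nonneg X)]
      have : 0 ≤ n2 X * |τ| := mul_nonneg (n2_nonneg X) (abs_nonneg _)
      calc _ ≤ 4 * (n2 X * |τ|) := by linarith
        _ = _ := by rw [hu]; field_simp
    have hsA : s * A = |τ| / s + ‖y‖ / σ := by rw [hA]; field_simp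
    rw [hsA]
    have g1 : 0 ≤ |τ| / s := by positivity
    have g2 : 0 ≤ ‖y‖ / σ := by positivity
    have g3 : (0:ℝ) ≤ d := by positivity
    calc _ ≤ _ + _ + _ := (abs_sub _ _).trans (by gcongr; exact abs_add_le _ _)
      _ ≤ d * (|τ| / s) + d * ((1 + u) * (‖y‖ / σ)) + u * (|τ| / s) := by gcongr
      _ ≤ _ := by nlinarith [mul_nonneg hu0 g1, mul_nonneg hu0 g2, mul_nonneg g3 (mul_nonneg hu0 g1)]
  calc _ ≤ (A * (1 + u) + (1 / s) * (1 + u) * ((d + 1) * (1 + u) * (s * A))) * (c * e) := by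
        gcongr
        refine (abs_add_le _ _).trans ?_
        rw [abs_mul]
        gcongr
    _ = (A * (1 + u) + (d + 1) * A * (1 + u) ^ 2) * (c * e) := by field_simp
    _ ≤ ((d + 2) * A * (1 + u) ^ 2) * (c * e) := by
        gcongr
        nlinarith [mul_nonneg hA0 hu0, mul_nonneg (mul_nonneg hA0 hu0) hu0]
    _ = (d + 2) * A * ((1 + u) ^ 2 * (c * e)) := by ring
    _ ≤ (d + 2) * A * (gaC * hps s X) := mul_le_mul_of_nonneg_left (gaC_le hs X) (by positivity)
    _ = _ := by ring

end

section

/-- L1 constant. -/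
def hc1 (d : ℕ) : ℝ := gaC * 2 ^ ((d:ℝ) / 2)
lemma hc1_pos (d : ℕ) : 0 < hc1 d := mul_pos gaC_pos (by positivity)

lemma hk_abs_le {d : ℕ} (i j : Fin d) {t : ℝ} (ht : 0 < t) (x : Fin d → ℝ) : |hk i j t x| ≤ gaC / t * hps t x := by
  refine le_trans ?_ (hk_bound i j ht x)
  have : 0 ≤ n2 x / t := div_nonneg (n2_nonneg x) ht.le
  exact le_mul_of_one_le_right (abs_nonneg _) (by linarith)

lemma norm_sq_le_n2 {d : ℕ} (x : Fin d → ℝ) : ‖x‖ ^ 2 ≤ n2 x := by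
  rw [← Real.sqrt_le_sqrt_iff (n2_nonneg x), Real.sqrt_sq (norm_nonneg _), pi_norm_le_iff_of_nonneg (Real.sqrt_nonneg _)]
  intro k
  exact Real.abs_le_sqrt (sq_le_n2 x k)

lemma hk_far {d : ℕ} (i j : Fin d) {t h : ℝ} (ht : 0 < t) (hh : 0 < h) {x : Fin d → ℝ} (hx : h ≤ ‖x‖) : |hk i j t x| ≤ gaC / h ^ 2 * hps t x := by
  have h1 := hk_bound i j ht x
  have h2 : h ^ 2 ≤ n2 x := (pow_le_pow_left₀ hh.le hx 2).trans (norm_sq_le_n2 x)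
  have h3 : |hk i j t x| * (h ^ 2 / t) ≤ gaC / t * hps t x := by
    refine le_trans ?_ h1
    gcongr
    have : h ^ 2 / t ≤ n2 x / t := by gcongr
    linarith
  have h4 : |hk i j t x| * h ^ 2 ≤ gaC * hps t x := by
    have := mul_le_mul_of_nonneg_right h3 ht.le
    calc _ = |hk i j t x| * (h ^ 2 / t) * t := by field_simp
      _ ≤ _ := this
      _ = _ := by field_simp
  rw [div_mul_eq_mul_div, le_div_iff₀ (by positivity)]
  exact h4

lemma lint_of_hps {d : ℕ} {s : Set (Fin d → ℝ)} {f : (Fin d → ℝ) → ℝ} {t c : ℝ} (ht : 0 < t) (hc : 0 ≤ c) (hs : MeasurableSet s)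
    (hf : ∀ x ∈ s, |f x| ≤ c * hps t x) : ∫⁻ x in s, ‖f x‖ₑ ≤ ENNReal.ofReal (c * 2 ^ ((d:ℝ) / 2)) := by
  have h0 := lint_hps (d := d) ht 0
  simp only [sub_zero] at h0
  calc ∫⁻ x in s, ‖f x‖ₑ ≤ ∫⁻ x in s, ENNReal.ofReal c * ENNReal.ofReal (hps t x) := by
        refine setLIntegral_mono' hs fun x hx => ?_
        rw [← ENNReal.ofReal_mul hc, ← ofReal_norm]
        exact ENNReal.ofReal_le_ofReal (hf x hx)
    _ ≤ ∫⁻ x, ENNReal.ofReal c * ENNReal.ofReal (hps t x) := setLIntegral_le_lintegral _ _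
    _ = _ := by
        rw [lintegral_const_mul _ (by fun_prop), h0, ← ENNReal.ofReal_mul hc]

lemma hps_le {d : ℕ} {t₀ t : ℝ} (h0 : 0 < t₀) (ht : t₀ ≤ t) (x : Fin d → ℝ) : hps t x ≤ (4 * Real.pi * t₀) ^ (-((d:ℝ) / 2)) := by
  have hpi := Real.pi_pos
  have htp : 0 < t := h0.trans_le ht
  unfold hps
  refine (mul_le_of_le_one_right (by positivity) ?_).trans ?_
  · rw [Real.exp_le_one_iff]; exact div_nonpos_of_nonpos_of_nonneg (by linarith [n2_nonneg x]) (by positivity)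
  · exact Real.rpow_le_rpow_of_nonpos (by positivity) (by gcongr) (by simp; positivity)

lemma hk_diff {d : ℕ} (i j : Fin d) {t₀ t τ : ℝ} (y : Fin d → ℝ) (h0 : 0 < t₀) (h1 : t₀ ≤ t) (h2 : t₀ ≤ t - τ) :
    ∫⁻ x, ‖hk i j (t - τ) (x - y) - hk i j t x‖ₑ ≤ ENNReal.ofReal ((d + 2) * hc1 d * (|τ| / t₀ ^ 2 + ‖y‖ / (t₀ * √t₀))) := by
  set M := (d + 2) * gaC * (|τ| / t₀ ^ 2 + ‖y‖ / (t₀ * √t₀)) with hM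
  have hg := gaC_pos
  have hM0 : 0 ≤ M := by positivity
  have hs : ∀ r ∈ Icc (0:ℝ) 1, t₀ ≤ t - r * τ := fun r hr => by nlinarith [hr.1, hr.2]
  have hpt : ∀ x, ‖hk i j (t - τ) (x - y) - hk i j t x‖ₑ ≤ ∫⁻ r in Icc (0:ℝ) 1, ENNReal.ofReal M * ENNReal.ofReal (hps (t - r * τ) (x - r • y)) := by
    intro x
    have hex : ∀ r : ℝ, ∃ D, r ∈ Icc (0:ℝ) 1 → (HasDerivAt (fun r => hk i j (t - r * τ) (x - r • y)) D r ∧ |D| ≤ M * hps (t - r * τ) (x - r • y)) := by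
      intro r
      by_cases hr : r ∈ Icc (0:ℝ) 1
      · have hsr := hs r hr
        have hsp := h0.trans_le hsr
        obtain ⟨D, hD, hb⟩ := hk_deriv i j t τ x y r hsp
        refine ⟨D, fun _ => ⟨hD, hb.trans ?_⟩⟩
        have := hps_nonneg hsp (x - r • y)
        rw [hM]
        gcongr
      · exact ⟨0, fun h => absurd h hr⟩
    choose D hD using hex
    have hIntg : IntegrableOn (fun r => M * hps (t - r * τ) (x - r • y)) (Icc 0 1) := by
      refine Measure.integrableOn_of_bounded (M := M * (4 * Real.pi * t₀) ^ (-((d:ℝ) / 2))) (by simp) (Measurable.aestronglyMeasurable (by fun_prop)) ?_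
      filter_upwards [ae_restrict_mem measurableSet_Icc] with r hr
      have := hps_nonneg (h0.trans_le (hs r hr)) (x - r • y)
      rw [Real.norm_of_nonneg (by positivity)]
      gcongr
      exact hps_le h0 (hs r hr) _
    have hcont : ContinuousOn (fun r => hk i j (t - r * τ) (x - r • y)) (Icc 0 1) := fun r hr => (hD r hr).1.continuousAt.continuousWithinAt
    have k1 := intervalIntegral.sub_le_integral_of_hasDeriv_right_of_le zero_le_one hcont
      (fun r hr => (hD r (Ioo_subset_Icc_self hr)).1.hasDerivWithinAt) hIntg (fun r hr => (le_abs_self _).trans (hD r (Ioo_subset_Icc_self hr)).2)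
    have k2 := intervalIntegral.sub_le_integral_of_hasDeriv_right_of_le zero_le_one hcont.neg
      (fun r hr => (hD r (Ioo_subset_Icc_self hr)).1.neg.hasDerivWithinAt) hIntg (fun r hr => (neg_le_abs _).trans (hD r (Ioo_subset_Icc_self hr)).2)
    rw [intervalIntegral.integral_of_le zero_le_one, ← integral_Icc_eq_integral_Ioc] at k1 k2
    simp only [one_mul, one_smul, zero_mul, zero_smul, sub_zero, Pi.neg_apply] at k1 k2
    have k3 : ‖hk i j (t - τ) (x - y) - hk i j t x‖ ≤ ∫ r in Icc (0:ℝ) 1, M * hps (t - r * τ) (x - r • y) := by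
      rw [Real.norm_eq_abs, abs_le]; constructor <;> linarith
    rw [← ofReal_norm]
    refine (ENNReal.ofReal_le_ofReal k3).trans (le_of_eq ?_)
    rw [ofReal_integral_eq_lintegral_ofReal hIntg]
    · exact lintegral_congr fun r => ENNReal.ofReal_mul hM0
    · filter_upwards [ae_restrict_mem measurableSet_Icc] with r hr
      exact mul_nonneg hM0 (hps_nonneg (h0.trans_le (hs r hr)) _)
  calc _ ≤ ∫⁻ x, ∫⁻ r in Icc (0:ℝ) 1, ENNReal.ofReal M * ENNReal.ofReal (hps (t - r * τ) (x - r • y)) := lintegral_mono hpt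
    _ = ∫⁻ r in Icc (0:ℝ) 1, ∫⁻ x, ENNReal.ofReal M * ENNReal.ofReal (hps (t - r * τ) (x - r • y)) :=
        lintegral_lintegral_swap (Measurable.aemeasurable (by simp only [Function.uncurry_def]; fun_prop))
    _ = ∫⁻ r in Icc (0:ℝ) 1, ENNReal.ofReal (M * 2 ^ ((d:ℝ) / 2)) := by
        refine setLIntegral_congr_fun measurableSet_Icc fun r hr => ?_
        rw [lintegral_const_mul _ (by fun_prop), lint_hps (h0.trans_le (hs r hr)), ← ENNReal.ofReal_mul hM0]
    _ = _ := by
        rw [setLIntegral_const, Real.volume_Icc]; simp only [sub_zero, ENNReal.ofReal_one, mul_one]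
        congr 1; rw [hM, hc1]; ring

/-- The truncated heat second-derivative kernel. -/
def hKer {d : ℕ} (i j : Fin d) (ε S : ℝ) (z : ℝ × (Fin d → ℝ)) : ℝ := if 0 < z.1 ∧ z.1 < S then hk i j (ε + z.1) z.2 else 0

@[fun_prop] lemma measurable_hKer {d : ℕ} (i j : Fin d) (ε S : ℝ) : Measurable (hKer i j ε S) := by
  unfold hKer
  refine Measurable.ite ?_ (by fun_prop) (by fun_prop)
  exact (measurableSet_lt measurable_const measurable_fst).inter (measurableSet_lt measurable_fst measurable_const)

lemma hKer_bdd {d : ℕ} (i j : Fin d) {ε S : ℝ} (hε : 0 < ε) : ∃ B, ∀ z, |hKer i j ε S z| ≤ B := by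
  have hpi := Real.pi_pos
  have hg := gaC_pos
  refine ⟨gaC / ε * (4 * Real.pi * ε) ^ (-((d:ℝ) / 2)), fun z => ?_⟩
  unfold hKer
  split_ifs with h
  · have h1 : ε ≤ ε + z.1 := by linarith [h.1]
    have h2 : 0 < ε + z.1 := by linarith [h.1]
    refine (hk_abs_le i j h2 z.2).trans ?_
    have := hps_nonneg h2 z.2
    have := hps_le hε h1 z.2
    gcongr
  · rw [abs_zero]; positivity

lemma hKer_far {d : ℕ} (i j : Fin d) {ε S h : ℝ} (hε : 0 < ε) (hh : 0 < h) (t : ℝ) : ∫⁻ x in {x | h ≤ ‖x‖}, ‖hKer i j ε S (t, x)‖ₑ ≤ ENNReal.ofReal (hc1 d / h ^ 2) := by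
  have hg := gaC_pos
  unfold hKer
  simp only
  split_ifs with H
  · refine (lint_of_hps (c := gaC / h ^ 2) (show 0 < ε + t by linarith [H.1]) (by positivity) (measurableSet_le measurable_const measurable_norm) fun x hx => hk_far i j (by linarith [H.1]) hh hx).trans ?_
    rw [hc1]; exact ENNReal.ofReal_le_ofReal (le_of_eq (by ring))
  · simp

lemma hKer_all {d : ℕ} (i j : Fin d) {ε S h : ℝ} (hh : 0 < h) (t : ℝ) (ht : h ≤ ε + t) : ∫⁻ x, ‖hKer i j ε S (t, x)‖ₑ ≤ ENNReal.ofReal (hc1 d / h) := by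
  have hg := gaC_pos
  unfold hKer
  simp only
  split_ifs with H
  · have := (lint_of_hps (s := univ) (f := hk i j (ε + t)) (c := gaC / h) (show 0 < ε + t by linarith) (by positivity) MeasurableSet.univ fun x hx => ?_)
    · rw [setLIntegral_univ] at this
      refine this.trans ?_
      rw [hc1]; exact ENNReal.ofReal_le_ofReal (le_of_eq (by ring))
    · refine (hk_abs_le i j (by linarith) x).trans ?_
      have := hps_nonneg (show 0 < ε + t by linarith) x
      gcongr
  · simp

lemma hKer_int {d : ℕ} (i j : Fin d) {ε S : ℝ} (hε : 0 < ε) : Integrable (hKer i j ε S) := by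
  refine ⟨(measurable_hKer i j ε S).aestronglyMeasurable, ?_⟩
  rw [HasFiniteIntegral, Measure.volume_eq_prod, lintegral_prod _ (by fun_prop)]
  calc _ ≤ ∫⁻ t, (Ioo 0 S).indicator (fun _ => ENNReal.ofReal (hc1 d / ε)) t := by
        refine lintegral_mono fun t => ?_
        by_cases ht : t ∈ Ioo 0 S
        · rw [indicator_of_mem ht]
          exact hKer_all i j hε t (by linarith [ht.1])
        · rw [indicator_of_notMem ht]
          have : ∀ x, hKer i j ε S (t, x) = 0 := fun x => by unfold hKer; exact if_neg ht
          simp [this]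
    _ < ⊤ := by
        rw [lintegral_indicator measurableSet_Ioo, setLIntegral_const]
        exact ENNReal.mul_lt_top ENNReal.ofReal_lt_top (by simp)

end

section

/-- Hormander constant of the heat kernel. -/
def hA (d : ℕ) : ℝ := 20 * hc1 d + (d + 2) * hc1 d * (2 + (1/2:ℝ) ^ (-(3/2):ℝ) * (2 * 2 ^ (-(1/2):ℝ)))

lemma hA_nonneg (d : ℕ) : 0 ≤ hA d := by have := hc1_pos d; unfold hA; positivity

/-- time majorant -/
def hTh (d : ℕ) (S h t : ℝ) : ℝ≥0∞ :=
  (Icc (-(4 * h ^ 2)) (4 * h ^ 2)).indicator (fun _ => ENNReal.ofReal (2 * hc1 d / h ^ 2)) t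
  + (Ioi (2 * h ^ 2)).indicator (fun t => ENNReal.ofReal ((d + 2) * hc1 d * (4 * h ^ 2)) * ENNReal.ofReal (t ^ (-2:ℝ))
      + ENNReal.ofReal ((d + 2) * hc1 d * (h * (1/2:ℝ) ^ (-(3/2):ℝ))) * ENNReal.ofReal (t ^ (-(3/2):ℝ))) t
  + (Icc (S - h ^ 2) (S + h ^ 2)).indicator (fun _ => ENNReal.ofReal (2 * hc1 d / h ^ 2)) t

lemma lint_hTh (d : ℕ) (S : ℝ) {h : ℝ} (hh : 0 < h) : ∫⁻ t, hTh d S h t ≤ ENNReal.ofReal (hA d) := by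
  have hc := hc1_pos d
  unfold hTh
  rw [lintegral_add_right _ (Measurable.indicator (by fun_prop) measurableSet_Icc), lintegral_add_left (Measurable.indicator (by fun_prop) measurableSet_Icc),
    lintegral_indicator measurableSet_Icc, lintegral_indicator measurableSet_Icc, lintegral_indicator measurableSet_Ioi,
    setLIntegral_const, setLIntegral_const, lintegral_add_left (by fun_prop), lintegral_const_mul _ (by fun_prop), lintegral_const_mul _ (by fun_prop),
    lint_rpow_Ioi (by norm_num) (by positivity), lint_rpow_Ioi (by norm_num) (by positivity), Real.volume_Icc, Real.volume_Icc]
  have e1 : -(2 * h ^ 2) ^ ((-2:ℝ) + 1) / (-2 + 1) = 1 / (2 * h ^ 2) := by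
    rw [show ((-2:ℝ) + 1) = -1 by norm_num, Real.rpow_neg_one]; ring
  have e2 : -(2 * h ^ 2) ^ ((-(3/2):ℝ) + 1) / (-(3/2) + 1) = 2 * (2 ^ (-(1/2):ℝ) * h⁻¹) := by
    rw [show ((-(3/2):ℝ) + 1) = -(1/2) by norm_num, Real.mul_rpow (by positivity) (by positivity), ← Real.rpow_natCast h 2, ← Real.rpow_mul hh.le]
    rw [show ((2:ℕ):ℝ) * -(1/2) = -1 by norm_num, Real.rpow_neg_one]; ring
  rw [e1, e2, ← ENNReal.ofReal_mul (by positivity), ← ENNReal.ofReal_mul (by positivity), ← ENNReal.ofReal_mul (by positivity), ← ENNReal.ofReal_mul (by positivity),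
    ← ENNReal.ofReal_add (by positivity) (by positivity), ← ENNReal.ofReal_add (mul_nonneg (by positivity) (by nlinarith [sq_nonneg h])) (by positivity),
    ← ENNReal.ofReal_add _ (mul_nonneg (by positivity) (by nlinarith [sq_nonneg h]))]
  · refine ENNReal.ofReal_le_ofReal (le_of_eq ?_)
    unfold hA; field_simp; ring
  · refine add_nonneg (mul_nonneg (by positivity) (by nlinarith [sq_nonneg h])) (by positivity)

lemma hKer_hor {d : ℕ} (i j : Fin d) {ε S : ℝ} (hε : 0 < ε) {h : ℝ} (hh : 0 < h) (w : ℝ × (Fin d → ℝ)) (hw1 : |w.1| ≤ h ^ 2) (hw2 : ‖w.2‖ ≤ h) :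
    ∫⁻ z in {z | |z.1| < 4 * h ^ 2 ∧ ‖z.2‖ < 2 * h}ᶜ, ‖hKer i j ε S (z - w) - hKer i j ε S z‖ₑ ≤ ENNReal.ofReal (hA d) := by
  have hc := hc1_pos d
  obtain ⟨τ, y⟩ := w
  simp only at hw1 hw2
  have hms : MeasurableSet {z : ℝ × (Fin d → ℝ) | |z.1| < 4 * h ^ 2 ∧ ‖z.2‖ < 2 * h} :=
    MeasurableSet.inter (measurableSet_lt (f := fun z : ℝ × (Fin d → ℝ) => |z.1|) (by fun_prop) measurable_const) (measurableSet_lt (f := fun z : ℝ × (Fin d → ℝ) => ‖z.2‖) (by fun_prop) measurable_const)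
  have hm : Measurable fun z : ℝ × (Fin d → ℝ) => ‖hKer i j ε S (z - (τ, y)) - hKer i j ε S z‖ₑ :=
    (((measurable_hKer i j ε S).comp (measurable_id.sub_const _)).sub (measurable_hKer i j ε S)).enorm
  have hKs : ∀ t, Measurable fun x : Fin d → ℝ => ‖hKer i j ε S (t, x)‖ₑ := fun t => ((measurable_hKer i j ε S).comp (measurable_const.prodMk measurable_id)).enorm
  rw [← lintegral_indicator hms.compl, Measure.volume_eq_prod, lintegral_prod _ (hm.indicator hms.compl).aemeasurable]
  refine le_trans (lintegral_mono fun t => ?_) (lint_hTh d S hh)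
  have hττ := abs_le.1 hw1
  have two : ∀ {a b : ℝ≥0∞}, a ≤ ENNReal.ofReal (hc1 d / h ^ 2) → b ≤ ENNReal.ofReal (hc1 d / h ^ 2) → a + b ≤ ENNReal.ofReal (2 * hc1 d / h ^ 2) := by
    intro a b ha hb
    refine (add_le_add ha hb).trans (le_of_eq ?_)
    rw [← ENNReal.ofReal_add (by positivity) (by positivity)]; congr 1; ring
  have shift : ∀ (t : ℝ) (g : (Fin d → ℝ) → ℝ≥0∞), ∫⁻ x, g (x - y) = ∫⁻ x, g x := fun t g => lintegral_sub_right_eq_self g y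
  by_cases c1 : |t| < 4 * h ^ 2
  · have hmem : t ∈ Icc (-(4 * h ^ 2)) (4 * h ^ 2) := ⟨(abs_lt.1 c1).1.le, (abs_lt.1 c1).2.le⟩
    unfold hTh
    rw [indicator_of_mem hmem]
    refine le_trans ?_ (le_self_add.trans le_self_add)
    have hfs : MeasurableSet {x : Fin d → ℝ | h ≤ ‖x‖} := measurableSet_le measurable_const measurable_norm
    calc _ ≤ ∫⁻ x, (({x : Fin d → ℝ | h ≤ ‖x‖}.indicator fun x => ‖hKer i j ε S (t - τ, x)‖ₑ) (x - y) + ({x : Fin d → ℝ | h ≤ ‖x‖}.indicator fun x => ‖hKer i j ε S (t, x)‖ₑ) x) := by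
          refine lintegral_mono fun x => ?_
          by_cases hx : ‖x‖ < 2 * h
          · rw [indicator_of_notMem (by simp [c1, hx])]; exact zero_le
          · push Not at hx
            have hx1 : h ≤ ‖x‖ := by linarith
            have hx2 : h ≤ ‖x - y‖ := by have := norm_sub_norm_le x y; linarith
            rw [indicator_of_mem (by simp [hx]), indicator_of_mem (show x - y ∈ {x : Fin d → ℝ | h ≤ ‖x‖} from hx2), indicator_of_mem (show x ∈ {x : Fin d → ℝ | h ≤ ‖x‖} from hx1)]
            exact enorm_sub_le
      _ = _ := lintegral_add_right _ ((hKs t).indicator hfs)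
      _ ≤ _ := by
          refine two ?_ ?_
          · rw [shift t ({x : Fin d → ℝ | h ≤ ‖x‖}.indicator fun x => ‖hKer i j ε S (t - τ, x)‖ₑ), lintegral_indicator hfs]; exact hKer_far i j hε hh _
          · rw [lintegral_indicator hfs]; exact hKer_far i j hε hh _
  push Not at c1
  have hle : ∫⁻ x, ({z : ℝ × (Fin d → ℝ) | |z.1| < 4 * h ^ 2 ∧ ‖z.2‖ < 2 * h}ᶜ).indicator (fun z => ‖hKer i j ε S (z - (τ, y)) - hKer i j ε S z‖ₑ) (t, x)
      ≤ ∫⁻ x, ‖hKer i j ε S (t - τ, x - y) - hKer i j ε S (t, x)‖ₑ := lintegral_mono fun x => indicator_le_self _ _ _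
  refine hle.trans ?_
  have hh2 : 0 < h ^ 2 := by positivity
  rcases le_abs.1 c1 with c2 | c2
  swap
  · have : ∀ x, ‖hKer i j ε S (t - τ, x - y) - hKer i j ε S (t, x)‖ₑ = 0 := fun x => by
      unfold hKer
      rw [if_neg (by simp only; rintro ⟨h1, h2⟩; linarith), if_neg (by simp only; rintro ⟨h1, h2⟩; linarith)]; simp
    simp [this]
  by_cases c3 : t ∈ Icc (S - h ^ 2) (S + h ^ 2)
  · unfold hTh
    rw [indicator_of_mem c3]
    refine le_trans ?_ le_add_self
    calc _ ≤ ∫⁻ x, (‖hKer i j ε S (t - τ, x - y)‖ₑ + ‖hKer i j ε S (t, x)‖ₑ) := lintegral_mono fun x => enorm_sub_le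
      _ = _ := lintegral_add_right _ (hKs t)
      _ ≤ _ := by
          refine two ?_ ?_
          · rw [shift t (fun x => ‖hKer i j ε S (t - τ, x)‖ₑ)]; exact hKer_all i j hh2 _ (by linarith)
          · exact hKer_all i j hh2 _ (by linarith)
  have hmem : t ∈ Ioi (2 * h ^ 2) := by simp only [mem_Ioi]; linarith
  have htp : 0 < t := by linarith
  by_cases c4 : t < S
  · have c5 : t - τ < S := by
      by_contra hcon
      exact c3 ⟨by linarith, by linarith⟩
    have : ∀ x, hKer i j ε S (t - τ, x - y) - hKer i j ε S (t, x) = hk i j (ε + t - τ) (x - y) - hk i j (ε + t) x := fun x => by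
      unfold hKer
      rw [if_pos ⟨by simp only; linarith, c5⟩, if_pos ⟨htp, c4⟩]
      simp only [add_sub_assoc]
    simp only [this]
    refine (hk_diff i j (t₀ := t / 2) y (by linarith) (by linarith) (by linarith)).trans ?_
    unfold hTh
    rw [indicator_of_mem hmem]
    refine le_trans ?_ (le_add_self.trans le_self_add)
    rw [← ENNReal.ofReal_mul (by positivity), ← ENNReal.ofReal_mul (by positivity), ← ENNReal.ofReal_add (by positivity) (by positivity)]
    refine ENNReal.ofReal_le_ofReal ?_
    have e1 : t ^ (-2:ℝ) = 1 / t ^ 2 := by rw [Real.rpow_neg htp.le]; norm_num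
    have e2 : 1 / (t / 2 * √(t / 2)) = (1/2:ℝ) ^ (-(3/2):ℝ) * t ^ (-(3/2):ℝ) := by
      rw [← Real.mul_rpow (by norm_num) htp.le, show (1/2:ℝ) * t = t / 2 by ring, Real.rpow_neg (by positivity), show (3/2:ℝ) = 1 + 1/2 by norm_num,
        Real.rpow_add (by positivity), Real.rpow_one, ← Real.sqrt_eq_rpow, one_div]
    calc _ ≤ (d + 2) * hc1 d * (h ^ 2 / (t / 2) ^ 2 + h / (t / 2 * √(t / 2))) := by gcongr
      _ = (d + 2) * hc1 d * (4 * h ^ 2 * (1 / t ^ 2) + h * (1 / (t / 2 * √(t / 2)))) := by field_simp; ring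
      _ = _ := by rw [e1, e2]; ring
  · have c5 : ¬ t - τ < S := by
      intro hcon
      exact c3 ⟨by linarith, by linarith⟩
    have : ∀ x, ‖hKer i j ε S (t - τ, x - y) - hKer i j ε S (t, x)‖ₑ = 0 := fun x => by
      unfold hKer
      rw [if_neg (fun H => c5 H.2), if_neg (fun H => c4 H.2)]; simp
    simp [this]

end

section

lemma gf_n2_nonneg {d : ℕ} {t : ℝ} (ht : 0 < t) (x : Fin d → ℝ) : 0 ≤ gf (fun ξ => t * n2 ξ) x := by
  rw [gf_n2 ht]; positivity

lemma lint_gf_n2 {d : ℕ} {t : ℝ} (ht : 0 < t) : ∫⁻ x : Fin d → ℝ, ‖gf (fun ξ => t * n2 ξ) x‖ₑ = 1 := by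
  have hb : 0 < 1 / (4 * t) := by positivity
  have h1 := gauss_cos (d := d) hb 0
  simp only [zero_dotProduct, Real.cos_zero, mul_one] at h1
  have hn : n2 (0 : Fin d → ℝ) = 0 := by simp [n2]
  rw [hn] at h1
  have e : ∀ x : Fin d → ℝ, gf (fun ξ => t * n2 ξ) x = (4 * Real.pi * t) ^ (-((d:ℝ) / 2)) * Real.exp (-(1 / (4 * t)) * n2 x) := by
    intro x; rw [gf_n2 ht]; congr 2; field_simp
  have e2 : ∀ x : Fin d → ℝ, ‖gf (fun ξ => t * n2 ξ) x‖ₑ = ENNReal.ofReal ((4 * Real.pi * t) ^ (-((d:ℝ) / 2)) * Real.exp (-(1 / (4 * t)) * n2 x)) := by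
    intro x; rw [Real.enorm_of_nonneg (gf_n2_nonneg ht x), e]
  simp_rw [e2]
  rw [← ofReal_integral_eq_lintegral_ofReal ((integrable_exp_n2 hb).const_mul _) (Filter.Eventually.of_forall fun x => by positivity),
    integral_const_mul, h1]
  have : Real.pi / (1 / (4 * t)) = 4 * Real.pi * t := by field_simp
  rw [this, neg_zero, zero_div, Real.exp_zero, mul_one, ← Real.rpow_add (by positivity)]
  simp

/-- Cosine transform of a function. -/
def ctf {d : ℕ} (f : (Fin d → ℝ) → ℝ) (ξ : Fin d → ℝ) : ℝ := ∫ x, f x * Real.cos (2 * Real.pi * (x ⬝ᵥ ξ))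
/-- Sine transform of a function. -/
def stf {d : ℕ} (f : (Fin d → ℝ) → ℝ) (ξ : Fin d → ℝ) : ℝ := ∫ x, f x * Real.sin (2 * Real.pi * (x ⬝ᵥ ξ))

lemma cosmul_int {d : ℕ} {f : (Fin d → ℝ) → ℝ} (hf : Integrable f) (ξ : Fin d → ℝ) :
    Integrable fun x => f x * Real.cos (2 * Real.pi * (x ⬝ᵥ ξ)) :=
  hf.mul_bdd (c := 1) (Measurable.aestronglyMeasurable (by fun_prop)) (Filter.Eventually.of_forall fun x => Real.abs_cos_le_one _)
lemma sinmul_int {d : ℕ} {f : (Fin d → ℝ) → ℝ} (hf : Integrable f) (ξ : Fin d → ℝ) :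
    Integrable fun x => f x * Real.sin (2 * Real.pi * (x ⬝ᵥ ξ)) :=
  hf.mul_bdd (c := 1) (Measurable.aestronglyMeasurable (by fun_prop)) (Filter.Eventually.of_forall fun x => Real.abs_sin_le_one _)

lemma ctf_sq {d : ℕ} {f g : (Fin d → ℝ) → ℝ} (hf : Integrable f) (hg : Integrable g) (ξ : Fin d → ℝ) :
    ctf f ξ * ctf g ξ + stf f ξ * stf g ξ = ∫ z : (Fin d → ℝ) × (Fin d → ℝ), f z.1 * g z.2 * Real.cos (2 * Real.pi * ((z.1 - z.2) ⬝ᵥ ξ)) := by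
  unfold ctf stf
  rw [← integral_prod_mul, ← integral_prod_mul, ← integral_add]
  · rw [← Measure.volume_eq_prod]
    congr 1; ext z
    rw [sub_dotProduct, mul_sub, Real.cos_sub]; ring
  · exact (cosmul_int hf ξ).mul_prod (cosmul_int hg ξ)
  · exact (sinmul_int hf ξ).mul_prod (sinmul_int hg ξ)

lemma measurable_gf {d : ℕ} {Q : (Fin d → ℝ) → ℝ} (hQ : Measurable Q) : Measurable (gf Q) := by
  unfold gf
  exact (StronglyMeasurable.integral_prod_right' (f := fun z : (Fin d → ℝ) × (Fin d → ℝ) => Real.exp (-(4 * Real.pi ^ 2) * Q z.2) * Real.cos (2 * Real.pi * (z.1 ⬝ᵥ z.2)))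
    (Measurable.stronglyMeasurable (by fun_prop))).measurable

lemma measurable_ctf {d : ℕ} {f : (Fin d → ℝ) → ℝ} (hf : Measurable f) : Measurable (ctf f) := by
  unfold ctf
  exact (StronglyMeasurable.integral_prod_right' (f := fun z : (Fin d → ℝ) × (Fin d → ℝ) => f z.2 * Real.cos (2 * Real.pi * (z.2 ⬝ᵥ z.1)))
    (Measurable.stronglyMeasurable (by fun_prop))).measurable
lemma measurable_stf {d : ℕ} {f : (Fin d → ℝ) → ℝ} (hf : Measurable f) : Measurable (stf f) := by
  unfold stf
  exact (StronglyMeasurable.integral_prod_right' (f := fun z : (Fin d → ℝ) × (Fin d → ℝ) => f z.2 * Real.sin (2 * Real.pi * (z.2 ⬝ᵥ z.1)))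
    (Measurable.stronglyMeasurable (by fun_prop))).measurable

/-- Schur test for a translation kernel. -/
lemma schur_l2 {d : ℕ} {k f : (Fin d → ℝ) → ℝ} (hk : Measurable k) (hf : Measurable f) :
    ∫⁻ z : (Fin d → ℝ) × (Fin d → ℝ), ‖f z.1 * f z.2 * k (z.1 - z.2)‖ₑ ≤ (∫⁻ x, ‖k x‖ₑ) * ∫⁻ x, ‖f x‖ₑ ^ 2 := by
  have key : ∀ z : (Fin d → ℝ) × (Fin d → ℝ), ‖f z.1 * f z.2 * k (z.1 - z.2)‖ₑ ≤
      2⁻¹ * (‖f z.1‖ₑ ^ 2 * ‖k (z.1 - z.2)‖ₑ + ‖f z.2‖ₑ ^ 2 * ‖k (z.1 - z.2)‖ₑ) := by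
    intro z
    rw [enorm_mul, enorm_mul, ← add_mul, ← mul_assoc]
    refine mul_le_mul_left ?_ _
    rw [← ofReal_norm, ← ofReal_norm, ← ENNReal.ofReal_mul (norm_nonneg _), ← ENNReal.ofReal_pow (norm_nonneg _), ← ENNReal.ofReal_pow (norm_nonneg _),
      ← ENNReal.ofReal_add (by positivity) (by positivity), show (2⁻¹ : ℝ≥0∞) = ENNReal.ofReal 2⁻¹ by rw [ENNReal.ofReal_inv_of_pos (by norm_num)]; norm_num,
      ← ENNReal.ofReal_mul (by positivity)]
    refine ENNReal.ofReal_le_ofReal ?_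
    nlinarith [sq_nonneg (‖f z.1‖ - ‖f z.2‖)]
  refine (lintegral_mono key).trans ?_
  rw [lintegral_const_mul _ (by fun_prop), lintegral_add_left (by fun_prop), Measure.volume_eq_prod,
    lintegral_prod _ (by fun_prop), lintegral_prod_symm _ (by fun_prop)]
  have h1 : ∀ x : Fin d → ℝ, ∫⁻ y, ‖f x‖ₑ ^ 2 * ‖k (x - y)‖ₑ = ‖f x‖ₑ ^ 2 * ∫⁻ y, ‖k y‖ₑ := by
    intro x
    rw [lintegral_const_mul _ (by fun_prop), lintegral_sub_left_eq_self (fun y => ‖k y‖ₑ) x]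
  have h2 : ∀ y : Fin d → ℝ, ∫⁻ x, ‖f y‖ₑ ^ 2 * ‖k (x - y)‖ₑ = ‖f y‖ₑ ^ 2 * ∫⁻ y, ‖k y‖ₑ := by
    intro x
    rw [lintegral_const_mul _ (by fun_prop), lintegral_sub_right_eq_self (fun y => ‖k y‖ₑ) x]
  simp only [h1, h2]
  rw [lintegral_mul_const _ (by fun_prop), ← two_mul, ← mul_assoc, ENNReal.inv_mul_cancel (by norm_num) (by norm_num), one_mul, mul_comm]

/-- Bessel inequality for the Fourier transform. -/
lemma bessel {d : ℕ} {f : (Fin d → ℝ) → ℝ} (hf : Measurable f) (hi : Integrable f) :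
    ∫⁻ ξ, (‖ctf f ξ‖ₑ ^ 2 + ‖stf f ξ‖ₑ ^ 2) ≤ ∫⁻ x, ‖f x‖ₑ ^ 2 := by
  set h : (Fin d → ℝ) → ℝ := fun ξ => ctf f ξ ^ 2 + stf f ξ ^ 2 with hh
  have h0 : ∀ ξ, 0 ≤ h ξ := fun ξ => by positivity
  have hm : Measurable h := by have := measurable_ctf hf; have := measurable_stf hf; fun_prop
  have e1 : ∀ ξ, (‖ctf f ξ‖ₑ ^ 2 + ‖stf f ξ‖ₑ ^ 2) = ENNReal.ofReal (h ξ) := by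
    intro ξ
    rw [ENNReal.ofReal_add (by positivity) (by positivity)]
    rw [← ofReal_norm, ← ofReal_norm, ← ENNReal.ofReal_pow (norm_nonneg _), ← ENNReal.ofReal_pow (norm_nonneg _), Real.norm_eq_abs, Real.norm_eq_abs, sq_abs, sq_abs]
  simp_rw [e1]
  have step : ∀ η : ℝ, 0 < η → ∫⁻ ξ, ENNReal.ofReal (h ξ * Real.exp (-(4 * Real.pi ^ 2) * (η * n2 ξ))) ≤ ∫⁻ x, ‖f x‖ₑ ^ 2 := by
    intro η hη
    have hb : ∀ ξ, ‖h ξ‖ ≤ 2 * (∫ x, ‖f x‖) ^ 2 := by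
      intro ξ
      have a1 : |ctf f ξ| ≤ ∫ x, ‖f x‖ := by
        refine (norm_integral_le_integral_norm _).trans (integral_mono (cosmul_int hi ξ).norm hi.norm fun x => ?_)
        simp only [norm_mul]; exact mul_le_of_le_one_right (norm_nonneg _) (Real.abs_cos_le_one _)
      have a2 : |stf f ξ| ≤ ∫ x, ‖f x‖ := by
        refine (norm_integral_le_integral_norm _).trans (integral_mono (sinmul_int hi ξ).norm hi.norm fun x => ?_)
        simp only [norm_mul]; exact mul_le_of_le_one_right (norm_nonneg _) (Real.abs_sin_le_one _)
      rw [Real.norm_of_nonneg (h0 ξ)]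
      have := sq_le_sq' (abs_le.1 a1).1 (abs_le.1 a1).2
      have := sq_le_sq' (abs_le.1 a2).1 (abs_le.1 a2).2
      simp only [hh]; linarith
    have hex : Integrable fun ξ : Fin d → ℝ => Real.exp (-(4 * Real.pi ^ 2) * (η * n2 ξ)) := by
      have := integrable_exp_n2 (d := d) (c := 4 * Real.pi ^ 2 * η) (by positivity)
      refine this.congr (Filter.Eventually.of_forall fun ξ => ?_)
      simp only; congr 1; ring
    rw [← ofReal_integral_eq_lintegral_ofReal (hex.bdd_mul hm.aestronglyMeasurable (Filter.Eventually.of_forall hb))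
      (Filter.Eventually.of_forall fun ξ => mul_nonneg (h0 ξ) (Real.exp_pos _).le)]
    have e2 : ∫ ξ, h ξ * Real.exp (-(4 * Real.pi ^ 2) * (η * n2 ξ)) =
        ∫ z : (Fin d → ℝ) × (Fin d → ℝ), f z.1 * f z.2 * gf (fun ξ => η * n2 ξ) (z.1 - z.2) := by
      have : ∀ ξ, h ξ * Real.exp (-(4 * Real.pi ^ 2) * (η * n2 ξ)) =
          ∫ z : (Fin d → ℝ) × (Fin d → ℝ), f z.1 * f z.2 * (Real.exp (-(4 * Real.pi ^ 2) * (η * n2 ξ)) * Real.cos (2 * Real.pi * ((z.1 - z.2) ⬝ᵥ ξ))) := by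
        intro ξ
        simp only [hh, sq (ctf f ξ), sq (stf f ξ)]
        rw [ctf_sq hi hi, ← integral_mul_const]
        congr 1; ext z; ring
      simp_rw [this]
      rw [integral_integral_swap]
      · congr 1; ext z; rw [integral_const_mul]; rfl
      · have hff : Integrable (fun z : (Fin d → ℝ) × (Fin d → ℝ) => f z.1 * f z.2) := hi.mul_prod hi
        have := (hex.mul_prod hff).mul_bdd (c := 1) (g := fun y : (Fin d → ℝ) × ((Fin d → ℝ) × (Fin d → ℝ)) => Real.cos (2 * Real.pi * ((y.2.1 - y.2.2) ⬝ᵥ y.1))) (Measurable.aestronglyMeasurable (by fun_prop)) (Filter.Eventually.of_forall fun x => Real.abs_cos_le_one _)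
        refine this.congr (Filter.Eventually.of_forall fun y => ?_)
        simp only [Function.uncurry_def]; ring
    rw [e2]
    refine (ENNReal.ofReal_le_ofReal (Real.le_norm_self _)).trans ((ofReal_norm _).le.trans ((enorm_integral_le_lintegral_enorm _).trans ?_))
    refine (schur_l2 (measurable_gf (by fun_prop)) hf).trans ?_
    rw [lint_gf_n2 hη, one_mul]
  have hη : ∀ n : ℕ, 0 < 1 / ((n:ℝ) + 1) := fun n => by positivity
  have lim : ∀ ξ, Filter.liminf (fun n : ℕ => ENNReal.ofReal (h ξ * Real.exp (-(4 * Real.pi ^ 2) * ((1 / ((n:ℝ) + 1)) * n2 ξ)))) Filter.atTop = ENNReal.ofReal (h ξ) := by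
    intro ξ
    refine Filter.Tendsto.liminf_eq (ENNReal.tendsto_ofReal ?_)
    have c1 : Continuous fun η : ℝ => h ξ * Real.exp (-(4 * Real.pi ^ 2) * (η * n2 ξ)) := by fun_prop
    have := (c1.tendsto 0).comp (tendsto_one_div_add_atTop_nhds_zero_nat (𝕜 := ℝ))
    simpa [Function.comp_def] using this
  simp_rw [← lim]
  refine (lintegral_liminf_le (fun n => by fun_prop)).trans ?_
  refine Filter.liminf_le_of_le (by isBoundedDefault) fun b hb => ?_
  obtain ⟨n, hn⟩ := hb.exists
  exact hn.trans (step _ (hη n))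

end

section

/-- Truncated multiplier in time and frequency. -/
def mlt {d : ℕ} (i j : Fin d) (ε S : ℝ) (ξ : Fin d → ℝ) (r : ℝ) : ℝ :=
  if 0 < r ∧ r < S then -(4 * Real.pi ^ 2) * (ξ i * ξ j) * Real.exp (-(4 * Real.pi ^ 2) * ((ε + r) * n2 ξ)) else 0

@[fun_prop] lemma measurable_mlt {d : ℕ} (i j : Fin d) (ε S : ℝ) : Measurable fun z : (Fin d → ℝ) × ℝ => mlt i j ε S z.1 z.2 := by
  unfold mlt
  refine Measurable.ite ?_ (by fun_prop) (by fun_prop)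
  exact MeasurableSet.inter (measurableSet_lt (f := fun z : (Fin d → ℝ) × ℝ => (0:ℝ)) (by fun_prop) (by fun_prop)) (measurableSet_lt (f := fun z : (Fin d → ℝ) × ℝ => z.2) (by fun_prop) (by fun_prop))

lemma mlt_abs_le {d : ℕ} (i j : Fin d) {ε S : ℝ} (ξ : Fin d → ℝ) (r : ℝ) :
    |mlt i j ε S ξ r| ≤ 4 * Real.pi ^ 2 * n2 ξ * Real.exp (-(4 * Real.pi ^ 2 * ε) * n2 ξ) := by
  have hn := n2_nonneg ξ
  unfold mlt
  split_ifs with h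
  · rw [abs_mul, abs_mul, abs_neg, abs_of_nonneg (by positivity : (0:ℝ) ≤ 4 * Real.pi ^ 2), Real.abs_exp]
    refine mul_le_mul (mul_le_mul_of_nonneg_left (abs_mul_le_n2 ξ i j) (by positivity)) (Real.exp_le_exp.2 ?_) (Real.exp_pos _).le (by positivity)
    have : 0 ≤ Real.pi ^ 2 * (r * n2 ξ) := by have := h.1; positivity
    nlinarith
  · rw [abs_zero]; positivity

lemma lint_mlt {d : ℕ} (i j : Fin d) {ε S : ℝ} (hε : 0 < ε) (ξ : Fin d → ℝ) : ∫⁻ r, ‖mlt i j ε S ξ r‖ₑ ≤ 1 := by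
  have hn := n2_nonneg ξ
  rcases hn.eq_or_lt with h0 | hpos
  · have : ∀ r, mlt i j ε S ξ r = 0 := by
      intro r
      have := mlt_abs_le (ε := ε) (S := S) i j ξ r
      rw [← h0, mul_zero, zero_mul] at this
      exact abs_nonpos_iff.1 this
    simp [this]
  set c : ℝ := 4 * Real.pi ^ 2 * n2 ξ with hc
  have hc0 : 0 < c := by positivity
  have hb : ∀ r, ‖mlt i j ε S ξ r‖ₑ ≤ (Ioi (0:ℝ)).indicator (fun r => ENNReal.ofReal (c * Real.exp (-c * r))) r := by
    intro r
    by_cases hr : 0 < r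
    · rw [indicator_of_mem (mem_Ioi.2 hr), ← ofReal_norm]
      refine ENNReal.ofReal_le_ofReal ?_
      unfold mlt
      split_ifs with h
      · rw [Real.norm_eq_abs, abs_mul, abs_mul, abs_neg, abs_of_nonneg (by positivity : (0:ℝ) ≤ 4 * Real.pi ^ 2), Real.abs_exp]
        refine mul_le_mul (mul_le_mul_of_nonneg_left (abs_mul_le_n2 ξ i j) (by positivity)) (Real.exp_le_exp.2 ?_) (Real.exp_pos _).le (by positivity)
        have : 0 ≤ Real.pi ^ 2 * (ε * n2 ξ) := by positivity
        rw [hc]; nlinarith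
      · rw [norm_zero]; positivity
    · have : mlt i j ε S ξ r = 0 := by unfold mlt; rw [if_neg (fun h => hr h.1)]
      simp [this]
  refine (lintegral_mono hb).trans ?_
  rw [lintegral_indicator measurableSet_Ioi, ← ofReal_integral_eq_lintegral_ofReal ((integrableOn_exp_mul_Ioi (by linarith) 0).const_mul c)
    (Filter.Eventually.of_forall fun r => by positivity), integral_const_mul, integral_exp_mul_Ioi (by linarith)]
  rw [mul_zero, Real.exp_zero, neg_div_neg_eq, mul_one_div_cancel hc0.ne', ENNReal.ofReal_one]

lemma hKer_eq {d : ℕ} (i j : Fin d) {ε S : ℝ} (hε : 0 < ε) (r : ℝ) (x : Fin d → ℝ) :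
    hKer i j ε S (r, x) = ∫ ξ, mlt i j ε S ξ r * Real.cos (2 * Real.pi * (x ⬝ᵥ ξ)) := by
  unfold hKer mlt
  simp only
  split_ifs with h
  · have := kf_n2 (show 0 < ε + r by linarith [h.1]) i j x
    rw [hk, ← this, kf]
  · simp

/-- Slice cosine transform. -/
def sct {d : ℕ} (F : ℝ × (Fin d → ℝ) → ℝ) (ξ : Fin d → ℝ) (s : ℝ) : ℝ := ctf (fun x => F (s, x)) ξ
/-- Slice sine transform. -/
def sst {d : ℕ} (F : ℝ × (Fin d → ℝ) → ℝ) (ξ : Fin d → ℝ) (s : ℝ) : ℝ := stf (fun x => F (s, x)) ξ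

lemma measurable_sct {d : ℕ} {F : ℝ × (Fin d → ℝ) → ℝ} (hF : Measurable F) : Measurable fun z : (Fin d → ℝ) × ℝ => sct F z.1 z.2 := by
  unfold sct ctf
  exact (StronglyMeasurable.integral_prod_right' (f := fun z : ((Fin d → ℝ) × ℝ) × (Fin d → ℝ) => F (z.1.2, z.2) * Real.cos (2 * Real.pi * (z.2 ⬝ᵥ z.1.1)))
    (Measurable.stronglyMeasurable (by fun_prop))).measurable
lemma measurable_sst {d : ℕ} {F : ℝ × (Fin d → ℝ) → ℝ} (hF : Measurable F) : Measurable fun z : (Fin d → ℝ) × ℝ => sst F z.1 z.2 := by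
  unfold sst stf
  exact (StronglyMeasurable.integral_prod_right' (f := fun z : ((Fin d → ℝ) × ℝ) × (Fin d → ℝ) => F (z.1.2, z.2) * Real.sin (2 * Real.pi * (z.2 ⬝ᵥ z.1.1)))
    (Measurable.stronglyMeasurable (by fun_prop))).measurable

lemma bessel_slice {d : ℕ} {F : ℝ × (Fin d → ℝ) → ℝ} (hF : Measurable F) (hi : Integrable F) :
    ∫⁻ ξ, ∫⁻ s, (‖sct F ξ s‖ₑ ^ 2 + ‖sst F ξ s‖ₑ ^ 2) ≤ ∫⁻ z, ‖F z‖ₑ ^ 2 := by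
  have hm1 := measurable_sct hF
  have hm2 := measurable_sst hF
  rw [lintegral_lintegral_swap (by simp only [Function.uncurry_def]; fun_prop), Measure.volume_eq_prod, lintegral_prod _ (by fun_prop)]
  refine lintegral_mono_ae ?_
  filter_upwards [hi.prod_right_ae] with s hs
  exact bessel (by fun_prop) hs

/-- integral of a product form with multiplier. -/
lemma mult_form {d : ℕ} {F G : ℝ × (Fin d → ℝ) → ℝ} (hF : Integrable F) (hG : Integrable G) {m : ℝ → ℝ} (hm : Measurable m) {B : ℝ} (hB : ∀ r, |m r| ≤ B) :
    ∫ y : (ℝ × (Fin d → ℝ)) × (ℝ × (Fin d → ℝ)), m (y.2.1 - y.1.1) * (F y.1 * G y.2) =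
      ∫ s, ∫ t, m (t - s) * ((∫ x, F (s, x)) * ∫ x, G (t, x)) := by
  have hi : Integrable (fun y : (ℝ × (Fin d → ℝ)) × (ℝ × (Fin d → ℝ)) => m (y.2.1 - y.1.1) * (F y.1 * G y.2)) :=
    (hF.mul_prod hG).bdd_mul (c := B) (Measurable.aestronglyMeasurable (by fun_prop)) (Filter.Eventually.of_forall fun y => hB _)
  have hGi : ∀ s : ℝ, Integrable (fun z : ℝ × (Fin d → ℝ) => m (z.1 - s) * G z) := fun s =>
    hG.bdd_mul (c := B) (Measurable.aestronglyMeasurable (by fun_prop)) (Filter.Eventually.of_forall fun y => hB _)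
  set h : ℝ → ℝ := fun s => ∫ t, m (t - s) * ∫ x, G (t, x) with hh
  have e1 : ∀ w : ℝ × (Fin d → ℝ), ∫ z : ℝ × (Fin d → ℝ), m (z.1 - w.1) * (F w * G z) = F w * h w.1 := by
    intro w
    have : ∀ z : ℝ × (Fin d → ℝ), m (z.1 - w.1) * (F w * G z) = F w * (m (z.1 - w.1) * G z) := fun z => by ring
    simp_rw [this]
    rw [integral_const_mul, Measure.volume_eq_prod, integral_prod _ (hGi w.1)]
    congr 2; ext t
    simp only
    rw [integral_const_mul]
  rw [Measure.volume_eq_prod, integral_prod _ hi]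
  simp_rw [e1]
  have hi2 : Integrable (fun w : ℝ × (Fin d → ℝ) => F w * h w.1) := by
    have := hi.integral_prod_left
    refine this.congr (Filter.Eventually.of_forall fun w => e1 w)
  rw [Measure.volume_eq_prod, integral_prod _ hi2]
  congr 1; ext s
  simp only
  rw [integral_mul_const, hh, ← integral_const_mul]
  congr 1; ext t; ring

lemma half_form {m a b a' b' : ℝ} : ‖m * (a * b + a' * b')‖ₑ ≤ 2⁻¹ * (‖m‖ₑ * (‖a‖ₑ ^ 2 + ‖a'‖ₑ ^ 2) + ‖m‖ₑ * (‖b‖ₑ ^ 2 + ‖b'‖ₑ ^ 2)) := by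
  rw [enorm_mul, ← mul_add, mul_left_comm]
  refine mul_le_mul_right ?_ _
  simp only [← ofReal_norm]
  rw [← ENNReal.ofReal_pow (norm_nonneg _), ← ENNReal.ofReal_pow (norm_nonneg _), ← ENNReal.ofReal_pow (norm_nonneg _), ← ENNReal.ofReal_pow (norm_nonneg _),
    ← ENNReal.ofReal_add (by positivity) (by positivity), ← ENNReal.ofReal_add (by positivity) (by positivity), ← ENNReal.ofReal_add (by positivity) (by positivity),
    show (2⁻¹ : ℝ≥0∞) = ENNReal.ofReal 2⁻¹ by rw [ENNReal.ofReal_inv_of_pos (by norm_num)]; norm_num, ← ENNReal.ofReal_mul (by positivity)]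
  refine ENNReal.ofReal_le_ofReal ?_
  refine (norm_add_le _ _).trans ?_
  rw [norm_mul, norm_mul]
  nlinarith [sq_nonneg (‖a‖ - ‖b‖), sq_nonneg (‖a'‖ - ‖b'‖)]

lemma hKer_l2_form {d : ℕ} (i j : Fin d) {ε S : ℝ} (hε : 0 < ε) {F G : ℝ × (Fin d → ℝ) → ℝ} (hF : Measurable F) (hFi : Integrable F) (hG : Measurable G) (hGi : Integrable G) :
    ‖BLF (fun s t x => hKer i j ε S (t - s, x)) F G‖ₑ ≤ 2⁻¹ * ((∫⁻ z, ‖F z‖ₑ ^ 2) + ∫⁻ z, ‖G z‖ₑ ^ 2) := by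
  have hbi : Integrable fun ξ : Fin d → ℝ => 4 * Real.pi ^ 2 * n2 ξ * Real.exp (-(4 * Real.pi ^ 2 * ε) * n2 ξ) := by
    have := (integrable_poly_exp (d := d) (c := 4 * Real.pi ^ 2 * ε) (by positivity) 1).const_mul (4 * Real.pi ^ 2)
    refine this.mono (Measurable.aestronglyMeasurable (by fun_prop)) (Filter.Eventually.of_forall fun ξ => ?_)
    have hn := n2_nonneg ξ
    rw [Real.norm_of_nonneg (by positivity), Real.norm_of_nonneg (by positivity), pow_one, mul_assoc]
    gcongr; linarith
  have e : BLF (fun s t x => hKer i j ε S (t - s, x)) F G =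
      ∫ ξ, ∫ s, ∫ t, mlt i j ε S ξ (t - s) * (sct F ξ s * sct G ξ t + sst F ξ s * sst G ξ t) := by
    unfold BLF
    have e0 : ∀ y : (ℝ × (Fin d → ℝ)) × (ℝ × (Fin d → ℝ)), hKer i j ε S (y.2.1 - y.1.1, y.2.2 - y.1.2) * (F y.1 * G y.2) =
        ∫ ξ, mlt i j ε S ξ (y.2.1 - y.1.1) * Real.cos (2 * Real.pi * ((y.2.2 - y.1.2) ⬝ᵥ ξ)) * (F y.1 * G y.2) := by
      intro y; rw [hKer_eq i j hε, integral_mul_const]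
    simp_rw [e0]
    rw [integral_integral_swap]
    · congr 1; ext ξ
      have hmξ : Measurable (mlt i j ε S ξ) := (measurable_mlt i j ε S).comp (measurable_const.prodMk measurable_id)
      have hFc : Integrable fun w : ℝ × (Fin d → ℝ) => F w * Real.cos (2 * Real.pi * (w.2 ⬝ᵥ ξ)) :=
        hFi.mul_bdd (c := 1) (Measurable.aestronglyMeasurable (by fun_prop)) (Filter.Eventually.of_forall fun x => Real.abs_cos_le_one _)
      have hFs : Integrable fun w : ℝ × (Fin d → ℝ) => F w * Real.sin (2 * Real.pi * (w.2 ⬝ᵥ ξ)) :=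
        hFi.mul_bdd (c := 1) (Measurable.aestronglyMeasurable (by fun_prop)) (Filter.Eventually.of_forall fun x => Real.abs_sin_le_one _)
      have hGc : Integrable fun w : ℝ × (Fin d → ℝ) => G w * Real.cos (2 * Real.pi * (w.2 ⬝ᵥ ξ)) :=
        hGi.mul_bdd (c := 1) (Measurable.aestronglyMeasurable (by fun_prop)) (Filter.Eventually.of_forall fun x => Real.abs_cos_le_one _)
      have hGs : Integrable fun w : ℝ × (Fin d → ℝ) => G w * Real.sin (2 * Real.pi * (w.2 ⬝ᵥ ξ)) :=
        hGi.mul_bdd (c := 1) (Measurable.aestronglyMeasurable (by fun_prop)) (Filter.Eventually.of_forall fun x => Real.abs_sin_le_one _)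
      have bd := mlt_abs_le (ε := ε) (S := S) i j ξ
      have hI : ∀ {P Q : ℝ × (Fin d → ℝ) → ℝ}, Integrable P → Integrable Q → Integrable (fun y : (ℝ × (Fin d → ℝ)) × (ℝ × (Fin d → ℝ)) => mlt i j ε S ξ (y.2.1 - y.1.1) * (P y.1 * Q y.2)) :=
        fun hP hQ => (hP.mul_prod hQ).bdd_mul (Measurable.aestronglyMeasurable (by fun_prop)) (Filter.Eventually.of_forall fun y => bd _)
      have s1 : ∀ y : (ℝ × (Fin d → ℝ)) × (ℝ × (Fin d → ℝ)), mlt i j ε S ξ (y.2.1 - y.1.1) * Real.cos (2 * Real.pi * ((y.2.2 - y.1.2) ⬝ᵥ ξ)) * (F y.1 * G y.2) =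
          mlt i j ε S ξ (y.2.1 - y.1.1) * ((F y.1 * Real.cos (2 * Real.pi * (y.1.2 ⬝ᵥ ξ))) * (G y.2 * Real.cos (2 * Real.pi * (y.2.2 ⬝ᵥ ξ)))) +
          mlt i j ε S ξ (y.2.1 - y.1.1) * ((F y.1 * Real.sin (2 * Real.pi * (y.1.2 ⬝ᵥ ξ))) * (G y.2 * Real.sin (2 * Real.pi * (y.2.2 ⬝ᵥ ξ)))) := by
        intro y; rw [sub_dotProduct, mul_sub, Real.cos_sub]; ring
      simp_rw [s1]
      rw [integral_add (hI hFc hGc) (hI hFs hGs)]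
      have m1 := mult_form (m := mlt i j ε S ξ) hFc hGc hmξ bd
      have m2 := mult_form (m := mlt i j ε S ξ) hFs hGs hmξ bd
      have hP : ∀ {P Q : ℝ × (Fin d → ℝ) → ℝ}, Integrable P → Integrable Q → Integrable (fun y : ℝ × ℝ => mlt i j ε S ξ (y.2 - y.1) * ((∫ x, P (y.1, x)) * ∫ x, Q (y.2, x))) :=
        fun hP hQ => (hP.integral_prod_left.mul_prod hQ.integral_prod_left).bdd_mul (Measurable.aestronglyMeasurable (by fun_prop)) (Filter.Eventually.of_forall fun y => bd _)
      rw [m1, m2]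
      have i1 := hP hFc hGc
      have i2 := hP hFs hGs
      have := integral_prod _ i1
      have j1 := integral_prod _ (i1.add i2)
      have j2 := integral_add i1 i2
      have j3 := integral_prod _ i2
      refine (congrArg₂ (· + ·) this.symm j3.symm).trans (j2.symm.trans (j1.trans ?_))
      congr 1; ext s; congr 1; ext t
      simp only [Pi.add_apply, sct, sst, ctf, stf]; ring
    · have hFG : Integrable (fun y : (ℝ × (Fin d → ℝ)) × (ℝ × (Fin d → ℝ)) => F y.1 * G y.2) := hFi.mul_prod hGi
      refine (hFG.norm.mul_prod hbi).mono (Measurable.aestronglyMeasurable ?_) (Filter.Eventually.of_forall fun y => ?_)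
      · simp only [Function.uncurry_def]
        have := (measurable_mlt i j ε S).comp (f := fun p : ((ℝ × (Fin d → ℝ)) × (ℝ × (Fin d → ℝ))) × (Fin d → ℝ) => (p.2, p.1.2.1 - p.1.1.1)) (by fun_prop)
        simp only [Function.comp_def] at this
        fun_prop
      · have hn := n2_nonneg y.2
        simp only [Function.uncurry_def, norm_mul]
        rw [mul_comm]
        have h2 : 0 ≤ 4 * Real.pi ^ 2 * n2 y.2 * Real.exp (-(4 * Real.pi ^ 2 * ε) * n2 y.2) := by positivity
        have h1 := mlt_abs_le (ε := ε) (S := S) i j y.2 (y.1.2.1 - y.1.1.1)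
        have h3 := Real.abs_cos_le_one (2 * Real.pi * ((y.1.2.2 - y.1.1.2) ⬝ᵥ y.2))
        have h4 : ‖mlt i j ε S y.2 (y.1.2.1 - y.1.1.1)‖ * ‖Real.cos (2 * Real.pi * ((y.1.2.2 - y.1.1.2) ⬝ᵥ y.2))‖ ≤ 4 * Real.pi ^ 2 * n2 y.2 * Real.exp (-(4 * Real.pi ^ 2 * ε) * n2 y.2) := by
          rw [← mul_one (4 * Real.pi ^ 2 * n2 y.2 * Real.exp (-(4 * Real.pi ^ 2 * ε) * n2 y.2))]
          exact mul_le_mul h1 h3 (abs_nonneg _) h2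
        have h5 := mul_le_mul_of_nonneg_left h4 (mul_nonneg (norm_nonneg (F y.1.1)) (norm_nonneg (G y.1.2)))
        rw [Real.norm_of_nonneg (Real.exp_pos _).le, Real.norm_of_nonneg hn]
        simp only [norm_norm]
        refine h5.trans (le_of_eq ?_)
        simp only [Real.norm_eq_abs, abs_pow, abs_of_pos Real.pi_pos]; norm_num
  rw [e]
  have hm1 := measurable_sct hF
  have hm2 := measurable_sst hF
  have hm3 := measurable_sct hG
  have hm4 := measurable_sst hG
  have hmm : Measurable fun q : (Fin d → ℝ) × ℝ × ℝ => mlt i j ε S q.1 (q.2.2 - q.2.1) :=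
    (measurable_mlt i j ε S).comp (f := fun q : (Fin d → ℝ) × ℝ × ℝ => (q.1, q.2.2 - q.2.1)) (by fun_prop)
  have inner : ∀ ξ, ‖∫ s, ∫ t, mlt i j ε S ξ (t - s) * (sct F ξ s * sct G ξ t + sst F ξ s * sst G ξ t)‖ₑ ≤
      2⁻¹ * ((∫⁻ s, (‖sct F ξ s‖ₑ ^ 2 + ‖sst F ξ s‖ₑ ^ 2)) + ∫⁻ s, (‖sct G ξ s‖ₑ ^ 2 + ‖sst G ξ s‖ₑ ^ 2)) := by
    intro ξ
    have a1 : Measurable fun s => sct F ξ s := hm1.comp (measurable_const.prodMk measurable_id)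
    have a2 : Measurable fun s => sst F ξ s := hm2.comp (measurable_const.prodMk measurable_id)
    have a3 : Measurable fun s => sct G ξ s := hm3.comp (measurable_const.prodMk measurable_id)
    have a4 : Measurable fun s => sst G ξ s := hm4.comp (measurable_const.prodMk measurable_id)
    have a5 : Measurable (mlt i j ε S ξ) := (measurable_mlt i j ε S).comp (measurable_const.prodMk measurable_id)
    calc _ ≤ ∫⁻ s, ∫⁻ t, ‖mlt i j ε S ξ (t - s) * (sct F ξ s * sct G ξ t + sst F ξ s * sst G ξ t)‖ₑ :=
          (enorm_integral_le_lintegral_enorm _).trans (lintegral_mono fun s => enorm_integral_le_lintegral_enorm _)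
      _ ≤ ∫⁻ s, ∫⁻ t, 2⁻¹ * (‖mlt i j ε S ξ (t - s)‖ₑ * (‖sct F ξ s‖ₑ ^ 2 + ‖sst F ξ s‖ₑ ^ 2) + ‖mlt i j ε S ξ (t - s)‖ₑ * (‖sct G ξ t‖ₑ ^ 2 + ‖sst G ξ t‖ₑ ^ 2)) :=
          lintegral_mono fun s => lintegral_mono fun t => half_form
      _ = 2⁻¹ * ((∫⁻ s, ∫⁻ t, ‖mlt i j ε S ξ (t - s)‖ₑ * (‖sct F ξ s‖ₑ ^ 2 + ‖sst F ξ s‖ₑ ^ 2)) + ∫⁻ s, ∫⁻ t, ‖mlt i j ε S ξ (t - s)‖ₑ * (‖sct G ξ t‖ₑ ^ 2 + ‖sst G ξ t‖ₑ ^ 2)) := by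
          rw [← lintegral_add_left (by fun_prop), ← lintegral_const_mul _ (by fun_prop)]
          congr 1; ext s
          rw [← lintegral_add_left (by fun_prop), ← lintegral_const_mul _ (by fun_prop)]
      _ ≤ _ := by
          refine mul_le_mul_right (add_le_add ?_ ?_) _
          · refine lintegral_mono fun s => ?_
            rw [lintegral_mul_const _ (by fun_prop), lintegral_sub_right_eq_self (fun r => ‖mlt i j ε S ξ r‖ₑ) s]
            exact mul_le_of_le_one_left' (lint_mlt i j hε ξ)
          · rw [lintegral_lintegral_swap (by simp only [Function.uncurry_def]; fun_prop)]
            refine lintegral_mono fun s => ?_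
            rw [lintegral_mul_const _ (by fun_prop), lintegral_sub_left_eq_self (fun r => ‖mlt i j ε S ξ r‖ₑ) s]
            exact mul_le_of_le_one_left' (lint_mlt i j hε ξ)
  refine (enorm_integral_le_lintegral_enorm _).trans ((lintegral_mono inner).trans ?_)
  rw [lintegral_const_mul _ (by fun_prop), lintegral_add_left (by fun_prop)]
  exact mul_le_mul_right (add_le_add (bessel_slice hF hFi) (bessel_slice hG hGi)) _

end

section

lemma blf_eq {d : ℕ} {K F G : ℝ × (Fin d → ℝ) → ℝ} (hK : Measurable K) {B : ℝ} (hB : ∀ z, |K z| ≤ B) (hF : Integrable F) (hG : Integrable G) :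
    BLF (fun s t x => K (t - s, x)) F G = ∫ w, F w * Tc (fun z => K (-z)) G w := by
  unfold BLF
  rw [Measure.volume_eq_prod, integral_prod]
  · congr 1; ext w
    rw [Tc, ← integral_const_mul]
    congr 1; ext z
    simp only [neg_sub]
    rw [show (z.1 - w.1, z.2 - w.2) = z - w from rfl]; ring
  · exact (hF.mul_prod hG).bdd_mul (c := B) (Measurable.aestronglyMeasurable (by fun_prop)) (Filter.Eventually.of_forall fun w => hB _)

lemma Tc_nice {d : ℕ} {K G : ℝ × (Fin d → ℝ) → ℝ} (hK : Measurable K) (hKi : Integrable K) {B : ℝ} (hB : ∀ z, |K z| ≤ B) (hG : Measurable G) (hGi : Integrable G) :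
    Nice volume (Tc K G) := by
  have hm := Tc_sm hK hG
  refine ⟨hm.measurable, ⟨hm.aestronglyMeasurable, ?_⟩, ∫ w, B * ‖G w‖, fun z => ?_⟩
  · have : ∫⁻ z, ‖Tc K G z‖ₑ ≤ (∫⁻ z, ‖K z‖ₑ) * ∫⁻ z, ‖G z‖ₑ := by
      calc _ ≤ ∫⁻ z, ∫⁻ w, ‖K (z - w)‖ₑ * ‖G w‖ₑ := lintegral_mono fun z => by
            refine (enorm_integral_le_lintegral_enorm _).trans (le_of_eq ?_)
            simp only [enorm_mul]
        _ = ∫⁻ w, ∫⁻ z, ‖K (z - w)‖ₑ * ‖G w‖ₑ := lintegral_lintegral_swap (by simp only [Function.uncurry_def]; fun_prop)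
        _ = _ := by
            rw [← lintegral_const_mul _ (by fun_prop)]
            congr 1; ext w
            rw [lintegral_mul_const _ (by fun_prop), lintegral_sub_right_eq_self (fun z => ‖K z‖ₑ) w]
    exact this.trans_lt (ENNReal.mul_lt_top hKi.2 hGi.2)
  · unfold Tc
    refine (norm_integral_le_integral_norm _).trans (integral_mono_of_nonneg (Filter.Eventually.of_forall fun w => norm_nonneg (K (z - w) * G w)) (hGi.norm.const_mul B) (Filter.Eventually.of_forall fun w => ?_))
    simp only [norm_mul]
    exact mul_le_mul_of_nonneg_right (hB _) (norm_nonneg _)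

lemma hKer_czk {d : ℕ} (i j : Fin d) {ε S : ℝ} (hε : 0 < ε) : CZK (fun z => hKer i j ε S (-z)) (hA d) := by
  obtain ⟨B, hB⟩ := hKer_bdd (S := S) i j hε
  have hm : Measurable fun z => hKer i j ε S (-z) := (measurable_hKer i j ε S).comp measurable_neg
  have hIntg : Integrable fun z => hKer i j ε S (-z) := (hKer_int i j hε).comp_neg
  refine ⟨hm, ⟨B, fun z => hB _⟩, hIntg, ?_, hA_nonneg d, ?_⟩
  · intro G hG hGi _
    have hH := Tc_nice hm hIntg (fun z => hB (-z)) hG hGi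
    set H := Tc (fun z => hKer i j ε S (-z)) G with hHd
    have h1 := hKer_l2_form (S := S) i j hε hH.meas hH.int hG hGi
    rw [blf_eq (measurable_hKer i j ε S) hB hH.int hGi, ← hHd] at h1
    have hfin : ∫⁻ z, ‖H z‖ₑ ^ 2 ≠ ⊤ := by
      have := hH.lt_top (p := 2) (by norm_num)
      simp only [ENNReal.rpow_two] at this
      exact this.ne
    have hI : Integrable fun w => H w * H w := by
      obtain ⟨C, hC⟩ := hH.bdd
      exact hH.int.mul_bdd hH.int.1 (Filter.Eventually.of_forall fun z => hC z)
    have h2 : ‖∫ w, H w * H w‖ₑ = ∫⁻ z, ‖H z‖ₑ ^ 2 := by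
      rw [Real.enorm_of_nonneg (integral_nonneg fun z => mul_self_nonneg _), ofReal_integral_eq_lintegral_ofReal hI (Filter.Eventually.of_forall fun z => mul_self_nonneg _)]
      congr 1; ext z
      rw [← Real.enorm_of_nonneg (mul_self_nonneg _), enorm_mul, sq]
    rw [h2] at h1
    set a := ∫⁻ z, ‖H z‖ₑ ^ 2
    set b := ∫⁻ z, ‖G z‖ₑ ^ 2
    have h3 : a + a ≤ a + b := by
      calc a + a = 2 * a := (two_mul a).symm
        _ ≤ 2 * (2⁻¹ * (a + b)) := mul_le_mul_right h1 _
        _ = a + b := by rw [← mul_assoc, ENNReal.mul_inv_cancel (by norm_num) (by norm_num), one_mul]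
    exact (ENNReal.add_le_add_iff_left hfin).1 h3
  · intro h hh w hw1 hw2
    have h0 := hKer_hor (S := S) i j hε hh (-w) (by simpa using hw1) (by simpa using hw2)
    refine le_trans (le_of_eq ?_) h0
    have hms : MeasurableSet ({z : ℝ × (Fin d → ℝ) | |z.1| < 4 * h ^ 2 ∧ ‖z.2‖ < 2 * h}ᶜ) := by
      refine (MeasurableSet.inter (measurableSet_lt (f := fun z : ℝ × (Fin d → ℝ) => |z.1|) (by fun_prop) (by fun_prop)) (measurableSet_lt (f := fun z : ℝ × (Fin d → ℝ) => ‖z.2‖) (by fun_prop) (by fun_prop))).compl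
    rw [← lintegral_indicator hms, ← lintegral_indicator hms, ← lintegral_neg_eq_self]
    congr 1; ext z
    simp only [indicator, mem_compl_iff, mem_ofPred_eq, Prod.fst_neg, Prod.snd_neg, abs_neg, norm_neg, neg_neg, sub_neg_eq_add, neg_sub]
    rw [add_comm w z]

/-- Constant of the model estimate. -/
def cM (d : ℕ) (q : ℝ) : ℝ≥0∞ := ENNReal.ofReal (czC d (hA d) q) ^ (1 / q)

lemma cM_ne_top (d : ℕ) {q : ℝ} (hq : 0 < q) : cM d q ≠ ⊤ := ENNReal.rpow_ne_top_of_nonneg (by positivity) ofReal_ne_top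

lemma hKer_blb {d : ℕ} (i j : Fin d) {ε S : ℝ} (hε : 0 < ε) {p q : ℝ} (hpq : p.HolderConjugate q) (hq2 : q ≤ 2) :
    BLB p q (cM d q) (fun s t x => hKer i j ε S (t - s, x)) := cz_dual (hKer_czk i j hε) hpq hq2

end

section

/-- Quadratic form of a matrix. -/
def qf {d : ℕ} (M : Fin d → Fin d → ℝ) (ξ : Fin d → ℝ) : ℝ := ∑ i, ∑ j, M i j * ξ i * ξ j

/-- The function `exp (-4π² N)` is the characteristic function of a symmetric probability. -/
def Gs {d : ℕ} (N : (Fin d → ℝ) → ℝ) : Prop :=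
  ∃ μ : Measure (Fin d → ℝ), IsProbabilityMeasure μ ∧
    (∀ ξ, ∫ y, Real.cos (2 * Real.pi * (y ⬝ᵥ ξ)) ∂μ = Real.exp (-(4 * Real.pi ^ 2) * N ξ)) ∧
    (∀ ξ, ∫ y, Real.sin (2 * Real.pi * (y ⬝ᵥ ξ)) ∂μ = 0)

lemma continuous_qf {d : ℕ} (M : Fin d → Fin d → ℝ) : Continuous (qf M) := by unfold qf; fun_prop
@[fun_prop] lemma measurable_qf {d : ℕ} (M : Fin d → Fin d → ℝ) : Measurable (qf M) := (continuous_qf M).measurable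

open scoped MatrixOrder Matrix.Norms.L2Operator in
lemma exists_sqrt_qf {d : ℕ} {M : Fin d → Fin d → ℝ} (hs : ∀ i j, M i j = M j i) (hp : ∀ ξ, 0 ≤ qf M ξ) :
    ∃ B : Matrix (Fin d) (Fin d) ℝ, ∀ ξ, qf M ξ = n2 (B.mulVec ξ) := by
  have e : ∀ ξ : Fin d → ℝ, qf M ξ = ξ ⬝ᵥ (Matrix.mulVec (Matrix.of M) ξ) := by
    intro ξ
    simp only [qf, dotProduct, Matrix.mulVec, Finset.mul_sum, Matrix.of_apply]
    exact Finset.sum_congr rfl fun i _ => Finset.sum_congr rfl fun j _ => by ring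
  have hM : (Matrix.of M).PosSemidef := by
    rw [Matrix.posSemidef_iff_dotProduct_mulVec]
    refine ⟨Matrix.IsHermitian.ext fun i j => by simpa using hs j i, fun ξ => ?_⟩
    have := hp ξ
    rw [e] at this
    simpa using this
  obtain ⟨B, hB⟩ := CStarAlgebra.nonneg_iff_eq_star_mul_self.mp hM.nonneg
  refine ⟨B, fun ξ => ?_⟩
  rw [e, hB, ← Matrix.mulVec_mulVec, Matrix.dotProduct_mulVec, Matrix.star_eq_conjTranspose, Matrix.conjTranspose_eq_transpose_of_trivial, Matrix.vecMul_transpose]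
  simp only [n2, dotProduct, sq]

lemma gs_qf {d : ℕ} {M : Fin d → Fin d → ℝ} (hs : ∀ i j, M i j = M j i) (hp : ∀ ξ, 0 ≤ qf M ξ) : Gs (qf M) := by
  obtain ⟨B, hB⟩ := exists_sqrt_qf hs hp
  set c : ℝ := (4 * Real.pi) ^ (-((d:ℝ) / 2)) with hc
  set ρ : (Fin d → ℝ) → ℝ := fun v => c * Real.exp (-(1 / 4) * n2 v) with hρ
  have hc0 : 0 ≤ c := by positivity
  have hρ0 : ∀ v, 0 ≤ ρ v := fun v => by positivity
  have hρm : Measurable ρ := by fun_prop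
  have hρi : Integrable ρ := (integrable_exp_n2 (by norm_num)).const_mul c
  have g : ∀ x : Fin d → ℝ, ∫ v, ρ v * Real.cos (x ⬝ᵥ v) = Real.exp (-n2 x) := by
    intro x
    have := gauss_cos (b := 1 / 4) (by norm_num) x
    simp only [hρ, mul_assoc]
    rw [integral_const_mul, this, hc, ← mul_assoc, show Real.pi / (1 / 4) = 4 * Real.pi by ring, ← Real.rpow_add (by positivity)]
    rw [neg_add_cancel, Real.rpow_zero]; norm_num
  have gs : ∀ x : Fin d → ℝ, ∫ v, ρ v * Real.sin (x ⬝ᵥ v) = 0 := by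
    intro x
    have h := integral_neg_eq_self (fun v : Fin d → ℝ => ρ v * Real.sin (x ⬝ᵥ v)) volume
    have h2 : ∀ v : Fin d → ℝ, ρ (-v) * Real.sin (x ⬝ᵥ (-v)) = -(ρ v * Real.sin (x ⬝ᵥ v)) := by
      intro v
      rw [dotProduct_neg, Real.sin_neg, mul_neg]
      simp [hρ, n2]
    simp_rw [h2] at h
    rw [integral_neg] at h
    linarith
  set ν : Measure (Fin d → ℝ) := volume.withDensity (fun v => ENNReal.ofReal (ρ v)) with hν
  have hν1 : IsProbabilityMeasure ν := by
    refine ⟨?_⟩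
    rw [hν, withDensity_apply _ MeasurableSet.univ, Measure.restrict_univ, ← ofReal_integral_eq_lintegral_ofReal hρi (Filter.Eventually.of_forall hρ0)]
    have := g 0
    simp [n2] at this
    rw [this, ENNReal.ofReal_one]
  set Φ : (Fin d → ℝ) → (Fin d → ℝ) := fun v => B.transpose.mulVec v with hΦ
  have hΦm : Measurable Φ := (Continuous.matrix_mulVec continuous_const continuous_id).measurable
  have tr : ∀ (φ : ℝ → ℝ), Measurable φ → ∀ ξ, ∫ y, φ (2 * Real.pi * (y ⬝ᵥ ξ)) ∂(ν.map Φ) = ∫ v, ρ v * φ ((fun k => 2 * Real.pi * B.mulVec ξ k) ⬝ᵥ v) := by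
    intro φ hφ ξ
    rw [integral_map hΦm.aemeasurable (Measurable.aestronglyMeasurable (by fun_prop)), hν, integral_withDensity_eq_integral_toReal_smul (by fun_prop) (by simp)]
    congr 1; ext v
    rw [ENNReal.toReal_ofReal (hρ0 v), smul_eq_mul]
    congr 2
    rw [hΦ]; simp only
    rw [Matrix.mulVec_transpose, ← Matrix.dotProduct_mulVec, dotProduct_comm, show (fun k => 2 * Real.pi * B.mulVec ξ k) = (2 * Real.pi) • B.mulVec ξ from rfl, smul_dotProduct, smul_eq_mul]
  refine ⟨ν.map Φ, Measure.isProbabilityMeasure_map hΦm.aemeasurable, fun ξ => ?_, fun ξ => ?_⟩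
  · rw [tr _ Real.measurable_cos, g, hB]
    congr 1
    simp only [n2, mul_pow, Finset.mul_sum, ← Finset.sum_neg_distrib]
    exact Finset.sum_congr rfl fun k _ => by ring
  · rw [tr _ Real.measurable_sin, gs]

lemma Gs.nonneg {d : ℕ} {N : (Fin d → ℝ) → ℝ} (h : Gs N) (ξ : Fin d → ℝ) : 0 ≤ N ξ := by
  obtain ⟨μ, hμ, hc, -⟩ := h
  have h1 : ∫ y, Real.cos (2 * Real.pi * (y ⬝ᵥ ξ)) ∂μ ≤ 1 := by
    calc _ ≤ ∫ y, (1:ℝ) ∂μ := integral_mono ((integrable_const (1:ℝ)).mono' (Measurable.aestronglyMeasurable (by fun_prop)) (Filter.Eventually.of_forall fun y => Real.abs_cos_le_one _)) (integrable_const 1) fun y => Real.cos_le_one _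
      _ = 1 := by simp
  rw [hc, ← Real.exp_zero, Real.exp_le_exp] at h1
  have := Real.pi_pos
  by_contra hN
  push Not at hN
  have : 0 < 4 * Real.pi ^ 2 * (- N ξ) := by have : 0 < - N ξ := by linarith
                                             positivity
  nlinarith

lemma Gs.cos_add {d : ℕ} {μ : Measure (Fin d → ℝ)} [IsProbabilityMeasure μ] {N : ℝ} {ξ : Fin d → ℝ} (hc : ∫ y, Real.cos (2 * Real.pi * (y ⬝ᵥ ξ)) ∂μ = N)
    (hs : ∫ y, Real.sin (2 * Real.pi * (y ⬝ᵥ ξ)) ∂μ = 0) (x : Fin d → ℝ) :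
    ∫ y, Real.cos (2 * Real.pi * ((x + y) ⬝ᵥ ξ)) ∂μ = N * Real.cos (2 * Real.pi * (x ⬝ᵥ ξ)) := by
  have e : ∀ y : Fin d → ℝ, Real.cos (2 * Real.pi * ((x + y) ⬝ᵥ ξ)) = Real.cos (2 * Real.pi * (x ⬝ᵥ ξ)) * Real.cos (2 * Real.pi * (y ⬝ᵥ ξ)) - Real.sin (2 * Real.pi * (x ⬝ᵥ ξ)) * Real.sin (2 * Real.pi * (y ⬝ᵥ ξ)) := by
    intro y; rw [add_dotProduct, mul_add, Real.cos_add]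
  simp_rw [e]
  have i1 : Integrable (fun y : Fin d → ℝ => Real.cos (2 * Real.pi * (y ⬝ᵥ ξ))) μ :=
    (integrable_const (1:ℝ)).mono' (Measurable.aestronglyMeasurable (by fun_prop)) (Filter.Eventually.of_forall fun y => Real.abs_cos_le_one _)
  have i2 : Integrable (fun y : Fin d → ℝ => Real.sin (2 * Real.pi * (y ⬝ᵥ ξ))) μ :=
    (integrable_const (1:ℝ)).mono' (Measurable.aestronglyMeasurable (by fun_prop)) (Filter.Eventually.of_forall fun y => Real.abs_sin_le_one _)
  rw [integral_sub (i1.const_mul _) (i2.const_mul _), integral_const_mul, integral_const_mul, hc, hs]; ring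

/-- A general averaged multiplier identity. -/
lemma avg_mult {d : ℕ} {μ : Measure (Fin d → ℝ)} [IsProbabilityMeasure μ] {N : (Fin d → ℝ) → ℝ}
    (hc : ∀ ξ, ∫ y, Real.cos (2 * Real.pi * (y ⬝ᵥ ξ)) ∂μ = Real.exp (-(4 * Real.pi ^ 2) * N ξ))
    (hs : ∀ ξ, ∫ y, Real.sin (2 * Real.pi * (y ⬝ᵥ ξ)) ∂μ = 0) {m : (Fin d → ℝ) → ℝ} (hm : Integrable m) (x : Fin d → ℝ) :
    ∫ ξ, m ξ * Real.exp (-(4 * Real.pi ^ 2) * N ξ) * Real.cos (2 * Real.pi * (x ⬝ᵥ ξ)) = ∫ y, (∫ ξ, m ξ * Real.cos (2 * Real.pi * ((x + y) ⬝ᵥ ξ))) ∂μ := by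
  have e : ∀ ξ, m ξ * Real.exp (-(4 * Real.pi ^ 2) * N ξ) * Real.cos (2 * Real.pi * (x ⬝ᵥ ξ)) = ∫ y, m ξ * Real.cos (2 * Real.pi * ((x + y) ⬝ᵥ ξ)) ∂μ := by
    intro ξ; rw [integral_const_mul, Gs.cos_add (hc ξ) (hs ξ), mul_assoc]
  simp_rw [e]
  rw [integral_integral_swap]
  have h1 : Integrable (fun y : (Fin d → ℝ) × (Fin d → ℝ) => m y.1) (volume.prod μ) := hm.comp_fst μ
  exact h1.mul_bdd (c := 1) (Measurable.aestronglyMeasurable (by fun_prop)) (Filter.Eventually.of_forall fun y => Real.abs_cos_le_one _)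

end

section

/-- Admissible families of exponents. -/
structure AdmQ {d : ℕ} (ε : ℝ) (Q : ℝ → ℝ → (Fin d → ℝ) → ℝ) : Prop where
  meas : Measurable fun z : ℝ × ℝ × (Fin d → ℝ) => Q z.1 z.2.1 z.2.2
  lb : ∀ s t, s < t → ∀ ξ, ε * n2 ξ ≤ Q s t ξ

/-- Space-time kernel with exponents `Q`. -/
def kk {d : ℕ} (i j : Fin d) (S : ℝ) (Q : ℝ → ℝ → (Fin d → ℝ) → ℝ) (s t : ℝ) (x : Fin d → ℝ) : ℝ :=
  if 0 < t - s ∧ t - s < S then kf i j (Q s t) x else 0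

/-- multiplier of `kf`. -/
def mq {d : ℕ} (i j : Fin d) (Q : (Fin d → ℝ) → ℝ) (ξ : Fin d → ℝ) : ℝ :=
  -(4 * Real.pi ^ 2) * (ξ i * ξ j) * Real.exp (-(4 * Real.pi ^ 2) * Q ξ)

/-- bound of the multiplier. -/
def mb {d : ℕ} (ε : ℝ) (ξ : Fin d → ℝ) : ℝ := 4 * Real.pi ^ 2 * n2 ξ * Real.exp (-(4 * Real.pi ^ 2 * ε) * n2 ξ)

lemma mb_nonneg {d : ℕ} (ε : ℝ) (ξ : Fin d → ℝ) : 0 ≤ mb ε ξ := by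
  have hn := n2_nonneg ξ; unfold mb; positivity

lemma mb_int {d : ℕ} {ε : ℝ} (hε : 0 < ε) : Integrable (mb (d := d) ε) := by
  have := (integrable_poly_exp (d := d) (c := 4 * Real.pi ^ 2 * ε) (by positivity) 1).const_mul (4 * Real.pi ^ 2)
  refine this.mono (Measurable.aestronglyMeasurable (by unfold mb; fun_prop)) (Filter.Eventually.of_forall fun ξ => ?_)
  have hn := n2_nonneg ξ
  rw [Real.norm_of_nonneg (mb_nonneg _ _), Real.norm_of_nonneg (by positivity), pow_one, mb, mul_assoc]
  gcongr; linarith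

lemma mq_le {d : ℕ} (i j : Fin d) {ε : ℝ} {Q : (Fin d → ℝ) → ℝ} (hQ : ∀ ξ, ε * n2 ξ ≤ Q ξ) (ξ : Fin d → ℝ) : |mq i j Q ξ| ≤ mb ε ξ := by
  have hn := n2_nonneg ξ
  unfold mq mb
  rw [abs_mul, abs_mul, abs_neg, abs_of_nonneg (by positivity : (0:ℝ) ≤ 4 * Real.pi ^ 2), Real.abs_exp]
  refine mul_le_mul (mul_le_mul_of_nonneg_left (abs_mul_le_n2 ξ i j) (by positivity)) (Real.exp_le_exp.2 ?_) (Real.exp_pos _).le (by positivity)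
  have := hQ ξ
  have : 0 ≤ Real.pi ^ 2 * (Q ξ - ε * n2 ξ) := mul_nonneg (by positivity) (by linarith)
  nlinarith

lemma mq_int {d : ℕ} (i j : Fin d) {ε : ℝ} (hε : 0 < ε) {Q : (Fin d → ℝ) → ℝ} (hm : Measurable Q) (hQ : ∀ ξ, ε * n2 ξ ≤ Q ξ) : Integrable (mq i j Q) :=
  (mb_int hε).mono' (Measurable.aestronglyMeasurable (by unfold mq; fun_prop)) (Filter.Eventually.of_forall (mq_le i j hQ))

lemma kf_abs_le {d : ℕ} (i j : Fin d) {ε : ℝ} (hε : 0 < ε) {Q : (Fin d → ℝ) → ℝ} (hQ : ∀ ξ, ε * n2 ξ ≤ Q ξ) (x : Fin d → ℝ) :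
    |kf i j Q x| ≤ ∫ ξ, mb (d := d) ε ξ := by
  unfold kf
  rw [← Real.norm_eq_abs]
  refine norm_integral_le_of_norm_le (mb_int hε) (Filter.Eventually.of_forall fun ξ => ?_)
  rw [norm_mul]
  calc _ ≤ mb ε ξ * 1 := mul_le_mul (mq_le i j hQ ξ) (Real.abs_cos_le_one _) (abs_nonneg _) (mb_nonneg _ _)
    _ = _ := mul_one _

lemma measurable_kfQ {d : ℕ} (i j : Fin d) {X : Type*} [MeasurableSpace X] {Q : X → (Fin d → ℝ) → ℝ} (hQ : Measurable fun z : X × (Fin d → ℝ) => Q z.1 z.2) :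
    Measurable fun z : X × (Fin d → ℝ) => kf i j (Q z.1) z.2 := by
  unfold kf
  have h1 := hQ.comp (f := fun z : (X × (Fin d → ℝ)) × (Fin d → ℝ) => (z.1.1, z.2)) (by fun_prop)
  simp only [Function.comp_def] at h1
  exact (StronglyMeasurable.integral_prod_right' (f := fun z : (X × (Fin d → ℝ)) × (Fin d → ℝ) => (-(4 * Real.pi ^ 2) * (z.2 i * z.2 j) * Real.exp (-(4 * Real.pi ^ 2) * Q z.1.1 z.2)) * Real.cos (2 * Real.pi * (z.1.2 ⬝ᵥ z.2)))
    (Measurable.stronglyMeasurable (by fun_prop))).measurable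

lemma measurable_kk {d : ℕ} (i j : Fin d) (S : ℝ) {ε : ℝ} {Q : ℝ → ℝ → (Fin d → ℝ) → ℝ} (hQ : AdmQ ε Q) :
    Measurable fun z : ℝ × ℝ × (Fin d → ℝ) => kk i j S Q z.1 z.2.1 z.2.2 := by
  unfold kk
  refine Measurable.ite ?_ ?_ measurable_const
  · exact MeasurableSet.inter (measurableSet_lt (f := fun z : ℝ × ℝ × (Fin d → ℝ) => (0:ℝ)) (by fun_prop) (by fun_prop)) (measurableSet_lt (f := fun z : ℝ × ℝ × (Fin d → ℝ) => z.2.1 - z.1) (by fun_prop) (by fun_prop))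
  · have h0 : Measurable fun z : (ℝ × ℝ) × (Fin d → ℝ) => Q z.1.1 z.1.2 z.2 := hQ.meas.comp (f := fun z : (ℝ × ℝ) × (Fin d → ℝ) => (z.1.1, z.1.2, z.2)) (by fun_prop)
    exact (measurable_kfQ i j (Q := fun z : ℝ × ℝ => Q z.1 z.2) h0).comp (f := fun z : ℝ × ℝ × (Fin d → ℝ) => ((z.1, z.2.1), z.2.2)) (by fun_prop)

lemma kk_abs_le {d : ℕ} (i j : Fin d) (S : ℝ) {ε : ℝ} (hε : 0 < ε) {Q : ℝ → ℝ → (Fin d → ℝ) → ℝ} (hQ : AdmQ ε Q) (s t : ℝ) (x : Fin d → ℝ) :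
    |kk i j S Q s t x| ≤ ∫ ξ, mb (d := d) ε ξ := by
  unfold kk
  split_ifs with h
  · exact kf_abs_le i j hε (hQ.lb s t (by linarith [h.1])) x
  · rw [abs_zero]; exact integral_nonneg (mb_nonneg ε)

/-- Shear in space depending on time preserves measure. -/
lemma shear_mp {d : ℕ} {h : ℝ → Fin d → ℝ} (hh : Measurable h) : MeasurePreserving (fun z : ℝ × (Fin d → ℝ) => (z.1, z.2 + h z.1)) volume volume := by
  have := MeasurePreserving.skew_product (MeasurePreserving.id (volume : Measure ℝ)) (g := fun s (x : Fin d → ℝ) => x + h s) (μc := volume) (μd := volume)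
    (by simp only [Function.uncurry_def]; fun_prop) (Filter.Eventually.of_forall fun s => (measurePreserving_add_right volume (h s)).map_eq)
  exact this

lemma nice_shear {d : ℕ} {h : ℝ → Fin d → ℝ} (hh : Measurable h) {F : ℝ × (Fin d → ℝ) → ℝ} (hF : Nice volume F) :
    Nice volume (fun z : ℝ × (Fin d → ℝ) => F (z.1, z.2 + h z.1)) :=
  ⟨hF.meas.comp (shear_mp hh).measurable, (shear_mp hh).integrable_comp_of_integrable hF.int, by obtain ⟨B, hB⟩ := hF.bdd; exact ⟨B, fun z => hB _⟩⟩

lemma nrm_shear {d : ℕ} {h : ℝ → Fin d → ℝ} (hh : Measurable h) {F : ℝ × (Fin d → ℝ) → ℝ} (hF : Measurable F) (p : ℝ) :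
    nrm p (fun z : ℝ × (Fin d → ℝ) => F (z.1, z.2 + h z.1)) volume = nrm p F volume := by
  unfold nrm
  congr 1
  exact (shear_mp hh).lintegral_comp (f := fun z => ‖F z‖ₑ ^ p) (by fun_prop)

/-- Adding one jump keeps the bilinear bound. -/
lemma blb_jump {d : ℕ} (i j : Fin d) {S ε p q : ℝ} {C : ℝ≥0∞} (hε : 0 < ε) {Q : ℝ → ℝ → (Fin d → ℝ) → ℝ} (hQ : AdmQ ε Q) (hb : BLB p q C (kk i j S Q))
    {N : (Fin d → ℝ) → ℝ} (hN : Gs N) (τ : ℝ) :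
    BLB p q C (kk i j S (fun s t ξ => Q s t ξ + ((if τ ≤ t then N ξ else 0) - (if τ ≤ s then N ξ else 0)))) := by
  obtain ⟨μ, hμ, hc, hs⟩ := hN
  intro F G hF hG
  set H : ℝ → (Fin d → ℝ) → (Fin d → ℝ) := fun t y => if τ ≤ t then y else 0 with hH
  have hHm : Measurable fun z : ℝ × (Fin d → ℝ) => H z.1 z.2 := by
    simp only [hH]
    exact Measurable.ite (measurableSet_le (f := fun z : ℝ × (Fin d → ℝ) => τ) (by fun_prop) (by fun_prop)) measurable_snd measurable_const
  have key : ∀ s t x, kk i j S (fun s t ξ => Q s t ξ + ((if τ ≤ t then N ξ else 0) - (if τ ≤ s then N ξ else 0))) s t x =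
      ∫ y, kk i j S Q s t (x + (H t y - H s y)) ∂μ := by
    intro s t x
    unfold kk
    split_ifs with h
    · have hst : s < t := by linarith [h.1]
      by_cases h1 : τ ≤ s
      · have h2 : τ ≤ t := h1.trans hst.le
        simp [hH, h1, h2]
      by_cases h2 : τ ≤ t
      · simp only [hH, h1, h2, if_true, if_false, sub_zero]
        have := avg_mult hc hs (mq_int i j hε (hQ.meas.comp (f := fun ξ : Fin d → ℝ => (s, t, ξ)) (by fun_prop)) (hQ.lb s t hst)) x
        refine Eq.trans ?_ this
        unfold kf
        congr 1; ext ξ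
        simp only [mq, Function.comp_def]
        rw [mul_add, Real.exp_add]; ring
      · simp [hH, h1, h2]
    · simp
  have hkm := measurable_kk i j S hQ
  set D := ∫ ξ, mb (d := d) ε ξ
  have hD := kk_abs_le i j S hε hQ
  have e1 : BLF (kk i j S (fun s t ξ => Q s t ξ + ((if τ ≤ t then N ξ else 0) - (if τ ≤ s then N ξ else 0)))) F G =
      ∫ y, (∫ w : (ℝ × (Fin d → ℝ)) × (ℝ × (Fin d → ℝ)), kk i j S Q w.1.1 w.2.1 ((w.2.2 + H w.2.1 y) - (w.1.2 + H w.1.1 y)) * (F w.1 * G w.2)) ∂μ := by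
    unfold BLF
    simp_rw [key, ← integral_mul_const]
    rw [integral_integral_swap]
    · congr 1; ext y; congr 1; ext w
      rw [show w.2.2 - w.1.2 + (H w.2.1 y - H w.1.1 y) = (w.2.2 + H w.2.1 y) - (w.1.2 + H w.1.1 y) by abel]
    · have h1 : Integrable (fun z : ((ℝ × (Fin d → ℝ)) × (ℝ × (Fin d → ℝ))) × (Fin d → ℝ) => F z.1.1 * G z.1.2) (volume.prod μ) :=
        Integrable.comp_fst (f := fun z : (ℝ × (Fin d → ℝ)) × (ℝ × (Fin d → ℝ)) => F z.1 * G z.2) (hF.int.mul_prod hG.int) μ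
      refine h1.bdd_mul (c := D) (Measurable.aestronglyMeasurable ?_) (Filter.Eventually.of_forall fun z => hD _ _ _)
      have a1 := hHm.comp (f := fun z : ((ℝ × (Fin d → ℝ)) × (ℝ × (Fin d → ℝ))) × (Fin d → ℝ) => (z.1.1.1, z.2)) (by fun_prop)
      have a2 := hHm.comp (f := fun z : ((ℝ × (Fin d → ℝ)) × (ℝ × (Fin d → ℝ))) × (Fin d → ℝ) => (z.1.2.1, z.2)) (by fun_prop)
      simp only [Function.comp_def] at a1 a2
      exact hkm.comp (f := fun z : ((ℝ × (Fin d → ℝ)) × (ℝ × (Fin d → ℝ))) × (Fin d → ℝ) => (z.1.1.1, z.1.2.1, z.1.2.2 - z.1.1.2 + (H z.1.2.1 z.2 - H z.1.1.1 z.2))) (by fun_prop)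
  have e2 : ∀ y, (∫ w : (ℝ × (Fin d → ℝ)) × (ℝ × (Fin d → ℝ)), kk i j S Q w.1.1 w.2.1 ((w.2.2 + H w.2.1 y) - (w.1.2 + H w.1.1 y)) * (F w.1 * G w.2)) =
      BLF (kk i j S Q) (fun z => F (z.1, z.2 + (- H z.1 y))) (fun z => G (z.1, z.2 + (- H z.1 y))) := by
    intro y
    have hy : Measurable fun s => H s y := hHm.comp (measurable_id.prodMk measurable_const)
    have mp : MeasurePreserving (fun w : (ℝ × (Fin d → ℝ)) × (ℝ × (Fin d → ℝ)) => ((w.1.1, w.1.2 + H w.1.1 y), (w.2.1, w.2.2 + H w.2.1 y))) volume volume :=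
      (shear_mp hy).prod (shear_mp hy)
    unfold BLF
    have hmeas : Measurable fun w : (ℝ × (Fin d → ℝ)) × (ℝ × (Fin d → ℝ)) => kk i j S Q w.1.1 w.2.1 (w.2.2 - w.1.2) * (F (w.1.1, w.1.2 + (- H w.1.1 y)) * G (w.2.1, w.2.2 + (- H w.2.1 y))) := by
      have b1 := hkm.comp (f := fun w : (ℝ × (Fin d → ℝ)) × (ℝ × (Fin d → ℝ)) => (w.1.1, w.2.1, w.2.2 - w.1.2)) (by fun_prop)
      have b2 := hF.meas
      have b3 := hG.meas
      simp only [Function.comp_def] at b1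
      fun_prop
    have h3 := integral_map (μ := volume) mp.measurable.aemeasurable (hmeas.aestronglyMeasurable)
    rw [mp.map_eq] at h3
    rw [h3]
    congr 1; ext w
    simp
  rw [e1]
  have e3 : ∀ y, ‖∫ w : (ℝ × (Fin d → ℝ)) × (ℝ × (Fin d → ℝ)), kk i j S Q w.1.1 w.2.1 ((w.2.2 + H w.2.1 y) - (w.1.2 + H w.1.1 y)) * (F w.1 * G w.2)‖ₑ ≤ C * (nrm p F volume * nrm q G volume) := by
    intro y
    have hy : Measurable fun s => - H s y := (hHm.comp (measurable_id.prodMk measurable_const)).neg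
    rw [e2]
    refine (hb _ _ (nice_shear hy hF) (nice_shear hy hG)).trans ?_
    rw [nrm_shear hy hF.meas, nrm_shear hy hG.meas]
  calc _ ≤ ∫⁻ y, C * (nrm p F volume * nrm q G volume) ∂μ := (enorm_integral_le_lintegral_enorm _).trans (lintegral_mono e3)
    _ = _ := by simp

end

section

/-- Exponents with finitely many jumps. -/
def jQ {d : ℕ} (ε : ℝ) (τ : ℕ → ℝ) (N : ℕ → (Fin d → ℝ) → ℝ) (n : ℕ) (s t : ℝ) (ξ : Fin d → ℝ) : ℝ :=
  (ε + (t - s)) * n2 ξ + ∑ k ∈ Finset.range n, ((if τ k ≤ t then N k ξ else 0) - (if τ k ≤ s then N k ξ else 0))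

lemma jQ_adm {d : ℕ} (ε : ℝ) (τ : ℕ → ℝ) {N : ℕ → (Fin d → ℝ) → ℝ} (hN : ∀ k ξ, 0 ≤ N k ξ) (hm : ∀ k, Measurable (N k)) (n : ℕ) : AdmQ ε (jQ ε τ N n) := by
  refine ⟨?_, fun s t hst ξ => ?_⟩
  · unfold jQ
    refine Measurable.add (by fun_prop) (Finset.measurable_fun_sum _ fun k _ => Measurable.sub ?_ ?_)
    · exact Measurable.ite (measurableSet_le (f := fun z : ℝ × ℝ × (Fin d → ℝ) => τ k) (by fun_prop) (by fun_prop)) (by fun_prop) (by fun_prop)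
    · exact Measurable.ite (measurableSet_le (f := fun z : ℝ × ℝ × (Fin d → ℝ) => τ k) (by fun_prop) (by fun_prop)) (by fun_prop) (by fun_prop)
  · unfold jQ
    have h1 : 0 ≤ ∑ k ∈ Finset.range n, ((if τ k ≤ t then N k ξ else 0) - (if τ k ≤ s then N k ξ else 0)) := by
      refine Finset.sum_nonneg fun k _ => ?_
      have := hN k ξ
      by_cases h1 : τ k ≤ s
      · simp [h1, h1.trans hst.le]
      · by_cases h2 : τ k ≤ t <;> simp [h1, h2, this]
    have h2 : 0 ≤ (t - s) * n2 ξ := mul_nonneg (by linarith) (n2_nonneg ξ)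
    nlinarith

lemma jQ_blb {d : ℕ} (i j : Fin d) {S ε p q : ℝ} (hε : 0 < ε) (hpq : p.HolderConjugate q) (hq2 : q ≤ 2)
    (τ : ℕ → ℝ) {N : ℕ → (Fin d → ℝ) → ℝ} (hN : ∀ k, Gs (N k)) (hm : ∀ k, Measurable (N k)) (n : ℕ) :
    BLB p q (cM d q) (kk i j S (jQ ε τ N n)) := by
  induction n with
  | zero =>
    have h := hKer_blb (S := S) i j hε hpq hq2
    have e : kk i j S (jQ ε τ N 0) = fun s t x => hKer i j ε S (t - s, x) := by
      funext s t x
      simp only [kk, hKer]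
      split_ifs with h
      · have : jQ ε τ N 0 s t = fun ξ => (ε + (t - s)) * n2 ξ := by funext ξ; simp [jQ]
        rw [this, kf_n2 (by linarith [h.1])]; rfl
      · rfl
    rw [e]; exact h
  | succ n ih =>
    have h := blb_jump i j hε (jQ_adm ε τ (fun k => (hN k).nonneg) hm n) ih (hN n) (τ n)
    have e : jQ ε τ N (n + 1) = fun s t ξ => jQ ε τ N n s t ξ + ((if τ n ≤ t then N n ξ else 0) - (if τ n ≤ s then N n ξ else 0)) := by
      funext s t ξ
      simp only [jQ, Finset.sum_range_succ]; ring
    rw [e]; exact h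

lemma blb_lim {d : ℕ} (i j : Fin d) {S ε p q : ℝ} {C : ℝ≥0∞} (hε : 0 < ε) {Q : ℝ → ℝ → (Fin d → ℝ) → ℝ} {Qm : ℕ → ℝ → ℝ → (Fin d → ℝ) → ℝ}
    (hQm : ∀ m, AdmQ ε (Qm m)) (hb : ∀ m, BLB p q C (kk i j S (Qm m)))
    (hl : ∀ s t, s < t → ∀ ξ, Filter.Tendsto (fun m => Qm m s t ξ) Filter.atTop (nhds (Q s t ξ))) : BLB p q C (kk i j S Q) := by
  intro F G hF hG
  have hk : ∀ s t x, Filter.Tendsto (fun m => kk i j S (Qm m) s t x) Filter.atTop (nhds (kk i j S Q s t x)) := by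
    intro s t x
    unfold kk
    split_ifs with h
    · have hst : s < t := by linarith [h.1]
      unfold kf
      refine tendsto_integral_of_dominated_convergence (mb ε) (fun m => ?_) (mb_int hε) (fun m => Filter.Eventually.of_forall fun ξ => ?_) (Filter.Eventually.of_forall fun ξ => ?_)
      · have := (hQm m).meas.comp (f := fun ξ : Fin d → ℝ => (s, t, ξ)) (by fun_prop)
        simp only [Function.comp_def] at this
        exact Measurable.aestronglyMeasurable (by fun_prop)
      · rw [norm_mul]
        calc _ ≤ mb ε ξ * 1 := mul_le_mul (mq_le i j ((hQm m).lb s t hst) ξ) (Real.abs_cos_le_one _) (abs_nonneg _) (mb_nonneg _ _)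
          _ = _ := mul_one _
      · refine Filter.Tendsto.mul_const _ (Filter.Tendsto.const_mul _ ?_)
        exact (Real.continuous_exp.tendsto _).comp ((hl s t hst ξ).const_mul _)
    · exact tendsto_const_nhds
  have hT : Filter.Tendsto (fun m => BLF (kk i j S (Qm m)) F G) Filter.atTop (nhds (BLF (kk i j S Q) F G)) := by
    unfold BLF
    have hFG : Integrable (fun y : (ℝ × (Fin d → ℝ)) × (ℝ × (Fin d → ℝ)) => F y.1 * G y.2) := hF.int.mul_prod hG.int
    refine tendsto_integral_of_dominated_convergence (fun y => (∫ ξ, mb (d := d) ε ξ) * ‖F y.1 * G y.2‖) (fun m => ?_) (hFG.norm.const_mul _) (fun m => Filter.Eventually.of_forall fun y => ?_) (Filter.Eventually.of_forall fun y => ?_)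
    · have := (measurable_kk i j S (hQm m)).comp (f := fun y : (ℝ × (Fin d → ℝ)) × (ℝ × (Fin d → ℝ)) => (y.1.1, y.2.1, y.2.2 - y.1.2)) (by fun_prop)
      exact this.aestronglyMeasurable.mul hFG.1
    · rw [norm_mul]
      exact mul_le_mul_of_nonneg_right (kk_abs_le i j S hε (hQm m) _ _ _) (norm_nonneg _)
    · exact (hk _ _ _).mul_const _
  exact le_of_tendsto (hT.enorm) (Filter.Eventually.of_forall fun m => hb m F G hF hG)

lemma sum_step {c : ℕ → ℝ} (J n : ℕ) : ∑ k ∈ Finset.range n, (if k + 1 ≤ J then c (k + 1) - c k else 0) = c (min n J) - c 0 := by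
  induction n with
  | zero => simp
  | succ n ih =>
    rw [Finset.sum_range_succ, ih]
    split_ifs with h
    · rw [min_eq_left (by omega), min_eq_left h]; ring
    · rw [min_eq_right (by omega), min_eq_right (by omega)]; ring

lemma qf_sub {d : ℕ} (M N : Fin d → Fin d → ℝ) (ξ : Fin d → ℝ) : qf (fun i j => M i j - N i j) ξ = qf M ξ - qf N ξ := by
  simp only [qf, sub_mul, Finset.sum_sub_distrib]

/-- The main bilinear bound for continuous increasing covariance. -/
lemma main_blb {d : ℕ} (i j : Fin d) {S ε p q : ℝ} (hε : 0 < ε) (hpq : p.HolderConjugate q) (hq2 : q ≤ 2)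
    {B : ℝ → Fin d → Fin d → ℝ} (hB : ∀ i j, Continuous fun t => B t i j) (hs : ∀ t i j, B t i j = B t j i)
    (hmono : ∀ s t, s ≤ t → ∀ ξ, qf (B s) ξ ≤ qf (B t) ξ) :
    BLB p q (cM d q) (kk i j S (fun s t ξ => (ε + (t - s)) * n2 ξ + (qf (B t) ξ - qf (B s) ξ))) := by
  set g : ℕ → ℕ → ℝ := fun m k => -(m:ℝ) + k / ((m:ℝ)+1) with hg
  set N : ℕ → ℕ → (Fin d → ℝ) → ℝ := fun m k => qf (fun i j => B (g m (k + 1)) i j - B (g m k) i j) with hN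
  have hgm : ∀ m k, g m k ≤ g m (k + 1) := by
    intro m k; simp only [hg]; push_cast; gcongr; linarith
  have hGs : ∀ m k, Gs (N m k) := fun m k => gs_qf (fun i j => by rw [hs _ i j, hs _ i j]) (fun ξ => by
    rw [qf_sub]; linarith [hmono _ _ (hgm m k) ξ])
  have hNm : ∀ m k, Measurable (N m k) := fun m k => measurable_qf _
  set n : ℕ → ℕ := fun m => 2 * m * (m + 1) with hn
  refine blb_lim i j hε (Qm := fun m => jQ ε (fun k => g m (k + 1)) (N m) (n m)) (fun m => jQ_adm ε _ (fun k => (hGs m k).nonneg) (hNm m) _)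
    (fun m => jQ_blb i j hε hpq hq2 _ (hGs m) (hNm m) _) ?_
  intro s t hst ξ
  have hcq : Continuous fun t => qf (B t) ξ := by unfold qf; fun_prop
  set J : ℕ → ℝ → ℕ := fun m t => ⌊((m:ℝ)+1) * (t + m)⌋₊ with hJ
  have hle : ∀ m k r, g m (k + 1) ≤ r ↔ k + 1 ≤ J m r := by
    intro m k r
    simp only [hJ]
    rw [Nat.le_floor_iff' (by omega)]
    simp only [hg]
    rw [← le_sub_iff_add_le', div_le_iff₀ (by positivity)]
    constructor <;> intro h <;> nlinarith
  have hsum : ∀ m r, ∑ k ∈ Finset.range (n m), (if g m (k + 1) ≤ r then N m k ξ else 0) = qf (B (g m (min (n m) (J m r)))) ξ - qf (B (g m 0)) ξ := by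
    intro m r
    rw [← sum_step (c := fun k => qf (B (g m k)) ξ)]
    refine Finset.sum_congr rfl fun k _ => ?_
    simp only [hle, hN, qf_sub]
  have hlim : ∀ r, Filter.Tendsto (fun m => qf (B (g m (min (n m) (J m r)))) ξ) Filter.atTop (nhds (qf (B r) ξ)) := by
    intro r
    refine (hcq.tendsto r).comp ?_
    rw [Metric.tendsto_atTop]
    intro e he
    obtain ⟨M1, hM1⟩ := exists_nat_gt |r|
    obtain ⟨M2, hM2⟩ := exists_nat_gt (1 / e)
    refine ⟨max M1 M2, fun m hm => ?_⟩
    have m1 : |r| < m := hM1.trans_le (by exact_mod_cast (le_max_left _ _).trans hm)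
    have m2 : 1 / e < m := hM2.trans_le (by exact_mod_cast (le_max_right _ _).trans hm)
    have hr := abs_lt.1 m1
    have h0 : 0 ≤ ((m:ℝ)+1) * (r + m) := mul_nonneg (by positivity) (by linarith)
    have hJn : J m r ≤ n m := by
      have : J m r ≤ ⌊(((n m : ℕ)) : ℝ)⌋₊ := by
        refine Nat.floor_le_floor ?_
        simp only [hn]; push_cast
        nlinarith
      simpa using this
    rw [min_eq_right hJn]
    have f1 := Nat.floor_le h0
    have f2 := Nat.lt_floor_add_one (((m:ℝ)+1) * (r + m))
    have hm0 : (0:ℝ) < (m:ℝ) + 1 := by positivity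
    rw [Real.dist_eq]
    have e1 : g m (J m r) - r = ((J m r : ℝ) - ((m:ℝ)+1) * (r + m)) / ((m:ℝ)+1) := by simp only [hg]; field_simp; ring
    rw [e1, abs_div, abs_of_pos hm0, div_lt_iff₀ hm0]
    have : |(J m r : ℝ) - ((m:ℝ)+1) * (r + m)| ≤ 1 := by rw [abs_le]; constructor <;> simp only [hJ] <;> linarith
    have h3 : 1 < e * m := by rw [div_lt_iff₀ he] at m2; linarith
    nlinarith
  have e : ∀ m, jQ ε (fun k => g m (k + 1)) (N m) (n m) s t ξ = (ε + (t - s)) * n2 ξ + (qf (B (g m (min (n m) (J m t)))) ξ - qf (B (g m (min (n m) (J m s)))) ξ) := by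
    intro m
    simp only [jQ, Finset.sum_sub_distrib, hsum]; ring
  simp only [e]
  exact ((hlim t).sub (hlim s)).const_add _

end

section

/-- Cleaned-up coefficients. -/
structure Cf {d : ℕ} (T : ℝ) (A : ℝ → Fin d → Fin d → ℝ) (δ : ℝ → ℝ) : Prop where
  hT : 0 < T
  dm : Measurable δ
  dpos : ∀ t, 0 < δ t
  dint : LocallyIntegrable δ
  done : ∀ t, t ∉ Ioc 0 T → δ t = 1
  am : ∀ i j, Measurable fun t => A t i j
  aint : ∀ i j, LocallyIntegrable fun t => A t i j
  sym : ∀ t i j, A t i j = A t j i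
  low : ∀ t ξ, δ t * n2 ξ ≤ qf (A t) ξ

/-- New time. -/
def th (δ : ℝ → ℝ) (t : ℝ) : ℝ := ∫ r in (0:ℝ)..t, δ r

/-- Integrated coefficients. -/
def IA {d : ℕ} (A : ℝ → Fin d → Fin d → ℝ) (t : ℝ) (i j : Fin d) : ℝ := ∫ r in (0:ℝ)..t, A r i j

/-- Exponent. -/
def QA {d : ℕ} (A : ℝ → Fin d → Fin d → ℝ) (ε s t : ℝ) (ξ : Fin d → ℝ) : ℝ := ε * n2 ξ + (qf (IA A t) ξ - qf (IA A s) ξ)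

variable {d : ℕ} {T : ℝ} {A : ℝ → Fin d → Fin d → ℝ} {δ : ℝ → ℝ}

lemma ii_of_loc {g : ℝ → ℝ} (h : LocallyIntegrable g) {s t : ℝ} : IntervalIntegrable g volume s t :=
  intervalIntegrable_iff.2 ((h.integrableOn_isCompact isCompact_uIcc).mono_set uIoc_subset_uIcc)

lemma ii_sum {ι : Type} [Fintype ι] {g : ι → ℝ → ℝ} {s t : ℝ} (h : ∀ i, i ∈ Finset.univ → IntervalIntegrable (g i) volume s t) :
    IntervalIntegrable (fun r => ∑ i, g i r) volume s t := by
  have := IntervalIntegrable.sum Finset.univ h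
  rwa [Finset.sum_fn] at this

lemma Cf.dii (h : Cf T A δ) (s t : ℝ) : IntervalIntegrable δ volume s t := ii_of_loc h.dint
lemma Cf.aii (h : Cf T A δ) (i j : Fin d) (s t : ℝ) : IntervalIntegrable (fun r => A r i j) volume s t := ii_of_loc (h.aint i j)

lemma Cf.th_sub (h : Cf T A δ) (s t : ℝ) : th δ t - th δ s = ∫ r in s..t, δ r :=
  intervalIntegral.integral_interval_sub_left (h.dii _ _) (h.dii _ _)
lemma Cf.IA_sub (h : Cf T A δ) (i j : Fin d) (s t : ℝ) : IA A t i j - IA A s i j = ∫ r in s..t, A r i j :=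
  intervalIntegral.integral_interval_sub_left (h.aii _ _ _ _) (h.aii _ _ _ _)

lemma Cf.th_cont (h : Cf T A δ) : Continuous (th δ) := intervalIntegral.continuous_primitive (fun _ _ => h.dii _ _) 0
lemma Cf.IA_cont (h : Cf T A δ) (i j : Fin d) : Continuous (fun t => IA A t i j) := intervalIntegral.continuous_primitive (fun _ _ => h.aii _ _ _ _) 0

lemma Cf.th_mono (h : Cf T A δ) : StrictMono (th δ) := by
  intro s t hst
  have h1 : 0 < ∫ r in s..t, δ r := intervalIntegral.intervalIntegral_pos_of_pos (h.dii s t) h.dpos hst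
  linarith [h.th_sub s t]

lemma th_zero (δ : ℝ → ℝ) : th δ 0 = 0 := intervalIntegral.integral_same

lemma Cf.th_ge (h : Cf T A δ) {t : ℝ} (ht : T ≤ t) : t - T ≤ th δ t := by
  have h1 := h.th_sub T t
  have h2 : ∫ r in T..t, δ r = ∫ r in T..t, (1:ℝ) := by
    refine intervalIntegral.integral_congr_ae (Filter.Eventually.of_forall fun r hr => ?_)
    rw [uIoc_of_le ht] at hr
    exact h.done r fun hh => absurd hh.2 (not_le.2 hr.1)
  rw [h2] at h1
  simp at h1
  have h3 := h.th_mono.monotone h.hT.le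
  rw [th_zero] at h3
  linarith

lemma Cf.th_le (h : Cf T A δ) {t : ℝ} (ht : t ≤ 0) : th δ t = t := by
  have h2 : ∫ r in t..0, δ r = ∫ r in t..0, (1:ℝ) := by
    refine intervalIntegral.integral_congr_ae (Filter.Eventually.of_forall fun r hr => ?_)
    rw [uIoc_of_le ht] at hr
    exact h.done r fun hh => absurd hh.1 (not_lt.2 hr.2)
  rw [th, intervalIntegral.integral_symm, h2]; simp

lemma Cf.th_surj (h : Cf T A δ) : Function.Surjective (th δ) := by
  refine h.th_cont.surjective ?_ ?_
  · refine Filter.tendsto_atTop_mono' _ ?_ (Filter.tendsto_atTop_add_const_right _ (-T) Filter.tendsto_id)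
    filter_upwards [Filter.eventually_ge_atTop T] with t ht
    have := h.th_ge ht
    simp only [id]; linarith
  · refine Filter.Tendsto.congr' ?_ Filter.tendsto_id
    filter_upwards [Filter.eventually_le_atBot 0] with t ht
    exact (h.th_le ht).symm

/-- Inverse time change. -/
def Cf.iso (h : Cf T A δ) : ℝ ≃o ℝ := h.th_mono.orderIsoOfSurjective _ h.th_surj

lemma Cf.iso_apply (h : Cf T A δ) (t : ℝ) : h.iso t = th δ t := rfl
lemma Cf.iso_symm (h : Cf T A δ) (t : ℝ) : h.iso.symm (th δ t) = t := h.iso.symm_apply_apply t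
lemma Cf.th_symm (h : Cf T A δ) (t : ℝ) : th δ (h.iso.symm t) = t := h.iso.apply_symm_apply t

/-- Weighted time measure. -/
def nu (δ : ℝ → ℝ) : Measure ℝ := volume.withDensity fun t => ENNReal.ofReal (δ t)

instance (δ : ℝ → ℝ) : SFinite (nu δ) := by unfold nu; infer_instance

lemma Cf.nu_Ioc (h : Cf T A δ) {s t : ℝ} (hst : s ≤ t) : nu δ (Ioc s t) = ENNReal.ofReal (th δ t - th δ s) := by
  rw [nu, withDensity_apply _ measurableSet_Ioc, h.th_sub, intervalIntegral.integral_of_le hst,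
    ofReal_integral_eq_lintegral_ofReal ((intervalIntegrable_iff_integrableOn_Ioc_of_le hst).1 (h.dii s t)) (Filter.Eventually.of_forall fun r => (h.dpos r).le)]

lemma Cf.th_mp (h : Cf T A δ) : MeasurePreserving (th δ) (nu δ) volume := by
  refine ⟨h.th_cont.measurable, ?_⟩
  symm
  refine Measure.ext_of_Ioc _ _ fun a b hab => ?_
  rw [Real.volume_Ioc, Measure.map_apply h.th_cont.measurable measurableSet_Ioc]
  have e : th δ ⁻¹' Ioc a b = Ioc (h.iso.symm a) (h.iso.symm b) := by
    ext r
    simp only [mem_preimage, mem_Ioc, ← h.iso_apply, ← OrderIso.symm_apply_lt, ← OrderIso.le_symm_apply]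
  rw [e, h.nu_Ioc (h.iso.symm.monotone hab.le), h.th_symm, h.th_symm]

/-- Space-time weighted measure. -/
def nuZ (d : ℕ) (δ : ℝ → ℝ) : Measure (ℝ × (Fin d → ℝ)) := (nu δ).prod volume

instance (δ : ℝ → ℝ) : SFinite (nuZ d δ) := by unfold nuZ; infer_instance

lemma Cf.TH_mp (h : Cf T A δ) : MeasurePreserving (fun z : ℝ × (Fin d → ℝ) => (th δ z.1, z.2)) (nuZ d δ) volume :=
  h.th_mp.prod (MeasurePreserving.id _)

lemma qf_n2 (M : Fin d → Fin d → ℝ) (c : ℝ) (ξ : Fin d → ℝ) : qf (fun i j => M i j - if i = j then c else 0) ξ = qf M ξ - c * n2 ξ := by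
  rw [qf_sub]; congr 1
  simp only [qf, n2, ite_mul, zero_mul, Finset.sum_ite_eq, Finset.mem_univ, if_true, Finset.mul_sum]
  exact Finset.sum_congr rfl fun k _ => by ring

lemma qf_int {M : ℝ → Fin d → Fin d → ℝ} {s t : ℝ} (hM : ∀ i j, IntervalIntegrable (fun r => M r i j) volume s t) (ξ : Fin d → ℝ) :
    qf (fun i j => ∫ r in s..t, M r i j) ξ = ∫ r in s..t, qf (M r) ξ := by
  unfold qf
  rw [intervalIntegral.integral_finsetSum]
  · refine Finset.sum_congr rfl fun i _ => ?_
    rw [intervalIntegral.integral_finsetSum]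
    · refine Finset.sum_congr rfl fun j _ => ?_
      rw [intervalIntegral.integral_mul_const, intervalIntegral.integral_mul_const]
    · intro j _; exact ((hM i j).mul_const _).mul_const _
  · intro i _
    exact ii_sum fun j _ => ((hM i j).mul_const _).mul_const _

lemma Cf.qf_IA_sub (h : Cf T A δ) (s t : ℝ) (ξ : Fin d → ℝ) : qf (IA A t) ξ - qf (IA A s) ξ = ∫ r in s..t, qf (A r) ξ := by
  rw [← qf_sub]
  simp only [h.IA_sub]
  exact qf_int (fun i j => h.aii i j s t) ξ

lemma Cf.qfA_int (h : Cf T A δ) (ξ : Fin d → ℝ) (s t : ℝ) : IntervalIntegrable (fun r => qf (A r) ξ) volume s t := by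
  unfold qf
  exact ii_sum fun i _ => ii_sum fun j _ => ((h.aii i j s t).mul_const _).mul_const _

lemma Cf.low_int (h : Cf T A δ) {s t : ℝ} (hst : s ≤ t) (ξ : Fin d → ℝ) : (th δ t - th δ s) * n2 ξ ≤ qf (IA A t) ξ - qf (IA A s) ξ := by
  rw [h.qf_IA_sub, h.th_sub, ← intervalIntegral.integral_mul_const]
  exact intervalIntegral.integral_mono_on hst ((h.dii s t).mul_const _) (h.qfA_int ξ s t) fun r _ => h.low r ξ

lemma Cf.QA_adm (h : Cf T A δ) (ε : ℝ) : AdmQ ε (QA A ε) := by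
  refine ⟨?_, fun s t hst ξ => ?_⟩
  · unfold QA qf
    have := fun i j => (h.IA_cont i j).measurable
    fun_prop
  · have h1 := h.low_int hst.le ξ
    have h2 : 0 ≤ (th δ t - th δ s) * n2 ξ := mul_nonneg (by linarith [h.th_mono hst]) (n2_nonneg _)
    unfold QA; linarith

/-- Kernel in the original time. -/
def kA (A : ℝ → Fin d → Fin d → ℝ) (i j : Fin d) (ε s t : ℝ) (x : Fin d → ℝ) : ℝ := if s < t then kf i j (QA A ε s t) x else 0

lemma Cf.kA_kk (h : Cf T A δ) (i j : Fin d) (ε : ℝ) {s t : ℝ} (hs : s ∈ Ioc 0 T) (ht : t ∈ Ioc 0 T) (x : Fin d → ℝ) :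
    kk i j (th δ T + 1) (fun s t ξ => (ε + (t - s)) * n2 ξ + (qf (fun i j => IA A (h.iso.symm t) i j - if i = j then t else 0) ξ - qf (fun i j => IA A (h.iso.symm s) i j - if i = j then s else 0) ξ)) (th δ s) (th δ t) x = kA A i j ε s t x := by
  have h1 : th δ t ≤ th δ T := h.th_mono.monotone ht.2
  have h2 : 0 < th δ s := by rw [← th_zero δ]; exact h.th_mono hs.1
  unfold kk kA
  have e : (0 < th δ t - th δ s ∧ th δ t - th δ s < th δ T + 1) ↔ s < t := by
    rw [sub_pos, h.th_mono.lt_iff_lt]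
    exact ⟨fun q => q.1, fun q => ⟨q, by linarith⟩⟩
  simp only [e]
  congr 2
  funext ξ
  simp only [QA, h.iso_symm, qf_n2]; ring

lemma Cf.time_blb (h : Cf T A δ) (i j : Fin d) {ε p q : ℝ} (hε : 0 < ε) (hpq : p.HolderConjugate q) (hq2 : q ≤ 2) {F G : ℝ × (Fin d → ℝ) → ℝ}
    (hF : Nice (nuZ d δ) F) (hG : Nice (nuZ d δ) G) (hF0 : ∀ z, z.1 ∉ Ioc 0 T → F z = 0) (hG0 : ∀ z, z.1 ∉ Ioc 0 T → G z = 0) :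
    ‖∫ y : (ℝ × (Fin d → ℝ)) × (ℝ × (Fin d → ℝ)), kA A i j ε y.1.1 y.2.1 (y.2.2 - y.1.2) * (F y.1 * G y.2) ∂((nuZ d δ).prod (nuZ d δ))‖ₑ ≤
      cM d q * (nrm p F (nuZ d δ) * nrm q G (nuZ d δ)) := by
  set B : ℝ → Fin d → Fin d → ℝ := fun t i j => IA A (h.iso.symm t) i j - if i = j then t else 0 with hB
  have hsc : Continuous h.iso.symm := h.iso.symm.continuous
  have hb := main_blb (S := th δ T + 1) i j hε hpq hq2 (B := B) (fun i j => by
      simp only [hB]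
      refine Continuous.sub ((h.IA_cont i j).comp hsc) ?_
      split_ifs <;> fun_prop) (fun t i j => by simp only [hB, IA, h.sym _ i j, eq_comm]) (fun s t hst ξ => by
      simp only [hB, qf_n2]
      have := h.low_int (h.iso.symm.monotone hst) ξ
      rw [h.th_symm, h.th_symm] at this
      linarith)
  set Th' : ℝ × (Fin d → ℝ) → ℝ × (Fin d → ℝ) := fun z => (h.iso.symm z.1, z.2) with hTh'
  have hTm' : Measurable Th' := by have := hsc.measurable; fun_prop
  have comp : ∀ {H : ℝ × (Fin d → ℝ) → ℝ}, Nice (nuZ d δ) H → Nice volume (fun z => H (Th' z)) := by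
    intro H hH
    refine ⟨hH.meas.comp hTm', ?_, ?_⟩
    · refine (h.TH_mp.integrable_comp (hH.meas.comp hTm').aestronglyMeasurable).1 ?_
      refine hH.int.congr (Filter.Eventually.of_forall fun z => ?_)
      simp [hTh', h.iso_symm]
    · obtain ⟨B, hB⟩ := hH.bdd; exact ⟨B, fun z => hB _⟩
  have compn : ∀ {H : ℝ × (Fin d → ℝ) → ℝ} (r : ℝ), Nice (nuZ d δ) H → nrm r (fun z => H (Th' z)) volume = nrm r H (nuZ d δ) := by
    intro H r hH
    unfold nrm
    congr 1
    rw [← h.TH_mp.lintegral_comp (by have := hH.meas; fun_prop)]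
    simp only [hTh', h.iso_symm]
  have := hb _ _ (comp hF) (comp hG)
  rw [compn p hF, compn q hG] at this
  refine le_trans (le_of_eq ?_) this
  congr 1
  unfold BLF
  have mp := h.TH_mp.prod h.TH_mp
  have hk0 := (measurable_kk i j (th δ T + 1) (ε := ε) (Q := fun s t ξ => (ε + (t - s)) * n2 ξ + (qf (B t) ξ - qf (B s) ξ)) ⟨by
    have e : ∀ i j, Measurable fun t => B t i j := fun i j => by
      simp only [hB]
      have h1 := ((h.IA_cont i j).comp hsc).measurable
      simp only [Function.comp_def] at h1
      split_ifs <;> fun_prop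
    unfold qf
    fun_prop, fun s t hst ξ => by
      simp only [hB, qf_n2]
      have := h.low_int (h.iso.symm.monotone hst.le) ξ
      rw [h.th_symm, h.th_symm] at this
      have h3 := n2_nonneg ξ
      nlinarith⟩)
  have hk := hk0.comp (f := fun w : (ℝ × (Fin d → ℝ)) × (ℝ × (Fin d → ℝ)) => (w.1.1, w.2.1, w.2.2 - w.1.2)) (by fun_prop)
  have hm : Measurable fun w : (ℝ × (Fin d → ℝ)) × (ℝ × (Fin d → ℝ)) => kk i j (th δ T + 1) (fun s t ξ => (ε + (t - s)) * n2 ξ + (qf (B t) ξ - qf (B s) ξ)) w.1.1 w.2.1 (w.2.2 - w.1.2) * (F (Th' w.1) * G (Th' w.2)) := by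
    have b2 := hF.meas
    have b3 := hG.meas
    simp only [Function.comp_def] at hk
    fun_prop
  have h3 := integral_map (μ := (nuZ d δ).prod (nuZ d δ)) mp.measurable.aemeasurable hm.aestronglyMeasurable
  rw [mp.map_eq, ← Measure.volume_eq_prod] at h3
  rw [h3]
  congr 1; ext w
  simp only [Prod.map, hTh', h.iso_symm]
  by_cases h1 : w.1.1 ∈ Ioc 0 T
  · by_cases h2 : w.2.1 ∈ Ioc 0 T
    · rw [← h.kA_kk i j ε h1 h2]
    · simp [hG0 w.2 h2]
  · simp [hF0 w.1 h1]

end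

section

lemma rpow_self_bound {I C : ℝ≥0∞} {p q : ℝ} (hpq : p.HolderConjugate q) (hI : I ≠ ⊤) (h : I ≤ C * I ^ (1/q)) : I ≤ C ^ p := by
  have hp := hpq.pos
  by_cases h0 : I = 0
  · rw [h0]; exact zero_le
  have hs : 1 / q = 1 - 1/p := by have := hpq.inv_add_inv_eq_one; simp only [one_div]; linarith
  have h1 : I ^ (1/p) ≤ C := by
    have e : I = I ^ (1/p) * I ^ (1/q) := by
      rw [← ENNReal.rpow_add _ _ h0 hI, hs]; simp
    have h2 : I ^ (1/p) * I ^ (1/q) ≤ C * I ^ (1/q) := by rw [← e]; exact h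
    have h3 : I ^ (1/q) ≠ 0 := by simp [ENNReal.rpow_eq_zero_iff, h0, hI]
    have h4 : I ^ (1/q) ≠ ⊤ := ENNReal.rpow_ne_top_of_nonneg (by have := hpq.symm.pos; positivity) hI
    exact (ENNReal.mul_le_mul_iff_left h3 h4).1 h2
  calc I = (I ^ (1/p)) ^ p := by rw [← ENNReal.rpow_mul, one_div_mul_cancel hp.ne', ENNReal.rpow_one]
    _ ≤ C ^ p := ENNReal.rpow_le_rpow h1 hp.le

lemma conv_holder {X : Type} [MeasurableSpace X] {μ : Measure X} {p q : ℝ} (hpq : p.HolderConjugate q) (hp2 : 2 ≤ p) {U : X → ℝ} (hU : Measurable U) {S : Set X}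
    (hS : MeasurableSet S) (hSf : μ S < ⊤) {B : ℝ} (hB : ∀ z ∈ S, |U z| ≤ B) {C : ℝ≥0∞}
    (hc : ∀ G, Nice μ G → (∀ z, z ∉ S → G z = 0) → ‖∫ z, U z * G z ∂μ‖ₑ ≤ C * nrm q G μ) : ∫⁻ z in S, ‖U z‖ₑ ^ p ∂μ ≤ C ^ p := by
  have hp := hpq.pos
  have hq := hpq.symm.pos
  set V : X → ℝ := S.indicator U with hV
  have hVm : Measurable V := hU.indicator hS
  have hVB : ∀ z, |V z| ≤ |B| := fun z => by
    by_cases hz : z ∈ S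
    · simp only [hV, indicator_of_mem hz]; exact (hB z hz).trans (le_abs_self B)
    · simp [hV, indicator_of_notMem hz]
  set G : X → ℝ := fun z => |V z| ^ (p - 2) * V z with hG
  have hG0 : ∀ z, z ∉ S → G z = 0 := fun z hz => by simp [hG, hV, indicator_of_notMem hz]
  have hGm : Measurable G := by simp only [hG]; fun_prop
  have hGB : ∀ z, |G z| ≤ |B| ^ (p - 2) * |B| := fun z => by
    simp only [hG, abs_mul, abs_of_nonneg (Real.rpow_nonneg (abs_nonneg (V z)) _)]
    exact mul_le_mul (Real.rpow_le_rpow (abs_nonneg _) (hVB z) (by linarith)) (hVB z) (abs_nonneg _) (Real.rpow_nonneg (abs_nonneg _) _)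
  have hGn : Nice μ G := by
    refine ⟨hGm, ?_, _, hGB⟩
    have : Integrable (S.indicator fun _ => |B| ^ (p - 2) * |B|) μ := (integrable_indicator_iff hS).2 (integrableOn_const hSf.ne)
    refine this.mono' hGm.aestronglyMeasurable (Filter.Eventually.of_forall fun z => ?_)
    by_cases hz : z ∈ S
    · rw [indicator_of_mem hz]; exact hGB z
    · rw [indicator_of_notMem hz, hG0 z hz]; simp
  have hUG : ∀ z, U z * G z = |V z| ^ p := fun z => by
    by_cases hz : z ∈ S
    · have e : V z = U z := indicator_of_mem hz U
      simp only [hG, e]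
      by_cases h0 : U z = 0
      · simp [h0, Real.zero_rpow hp.ne']
      · have : |U z| ^ p = |U z| ^ (p - 2) * |U z| ^ (2:ℝ) := by
          rw [← Real.rpow_add (abs_pos.2 h0)]; ring_nf
        rw [this, Real.rpow_two, sq_abs]; ring
    · rw [hG0 z hz]; simp [hV, indicator_of_notMem hz, Real.zero_rpow hp.ne']
  have hGq : ∀ z, ‖G z‖ₑ ^ q = ‖V z‖ₑ ^ p := fun z => by
    have e : |G z| = |V z| ^ (p - 1) := by
      simp only [hG, abs_mul, abs_of_nonneg (Real.rpow_nonneg (abs_nonneg (V z)) _)]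
      by_cases h0 : V z = 0
      · have : p - 1 ≠ 0 := by linarith
        simp [h0, Real.zero_rpow this]
      · have := Real.rpow_add (abs_pos.2 h0) (p-2) 1
        rw [Real.rpow_one] at this
        rw [← this]; ring_nf
    rw [← ofReal_norm, ← ofReal_norm, Real.norm_eq_abs, Real.norm_eq_abs, ENNReal.ofReal_rpow_of_nonneg (abs_nonneg _) hq.le, ENNReal.ofReal_rpow_of_nonneg (abs_nonneg _) hp.le, e,
      ← Real.rpow_mul (abs_nonneg _), hpq.sub_one_mul_conj]
  set I := ∫⁻ z, ‖V z‖ₑ ^ p ∂μ with hI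
  have hIS : ∫⁻ z in S, ‖U z‖ₑ ^ p ∂μ = I := by
    rw [hI, ← lintegral_indicator hS]
    congr 1; ext z
    by_cases hz : z ∈ S
    · simp [hV, hz]
    · simp [hV, hz, hp]
  have hIntg : ‖∫ z, U z * G z ∂μ‖ₑ = I := by
    simp only [hUG]
    rw [integral_eq_lintegral_of_nonneg_ae (Filter.Eventually.of_forall fun z => by positivity) (Measurable.aestronglyMeasurable (by fun_prop))]
    have e : ∫⁻ z, ENNReal.ofReal (|V z| ^ p) ∂μ = I := by
      rw [hI]; congr 1; ext z
      rw [← ENNReal.ofReal_rpow_of_nonneg (abs_nonneg _) hp.le, ← Real.norm_eq_abs, ofReal_norm]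
    have hIt : I < ⊤ := by
      rw [← hIS]
      refine lt_of_le_of_lt (setLIntegral_mono (g := fun _ => ENNReal.ofReal |B| ^ p) measurable_const fun z hz => ?_) ?_
      · refine ENNReal.rpow_le_rpow ?_ hp.le
        rw [← ofReal_norm]; exact ENNReal.ofReal_le_ofReal ((hB z hz).trans (le_abs_self B))
      · rw [lintegral_const, Measure.restrict_apply_univ]
        exact ENNReal.mul_lt_top (ENNReal.rpow_lt_top_of_nonneg hp.le ofReal_ne_top) hSf
    rw [e, ← ofReal_norm, Real.norm_of_nonneg toReal_nonneg, ENNReal.ofReal_toReal hIt.ne]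
  have hIt : I ≠ ⊤ := by rw [← hIntg]; exact enorm_ne_top
  have := hc G hGn hG0
  rw [hIntg] at this
  rw [hIS]
  refine rpow_self_bound hpq hIt ?_
  refine this.trans (le_of_eq ?_)
  unfold nrm
  simp only [hGq, hI]

end

section

lemma avg_L1 {d : ℕ} {N : (Fin d → ℝ) → ℝ} (hN : Gs N) {m : (Fin d → ℝ) → ℝ} (hmm : Measurable m) (hm : Integrable m) :
    ∫⁻ x : Fin d → ℝ, ‖∫ ξ, m ξ * Real.exp (-(4 * Real.pi ^ 2) * N ξ) * Real.cos (2 * Real.pi * (x ⬝ᵥ ξ))‖ₑ ≤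
      ∫⁻ x : Fin d → ℝ, ‖∫ ξ, m ξ * Real.cos (2 * Real.pi * (x ⬝ᵥ ξ))‖ₑ := by
  obtain ⟨μ, hμ, hc, hs⟩ := hN
  set H : (Fin d → ℝ) → ℝ := fun x => ∫ ξ, m ξ * Real.cos (2 * Real.pi * (x ⬝ᵥ ξ)) with hH
  have hHm : Measurable H := by
    have h1 : Measurable fun z : (Fin d → ℝ) × (Fin d → ℝ) => m z.2 * Real.cos (2 * Real.pi * (z.1 ⬝ᵥ z.2)) := by fun_prop
    exact h1.stronglyMeasurable.integral_prod_right'.measurable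
  have e : ∀ x, ∫ ξ, m ξ * Real.exp (-(4 * Real.pi ^ 2) * N ξ) * Real.cos (2 * Real.pi * (x ⬝ᵥ ξ)) = ∫ y, H (x + y) ∂μ := fun x => avg_mult hc hs hm x
  simp_rw [e]
  calc ∫⁻ x, ‖∫ y, H (x + y) ∂μ‖ₑ ≤ ∫⁻ x, ∫⁻ y, ‖H (x + y)‖ₑ ∂μ := lintegral_mono fun x => enorm_integral_le_lintegral_enorm _
    _ = ∫⁻ y, (∫⁻ x, ‖H (x + y)‖ₑ) ∂μ := lintegral_lintegral_swap (by simp only [Function.uncurry_def]; fun_prop)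
    _ = ∫⁻ y, (∫⁻ x, ‖H x‖ₑ) ∂μ := by
      congr 1; ext y; exact lintegral_add_right_eq_self (fun x => ‖H x‖ₑ) y
    _ = _ := by rw [lintegral_const, measure_univ, mul_one]

lemma kf_L1 {d : ℕ} (i j : Fin d) {ε : ℝ} (hε : 0 < ε) : ∫⁻ x : Fin d → ℝ, ‖kf i j (fun ξ => ε * n2 ξ) x‖ₑ ≤ ENNReal.ofReal (hc1 d / ε) := by
  have := hKer_all (d := d) i j (ε := ε/2) (S := ε) hε (ε/2) (by linarith)
  refine le_trans (le_of_eq ?_) this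
  congr 1; ext x
  unfold hKer
  rw [if_pos ⟨by simp only; linarith, by simp only; linarith⟩, kf_n2 hε]
  simp only [add_halves]; rfl

variable {d : ℕ} {T : ℝ} {A : ℝ → Fin d → Fin d → ℝ} {δ : ℝ → ℝ}

lemma Cf.gs (h : Cf T A δ) {s t : ℝ} (hst : s ≤ t) : Gs (fun ξ => qf (IA A t) ξ - qf (IA A s) ξ) := by
  have e : (fun ξ => qf (IA A t) ξ - qf (IA A s) ξ) = qf (fun i j => IA A t i j - IA A s i j) := by
    ext ξ; rw [qf_sub]
  rw [e]
  refine gs_qf (fun i j => by simp only [IA, h.sym _ i j]) fun ξ => ?_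
  rw [qf_sub]
  have h1 := h.low_int hst ξ
  have h2 : 0 ≤ (th δ t - th δ s) * n2 ξ := mul_nonneg (by linarith [h.th_mono.monotone hst]) (n2_nonneg _)
  linarith

lemma Cf.QA_lb (h : Cf T A δ) (ε : ℝ) {s t : ℝ} (hst : s ≤ t) (ξ : Fin d → ℝ) : ε * n2 ξ ≤ QA A ε s t ξ := by
  have h1 := h.low_int hst ξ
  have h2 : 0 ≤ (th δ t - th δ s) * n2 ξ := mul_nonneg (by linarith [h.th_mono.monotone hst]) (n2_nonneg _)
  unfold QA; linarith

lemma Cf.QA_meas (h : Cf T A δ) (ε : ℝ) : Measurable fun z : (ℝ × ℝ) × (Fin d → ℝ) => QA A ε z.1.1 z.1.2 z.2 := by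
  unfold QA qf
  have := fun i j => (h.IA_cont i j).measurable
  fun_prop

lemma Cf.kf_QA_L1 (h : Cf T A δ) (i j : Fin d) {ε : ℝ} (hε : 0 < ε) {s t : ℝ} (hst : s ≤ t) :
    ∫⁻ x, ‖kf i j (QA A ε s t) x‖ₑ ≤ ENNReal.ofReal (hc1 d / ε) := by
  refine le_trans ?_ (kf_L1 i j hε)
  have hq : Measurable fun ξ : Fin d → ℝ => ε * n2 ξ := by have := measurable_n2 (d := d); fun_prop
  have hi := mq_int i j hε hq (fun ξ => le_rfl)
  have := avg_L1 (h.gs hst) (m := mq i j (fun ξ => ε * n2 ξ)) (by unfold mq; fun_prop) hi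
  refine le_trans (le_of_eq ?_) this
  congr 1; ext x; congr 1
  unfold kf; congr 1; ext ξ
  unfold mq QA
  rw [mul_add, Real.exp_add]; ring

lemma Cf.gf_QA_L1 (h : Cf T A δ) {ε : ℝ} (hε : 0 < ε) {s t : ℝ} (hst : s ≤ t) :
    ∫⁻ x, ‖gf (QA A ε s t) x‖ₑ ≤ 1 := by
  rw [← lint_gf_n2 (d := d) hε]
  have hi : Integrable fun ξ : Fin d → ℝ => Real.exp (-(4 * Real.pi ^ 2) * (ε * n2 ξ)) := by
    have := integrable_exp_n2 (d := d) (c := 4 * Real.pi ^ 2 * ε) (by positivity)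
    refine this.congr (Filter.Eventually.of_forall fun ξ => ?_)
    simp only; congr 1; ring
  have := avg_L1 (h.gs hst) (m := fun ξ => Real.exp (-(4 * Real.pi ^ 2) * (ε * n2 ξ))) (by have := measurable_n2 (d := d); fun_prop) hi
  refine le_trans (le_of_eq ?_) this
  congr 1; ext x; congr 1
  unfold gf; congr 1; ext ξ
  unfold QA
  rw [mul_add, Real.exp_add]

lemma measurable_gfQ {X : Type*} [MeasurableSpace X] {Q : X → (Fin d → ℝ) → ℝ} (hQ : Measurable fun z : X × (Fin d → ℝ) => Q z.1 z.2) :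
    Measurable fun z : X × (Fin d → ℝ) => gf (Q z.1) z.2 := by
  unfold gf
  have h1 : Measurable fun w : (X × (Fin d → ℝ)) × (Fin d → ℝ) => Real.exp (-(4 * Real.pi ^ 2) * Q w.1.1 w.2) * Real.cos (2 * Real.pi * (w.1.2 ⬝ᵥ w.2)) := by
    have := hQ.comp (f := fun w : (X × (Fin d → ℝ)) × (Fin d → ℝ) => (w.1.1, w.2)) (by fun_prop)
    simp only [Function.comp_def] at this
    fun_prop
  exact h1.stronglyMeasurable.integral_prod_right'.measurable

end

section

/-- Test functions. -/
structure Ts {d : ℕ} (ρ : (Fin d → ℝ) → ℝ) : Prop where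
  sm : ContDiff ℝ (⊤ : ℕ∞) ρ
  cs : HasCompactSupport ρ

variable {d : ℕ}

lemma Ts.cont {ρ : (Fin d → ℝ) → ℝ} (h : Ts ρ) : Continuous ρ := h.sm.continuous

lemma Ts.diff {ρ : (Fin d → ℝ) → ℝ} (h : Ts ρ) : Differentiable ℝ ρ := h.sm.differentiable (by simp)

lemma Ts.pd {ρ : (Fin d → ℝ) → ℝ} (h : Ts ρ) (i : Fin d) : Ts (pd i ρ) := by
  refine ⟨?_, ?_⟩
  · unfold _root_.pd
    exact (h.sm.fderiv_right (m := (⊤ : ℕ∞)) (by simp)).clm_apply contDiff_const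
  · exact h.cs.fderiv_apply (𝕜 := ℝ) _

lemma Ts.sub {ρ σ : (Fin d → ℝ) → ℝ} (h : Ts ρ) (h' : Ts σ) : Ts (fun x => ρ x - σ x) :=
  ⟨h.sm.sub h'.sm, h.cs.sub h'.cs⟩

lemma Ts.refl {ρ : (Fin d → ℝ) → ℝ} (h : Ts ρ) (y : Fin d → ℝ) : Ts (fun z => ρ (y - z)) := by
  refine ⟨h.sm.comp (contDiff_const.sub contDiff_id), ?_⟩
  exact h.cs.comp_homeomorph (Homeomorph.subLeft y)

lemma pd_refl {ρ : (Fin d → ℝ) → ℝ} (h : Differentiable ℝ ρ) (i : Fin d) (y z : Fin d → ℝ) : pd i (fun z => ρ (y - z)) z = -pd i ρ (y - z) := by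
  unfold pd
  have h1 : HasFDerivAt (fun z => ρ (y - z)) ((fderiv ℝ ρ (y - z)).comp (-(ContinuousLinearMap.id ℝ _))) z :=
    (h (y - z)).hasFDerivAt.comp z ((hasFDerivAt_id z).const_sub y)
  rw [h1.fderiv]; simp

lemma Ts.pd2_refl {ρ : (Fin d → ℝ) → ℝ} (h : Ts ρ) (i j : Fin d) (y z : Fin d → ℝ) :
    _root_.pd i (_root_.pd j (fun z => ρ (y - z))) z = _root_.pd i (_root_.pd j ρ) (y - z) := by
  have e : _root_.pd j (fun z => ρ (y - z)) = fun z => -_root_.pd j ρ (y - z) := by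
    ext z; exact pd_refl h.diff j y z
  rw [e]
  have h2 := pd_refl (h.pd j).diff i y z
  unfold _root_.pd at h2 ⊢
  rw [fderiv_fun_neg]
  simp only [_root_.neg_apply, h2, neg_neg]

lemma Ts.nice {ρ : (Fin d → ℝ) → ℝ} (h : Ts ρ) : Nice volume ρ := by
  refine ⟨h.cont.measurable, h.cont.integrable_of_hasCompactSupport h.cs, ?_⟩
  obtain ⟨C, hC⟩ := h.cs.exists_bound_of_continuous h.cont
  exact ⟨C, hC⟩

/-- Convolution. -/
def cv (h ρ : (Fin d → ℝ) → ℝ) (y : Fin d → ℝ) : ℝ := ∫ z, h z * ρ (y - z)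

lemma nrm_refl (q : ℝ) (ρ : (Fin d → ℝ) → ℝ) (y : Fin d → ℝ) : nrm q (fun z => ρ (y - z)) volume = nrm q ρ volume := by
  unfold nrm
  rw [lintegral_sub_left_eq_self (fun z => ‖ρ z‖ₑ ^ q) y]

/-- The dual norm of a test function. -/
def cn (q : ℝ) (ρ : (Fin d → ℝ) → ℝ) : ℝ := (nrm q ρ volume).toReal

abbrev LpE (d : ℕ) (p : ℝ) := Lp ℝ (ENNReal.ofReal p) (volume : Measure (Fin d → ℝ))

lemma Lp_enorm {p : ℝ} (hp : 0 < p) (h : LpE d p) : nrm p h volume = ‖h‖ₑ := by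
  rw [nrm_eq hp, Lp.enorm_def]

lemma cv_bound {p q : ℝ} (hpq : p.HolderConjugate q) (h : LpE d p) {ρ : (Fin d → ℝ) → ℝ} (hρ : Ts ρ) (y : Fin d → ℝ) :
    |cv h ρ y| ≤ ‖h‖ * cn q ρ := by
  have h1 := holder_enorm hpq (Lp.aestronglyMeasurable h) (hρ.refl y).nice.meas.aestronglyMeasurable
  rw [nrm_refl, Lp_enorm hpq.pos] at h1
  have h2 := (hρ.nice.nrm_lt hpq.symm.lt.le).ne
  have h3 := ENNReal.toReal_mono (ENNReal.mul_ne_top enorm_ne_top h2) h1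
  rw [ENNReal.toReal_mul, toReal_enorm, Lp.enorm_def, ← Lp.norm_def] at h3
  exact h3

lemma Lp_mul_int {p q : ℝ} (hpq : p.HolderConjugate q) (h : LpE d p) {ρ : (Fin d → ℝ) → ℝ} (hρ : Nice volume ρ) : Integrable fun z => h z * ρ z := by
  have h1 : MemLp h (ENNReal.ofReal p) volume := Lp.memLp h
  have h2 : MemLp ρ (ENNReal.ofReal q) volume := hρ.memLp hpq.symm.lt.le
  have := hpq.ennrealOfReal
  exact h1.integrable_mul h2

lemma cv_int {p q : ℝ} (hpq : p.HolderConjugate q) (h : LpE d p) {ρ : (Fin d → ℝ) → ℝ} (hρ : Ts ρ) (y : Fin d → ℝ) : Integrable fun z => h z * ρ (y - z) :=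
  Lp_mul_int hpq h (hρ.refl y).nice

lemma cv_sub {p q : ℝ} (hpq : p.HolderConjugate q) (h h' : LpE d p) {ρ : (Fin d → ℝ) → ℝ} (hρ : Ts ρ) (y : Fin d → ℝ) :
    cv (h - h' : LpE d p) ρ y = cv h ρ y - cv h' ρ y := by
  unfold cv
  rw [← integral_sub (cv_int hpq h hρ y) (cv_int hpq h' hρ y)]
  refine integral_congr_ae ?_
  filter_upwards [Lp.coeFn_sub h h'] with z hz
  rw [hz]; simp [sub_mul]

lemma cv_cont_right {p q : ℝ} (hpq : p.HolderConjugate q) (h : LpE d p) {ρ : (Fin d → ℝ) → ℝ} (hρ : Ts ρ) : Continuous (cv h ρ) := by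
  have hl : LocallyIntegrable h volume := (Lp.memLp h).locallyIntegrable (by
    rw [← ENNReal.ofReal_one]; exact ENNReal.ofReal_le_ofReal hpq.lt.le)
  exact hρ.cs.continuous_convolution_right (ContinuousLinearMap.mul ℝ ℝ) hl hρ.cont

lemma cv_cont {p q : ℝ} (hpq : p.HolderConjugate q) [Fact (1 ≤ ENNReal.ofReal p)] {ρ : (Fin d → ℝ) → ℝ} (hρ : Ts ρ) :
    Continuous fun z : LpE d p × (Fin d → ℝ) => cv z.1 ρ z.2 := by
  refine continuous_prod_of_continuous_lipschitzWith _ (Real.toNNReal (cn q ρ)) (fun h => cv_cont_right hpq h hρ) fun y => ?_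
  refine LipschitzWith.of_dist_le_mul fun h h' => ?_
  rw [dist_eq_norm, ← cv_sub hpq _ _ hρ, dist_eq_norm, mul_comm, Real.coe_toNNReal (cn q ρ) toReal_nonneg]
  exact cv_bound hpq _ hρ y

end

section
variable {d : ℕ}

/-- Phase. -/
def phs (x ξ z : Fin d → ℝ) : ℝ := 2 * Real.pi * ((x - z) ⬝ᵥ ξ)

lemma phs_cont (x ξ : Fin d → ℝ) : Continuous (phs x ξ) := by unfold phs; fun_prop

lemma phs_deriv (x ξ z : Fin d → ℝ) : ∃ L : (Fin d → ℝ) →L[ℝ] ℝ, HasFDerivAt (phs x ξ) L z ∧ ∀ i, L (Pi.single i 1) = -(2 * Real.pi * ξ i) := by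
  have e : phs x ξ = fun z => 2 * Real.pi * ∑ k, (x k - z k) * ξ k := by
    ext z; simp [phs, dotProduct]
  refine ⟨(2 * Real.pi) • ∑ k, ((ξ k) • (-(ContinuousLinearMap.proj (R := ℝ) (φ := fun _ : Fin d => ℝ) k))), ?_, ?_⟩
  · rw [e]
    refine HasFDerivAt.const_mul (HasFDerivAt.fun_sum fun k _ => ?_) _
    exact ((hasFDerivAt_apply k z).const_sub (x k)).mul_const (ξ k)
  · intro i
    simp [Pi.single_apply]

lemma cos_parts {f f' : (Fin d → ℝ) → ℝ} {i : Fin d} (hf : Differentiable ℝ f) (hf' : ∀ z, fderiv ℝ f z (Pi.single i 1) = f' z) (hc : Continuous f')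
    {σ : (Fin d → ℝ) → ℝ} (hσ : Ts σ) : ∫ z, f z * pd i σ z = - ∫ z, f' z * σ z := by
  have h := integral_mul_fderiv_eq_neg_fderiv_mul_of_integrable (μ := (volume : Measure (Fin d → ℝ))) (f := f) (g := σ) (v := Pi.single i 1) ?_ ?_ ?_ (fun z _ => hf z) (fun z _ => hσ.diff z)
  · simp only [hf'] at h
    exact h
  · simp only [hf']
    exact (hc.mul hσ.cont).integrable_of_hasCompactSupport hσ.cs.mul_left
  · exact (hf.continuous.mul (hσ.pd i).cont).integrable_of_hasCompactSupport (hσ.pd i).cs.mul_left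
  · exact (hf.continuous.mul hσ.cont).integrable_of_hasCompactSupport hσ.cs.mul_left

lemma cos_parts2 (i j : Fin d) (x ξ : Fin d → ℝ) {σ : (Fin d → ℝ) → ℝ} (hσ : Ts σ) :
    ∫ z, Real.cos (phs x ξ z) * pd i (pd j σ) z = -(4 * Real.pi ^ 2) * (ξ i * ξ j) * ∫ z, Real.cos (phs x ξ z) * σ z := by
  have hpc := phs_cont x ξ
  rw [cos_parts (f := fun z => Real.cos (phs x ξ z)) (f' := fun z => (2 * Real.pi * ξ i) * Real.sin (phs x ξ z)) (fun z => ?_) (fun z => ?_) (by fun_prop) (hσ.pd j)]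
  · simp only [mul_assoc, integral_const_mul]
    rw [cos_parts (f := fun z => Real.sin (phs x ξ z)) (f' := fun z => -((2 * Real.pi * ξ j) * Real.cos (phs x ξ z))) (fun z => ?_) (fun z => ?_) (by fun_prop) hσ]
    · simp only [neg_mul, integral_neg, mul_assoc, integral_const_mul]; ring
    · obtain ⟨L, hL, -⟩ := phs_deriv x ξ z; exact hL.sin.differentiableAt
    · obtain ⟨L, hL, hL'⟩ := phs_deriv x ξ z; rw [hL.sin.fderiv]; simp [hL']; ring
  · obtain ⟨L, hL, -⟩ := phs_deriv x ξ z; exact hL.cos.differentiableAt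
  · obtain ⟨L, hL, hL'⟩ := phs_deriv x ξ z; rw [hL.cos.fderiv]; simp [hL']; ring

lemma fub_xi {m : (Fin d → ℝ) → ℝ} (hm : Integrable m) {σ : (Fin d → ℝ) → ℝ} (hσ : Integrable σ) (x : Fin d → ℝ) :
    ∫ z, (∫ ξ, m ξ * Real.cos (2 * Real.pi * ((x - z) ⬝ᵥ ξ))) * σ z = ∫ ξ, m ξ * ∫ z, Real.cos (phs x ξ z) * σ z := by
  have hi : Integrable (fun w : (Fin d → ℝ) × (Fin d → ℝ) => m w.2 * Real.cos (2 * Real.pi * ((x - w.1) ⬝ᵥ w.2)) * σ w.1) (volume.prod volume) := by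
    have h1 : Integrable (fun w : (Fin d → ℝ) × (Fin d → ℝ) => σ w.1 * m w.2) (volume.prod volume) := hσ.mul_prod hm
    have h2 := h1.mul_bdd (g := fun w : (Fin d → ℝ) × (Fin d → ℝ) => Real.cos (2 * Real.pi * ((x - w.1) ⬝ᵥ w.2))) (c := 1) (Measurable.aestronglyMeasurable (by fun_prop)) (Filter.Eventually.of_forall fun w => Real.abs_cos_le_one _)
    refine h2.congr (Filter.Eventually.of_forall fun w => ?_)
    simp only; ring
  simp_rw [← integral_mul_const]
  rw [integral_integral_swap (f := fun z ξ => m ξ * Real.cos (2 * Real.pi * ((x - z) ⬝ᵥ ξ)) * σ z) hi]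
  congr 1; ext ξ
  rw [← integral_const_mul]
  congr 1; ext z; simp only [phs]; ring

lemma exp_int {ε : ℝ} (hε : 0 < ε) {Q : (Fin d → ℝ) → ℝ} (hm : Measurable Q) (hQ : ∀ ξ, ε * n2 ξ ≤ Q ξ) : Integrable fun ξ => Real.exp (-(4 * Real.pi ^ 2) * Q ξ) := by
  have := integrable_exp_n2 (d := d) (c := 4 * Real.pi ^ 2 * ε) (by positivity)
  refine this.mono' (Measurable.aestronglyMeasurable (by fun_prop)) (Filter.Eventually.of_forall fun ξ => ?_)
  rw [Real.norm_of_nonneg (Real.exp_pos _).le, Real.exp_le_exp]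
  have h1 := hQ ξ
  have h2 : 0 ≤ 4 * Real.pi ^ 2 := by positivity
  nlinarith

lemma parts_ts (i j : Fin d) {ε : ℝ} (hε : 0 < ε) {Q : (Fin d → ℝ) → ℝ} (hm : Measurable Q) (hQ : ∀ ξ, ε * n2 ξ ≤ Q ξ) {σ : (Fin d → ℝ) → ℝ} (hσ : Ts σ) (x : Fin d → ℝ) :
    ∫ z, kf i j Q (x - z) * σ z = ∫ z, gf Q (x - z) * pd i (pd j σ) z := by
  have h1 := fub_xi (mq_int i j hε hm hQ) hσ.nice.int x
  have h2 := fub_xi (exp_int hε hm hQ) ((hσ.pd j).pd i).nice.int x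
  unfold kf gf
  unfold mq at h1
  rw [h1, h2]
  congr 1; ext ξ
  rw [cos_parts2 i j x ξ hσ]; ring

lemma cv_fub {p q : ℝ} (hpq : p.HolderConjugate q) (h : LpE d p) {ρ : (Fin d → ℝ) → ℝ} (hρ : Ts ρ) {κ : (Fin d → ℝ) → ℝ} (hκ : Integrable κ) (hκm : Measurable κ) :
    ∫ z, κ z * cv h ρ z = ∫ y, h y * ∫ z, κ z * ρ (z - y) := by
  have hh : Measurable h := (Lp.stronglyMeasurable h).measurable
  have hρm := hρ.nice.meas
  have hi : Integrable (fun w : (Fin d → ℝ) × (Fin d → ℝ) => κ w.1 * (h w.2 * ρ (w.1 - w.2))) (volume.prod volume) := by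
    rw [integrable_prod_iff (Measurable.aestronglyMeasurable (by fun_prop))]
    refine ⟨Filter.Eventually.of_forall fun z => (cv_int hpq h hρ z).const_mul (κ z), ?_⟩
    have hb : ∀ z, ∫ y, ‖h y * ρ (z - y)‖ ≤ ‖h‖ * cn q ρ := fun z => by
      have h1 := holder_enorm (μ := volume) hpq (F := fun y => ‖h y‖) (G := fun y => ‖ρ (z - y)‖) (Measurable.aestronglyMeasurable (by fun_prop)) (Measurable.aestronglyMeasurable (by fun_prop))
      have e1 : nrm p (fun y => ‖h y‖) volume = ‖h‖ₑ := by rw [← Lp_enorm hpq.pos]; unfold nrm; simp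
      have e2 : nrm q (fun y => ‖ρ (z - y)‖) volume = nrm q ρ volume := by rw [← nrm_refl q ρ z]; unfold nrm; simp
      rw [e1, e2] at h1
      have h2 := (hρ.nice.nrm_lt hpq.symm.lt.le).ne
      have h3 := ENNReal.toReal_mono (ENNReal.mul_ne_top enorm_ne_top h2) h1
      rw [ENNReal.toReal_mul, toReal_enorm, Lp.enorm_def, ← Lp.norm_def] at h3
      simp only [norm_mul]
      exact (Real.le_norm_self _).trans h3
    refine (hκ.norm.mul_const (‖h‖ * cn q ρ)).mono' ?_ (Filter.Eventually.of_forall fun z => ?_)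
    · have hmm : Measurable fun w : (Fin d → ℝ) × (Fin d → ℝ) => ‖κ w.1 * (h w.2 * ρ (w.1 - w.2))‖ := by fun_prop
      exact hmm.stronglyMeasurable.integral_prod_right'.aestronglyMeasurable
    · simp only [norm_mul (κ z)]
      rw [integral_const_mul, Real.norm_of_nonneg (mul_nonneg (norm_nonneg _) (integral_nonneg fun _ => norm_nonneg _))]
      exact mul_le_mul_of_nonneg_left (hb z) (norm_nonneg _)
  unfold cv
  simp_rw [← integral_const_mul]
  rw [integral_integral_swap (f := fun z y => κ z * (h y * ρ (z - y))) hi]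
  congr 1; ext y; congr 1; ext z; ring

lemma pd_trans (ρ : (Fin d → ℝ) → ℝ) (i : Fin d) (y z : Fin d → ℝ) : pd i (fun z => ρ (z - y)) z = pd i ρ (z - y) := by
  unfold pd
  rw [fderiv_comp_sub y]

lemma Ts.trans {ρ : (Fin d → ℝ) → ℝ} (h : Ts ρ) (y : Fin d → ℝ) : Ts (fun z => ρ (z - y)) :=
  ⟨h.sm.comp (contDiff_id.sub contDiff_const), h.cs.comp_homeomorph (Homeomorph.subRight y)⟩

lemma measurable_kf (i j : Fin d) {Q : (Fin d → ℝ) → ℝ} (hQ : Measurable Q) : Measurable (kf i j Q) := by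
  have := measurable_kfQ i j (X := Unit) (Q := fun _ => Q) (by fun_prop)
  exact this.comp (f := fun x => ((), x)) (by fun_prop)

lemma int_of_lint {X : Type*} [MeasurableSpace X] {μ : Measure X} {κ : X → ℝ} (hm : Measurable κ) {C : ℝ≥0∞} (hC : C ≠ ⊤) (h : ∫⁻ x, ‖κ x‖ₑ ∂μ ≤ C) : Integrable κ μ :=
  ⟨hm.aestronglyMeasurable, lt_of_le_of_lt h hC.lt_top⟩

/-- Integration by parts on the convolution. -/
lemma parts_cv {p q : ℝ} (hpq : p.HolderConjugate q) (h : LpE d p) {ρ : (Fin d → ℝ) → ℝ} (hρ : Ts ρ) (i j : Fin d) {ε : ℝ} (hε : 0 < ε) {Q : (Fin d → ℝ) → ℝ} (hm : Measurable Q) (hQ : ∀ ξ, ε * n2 ξ ≤ Q ξ)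
    (hk : Integrable (kf i j Q)) (hg : Integrable (gf Q)) (x : Fin d → ℝ) :
    ∫ z, kf i j Q (x - z) * cv h ρ z = ∫ z, gf Q (x - z) * cv h (pd i (pd j ρ)) z := by
  have m1 := measurable_kf i j hm
  have m2 := measurable_gf hm
  rw [cv_fub hpq h hρ (hk.comp_sub_left x) (by fun_prop), cv_fub hpq h ((hρ.pd j).pd i) (hg.comp_sub_left x) (by fun_prop)]
  congr 1; ext y; congr 1
  rw [parts_ts i j hε hm hQ (hρ.trans y)]
  congr 1; ext z; congr 1
  have e : pd j (fun z => ρ (z - y)) = fun z => pd j ρ (z - y) := by ext z; exact pd_trans ρ j y z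
  rw [e, pd_trans]

end

section
variable {d : ℕ}

lemma ac_exp {g : ℝ → ℝ} {a b : ℝ} (hg : AbsolutelyContinuousOnInterval g a b) : AbsolutelyContinuousOnInterval (fun r => Real.exp (g r)) a b := by
  obtain ⟨C, hC⟩ := hg.exists_bound
  have hl : ∀ x ∈ uIcc a b, ∀ y ∈ uIcc a b, dist (Real.exp (g x)) (Real.exp (g y)) ≤ Real.exp C * dist (g x) (g y) := by
    intro x hx y hy
    have h1 : ∀ s ∈ Iic C, HasDerivWithinAt Real.exp (Real.exp s) (Iic C) s := fun s _ => (Real.hasDerivAt_exp s).hasDerivWithinAt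
    have h2 := (convex_Iic C).norm_image_sub_le_of_norm_hasDerivWithin_le (C := Real.exp C) h1 (fun s hs => by
      rw [Real.norm_of_nonneg (Real.exp_pos s).le]; exact Real.exp_le_exp.2 hs) (x := g y) (y := g x) ((Real.le_norm_self _).trans (hC y hy)) ((Real.le_norm_self _).trans (hC x hx))
    simpa [dist_eq_norm] using h2
  rw [absolutelyContinuousOnInterval_iff] at hg ⊢
  intro ε hε
  obtain ⟨δ, hδ, h⟩ := hg (ε / Real.exp C) (by positivity)
  refine ⟨δ, hδ, fun E hE hs => ?_⟩
  have h1 := h E hE hs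
  rw [lt_div_iff₀ (Real.exp_pos C), Finset.sum_mul] at h1
  refine lt_of_le_of_lt (Finset.sum_le_sum fun i hi => ?_) h1
  rw [mul_comm]
  have h3 := hE.1 i hi
  exact hl _ h3.1 _ h3.2

lemma ac_duh {b v : ℝ → ℝ} {t : ℝ} (hb : IntervalIntegrable b volume 0 t) (hv : IntervalIntegrable v volume 0 t) (κ c : ℝ) :
    Real.exp (κ * (∫ s in (0:ℝ)..t, b s) + c) * (∫ s in (0:ℝ)..t, v s) =
      ∫ r in (0:ℝ)..t, ((κ * b r) * Real.exp (κ * (∫ s in (0:ℝ)..r, b s) + c) * (∫ s in (0:ℝ)..r, v s) + Real.exp (κ * (∫ s in (0:ℝ)..r, b s) + c) * v r) := by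
  have h1 := hb.absolutelyContinuousOnInterval_intervalIntegral (c := 0) (by simp)
  have h2 := hv.absolutelyContinuousOnInterval_intervalIntegral (c := 0) (by simp)
  have hc : AbsolutelyContinuousOnInterval (fun _ : ℝ => c) 0 t :=
    ((LipschitzWith.const c).lipschitzOnWith (s := uIcc 0 t)).absolutelyContinuousOnInterval
  have h3 : AbsolutelyContinuousOnInterval (fun r => κ * (∫ s in (0:ℝ)..r, b s) + c) 0 t := (h1.const_mul κ).add hc
  have h4 := ac_exp h3
  have h5 := h4.integral_deriv_mul_eq_sub h2
  simp only [intervalIntegral.integral_same, mul_zero, sub_zero] at h5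
  rw [← h5]
  refine intervalIntegral.integral_congr_ae ?_
  filter_upwards [hb.ae_hasDerivAt_integral, hv.ae_hasDerivAt_integral] with r hr1 hr2 hr
  have hr' := uIoc_subset_uIcc hr
  have d1 := hr1 hr' 0 (by simp)
  have d2 := hr2 hr' 0 (by simp)
  rw [d2.deriv, ((d1.const_mul κ).add_const c).exp.deriv]
  ring

lemma int_L1 {X : Type*} [MeasurableSpace X] {μ : Measure X} [SFinite μ] {κ w : X → (Fin d → ℝ) → ℝ}
    (hκ : Measurable fun y : X × (Fin d → ℝ) => κ y.1 y.2) (hw : Measurable fun y : X × (Fin d → ℝ) => w y.1 y.2) {C : ℝ≥0∞} (hC0 : C ≠ ⊤)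
    (hC : ∀ᵐ r ∂μ, ∫⁻ z, ‖κ r z‖ₑ ≤ C) {W : X → ℝ} (hW : Integrable W μ) (hwW : ∀ᵐ r ∂μ, ∀ z, |w r z| ≤ W r) :
    Integrable (fun y : X × (Fin d → ℝ) => κ y.1 y.2 * w y.1 y.2) (μ.prod volume) := by
  refine ⟨(hκ.mul hw).aestronglyMeasurable, ?_⟩
  unfold HasFiniteIntegral
  rw [lintegral_prod _ (by fun_prop)]
  have hWl : ∫⁻ r, ‖W r‖ₑ ∂μ < ⊤ := hW.2
  calc ∫⁻ r, (∫⁻ z, ‖κ r z * w r z‖ₑ) ∂μ ≤ ∫⁻ r, C * ‖W r‖ₑ ∂μ := by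
        refine lintegral_mono_ae ?_
        filter_upwards [hC, hwW] with r h1 h2
        calc ∫⁻ z, ‖κ r z * w r z‖ₑ ≤ ∫⁻ z, ‖κ r z‖ₑ * ‖W r‖ₑ := by
              refine lintegral_mono fun z => ?_
              rw [enorm_mul]
              refine mul_le_mul_right ?_ _
              rw [← ofReal_norm, ← ofReal_norm]
              exact ENNReal.ofReal_le_ofReal ((h2 z).trans (Real.le_norm_self _))
          _ = (∫⁻ z, ‖κ r z‖ₑ) * ‖W r‖ₑ := lintegral_mul_const' _ _ enorm_ne_top
          _ ≤ C * ‖W r‖ₑ := mul_le_mul_left h1 _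
    _ = C * ∫⁻ r, ‖W r‖ₑ ∂μ := lintegral_const_mul' _ _ hC0
    _ < ⊤ := ENNReal.mul_lt_top hC0.lt_top hWl

end

section
variable {d : ℕ} {T p q : ℝ} {A : ℝ → Fin d → Fin d → ℝ} {δ : ℝ → ℝ}

/-- Cleaned-up solution. -/
structure Sol {d : ℕ} (T p : ℝ) [Fact (1 ≤ ENNReal.ofReal p)] (A : ℝ → Fin d → Fin d → ℝ) (f u : ℝ → LpE d p) : Prop where
  fm : StronglyMeasurable f
  fint : Integrable fun t => ‖f t‖
  uc : Continuous u
  ub : ∃ M, ∀ t, ‖u t‖ ≤ M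
  eq : ∀ φ : (Fin d → ℝ) → ℝ, Ts φ → ∀ t ∈ Icc 0 T, (∫ x, u t x * φ x) =
    ∫ s in Ioc (0:ℝ) t, ((∑ i, ∑ j, A s i j * ∫ x, u s x * pd i (pd j φ) x) + ∫ x, f s x * φ x)

variable [Fact (1 ≤ ENNReal.ofReal p)] {f u : ℝ → LpE d p}

lemma Sol.cvu (h : Sol T p A f u) (hpq : p.HolderConjugate q) {ρ : (Fin d → ℝ) → ℝ} (hρ : Ts ρ) : Continuous fun y : ℝ × (Fin d → ℝ) => cv (u y.1) ρ y.2 :=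
  (cv_cont hpq hρ).comp ((h.uc.comp continuous_fst).prodMk continuous_snd)

lemma Sol.cvf (h : Sol T p A f u) (hpq : p.HolderConjugate q) {ρ : (Fin d → ℝ) → ℝ} (hρ : Ts ρ) : Measurable fun y : ℝ × (Fin d → ℝ) => cv (f y.1) ρ y.2 := by
  have h1 : StronglyMeasurable fun y : ℝ × (Fin d → ℝ) => (f y.1, y.2) := (h.fm.comp_measurable measurable_fst).prodMk measurable_snd.stronglyMeasurable
  exact ((cv_cont hpq hρ).comp_stronglyMeasurable h1).measurable

/-- Right-hand side of the mollified equation. -/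
def vv (A : ℝ → Fin d → Fin d → ℝ) (f u : ℝ → LpE d p) (ρ : (Fin d → ℝ) → ℝ) (z : Fin d → ℝ) (s : ℝ) : ℝ :=
  (∑ i, ∑ j, A s i j * cv (u s) (pd i (pd j ρ)) z) + cv (f s) ρ z

lemma cn_nonneg (q : ℝ) (ρ : (Fin d → ℝ) → ℝ) : 0 ≤ cn q ρ := toReal_nonneg

lemma Sol.ubd (h : Sol T p A f u) (hpq : p.HolderConjugate q) {ρ : (Fin d → ℝ) → ℝ} (hρ : Ts ρ) : ∃ M, 0 ≤ M ∧ ∀ s z, |cv (u s) ρ z| ≤ M := by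
  obtain ⟨M, hM⟩ := h.ub
  exact ⟨M * cn q ρ, mul_nonneg ((norm_nonneg (u 0)).trans (hM 0)) (cn_nonneg q ρ),
    fun s z => (cv_bound hpq (u s) hρ z).trans (mul_le_mul_of_nonneg_right (hM s) (cn_nonneg q ρ))⟩

lemma Sol.fbd (_h : Sol T p A f u) (hpq : p.HolderConjugate q) {ρ : (Fin d → ℝ) → ℝ} (hρ : Ts ρ) (s : ℝ) (z : Fin d → ℝ) : |cv (f s) ρ z| ≤ ‖f s‖ * cn q ρ :=
  cv_bound hpq (f s) hρ z

lemma Sol.fii (h : Sol T p A f u) (hpq : p.HolderConjugate q) {ρ : (Fin d → ℝ) → ℝ} (hρ : Ts ρ) (z : Fin d → ℝ) : Integrable fun s => cv (f s) ρ z := by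
  refine (h.fint.mul_const (cn q ρ)).mono' ?_ (Filter.Eventually.of_forall fun s => h.fbd hpq hρ s z)
  exact ((h.cvf hpq hρ).comp (f := fun s => (s, z)) (by fun_prop)).aestronglyMeasurable

lemma Sol.uii (h : Sol T p A f u) (hA : Cf T A δ) (hpq : p.HolderConjugate q) {ρ : (Fin d → ℝ) → ℝ} (hρ : Ts ρ) (i j : Fin d) (z : Fin d → ℝ) (a b : ℝ) :
    IntervalIntegrable (fun s => A s i j * cv (u s) ρ z) volume a b :=
  (hA.aii i j a b).mul_continuousOn ((h.cvu hpq hρ).comp (f := fun s => (s, z)) (by fun_prop)).continuousOn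

lemma Sol.vii (h : Sol T p A f u) (hA : Cf T A δ) (hpq : p.HolderConjugate q) {ρ : (Fin d → ℝ) → ℝ} (hρ : Ts ρ) (z : Fin d → ℝ) (a b : ℝ) :
    IntervalIntegrable (vv A f u ρ z) volume a b := by
  unfold vv
  exact (ii_sum fun i _ => ii_sum fun j _ => h.uii hA hpq ((hρ.pd j).pd i) i j z a b).add (h.fii hpq hρ z).intervalIntegrable

lemma Sol.ueq (h : Sol T p A f u) {ρ : (Fin d → ℝ) → ℝ} (hρ : Ts ρ) (z : Fin d → ℝ) {t : ℝ} (ht : t ∈ Icc 0 T) :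
    cv (u t) ρ z = ∫ s in (0:ℝ)..t, vv A f u ρ z s := by
  have := h.eq _ (hρ.refl z) t ht
  simp only [hρ.pd2_refl] at this
  rw [intervalIntegral.integral_of_le ht.1]
  exact this

lemma QA_exp (A : ℝ → Fin d → Fin d → ℝ) (ε t r : ℝ) (ξ : Fin d → ℝ) : -(4 * Real.pi ^ 2) * QA A ε r t ξ = 4 * Real.pi ^ 2 * qf (IA A r) ξ + (-(4 * Real.pi ^ 2) * (ε * n2 ξ + qf (IA A t) ξ)) := by
  unfold QA; ring

lemma qf_IA (hA : Cf T A δ) (r : ℝ) (ξ : Fin d → ℝ) : qf (IA A r) ξ = ∫ s in (0:ℝ)..r, qf (A s) ξ := by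
  rw [← hA.qf_IA_sub]
  have : qf (IA A 0) ξ = 0 := by simp [qf, IA]
  rw [this, sub_zero]

/-- Duhamel on the Fourier side, pointwise in the space variable. -/
lemma Sol.duh_xi (h : Sol T p A f u) (hA : Cf T A δ) (hpq : p.HolderConjugate q) {ρ : (Fin d → ℝ) → ℝ} (hρ : Ts ρ) (ε : ℝ) {t : ℝ} (ht : t ∈ Icc 0 T) (z ξ : Fin d → ℝ) :
    Real.exp (-(4 * Real.pi ^ 2) * QA A ε t t ξ) * cv (u t) ρ z = ∫ r in Ioc 0 t, ((-∑ k, ∑ l, A r k l * mq k l (QA A ε r t) ξ * cv (u r) ρ z) + Real.exp (-(4 * Real.pi ^ 2) * QA A ε r t ξ) * vv A f u ρ z r) := by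
  have h1 := ac_duh (hA.qfA_int ξ 0 t) (h.vii hA hpq hρ z 0 t) (4 * Real.pi ^ 2) (-(4 * Real.pi ^ 2) * (ε * n2 ξ + qf (IA A t) ξ))
  simp only [← qf_IA hA, ← QA_exp] at h1
  rw [h.ueq hρ z ht, h1, intervalIntegral.integral_of_le ht.1]
  refine setIntegral_congr_fun measurableSet_Ioc fun r hr => ?_
  have hr' : r ∈ Icc 0 T := ⟨hr.1.le, hr.2.trans ht.2⟩
  simp only [← h.ueq hρ z hr']
  congr 1
  unfold mq qf
  simp only [Finset.mul_sum, Finset.sum_mul, ← Finset.sum_neg_distrib]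
  refine Finset.sum_congr rfl fun k _ => Finset.sum_congr rfl fun l _ => ?_
  ring

end

section
variable {d : ℕ} {T p q : ℝ} {A : ℝ → Fin d → Fin d → ℝ} {δ : ℝ → ℝ}
variable [Fact (1 ≤ ENNReal.ofReal p)] {f u : ℝ → LpE d p}

lemma int_piece {X : Type*} [MeasurableSpace X] {μ : Measure X} [SFinite μ] {g : X → ℝ} (hg : Integrable g μ) {b : (Fin d → ℝ) → ℝ} (hb : Integrable b)
    {F : (Fin d → ℝ) × X → ℝ} (hF : Measurable F) (h : ∀ᵐ r ∂μ, ∀ ξ, |F (ξ, r)| ≤ b ξ * g r) : Integrable F (volume.prod μ) := by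
  refine (hb.mul_prod hg).mono' hF.aestronglyMeasurable ?_
  have : ∀ᵐ y ∂((volume : Measure (Fin d → ℝ)).prod μ), ∀ ξ, |F (ξ, y.2)| ≤ b ξ * g y.2 := Measure.quasiMeasurePreserving_snd.ae h
  filter_upwards [this] with y hy
  exact hy y.1

lemma Cf.QA_meas1 (hA : Cf T A δ) (ε t : ℝ) : Measurable fun y : ℝ × (Fin d → ℝ) => QA A ε y.1 t y.2 :=
  (hA.QA_meas ε).comp (f := fun y : ℝ × (Fin d → ℝ) => ((y.1, t), y.2)) (by fun_prop)

lemma Cf.QA_meas0 (hA : Cf T A δ) (ε r t : ℝ) : Measurable (QA A ε r t) :=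
  (hA.QA_meas ε).comp (f := fun y : (Fin d → ℝ) => ((r, t), y)) (by fun_prop)

lemma Cf.kf_meas1 (hA : Cf T A δ) (k l : Fin d) (ε t : ℝ) (x : Fin d → ℝ) : Measurable fun y : ℝ × (Fin d → ℝ) => kf k l (QA A ε y.1 t) (x - y.2) :=
  (measurable_kfQ k l (Q := fun r => QA A ε r t) (hA.QA_meas1 ε t)).comp (f := fun y : ℝ × (Fin d → ℝ) => (y.1, x - y.2)) (by fun_prop)

lemma Cf.gf_meas1 (hA : Cf T A δ) (ε t : ℝ) (x : Fin d → ℝ) : Measurable fun y : ℝ × (Fin d → ℝ) => gf (QA A ε y.1 t) (x - y.2) :=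
  (measurable_gfQ (Q := fun r => QA A ε r t) (hA.QA_meas1 ε t)).comp (f := fun y : ℝ × (Fin d → ℝ) => (y.1, x - y.2)) (by fun_prop)

lemma Sol.vv_meas (h : Sol T p A f u) (hA : Cf T A δ) (hpq : p.HolderConjugate q) {ρ : (Fin d → ℝ) → ℝ} (hρ : Ts ρ) :
    Measurable fun y : ℝ × (Fin d → ℝ) => vv A f u ρ y.2 y.1 := by
  unfold vv
  have h1 := h.cvf hpq hρ
  have h2 : ∀ i j, Measurable fun y : ℝ × (Fin d → ℝ) => cv (u y.1) (pd i (pd j ρ)) y.2 := fun i j => (h.cvu hpq ((hρ.pd j).pd i)).measurable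
  have h3 := hA.am
  refine Measurable.add (Finset.measurable_sum _ fun i _ => Finset.measurable_sum _ fun j _ => ?_) h1
  exact ((h3 i j).comp measurable_fst).mul (h2 i j)

lemma mem_Ioc_ae (t : ℝ) : ∀ᵐ r ∂(volume.restrict (Ioc (0:ℝ) t)), r ∈ Ioc 0 t := ae_restrict_mem measurableSet_Ioc

set_option maxHeartbeats 1000000 in
/-- Duhamel, pointwise in `x` and `z`. -/
lemma Sol.duh_z (h : Sol T p A f u) (hA : Cf T A δ) (hpq : p.HolderConjugate q) {ρ : (Fin d → ℝ) → ℝ} (hρ : Ts ρ) {ε : ℝ} (hε : 0 < ε) {t : ℝ} (ht : t ∈ Icc 0 T) (x z : Fin d → ℝ) :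
    gf (QA A ε t t) (x - z) * cv (u t) ρ z = ∫ r in Ioc 0 t, ((-∑ k, ∑ l, A r k l * (kf k l (QA A ε r t) (x - z) * cv (u r) ρ z)) + gf (QA A ε r t) (x - z) * vv A f u ρ z r) := by
  obtain ⟨M, hM0, hM⟩ := h.ubd hpq hρ
  have hum : Measurable fun r => cv (u r) ρ z := ((h.cvu hpq hρ).comp (f := fun s => (s, z)) (by fun_prop)).measurable
  have hvm : Measurable fun r => vv A f u ρ z r := (h.vv_meas hA hpq hρ).comp (f := fun s => (s, z)) (by fun_prop)
  have hvi : Integrable (vv A f u ρ z) (volume.restrict (Ioc 0 t)) := (intervalIntegrable_iff_integrableOn_Ioc_of_le ht.1).1 (h.vii hA hpq hρ z 0 t)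
  have hai : ∀ k l, Integrable (fun s => A s k l) (volume.restrict (Ioc 0 t)) := fun k l => (intervalIntegrable_iff_integrableOn_Ioc_of_le ht.1).1 (hA.aii k l 0 t)
  have hQm : Measurable fun y : (Fin d → ℝ) × ℝ => QA A ε y.2 t y.1 := (hA.QA_meas1 ε t).comp measurable_swap
  set cs : (Fin d → ℝ) → ℝ := fun ξ => Real.cos (2 * Real.pi * ((x - z) ⬝ᵥ ξ)) with hcs
  have hcsm : Measurable cs := by rw [hcs]; fun_prop
  have hcs1 : ∀ ξ, |cs ξ| ≤ 1 := fun ξ => Real.abs_cos_le_one _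
  -- integrability of the pieces
  have I1 : ∀ k l, Integrable (fun y : (Fin d → ℝ) × ℝ => A y.2 k l * mq k l (QA A ε y.2 t) y.1 * cv (u y.2) ρ z * cs y.1) (volume.prod (volume.restrict (Ioc 0 t))) := by
    intro k l
    refine int_piece ((hai k l).norm.const_mul M) (mb_int (d := d) hε) ?_ ?_
    · have m1 : Measurable fun y : (Fin d → ℝ) × ℝ => A y.2 k l := (hA.am k l).comp measurable_snd
      have m2 : Measurable fun y : (Fin d → ℝ) × ℝ => cv (u y.2) ρ z := hum.comp measurable_snd
      have m3 : Measurable fun y : (Fin d → ℝ) × ℝ => mq k l (QA A ε y.2 t) y.1 := by unfold mq; fun_prop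
      exact ((m1.mul m3).mul m2).mul (hcsm.comp measurable_fst)
    · filter_upwards [mem_Ioc_ae t] with r hr ξ
      simp only [abs_mul]
      have e1 := mq_le k l (hA.QA_lb ε hr.2) ξ
      have e2 := hM r z
      have e3 := hcs1 ξ
      have e4 := mb_nonneg ε ξ
      calc |A r k l| * |mq k l (QA A ε r t) ξ| * |cv (u r) ρ z| * |cs ξ| ≤ |A r k l| * mb ε ξ * M * 1 := by gcongr
        _ = _ := by rw [Real.norm_eq_abs]; ring
  have I2 : Integrable (fun y : (Fin d → ℝ) × ℝ => Real.exp (-(4 * Real.pi ^ 2) * QA A ε y.2 t y.1) * vv A f u ρ z y.2 * cs y.1) (volume.prod (volume.restrict (Ioc 0 t))) := by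
    refine int_piece hvi.norm (integrable_exp_n2 (d := d) (c := 4 * Real.pi ^ 2 * ε) (by positivity)) ?_ ?_
    · fun_prop
    · filter_upwards [mem_Ioc_ae t] with r hr ξ
      simp only [abs_mul]
      have e1 := hA.QA_lb ε hr.2 ξ
      have e3 := hcs1 ξ
      rw [Real.abs_exp, Real.norm_eq_abs]
      have e5 : Real.exp (-(4 * Real.pi ^ 2) * QA A ε r t ξ) ≤ Real.exp (-(4 * Real.pi ^ 2 * ε) * n2 ξ) := by
        rw [Real.exp_le_exp]
        have hpi : 0 ≤ 4 * Real.pi ^ 2 := by positivity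
        nlinarith [mul_le_mul_of_nonneg_left e1 hpi]
      calc _ ≤ Real.exp (-(4 * Real.pi ^ 2 * ε) * n2 ξ) * |vv A f u ρ z r| * 1 := by gcongr
        _ = _ := by ring
  have I3 := (integrable_finsetSum Finset.univ fun k _ => integrable_finsetSum Finset.univ fun l _ => I1 k l).neg.add I2
  have e0 : gf (QA A ε t t) (x - z) * cv (u t) ρ z = ∫ ξ, ∫ r in Ioc 0 t, ((-∑ k, ∑ l, A r k l * mq k l (QA A ε r t) ξ * cv (u r) ρ z * cs ξ) + Real.exp (-(4 * Real.pi ^ 2) * QA A ε r t ξ) * vv A f u ρ z r * cs ξ) := by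
    unfold gf
    rw [← integral_mul_const]
    congr 1
    ext ξ
    have := h.duh_xi hA hpq hρ ε ht z ξ
    calc _ = (Real.exp (-(4 * Real.pi ^ 2) * QA A ε t t ξ) * cv (u t) ρ z) * cs ξ := by rw [hcs]; ring
      _ = _ := by
        rw [this, ← integral_mul_const]
        congr 1
        ext r
        simp only [add_mul, neg_mul, Finset.sum_mul]
  rw [e0, integral_integral_swap]
  swap
  · refine I3.congr (Filter.Eventually.of_forall fun y => ?_)
    simp only [Function.uncurry_def, Pi.add_apply, Pi.neg_apply]
  refine setIntegral_congr_fun measurableSet_Ioc fun r hr => ?_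
  have J1 : ∀ k l, Integrable fun ξ => A r k l * mq k l (QA A ε r t) ξ * cv (u r) ρ z * cs ξ := by
    intro k l
    have := (((mq_int k l hε (hA.QA_meas0 ε r t) (hA.QA_lb ε hr.2)).const_mul (A r k l)).mul_const (cv (u r) ρ z))
    exact this.mul_bdd (g := cs) (c := 1) hcsm.aestronglyMeasurable (Filter.Eventually.of_forall hcs1)
  have J2 : Integrable fun ξ => Real.exp (-(4 * Real.pi ^ 2) * QA A ε r t ξ) * vv A f u ρ z r * cs ξ := by
    have := (exp_int hε (hA.QA_meas0 ε r t) (hA.QA_lb ε hr.2)).mul_const (vv A f u ρ z r)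
    exact this.mul_bdd (g := cs) (c := 1) hcsm.aestronglyMeasurable (Filter.Eventually.of_forall hcs1)
  have J3 : Integrable fun ξ => -∑ k, ∑ l, A r k l * mq k l (QA A ε r t) ξ * cv (u r) ρ z * cs ξ :=
    (integrable_finsetSum Finset.univ fun k _ => integrable_finsetSum Finset.univ fun l _ => J1 k l).neg
  rw [integral_add J3 J2, integral_neg, integral_finsetSum _ (fun k _ => integrable_finsetSum Finset.univ fun l _ => J1 k l)]
  congr 1
  · congr 1
    refine Finset.sum_congr rfl fun k _ => ?_
    rw [integral_finsetSum _ (fun l _ => J1 k l)]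
    refine Finset.sum_congr rfl fun l _ => ?_
    unfold kf
    rw [← integral_mul_const, ← integral_const_mul]
    congr 1
    ext ξ
    unfold mq
    rw [hcs]; ring
  · unfold gf
    rw [← integral_mul_const]
    congr 1
    ext ξ
    rw [hcs]; ring

end

section
variable {d : ℕ} {T p q : ℝ} {A : ℝ → Fin d → Fin d → ℝ} {δ : ℝ → ℝ}
variable [Fact (1 ≤ ENNReal.ofReal p)] {f u : ℝ → LpE d p}

lemma Cf.kf_L1x (hA : Cf T A δ) (k l : Fin d) {ε : ℝ} (hε : 0 < ε) {r t : ℝ} (hr : r ≤ t) (x : Fin d → ℝ) :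
    ∫⁻ z, ‖kf k l (QA A ε r t) (x - z)‖ₑ ≤ ENNReal.ofReal (hc1 d / ε) := by
  rw [lintegral_sub_left_eq_self (fun z => ‖kf k l (QA A ε r t) z‖ₑ) x]
  exact hA.kf_QA_L1 k l hε hr

lemma Cf.gf_L1x (hA : Cf T A δ) {ε : ℝ} (hε : 0 < ε) {r t : ℝ} (hr : r ≤ t) (x : Fin d → ℝ) :
    ∫⁻ z, ‖gf (QA A ε r t) (x - z)‖ₑ ≤ 1 := by
  rw [lintegral_sub_left_eq_self (fun z => ‖gf (QA A ε r t) z‖ₑ) x]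
  exact hA.gf_QA_L1 hε hr

lemma Cf.kf_int (hA : Cf T A δ) (k l : Fin d) {ε : ℝ} (hε : 0 < ε) {r t : ℝ} (hr : r ≤ t) : Integrable (kf k l (QA A ε r t)) :=
  int_of_lint (measurable_kf k l (hA.QA_meas0 ε r t)) ofReal_ne_top (hA.kf_QA_L1 k l hε hr)

lemma Cf.gf_int (hA : Cf T A δ) {ε : ℝ} (hε : 0 < ε) {r t : ℝ} (hr : r ≤ t) : Integrable (gf (QA A ε r t)) :=
  int_of_lint (measurable_gf (hA.QA_meas0 ε r t)) one_ne_top (hA.gf_QA_L1 hε hr)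

lemma cvm (hpq : p.HolderConjugate q) (h : LpE d p) {ρ : (Fin d → ℝ) → ℝ} (hρ : Ts ρ) : Measurable (cv h ρ) :=
  ((cv_cont hpq hρ).comp (f := fun z => (h, z)) (by fun_prop)).measurable

lemma conv_int (hpq : p.HolderConjugate q) (h : LpE d p) {ρ : (Fin d → ℝ) → ℝ} (hρ : Ts ρ) {κ : (Fin d → ℝ) → ℝ} (hκ : Integrable κ) (x : Fin d → ℝ) :
    Integrable fun z => κ (x - z) * cv h ρ z :=
  (hκ.comp_sub_left x).mul_bdd (c := ‖h‖ * cn q ρ) (cvm hpq h hρ).aestronglyMeasurable (Filter.Eventually.of_forall fun z => cv_bound hpq h hρ z)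

/-- Duhamel formula, smoothed. -/
lemma Sol.duh (h : Sol T p A f u) (hA : Cf T A δ) (hpq : p.HolderConjugate q) {ρ : (Fin d → ℝ) → ℝ} (hρ : Ts ρ) {ε : ℝ} (hε : 0 < ε) {t : ℝ} (ht : t ∈ Icc 0 T) (x : Fin d → ℝ) :
    ∫ z, gf (QA A ε t t) (x - z) * cv (u t) ρ z = ∫ r in Ioc 0 t, ∫ z, gf (QA A ε r t) (x - z) * cv (f r) ρ z := by
  obtain ⟨M, hM0, hM⟩ := h.ubd hpq hρ
  choose M2 hM20 hM2 using fun k l => h.ubd hpq ((hρ.pd l).pd k)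
  have hai : ∀ k l, Integrable (fun s => A s k l) (volume.restrict (Ioc 0 t)) := fun k l => (intervalIntegrable_iff_integrableOn_Ioc_of_le ht.1).1 (hA.aii k l 0 t)
  have hum := (h.cvu hpq hρ).measurable
  have hvm := h.vv_meas hA hpq hρ
  have I1 : ∀ k l, Integrable (fun y : ℝ × (Fin d → ℝ) => A y.1 k l * (kf k l (QA A ε y.1 t) (x - y.2) * cv (u y.1) ρ y.2)) ((volume.restrict (Ioc 0 t)).prod volume) := by
    intro k l
    have m1 : Measurable fun y : ℝ × (Fin d → ℝ) => A y.1 k l := (hA.am k l).comp measurable_fst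
    have := int_L1 (μ := volume.restrict (Ioc 0 t)) (κ := fun r z => kf k l (QA A ε r t) (x - z)) (w := fun r z => A r k l * cv (u r) ρ z) (hA.kf_meas1 k l ε t x) (m1.mul hum) (C := ENNReal.ofReal (hc1 d / ε)) ofReal_ne_top
      (by filter_upwards [mem_Ioc_ae t] with r hr using hA.kf_L1x k l hε hr.2 x) ((hai k l).norm.mul_const M)
      (Filter.Eventually.of_forall fun r z => by rw [abs_mul, Real.norm_eq_abs]; exact mul_le_mul_of_nonneg_left (hM r z) (abs_nonneg _))
    refine this.congr (Filter.Eventually.of_forall fun y => ?_)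
    simp only
    ring
  have I2 : Integrable (fun y : ℝ × (Fin d → ℝ) => gf (QA A ε y.1 t) (x - y.2) * vv A f u ρ y.2 y.1) ((volume.restrict (Ioc 0 t)).prod volume) := by
    refine int_L1 (μ := volume.restrict (Ioc 0 t)) (κ := fun r z => gf (QA A ε r t) (x - z)) (w := fun r z => vv A f u ρ z r) (W := fun r => (∑ k, ∑ l, ‖A r k l‖ * M2 k l) + ‖f r‖ * cn q ρ) (hA.gf_meas1 ε t x) hvm (C := 1) one_ne_top
      (by filter_upwards [mem_Ioc_ae t] with r hr using hA.gf_L1x hε hr.2 x) ?_ ?_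
    · exact (integrable_finsetSum _ fun k _ => integrable_finsetSum _ fun l _ => (hai k l).norm.mul_const _).add (h.fint.mul_const _).integrableOn
    · refine Filter.Eventually.of_forall fun r z => ?_
      unfold vv
      refine (abs_add_le _ _).trans (add_le_add ?_ (h.fbd hpq hρ r z))
      refine (Finset.abs_sum_le_sum_abs _ _).trans (Finset.sum_le_sum fun k _ => (Finset.abs_sum_le_sum_abs _ _).trans (Finset.sum_le_sum fun l _ => ?_))
      rw [abs_mul, Real.norm_eq_abs]
      exact mul_le_mul_of_nonneg_left (hM2 k l r z) (abs_nonneg _)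
  have I3 := (integrable_finsetSum Finset.univ fun k _ => integrable_finsetSum Finset.univ fun l _ => I1 k l).neg.add I2
  have e0 : ∫ z, gf (QA A ε t t) (x - z) * cv (u t) ρ z = ∫ z, ∫ r in Ioc 0 t, ((-∑ k, ∑ l, A r k l * (kf k l (QA A ε r t) (x - z) * cv (u r) ρ z)) + gf (QA A ε r t) (x - z) * vv A f u ρ z r) := by
    congr 1
    ext z
    exact h.duh_z hA hpq hρ hε ht x z
  rw [e0, integral_integral_swap]
  swap
  · refine I3.swap.congr (Filter.Eventually.of_forall fun y => ?_)
    simp only [Function.uncurry_def, Pi.add_apply, Pi.neg_apply, Function.comp_apply, Prod.fst_swap, Prod.snd_swap]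
  refine setIntegral_congr_fun measurableSet_Ioc fun r hr => ?_
  have g1 := hA.gf_int hε hr.2
  have k1 := fun k l => hA.kf_int k l hε hr.2
  have J1 : ∀ k l, Integrable fun z => A r k l * (kf k l (QA A ε r t) (x - z) * cv (u r) ρ z) := fun k l =>
    (conv_int hpq (u r) hρ (k1 k l) x).const_mul _
  have J4 : ∀ k l, Integrable fun z => A r k l * (gf (QA A ε r t) (x - z) * cv (u r) (pd k (pd l ρ)) z) := fun k l =>
    (conv_int hpq (u r) ((hρ.pd l).pd k) g1 x).const_mul _
  have J5 : Integrable fun z => gf (QA A ε r t) (x - z) * cv (f r) ρ z := conv_int hpq (f r) hρ g1 x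
  have J3 : Integrable fun z => -∑ k, ∑ l, A r k l * (kf k l (QA A ε r t) (x - z) * cv (u r) ρ z) :=
    (integrable_finsetSum Finset.univ fun k _ => integrable_finsetSum Finset.univ fun l _ => J1 k l).neg
  have J6 : Integrable fun z => ∑ k, ∑ l, A r k l * (gf (QA A ε r t) (x - z) * cv (u r) (pd k (pd l ρ)) z) :=
    (integrable_finsetSum Finset.univ fun k _ => integrable_finsetSum Finset.univ fun l _ => J4 k l)
  have e1 : ∀ z, gf (QA A ε r t) (x - z) * vv A f u ρ z r = (∑ k, ∑ l, A r k l * (gf (QA A ε r t) (x - z) * cv (u r) (pd k (pd l ρ)) z)) + gf (QA A ε r t) (x - z) * cv (f r) ρ z := by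
    intro z
    unfold vv
    rw [mul_add, Finset.mul_sum]
    congr 1
    refine Finset.sum_congr rfl fun k _ => ?_
    rw [Finset.mul_sum]
    refine Finset.sum_congr rfl fun l _ => ?_
    ring
  simp only [e1]
  have J7 : Integrable fun z => (∑ k, ∑ l, A r k l * (gf (QA A ε r t) (x - z) * cv (u r) (pd k (pd l ρ)) z)) + gf (QA A ε r t) (x - z) * cv (f r) ρ z := J6.add J5
  rw [integral_add J3 J7, integral_add J6 J5, integral_neg, ← add_assoc]
  have e2 : ∫ z, ∑ k, ∑ l, A r k l * (kf k l (QA A ε r t) (x - z) * cv (u r) ρ z) = ∫ z, ∑ k, ∑ l, A r k l * (gf (QA A ε r t) (x - z) * cv (u r) (pd k (pd l ρ)) z) := by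
    rw [integral_finsetSum _ (fun k _ => integrable_finsetSum Finset.univ fun l _ => J1 k l), integral_finsetSum _ (fun k _ => integrable_finsetSum Finset.univ fun l _ => J4 k l)]
    refine Finset.sum_congr rfl fun k _ => ?_
    rw [integral_finsetSum _ (fun l _ => J1 k l), integral_finsetSum _ (fun l _ => J4 k l)]
    refine Finset.sum_congr rfl fun l _ => ?_
    rw [integral_const_mul, integral_const_mul, parts_cv hpq (u r) hρ k l hε (hA.QA_meas0 ε r t) (hA.QA_lb ε hr.2) (k1 k l) g1]
  rw [e2, neg_add_cancel, zero_add]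

lemma Sol.duh2 (h : Sol T p A f u) (hA : Cf T A δ) (hpq : p.HolderConjugate q) {ρ : (Fin d → ℝ) → ℝ} (hρ : Ts ρ) {ε : ℝ} (hε : 0 < ε) {t : ℝ} (ht : t ∈ Icc 0 T) (i j : Fin d) (x : Fin d → ℝ) :
    ∫ z, gf (fun ξ => ε * n2 ξ) (x - z) * cv (u t) (pd i (pd j ρ)) z = ∫ r in Ioc 0 t, ∫ z, kf i j (QA A ε r t) (x - z) * cv (f r) ρ z := by
  have e : QA A ε t t = fun ξ => ε * n2 ξ := by ext ξ; simp [QA]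
  rw [← e, h.duh hA hpq ((hρ.pd j).pd i) hε ht x]
  refine setIntegral_congr_fun measurableSet_Ioc fun r hr => ?_
  exact (parts_cv hpq (f r) hρ i j hε (hA.QA_meas0 ε r t) (hA.QA_lb ε hr.2) (hA.kf_int i j hε hr.2) (hA.gf_int hε hr.2) x).symm

end

section
variable {d : ℕ} {T p q : ℝ} {A : ℝ → Fin d → Fin d → ℝ} {δ : ℝ → ℝ}
variable [Fact (1 ≤ ENNReal.ofReal p)] {f u : ℝ → LpE d p}

lemma Cf.kA_meas (hA : Cf T A δ) (i j : Fin d) (ε : ℝ) : Measurable fun y : (ℝ × (Fin d → ℝ)) × (ℝ × (Fin d → ℝ)) => kA A i j ε y.1.1 y.2.1 (y.2.2 - y.1.2) := by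
  unfold kA
  refine Measurable.ite (measurableSet_lt (f := fun y : (ℝ × (Fin d → ℝ)) × (ℝ × (Fin d → ℝ)) => y.1.1) (by fun_prop) (by fun_prop)) ?_ measurable_const
  exact (measurable_kfQ i j (X := ℝ × ℝ) (Q := fun r => QA A ε r.1 r.2) (hA.QA_meas ε)).comp (f := fun y : (ℝ × (Fin d → ℝ)) × (ℝ × (Fin d → ℝ)) => ((y.1.1, y.2.1), y.2.2 - y.1.2)) (by fun_prop)

lemma Cf.kA_L1 (hA : Cf T A δ) (i j : Fin d) {ε : ℝ} (hε : 0 < ε) (s t : ℝ) (x : Fin d → ℝ) :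
    ∫⁻ y, ‖kA A i j ε s t (x - y)‖ₑ ≤ ENNReal.ofReal (hc1 d / ε) := by
  unfold kA
  split_ifs with h
  · exact hA.kf_L1x i j hε h.le x
  · simp

/-- Weighted right-hand side. -/
def FD (T : ℝ) (δ : ℝ → ℝ) (f : ℝ → LpE d p) (ρ : (Fin d → ℝ) → ℝ) (z : ℝ × (Fin d → ℝ)) : ℝ :=
  if z.1 ∈ Ioc 0 T then cv (f z.1) ρ z.2 / δ z.1 else 0

lemma Sol.FD_meas (h : Sol T p A f u) (hA : Cf T A δ) (hpq : p.HolderConjugate q) {ρ : (Fin d → ℝ) → ℝ} (hρ : Ts ρ) : Measurable (FD T δ f ρ) := by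
  unfold FD
  exact Measurable.ite (measurable_fst measurableSet_Ioc) ((h.cvf hpq hρ).div (hA.dm.comp measurable_fst)) measurable_const

lemma Sol.FD_bd (h : Sol T p A f u) (hA : Cf T A δ) (hpq : p.HolderConjugate q) {ρ : (Fin d → ℝ) → ℝ} (hρ : Ts ρ) (s : ℝ) (y : Fin d → ℝ) : |FD T δ f ρ (s, y)| ≤ ‖f s‖ * cn q ρ / δ s := by
  have h1 := hA.dpos s
  unfold FD
  split_ifs with hs
  · rw [abs_div, abs_of_pos h1]
    exact div_le_div_of_nonneg_right (h.fbd hpq hρ s y) h1.le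
  · rw [abs_zero]
    exact div_nonneg (mul_nonneg (norm_nonneg _) (cn_nonneg _ _)) h1.le

lemma Sol.FD_W (h : Sol T p A f u) (hA : Cf T A δ) (ρ : (Fin d → ℝ) → ℝ) : Integrable (fun s => ‖f s‖ * cn q ρ / δ s) (nu δ) := by
  unfold nu
  have := hA.dm
  rw [integrable_withDensity_iff (by fun_prop) (Filter.Eventually.of_forall fun _ => ofReal_lt_top)]
  refine (h.fint.mul_const (cn q ρ)).congr (Filter.Eventually.of_forall fun s => ?_)
  have h1 := hA.dpos s
  simp only [toReal_ofReal h1.le]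
  field_simp

lemma Sol.H_int (h : Sol T p A f u) (hA : Cf T A δ) (hpq : p.HolderConjugate q) {ρ : (Fin d → ℝ) → ℝ} (hρ : Ts ρ) (i j : Fin d) {ε : ℝ} (hε : 0 < ε) {G : ℝ × (Fin d → ℝ) → ℝ} (hG : Nice (nuZ d δ) G) :
    Integrable (fun y : (ℝ × (Fin d → ℝ)) × (ℝ × (Fin d → ℝ)) => kA A i j ε y.1.1 y.2.1 (y.2.2 - y.1.2) * (FD T δ f ρ y.1 * G y.2)) ((nuZ d δ).prod (nuZ d δ)) := by
  have m1 := hA.kA_meas i j ε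
  have m2 := h.FD_meas hA hpq hρ
  have m3 := hG.meas
  have m4 : Measurable (fun y : (ℝ × (Fin d → ℝ)) × (ℝ × (Fin d → ℝ)) => kA A i j ε y.1.1 y.2.1 (y.2.2 - y.1.2) * (FD T δ f ρ y.1 * G y.2)) :=
    m1.mul ((m2.comp measurable_fst).mul (m3.comp measurable_snd))
  refine ⟨m4.aestronglyMeasurable, ?_⟩
  unfold HasFiniteIntegral
  rw [lintegral_prod_symm _ m4.enorm.aemeasurable]
  have hW := (h.FD_W (q := q) hA ρ).2
  unfold HasFiniteIntegral at hW
  set KW := ENNReal.ofReal (hc1 d / ε) * ∫⁻ s, ‖‖f s‖ * cn q ρ / δ s‖ₑ ∂(nu δ) with hKW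
  have hKWt : KW ≠ ⊤ := mul_ne_top ofReal_ne_top hW.ne
  calc _ ≤ ∫⁻ z, KW * ‖G z‖ₑ ∂(nuZ d δ) := by
        refine lintegral_mono fun z => ?_
        have m5 : Measurable fun y : ℝ × (Fin d → ℝ) => kA A i j ε y.1 z.1 (z.2 - y.2) * FD T δ f ρ y := (m1.comp (f := fun y : ℝ × (Fin d → ℝ) => (y, z)) (by fun_prop)).mul m2
        calc ∫⁻ y, ‖kA A i j ε y.1 z.1 (z.2 - y.2) * (FD T δ f ρ y * G z)‖ₑ ∂(nuZ d δ) = ∫⁻ y, ‖kA A i j ε y.1 z.1 (z.2 - y.2) * FD T δ f ρ y‖ₑ * ‖G z‖ₑ ∂(nuZ d δ) := by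
              refine lintegral_congr fun y => ?_
              rw [← enorm_mul, mul_assoc]
          _ = (∫⁻ y, ‖kA A i j ε y.1 z.1 (z.2 - y.2) * FD T δ f ρ y‖ₑ ∂(nuZ d δ)) * ‖G z‖ₑ := lintegral_mul_const _ m5.enorm
          _ ≤ KW * ‖G z‖ₑ := by
              refine mul_le_mul_left ?_ _
              unfold nuZ
              rw [lintegral_prod _ m5.enorm.aemeasurable, hKW, ← lintegral_const_mul' _ _ ofReal_ne_top]
              refine lintegral_mono fun s => ?_
              calc ∫⁻ y, ‖kA A i j ε s z.1 (z.2 - y) * FD T δ f ρ (s, y)‖ₑ ≤ ∫⁻ y, ‖kA A i j ε s z.1 (z.2 - y)‖ₑ * ‖‖f s‖ * cn q ρ / δ s‖ₑ := by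
                    refine lintegral_mono fun y => ?_
                    rw [enorm_mul]
                    refine mul_le_mul_right ?_ _
                    rw [← ofReal_norm, ← ofReal_norm]
                    exact ofReal_le_ofReal ((h.FD_bd hA hpq hρ s y).trans (Real.le_norm_self _))
                _ = (∫⁻ y, ‖kA A i j ε s z.1 (z.2 - y)‖ₑ) * ‖‖f s‖ * cn q ρ / δ s‖ₑ := lintegral_mul_const' _ _ enorm_ne_top
                _ ≤ _ := mul_le_mul_left (hA.kA_L1 i j hε _ _ _) _
    _ = KW * ∫⁻ z, ‖G z‖ₑ ∂(nuZ d δ) := lintegral_const_mul' _ _ hKWt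
    _ < ⊤ := mul_lt_top hKWt.lt_top hG.int.2

/-- Truncation set. -/
def trS (T : ℝ) (δ : ℝ → ℝ) (f : ℝ → LpE d p) (ρ : (Fin d → ℝ) → ℝ) (n : ℕ) : Set (ℝ × (Fin d → ℝ)) :=
  (Ioc 0 T ×ˢ Metric.closedBall 0 n) ∩ {z | |FD T δ f ρ z| ≤ n}

lemma Cf.nuZ_box (hA : Cf T A δ) (R : ℝ) : nuZ d δ (Ioc 0 T ×ˢ Metric.closedBall 0 R) < ⊤ := by
  unfold nuZ
  rw [Measure.prod_prod, hA.nu_Ioc hA.hT.le]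
  exact mul_lt_top ofReal_lt_top (isCompact_closedBall _ _).measure_lt_top

lemma Sol.trS_meas (h : Sol T p A f u) (hA : Cf T A δ) (hpq : p.HolderConjugate q) {ρ : (Fin d → ℝ) → ℝ} (hρ : Ts ρ) (n : ℕ) : MeasurableSet (trS T δ f ρ n) := by
  have := h.FD_meas hA hpq hρ
  exact (measurableSet_Ioc.prod Metric.isClosed_closedBall.measurableSet).inter (measurableSet_le (f := fun z => |FD T δ f ρ z|) (g := fun _ => (n:ℝ)) (by fun_prop) measurable_const)

lemma Sol.trS_nice (h : Sol T p A f u) (hA : Cf T A δ) (hpq : p.HolderConjugate q) {ρ : (Fin d → ℝ) → ℝ} (hρ : Ts ρ) (n : ℕ) : Nice (nuZ d δ) ((trS T δ f ρ n).indicator (FD T δ f ρ)) := by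
  have m2 := h.FD_meas hA hpq hρ
  have hS := h.trS_meas hA hpq hρ n
  have hb : ∀ z, |(trS T δ f ρ n).indicator (FD T δ f ρ) z| ≤ n := by
    intro z
    by_cases hz : z ∈ trS T δ f ρ n
    · rw [indicator_of_mem hz]; exact hz.2
    · rw [indicator_of_notMem hz]; simp
  refine ⟨m2.indicator hS, ?_, n, hb⟩
  rw [integrable_indicator_iff hS]
  refine Measure.integrableOn_of_bounded (M := n) (lt_of_le_of_lt (measure_mono inter_subset_left) (hA.nuZ_box (d := d) n)).ne m2.aestronglyMeasurable ?_
  filter_upwards [ae_restrict_mem hS] with z hz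
  exact hz.2

lemma Sol.H_bd (h : Sol T p A f u) (hA : Cf T A δ) (hpq : p.HolderConjugate q) (hq2 : q ≤ 2) {ρ : (Fin d → ℝ) → ℝ} (hρ : Ts ρ) (i j : Fin d) {ε : ℝ} (hε : 0 < ε) {G : ℝ × (Fin d → ℝ) → ℝ} (hG : Nice (nuZ d δ) G)
    (hG0 : ∀ z, z.1 ∉ Ioc 0 T → G z = 0) :
    ‖∫ y : (ℝ × (Fin d → ℝ)) × (ℝ × (Fin d → ℝ)), kA A i j ε y.1.1 y.2.1 (y.2.2 - y.1.2) * (FD T δ f ρ y.1 * G y.2) ∂((nuZ d δ).prod (nuZ d δ))‖ₑ ≤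
      cM d q * (nrm p (FD T δ f ρ) (nuZ d δ) * nrm q G (nuZ d δ)) := by
  have m1 := hA.kA_meas i j ε
  have m2 := h.FD_meas hA hpq hρ
  have m3 := hG.meas
  have ht := tendsto_integral_of_dominated_convergence (μ := (nuZ d δ).prod (nuZ d δ)) (F := fun n y => kA A i j ε y.1.1 y.2.1 (y.2.2 - y.1.2) * ((trS T δ f ρ n).indicator (FD T δ f ρ) y.1 * G y.2))
    (f := fun y => kA A i j ε y.1.1 y.2.1 (y.2.2 - y.1.2) * (FD T δ f ρ y.1 * G y.2)) _ (fun n => (m1.mul (((h.trS_nice hA hpq hρ n).meas.comp measurable_fst).mul (m3.comp measurable_snd))).aestronglyMeasurable)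
    (h.H_int hA hpq hρ i j hε hG).norm (fun n => Filter.Eventually.of_forall fun y => ?_) (Filter.Eventually.of_forall fun y => ?_)
  · refine le_of_tendsto (ht.enorm) (Filter.Eventually.of_forall fun n => ?_)
    refine (hA.time_blb i j hε hpq hq2 (h.trS_nice hA hpq hρ n) hG ?_ hG0).trans ?_
    · intro z hz
      exact indicator_of_notMem (fun hz2 => hz hz2.1.1) _
    · refine mul_le_mul_right (mul_le_mul_left ?_ _) _
      unfold nrm
      refine ENNReal.rpow_le_rpow (lintegral_mono fun z => ENNReal.rpow_le_rpow ?_ hpq.pos.le) (by have := hpq.pos; positivity)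
      exact enorm_indicator_le_enorm_self _ _
  · rw [norm_mul, norm_mul, norm_mul, norm_mul]
    gcongr
    exact norm_indicator_le_norm_self _ _
  · refine Filter.Tendsto.const_mul _ (Filter.Tendsto.mul_const _ ?_)
    by_cases hz : y.1.1 ∈ Ioc 0 T
    · refine tendsto_const_nhds.congr' ?_
      filter_upwards [Filter.eventually_ge_atTop ⌈‖y.1.2‖⌉₊, Filter.eventually_ge_atTop ⌈|FD T δ f ρ y.1|⌉₊] with n h1 h2
      rw [indicator_of_mem]
      refine ⟨⟨hz, ?_⟩, Nat.ceil_le.1 h2⟩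
      rw [mem_closedBall_zero_iff]
      exact Nat.ceil_le.1 h1
    · have e : FD T δ f ρ y.1 = 0 := by unfold FD; rw [if_neg hz]
      refine tendsto_const_nhds.congr fun n => ?_
      unfold indicator
      split_ifs <;> simp [e]

end

section
variable {d : ℕ} {T p q : ℝ} {A : ℝ → Fin d → Fin d → ℝ} {δ : ℝ → ℝ}
variable [Fact (1 ≤ ENNReal.ofReal p)] {f u : ℝ → LpE d p}

/-- Smoothing. -/
def gU (ε : ℝ) (v : (Fin d → ℝ) → ℝ) (x : Fin d → ℝ) : ℝ := ∫ z, gf (fun ξ => ε * n2 ξ) (x - z) * v z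

lemma Sol.H_in (h : Sol T p A f u) (hA : Cf T A δ) (hpq : p.HolderConjugate q) {ρ : (Fin d → ℝ) → ℝ} (hρ : Ts ρ) (i j : Fin d) {ε : ℝ} (hε : 0 < ε) {t : ℝ} (ht : t ∈ Ioc 0 T) (x : Fin d → ℝ) :
    ∫ y, kA A i j ε y.1 t (x - y.2) * FD T δ f ρ y ∂(nuZ d δ) = gU ε (cv (u t) (pd i (pd j ρ))) x := by
  have m1 := hA.kA_meas i j ε
  have m2 := h.FD_meas hA hpq hρ
  unfold gU
  rw [h.duh2 hA hpq hρ hε ⟨ht.1.le, ht.2⟩ i j x]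
  have hi := int_L1 (μ := nu δ) (κ := fun s y => kA A i j ε s t (x - y)) (w := fun s y => FD T δ f ρ (s, y)) (m1.comp (f := fun y : ℝ × (Fin d → ℝ) => (y, (t, x))) (by fun_prop)) m2
    (C := ENNReal.ofReal (hc1 d / ε)) ofReal_ne_top (Filter.Eventually.of_forall fun s => hA.kA_L1 i j hε s t x) (h.FD_W (q := q) hA ρ) (Filter.Eventually.of_forall fun s y => h.FD_bd hA hpq hρ s y)
  unfold nuZ
  rw [integral_prod _ hi]
  unfold nu
  have hdm := hA.dm
  rw [integral_withDensity_eq_integral_toReal_smul (by fun_prop) (Filter.Eventually.of_forall fun _ => ofReal_lt_top), ← integral_indicator measurableSet_Ioc]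
  refine integral_congr_ae ?_
  filter_upwards [Measure.ae_ne volume t] with s hs
  have hd := hA.dpos s
  rw [toReal_ofReal hd.le, smul_eq_mul]
  by_cases hst : s ∈ Ioc 0 t
  · rw [indicator_of_mem hst, ← integral_const_mul]
    congr 1
    ext y
    have h1 : s < t := lt_of_le_of_ne hst.2 hs
    simp only [kA, FD, if_pos h1]
    rw [if_pos ⟨hst.1, hst.2.trans ht.2⟩]
    field_simp
  · rw [indicator_of_notMem hst]
    have : ∀ y, kA A i j ε s t (x - y) * FD T δ f ρ (s, y) = 0 := by
      intro y
      simp only [kA, FD]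
      split_ifs with h1 h2
      · exact absurd ⟨h2.1, h1.le⟩ hst
      all_goals simp
    simp [this]

lemma Sol.H_eq (h : Sol T p A f u) (hA : Cf T A δ) (hpq : p.HolderConjugate q) {ρ : (Fin d → ℝ) → ℝ} (hρ : Ts ρ) (i j : Fin d) {ε : ℝ} (hε : 0 < ε) {G : ℝ × (Fin d → ℝ) → ℝ} (hG : Nice (nuZ d δ) G)
    (hG0 : ∀ z, z.1 ∉ Ioc 0 T → G z = 0) :
    ∫ y : (ℝ × (Fin d → ℝ)) × (ℝ × (Fin d → ℝ)), kA A i j ε y.1.1 y.2.1 (y.2.2 - y.1.2) * (FD T δ f ρ y.1 * G y.2) ∂((nuZ d δ).prod (nuZ d δ)) =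
      ∫ z, gU ε (cv (u z.1) (pd i (pd j ρ))) z.2 * G z ∂(nuZ d δ) := by
  rw [integral_prod_symm _ (h.H_int hA hpq hρ i j hε hG)]
  congr 1
  ext z
  by_cases hz : z.1 ∈ Ioc 0 T
  · rw [← h.H_in hA hpq hρ i j hε hz z.2, ← integral_mul_const]
    congr 1
    ext y
    simp only
    ring
  · simp [hG0 z hz]

lemma gf_sc {ε : ℝ} (hε : 0 < ε) (y : Fin d → ℝ) : |Real.sqrt ε ^ d| * gf (fun ξ => ε * n2 ξ) (Real.sqrt ε • y) = gf (fun ξ => 1 * n2 ξ) y := by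
  have hs := Real.sqrt_pos.2 hε
  rw [gf_n2 hε, gf_n2 one_pos, abs_of_pos (pow_pos hs _)]
  have e1 : n2 (Real.sqrt ε • y) = ε * n2 y := by
    simp only [n2, Pi.smul_apply, smul_eq_mul, mul_pow, Real.sq_sqrt hε.le, Finset.mul_sum]
  have e2 : (4 * Real.pi * ε) ^ (-((d:ℝ)/2)) = (4 * Real.pi * 1) ^ (-((d:ℝ)/2)) * (Real.sqrt ε ^ d)⁻¹ := by
    rw [mul_one, Real.mul_rpow (by positivity) hε.le]
    congr 1
    rw [Real.rpow_neg hε.le, Real.sqrt_eq_rpow, ← Real.rpow_natCast, ← Real.rpow_mul hε.le]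
    congr 2; ring
  have e3 : -n2 (Real.sqrt ε • y) / (4 * ε) = -n2 y / (4 * 1) := by rw [e1]; field_simp
  rw [e2, e3]
  have := (pow_pos hs d).ne'
  field_simp

lemma gU_sc {ε : ℝ} (hε : 0 < ε) (v : (Fin d → ℝ) → ℝ) (x : Fin d → ℝ) : gU ε v x = ∫ y, gf (fun ξ => 1 * n2 ξ) y * v (x - Real.sqrt ε • y) := by
  have hs := Real.sqrt_pos.2 hε
  have e1 : gU ε v x = ∫ z, gf (fun ξ => ε * n2 ξ) z * v (x - z) := by
    unfold gU
    rw [← integral_sub_left_eq_self _ volume x]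
    simp
  have e2 := Measure.integral_comp_smul (volume : Measure (Fin d → ℝ)) (fun z => gf (fun ξ => ε * n2 ξ) z * v (x - z)) (Real.sqrt ε)
  rw [Module.finrank_fintype_fun_eq_card, Fintype.card_fin, abs_inv] at e2
  have h3 : |Real.sqrt ε ^ d| ≠ 0 := (abs_pos.2 (pow_pos hs d).ne').ne'
  rw [e1]
  have e4 : ∫ z, gf (fun ξ => ε * n2 ξ) z * v (x - z) = |Real.sqrt ε ^ d| * ∫ y, gf (fun ξ => ε * n2 ξ) (Real.sqrt ε • y) * v (x - Real.sqrt ε • y) := by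
    rw [e2, smul_eq_mul, mul_inv_cancel_left₀ h3]
  rw [e4, ← integral_const_mul]
  congr 1
  ext y
  rw [← mul_assoc, gf_sc hε]

lemma gf1_int : Integrable (gf (d := d) fun ξ => 1 * n2 ξ) :=
  int_of_lint (measurable_gf (by fun_prop)) one_ne_top (lint_gf_n2 one_pos).le

lemma gf1_one : ∫ y, gf (d := d) (fun ξ => 1 * n2 ξ) y = 1 := by
  rw [integral_eq_lintegral_of_nonneg_ae (Filter.Eventually.of_forall fun y => gf_n2_nonneg one_pos y) gf1_int.aestronglyMeasurable]
  have := lint_gf_n2 (d := d) one_pos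
  have e : ∀ y, ‖gf (d := d) (fun ξ => 1 * n2 ξ) y‖ₑ = ENNReal.ofReal (gf (fun ξ => 1 * n2 ξ) y) := fun y => Real.enorm_of_nonneg (gf_n2_nonneg one_pos y)
  simp only [e] at this
  rw [this]; rfl

lemma gU_bd {ε : ℝ} (hε : 0 < ε) {v : (Fin d → ℝ) → ℝ} {M : ℝ} (hM : ∀ z, |v z| ≤ M) (x : Fin d → ℝ) : |gU ε v x| ≤ M := by
  rw [gU_sc hε, ← Real.norm_eq_abs]
  refine (norm_integral_le_of_norm_le (gf1_int.mul_const M) (Filter.Eventually.of_forall fun y => ?_)).trans ?_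
  · rw [norm_mul, Real.norm_of_nonneg (gf_n2_nonneg one_pos y)]
    exact mul_le_mul_of_nonneg_left (hM _) (gf_n2_nonneg one_pos y)
  · rw [integral_mul_const, gf1_one, one_mul]

lemma gU_lim {v : (Fin d → ℝ) → ℝ} (hv : Continuous v) {M : ℝ} (hM : ∀ z, |v z| ≤ M) (x : Fin d → ℝ) :
    Filter.Tendsto (fun n : ℕ => gU (1 / ((n:ℝ) + 1)) v x) Filter.atTop (nhds (v x)) := by
  have h0 : ∀ n : ℕ, 0 < 1 / ((n:ℝ) + 1) := fun n => by positivity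
  simp only [gU_sc (h0 _)]
  have e : v x = ∫ y : Fin d → ℝ, gf (fun ξ => 1 * n2 ξ) y * v x := by rw [integral_mul_const, gf1_one, one_mul]
  rw [e]
  refine tendsto_integral_of_dominated_convergence (fun y => gf (fun ξ => 1 * n2 ξ) y * M) (fun n => ?_) (gf1_int.mul_const M) (fun n => Filter.Eventually.of_forall fun y => ?_) (Filter.Eventually.of_forall fun y => ?_)
  · exact gf1_int.aestronglyMeasurable.mul (by fun_prop)
  · rw [norm_mul, Real.norm_of_nonneg (gf_n2_nonneg one_pos y)]
    exact mul_le_mul_of_nonneg_left (hM _) (gf_n2_nonneg one_pos y)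
  · refine Filter.Tendsto.const_mul _ ?_
    have h1 : Filter.Tendsto (fun n : ℕ => Real.sqrt (1 / ((n:ℝ) + 1))) Filter.atTop (nhds 0) := by
      have := (Real.continuous_sqrt.tendsto 0).comp (tendsto_one_div_add_atTop_nhds_zero_nat (𝕜 := ℝ))
      rw [Real.sqrt_zero] at this
      exact this
    have h2 : Filter.Tendsto (fun n : ℕ => x - Real.sqrt (1 / ((n:ℝ) + 1)) • y) Filter.atTop (nhds x) := by
      have := (tendsto_const_nhds (x := x)).sub (h1.smul_const y)
      simpa using this
    exact (hv.tendsto x).comp h2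

end

section
variable {d : ℕ} {T p q : ℝ} {A : ℝ → Fin d → Fin d → ℝ} {δ : ℝ → ℝ}
variable [Fact (1 ≤ ENNReal.ofReal p)] {f u : ℝ → LpE d p}

lemma Sol.gU_meas (h : Sol T p A f u) (hpq : p.HolderConjugate q) {ρ : (Fin d → ℝ) → ℝ} (hρ : Ts ρ) (ε : ℝ) : Measurable fun z : ℝ × (Fin d → ℝ) => gU ε (cv (u z.1) ρ) z.2 := by
  unfold gU
  have m1 := (h.cvu hpq hρ).measurable
  have m2 := measurable_gf (d := d) (Q := fun ξ => ε * n2 ξ) (by fun_prop)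
  have m3 : Measurable fun y : (ℝ × (Fin d → ℝ)) × (Fin d → ℝ) => gf (fun ξ => ε * n2 ξ) (y.1.2 - y.2) * cv (u y.1.1) ρ y.2 :=
    (m2.comp (by fun_prop)).mul (m1.comp (f := fun y : (ℝ × (Fin d → ℝ)) × (Fin d → ℝ) => (y.1.1, y.2)) (by fun_prop))
  exact (m3.stronglyMeasurable.integral_prod_right').measurable

lemma Sol.dual (h : Sol T p A f u) (hA : Cf T A δ) (hpq : p.HolderConjugate q) (hq2 : q ≤ 2) {ρ : (Fin d → ℝ) → ℝ} (hρ : Ts ρ) (i j : Fin d) {G : ℝ × (Fin d → ℝ) → ℝ} (hG : Nice (nuZ d δ) G)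
    (hG0 : ∀ z, z.1 ∉ Ioc 0 T → G z = 0) :
    ‖∫ z, cv (u z.1) (pd i (pd j ρ)) z.2 * G z ∂(nuZ d δ)‖ₑ ≤ cM d q * (nrm p (FD T δ f ρ) (nuZ d δ) * nrm q G (nuZ d δ)) := by
  have hρ2 := (hρ.pd j).pd i
  obtain ⟨M, hM0, hM⟩ := h.ubd hpq hρ2
  have h0 : ∀ n : ℕ, 0 < 1 / ((n:ℝ) + 1) := fun n => by positivity
  have ht := tendsto_integral_of_dominated_convergence (μ := nuZ d δ) (F := fun n z => gU (1 / ((n:ℝ) + 1)) (cv (u z.1) (pd i (pd j ρ))) z.2 * G z)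
    (f := fun z => cv (u z.1) (pd i (pd j ρ)) z.2 * G z) (fun z => M * ‖G z‖) (fun n => ((h.gU_meas hpq hρ2 _).mul hG.meas).aestronglyMeasurable) (hG.int.norm.const_mul M) (fun n => Filter.Eventually.of_forall fun z => ?_) (Filter.Eventually.of_forall fun z => ?_)
  · refine le_of_tendsto ht.enorm (Filter.Eventually.of_forall fun n => ?_)
    have := h.H_bd hA hpq hq2 hρ i j (h0 n) hG hG0
    rwa [h.H_eq hA hpq hρ i j (h0 n) hG hG0] at this
  · rw [norm_mul]
    exact mul_le_mul_of_nonneg_right (gU_bd (h0 n) (hM z.1) z.2) (norm_nonneg _)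
  · refine Filter.Tendsto.mul_const _ ?_
    exact gU_lim ((h.cvu hpq hρ2).comp (f := fun x => (z.1, x)) (by fun_prop)) (hM z.1) z.2

/-- The main estimate for the mollified solution. -/
lemma Sol.claim (h : Sol T p A f u) (hA : Cf T A δ) (hpq : p.HolderConjugate q) (hp2 : 2 ≤ p) (hq2 : q ≤ 2) {ρ : (Fin d → ℝ) → ℝ} (hρ : Ts ρ) (i j : Fin d) :
    ∫⁻ z in Ioc 0 T ×ˢ univ, ‖cv (u z.1) (pd i (pd j ρ)) z.2‖ₑ ^ p ∂(nuZ d δ) ≤ cM d q ^ p * ∫⁻ z, ‖FD T δ f ρ z‖ₑ ^ p ∂(nuZ d δ) := by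
  have hp := hpq.pos
  have hρ2 := (hρ.pd j).pd i
  obtain ⟨M, hM0, hM⟩ := h.ubd hpq hρ2
  have mU := (h.cvu hpq hρ2).measurable
  rw [← nrm_rpow hp (FD T δ f ρ), ← ENNReal.mul_rpow_of_nonneg _ _ hp.le]
  have hm : Monotone fun n : ℕ => Ioc 0 T ×ˢ Metric.closedBall (0 : Fin d → ℝ) n := fun a b hab =>
    prod_mono_right (Metric.closedBall_subset_closedBall (by exact_mod_cast hab))
  have hU : (Ioc 0 T ×ˢ univ : Set (ℝ × (Fin d → ℝ))) = ⋃ n : ℕ, Ioc 0 T ×ˢ Metric.closedBall (0 : Fin d → ℝ) n := by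
    rw [← prod_iUnion, Metric.iUnion_closedBall_nat]
  rw [hU, setLIntegral_iUnion_of_directed _ hm.directed_le]
  refine iSup_le fun n => ?_
  refine conv_holder hpq hp2 mU (measurableSet_Ioc.prod Metric.isClosed_closedBall.measurableSet) (hA.nuZ_box (d := d) n) (fun z _ => hM z.1 z.2) fun G hG hG0 => ?_
  rw [mul_assoc]
  exact h.dual hA hpq hq2 hρ i j hG fun z hz => hG0 z fun h1 => hz h1.1

lemma Cf.lint_nuZ (hA : Cf T A δ) {F : ℝ × (Fin d → ℝ) → ℝ≥0∞} (hF : Measurable F) : ∫⁻ z in Ioc 0 T ×ˢ univ, F z ∂(nuZ d δ) = ∫⁻ t in Ioc 0 T, ENNReal.ofReal (δ t) * ∫⁻ x, F (t, x) := by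
  have hdm := hA.dm
  unfold nuZ
  rw [← Measure.prod_restrict, Measure.restrict_univ, lintegral_prod _ hF.aemeasurable]
  unfold nu
  rw [restrict_withDensity measurableSet_Ioc, lintegral_withDensity_eq_lintegral_mul _ (by fun_prop) hF.lintegral_prod_right']
  rfl

lemma Sol.FD_lint (h : Sol T p A f u) (hA : Cf T A δ) (hpq : p.HolderConjugate q) {ρ : (Fin d → ℝ) → ℝ} (hρ : Ts ρ) :
    ∫⁻ z, ‖FD T δ f ρ z‖ₑ ^ p ∂(nuZ d δ) = ∫⁻ t in Ioc 0 T, ENNReal.ofReal (δ t ^ (1 - p)) * ∫⁻ x, ‖cv (f t) ρ x‖ₑ ^ p := by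
  have hp := hpq.pos
  have mF := h.FD_meas hA hpq hρ
  have e : ∫⁻ z, ‖FD T δ f ρ z‖ₑ ^ p ∂(nuZ d δ) = ∫⁻ z in Ioc 0 T ×ˢ univ, ‖FD T δ f ρ z‖ₑ ^ p ∂(nuZ d δ) := by
    rw [← lintegral_indicator (measurableSet_Ioc.prod MeasurableSet.univ)]
    refine lintegral_congr fun z => ?_
    by_cases hz : z.1 ∈ Ioc 0 T
    · rw [indicator_of_mem (show z ∈ Ioc 0 T ×ˢ univ from ⟨hz, trivial⟩)]
    · rw [indicator_of_notMem (fun h1 => hz h1.1)]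
      have e0 : FD T δ f ρ z = 0 := by unfold FD; rw [if_neg hz]
      simp [e0, hp]
  rw [e, hA.lint_nuZ (by fun_prop)]
  refine setLIntegral_congr_fun measurableSet_Ioc fun t ht => ?_
  have hd := hA.dpos t
  simp only [FD, if_pos ht]
  have e2 : ∀ x, ‖cv (f t) ρ x / δ t‖ₑ ^ p = ENNReal.ofReal (δ t ^ (-p)) * ‖cv (f t) ρ x‖ₑ ^ p := by
    intro x
    rw [div_eq_inv_mul, enorm_mul, ENNReal.mul_rpow_of_nonneg _ _ hp.le, Real.enorm_of_nonneg (by positivity), ENNReal.ofReal_rpow_of_pos (by positivity), Real.inv_rpow hd.le, Real.rpow_neg hd.le]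
  simp only [e2]
  rw [lintegral_const_mul' _ _ ofReal_ne_top, ← mul_assoc, ← ofReal_mul hd.le]
  congr 2
  rw [sub_eq_add_neg, Real.rpow_add hd, Real.rpow_one]

end

section
variable {d : ℕ} {p q : ℝ}

lemma jensen (hpq : p.HolderConjugate q) {ρ : (Fin d → ℝ) → ℝ} (hρ : Ts ρ) (h0 : ∀ x, 0 ≤ ρ x) (h1 : ∫ x, ρ x = 1) {k : (Fin d → ℝ) → ℝ} (hk : Measurable k) :
    ‖∫ w, k w * ρ w‖ₑ ^ p ≤ ∫⁻ w, ENNReal.ofReal (ρ w) * ‖k w‖ₑ ^ p := by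
  have hp := hpq.pos
  have hρm := hρ.nice.meas
  have hl : ∫⁻ w, ENNReal.ofReal (ρ w) = 1 := by
    rw [← ofReal_integral_eq_lintegral_ofReal hρ.nice.int (Filter.Eventually.of_forall h0), h1, ofReal_one]
  have hm : Measurable fun w => ENNReal.ofReal (ρ w) := by fun_prop
  set P := volume.withDensity fun w => ENNReal.ofReal (ρ w) with hP
  have e1 : ∫⁻ w, ENNReal.ofReal (ρ w) * ‖k w‖ₑ ^ p = ∫⁻ w, ‖k w‖ₑ ^ p ∂P := by
    rw [hP, lintegral_withDensity_eq_lintegral_mul _ hm (by fun_prop)]; rfl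
  have e2 : ‖∫ w, k w * ρ w‖ₑ ≤ ∫⁻ w, ‖k w‖ₑ ∂P := by
    rw [hP, lintegral_withDensity_eq_lintegral_mul _ hm (by fun_prop)]
    refine (enorm_integral_le_lintegral_enorm _).trans (lintegral_mono fun w => ?_)
    rw [enorm_mul, mul_comm, Real.enorm_of_nonneg (h0 w)]; rfl
  have e3 := ENNReal.lintegral_mul_le_Lp_mul_Lq P hpq (f := fun w => ‖k w‖ₑ) (g := fun _ => 1) (by fun_prop) (by fun_prop)
  have e4 : P univ = 1 := by rw [hP, withDensity_apply _ MeasurableSet.univ, Measure.restrict_univ, hl]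
  simp only [Pi.mul_def, mul_one, one_rpow, lintegral_const, e4] at e3
  rw [e1]
  refine (ENNReal.rpow_le_rpow (e2.trans e3) hp.le).trans ?_
  rw [← ENNReal.rpow_mul, one_div, inv_mul_cancel₀ hp.ne', ENNReal.rpow_one]

lemma jensen2 (hpq : p.HolderConjugate q) {ρ : (Fin d → ℝ) → ℝ} (hρ : Ts ρ) (h0 : ∀ x, 0 ≤ ρ x) (h1 : ∫ x, ρ x = 1) {k : (Fin d → ℝ) → (Fin d → ℝ) → ℝ}
    (hk : Measurable fun z : (Fin d → ℝ) × (Fin d → ℝ) => k z.1 z.2) {C : ℝ≥0∞} (hC : ∀ w, ρ w ≠ 0 → ∫⁻ y, ‖k y w‖ₑ ^ p ≤ C) :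
    ∫⁻ y, ‖∫ w, k y w * ρ w‖ₑ ^ p ≤ C := by
  have hρm := hρ.nice.meas
  have hl : ∫⁻ w, ENNReal.ofReal (ρ w) = 1 := by
    rw [← ofReal_integral_eq_lintegral_ofReal hρ.nice.int (Filter.Eventually.of_forall h0), h1, ofReal_one]
  calc ∫⁻ y, ‖∫ w, k y w * ρ w‖ₑ ^ p ≤ ∫⁻ y, ∫⁻ w, ENNReal.ofReal (ρ w) * ‖k y w‖ₑ ^ p :=
        lintegral_mono fun y => jensen hpq hρ h0 h1 (hk.comp (f := fun w => (y, w)) (by fun_prop))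
    _ = ∫⁻ w, ∫⁻ y, ENNReal.ofReal (ρ w) * ‖k y w‖ₑ ^ p := lintegral_lintegral_swap (by
        have : Measurable fun z : (Fin d → ℝ) × (Fin d → ℝ) => ENNReal.ofReal (ρ z.2) * ‖k z.1 z.2‖ₑ ^ p := by fun_prop
        exact this.aemeasurable)
    _ ≤ ∫⁻ w, ENNReal.ofReal (ρ w) * C := by
        refine lintegral_mono fun w => ?_
        simp only
        rw [lintegral_const_mul' _ _ ofReal_ne_top]
        by_cases hw : ρ w = 0
        · simp [hw]
        · exact mul_le_mul_right (hC w hw) _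
    _ = C := by rw [lintegral_mul_const _ (by fun_prop), hl, one_mul]

lemma cv_eq (h ρ : (Fin d → ℝ) → ℝ) (y : Fin d → ℝ) : cv h ρ y = ∫ w, h (y - w) * ρ w := by
  unfold cv
  rw [← integral_sub_left_eq_self _ volume y]
  simp

lemma Lp_meas (h : LpE d p) : Measurable h := (Lp.stronglyMeasurable h).measurable

lemma Lp_lint (hp : 0 < p) (h : LpE d p) : ∫⁻ x, ‖h x‖ₑ ^ p = ‖h‖ₑ ^ p := by
  rw [← Lp_enorm hp, nrm_rpow hp]

lemma cv_contr (hpq : p.HolderConjugate q) {ρ : (Fin d → ℝ) → ℝ} (hρ : Ts ρ) (h0 : ∀ x, 0 ≤ ρ x) (h1 : ∫ x, ρ x = 1) (h : LpE d p) :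
    ∫⁻ y, ‖cv h ρ y‖ₑ ^ p ≤ ‖h‖ₑ ^ p := by
  simp only [cv_eq]
  have hm := Lp_meas h
  refine jensen2 hpq hρ h0 h1 (k := fun y w => h (y - w)) (hm.comp (by fun_prop)) fun w _ => ?_
  rw [lintegral_sub_right_eq_self (fun y => ‖h y‖ₑ ^ p) w, Lp_lint hpq.pos]

/-- Translation. -/
def trC (d : ℕ) (w : Fin d → ℝ) : C(Fin d → ℝ, Fin d → ℝ) := ⟨fun y => y - w, by fun_prop⟩

lemma trC_cont : Continuous (trC d) := ContinuousMap.continuous_of_continuous_uncurry _ (by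
  simp only [trC, Function.uncurry_def]
  exact continuous_snd.sub continuous_fst)

lemma tr_lim [Fact (1 ≤ ENNReal.ofReal p)] (hp : 0 < p) (h : LpE d p) : Filter.Tendsto (fun w => ∫⁻ y, ‖h (y - w) - h y‖ₑ ^ p) (nhds 0) (nhds 0) := by
  have hmp : ∀ w, MeasurePreserving (trC d w) volume volume := fun w => measurePreserving_sub_right volume w
  have h1 := (Continuous.compMeasurePreservingLp (f := fun _ : Fin d → ℝ => h) continuous_const (trC_cont (d := d)) hmp (ofReal_ne_top (r := p)))
  have h2 : Filter.Tendsto (fun w => ‖Lp.compMeasurePreserving (trC d w) (hmp w) h - h‖ₑ ^ p) (nhds 0) (nhds (‖Lp.compMeasurePreserving (trC d 0) (hmp 0) h - h‖ₑ ^ p)) :=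
    ((ENNReal.continuous_rpow_const.comp (continuous_enorm.comp (h1.sub continuous_const))).tendsto 0)
  have e : ∀ w, ‖Lp.compMeasurePreserving (trC d w) (hmp w) h - h‖ₑ ^ p = ∫⁻ y, ‖h (y - w) - h y‖ₑ ^ p := by
    intro w
    rw [← Lp_lint hp]
    refine lintegral_congr_ae ?_
    filter_upwards [Lp.coeFn_sub (Lp.compMeasurePreserving (trC d w) (hmp w) h) h, Lp.coeFn_compMeasurePreserving h (hmp w)] with y h3 h4
    rw [h3, Pi.sub_apply, h4]
    rfl
  simp only [e] at h2
  simpa [hp] using h2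

lemma cv_diff (hpq : p.HolderConjugate q) {ρ : (Fin d → ℝ) → ℝ} (hρ : Ts ρ) (h0 : ∀ x, 0 ≤ ρ x) (h1 : ∫ x, ρ x = 1) (h : LpE d p) {C : ℝ≥0∞} (hC : ∀ w, ρ w ≠ 0 → ∫⁻ y, ‖h (y - w) - h y‖ₑ ^ p ≤ C) :
    ∫⁻ y, ‖cv h ρ y - h y‖ₑ ^ p ≤ C := by
  have hm := Lp_meas h
  have e : ∀ y, cv h ρ y - h y = ∫ w, (h (y - w) - h y) * ρ w := by
    intro y
    have i1 : Integrable fun w => h (y - w) * ρ w := by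
      have := (cv_int hpq h hρ y).comp_sub_left y
      simpa using this
    simp only [sub_mul]
    rw [integral_sub i1 (hρ.nice.int.const_mul _), integral_const_mul, h1, mul_one, cv_eq]
  simp only [e]
  exact jensen2 hpq hρ h0 h1 (k := fun y w => h (y - w) - h y) ((hm.comp (by fun_prop)).sub (hm.comp (by fun_prop))) hC

/-- Mollifiers. -/
def rb (d n : ℕ) : ContDiffBump (0 : Fin d → ℝ) := ⟨1 / (n + 2), 1 / (n + 1), by positivity, by
  apply one_div_lt_one_div_of_lt <;> linarith [(Nat.cast_nonneg n : (0:ℝ) ≤ n)]⟩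

/-- Mollifiers. -/
def rh (d n : ℕ) : (Fin d → ℝ) → ℝ := (rb d n).normed volume

lemma rh_ts (d n : ℕ) : Ts (rh d n) := ⟨(rb d n).contDiff_normed, (rb d n).hasCompactSupport_normed⟩
lemma rh_nonneg (d n : ℕ) (x : Fin d → ℝ) : 0 ≤ rh d n x := (rb d n).nonneg_normed x
lemma rh_one (d n : ℕ) : ∫ x, rh d n x = 1 := (rb d n).integral_normed

lemma rh_supp {d n : ℕ} {w : Fin d → ℝ} (hw : rh d n w ≠ 0) : ‖w‖ < 1 / ((n:ℝ) + 1) := by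
  have : w ∈ Function.support ((rb d n).normed volume) := hw
  rw [ContDiffBump.support_normed_eq, mem_ball_zero_iff] at this
  exact this

lemma rh_lim [Fact (1 ≤ ENNReal.ofReal p)] (hpq : p.HolderConjugate q) (h : LpE d p) : Filter.Tendsto (fun n => ∫⁻ y, ‖cv h (rh d n) y - h y‖ₑ ^ p) Filter.atTop (nhds 0) := by
  rw [ENNReal.tendsto_nhds_zero]
  intro C hC
  have h1 := (tr_lim hpq.pos h).eventually (Iic_mem_nhds hC)
  obtain ⟨r, hr, h2⟩ := Metric.eventually_nhds_iff.1 h1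
  filter_upwards [(tendsto_one_div_add_atTop_nhds_zero_nat (𝕜 := ℝ)).eventually (Iio_mem_nhds hr)] with n hn
  refine cv_diff hpq (rh_ts d n) (rh_nonneg d n) (rh_one d n) h fun w hw => ?_
  exact h2 (by rw [dist_zero_right]; exact (rh_supp hw).trans hn)

end

section
variable {d : ℕ} {T p q : ℝ} {A : ℝ → Fin d → Fin d → ℝ} {δ : ℝ → ℝ}

lemma cv_subr (hpq : p.HolderConjugate q) (h : LpE d p) {ρ σ : (Fin d → ℝ) → ℝ} (hρ : Ts ρ) (hσ : Ts σ) (y : Fin d → ℝ) :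
    cv h (fun x => ρ x - σ x) y = cv h ρ y - cv h σ y := by
  unfold cv
  rw [← integral_sub (cv_int hpq h hρ y) (cv_int hpq h hσ y)]
  simp only [mul_sub]

lemma pd_subr {ρ σ : (Fin d → ℝ) → ℝ} (hρ : Ts ρ) (hσ : Ts σ) (i : Fin d) : pd i (fun x => ρ x - σ x) = fun x => pd i ρ x - pd i σ x := by
  funext x
  unfold pd
  rw [fderiv_fun_sub (hρ.diff x) (hσ.diff x)]
  rfl

lemma enorm_sub_rpow (hp : 1 ≤ p) (a b : ℝ) : ‖a - b‖ₑ ^ p ≤ 2 ^ (p - 1) * (‖a‖ₑ ^ p + ‖b‖ₑ ^ p) := by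
  refine (ENNReal.rpow_le_rpow (enorm_sub_le) (by linarith)).trans ?_
  exact ENNReal.rpow_add_le_mul_rpow_add_rpow _ _ hp

lemma c2_ne : (2 : ℝ≥0∞) ^ (p - 1) ≠ ⊤ := by
  rw [← ENNReal.ofReal_ofNat 2, ENNReal.ofReal_rpow_of_pos (by norm_num)]; exact ofReal_ne_top

lemma lint_sub_rpow (hp : 1 ≤ p) {F G : (Fin d → ℝ) → ℝ} (hF : Measurable F) : ∫⁻ x, ‖F x - G x‖ₑ ^ p ≤ 2 ^ (p - 1) * ((∫⁻ x, ‖F x‖ₑ ^ p) + ∫⁻ x, ‖G x‖ₑ ^ p) := by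
  rw [← lintegral_add_left (by fun_prop), ← lintegral_const_mul' _ _ c2_ne]
  exact lintegral_mono fun x => enorm_sub_rpow hp _ _

/-- Difference of two mollifiers. -/
def rr (d : ℕ) (n : ℕ × ℕ) (x : Fin d → ℝ) : ℝ := rh d n.1 x - rh d n.2 x

lemma rr_ts (d : ℕ) (n : ℕ × ℕ) : Ts (rr d n) := (rh_ts d n.1).sub (rh_ts d n.2)

lemma rr_bd [Fact (1 ≤ ENNReal.ofReal p)] (hpq : p.HolderConjugate q) (h : LpE d p) (n : ℕ × ℕ) : ∫⁻ y, ‖cv h (rr d n) y‖ₑ ^ p ≤ 2 ^ (p - 1) * (‖h‖ₑ ^ p + ‖h‖ₑ ^ p) := by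
  have e : ∀ y, cv h (rr d n) y = cv h (rh d n.1) y - cv h (rh d n.2) y := fun y => cv_subr hpq h (rh_ts d n.1) (rh_ts d n.2) y
  simp only [e]
  refine (lint_sub_rpow hpq.lt.le (cvm hpq h (rh_ts d n.1))).trans ?_
  gcongr <;> exact cv_contr hpq (rh_ts d _) (rh_nonneg d _) (rh_one d _) h

lemma rr_lim [Fact (1 ≤ ENNReal.ofReal p)] (hpq : p.HolderConjugate q) (h : LpE d p) : Filter.Tendsto (fun n : ℕ × ℕ => ∫⁻ y, ‖cv h (rr d n) y‖ₑ ^ p) Filter.atTop (nhds 0) := by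
  have e : ∀ n y, cv h (rr d n) y = (cv h (rh d n.1) y - h y) - (cv h (rh d n.2) y - h y) := fun n y => by
    rw [sub_sub_sub_cancel_right]; exact cv_subr hpq h (rh_ts d n.1) (rh_ts d n.2) y
  have h1 := rh_lim hpq h
  have f1 : Filter.Tendsto (Prod.fst : ℕ × ℕ → ℕ) Filter.atTop Filter.atTop := by
    rw [← Filter.prod_atTop_atTop_eq]; exact Filter.tendsto_fst
  have f2 : Filter.Tendsto (Prod.snd : ℕ × ℕ → ℕ) Filter.atTop Filter.atTop := by
    rw [← Filter.prod_atTop_atTop_eq]; exact Filter.tendsto_snd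
  have h2 := ENNReal.Tendsto.const_mul ((h1.comp f1).add (h1.comp f2)) (Or.inr (c2_ne (p := p)))
  rw [add_zero, mul_zero] at h2
  refine tendsto_of_tendsto_of_tendsto_of_le_of_le tendsto_const_nhds h2 (fun _ => zero_le) fun n => ?_
  simp only [e]
  exact lint_sub_rpow hpq.lt.le ((cvm hpq h (rh_ts d n.1)).sub (Lp_meas h))

variable [Fact (1 ≤ ENNReal.ofReal p)] {f u : ℝ → LpE d p}

lemma Sol.cvf_lint_meas (h : Sol T p A f u) (hpq : p.HolderConjugate q) {ρ : (Fin d → ℝ) → ℝ} (hρ : Ts ρ) : Measurable fun t => ∫⁻ x, ‖cv (f t) ρ x‖ₑ ^ p := by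
  have h1 : Measurable fun y : ℝ × (Fin d → ℝ) => ‖cv (f y.1) ρ y.2‖ₑ ^ p := (h.cvf hpq hρ).enorm.pow_const p
  exact h1.lintegral_prod_right'

lemma Sol.cvu_lint_meas (h : Sol T p A f u) (hpq : p.HolderConjugate q) {ρ : (Fin d → ℝ) → ℝ} (hρ : Ts ρ) : Measurable fun t => ∫⁻ x, ‖cv (u t) ρ x‖ₑ ^ p := by
  have h1 : Measurable fun y : ℝ × (Fin d → ℝ) => ‖cv (u y.1) ρ y.2‖ₑ ^ p := (h.cvu hpq hρ).measurable.enorm.pow_const p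
  exact h1.lintegral_prod_right'

lemma Sol.claim2 (h : Sol T p A f u) (hA : Cf T A δ) (hpq : p.HolderConjugate q) (hp2 : 2 ≤ p) (hq2 : q ≤ 2) {ρ : (Fin d → ℝ) → ℝ} (hρ : Ts ρ) (i j : Fin d) :
    ∫⁻ t in Ioc 0 T, ENNReal.ofReal (δ t) * ∫⁻ x, ‖cv (u t) (pd i (pd j ρ)) x‖ₑ ^ p ≤ cM d q ^ p * ∫⁻ t in Ioc 0 T, ENNReal.ofReal (δ t ^ (1 - p)) * ∫⁻ x, ‖cv (f t) ρ x‖ₑ ^ p := by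
  have h1 := h.claim hA hpq hp2 hq2 hρ i j
  rw [h.FD_lint hA hpq hρ, hA.lint_nuZ (F := fun z => ‖cv (u z.1) (pd i (pd j ρ)) z.2‖ₑ ^ p) ((h.cvu hpq ((hρ.pd j).pd i)).measurable.enorm.pow_const p)] at h1
  exact h1

lemma Sol.e_lim (h : Sol T p A f u) (hA : Cf T A δ) (hpq : p.HolderConjugate q) (hK : ∫⁻ t in Ioc 0 T, ENNReal.ofReal (δ t ^ (1 - p)) * ‖f t‖ₑ ^ p ≠ ⊤) :
    Filter.Tendsto (fun n : ℕ × ℕ => ∫⁻ t in Ioc 0 T, ENNReal.ofReal (δ t ^ (1 - p)) * ∫⁻ x, ‖cv (f t) (rr d n) x‖ₑ ^ p) Filter.atTop (nhds 0) := by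
  have hd := hA.dm
  have h0 : ∫⁻ t in Ioc 0 T, (0:ℝ≥0∞) = 0 := by simp
  rw [← h0]
  refine tendsto_lintegral_filter_of_dominated_convergence (fun t => 2 ^ (p - 1) * (2 * (ENNReal.ofReal (δ t ^ (1 - p)) * ‖f t‖ₑ ^ p))) (Filter.Eventually.of_forall fun n => ?_) (Filter.Eventually.of_forall fun n => Filter.Eventually.of_forall fun t => ?_) ?_ (Filter.Eventually.of_forall fun t => ?_)
  · exact Measurable.mul (by fun_prop) (h.cvf_lint_meas hpq (rr_ts d n))
  · refine (mul_le_mul_right (rr_bd hpq (f t) n) _).trans (le_of_eq ?_)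
    ring
  · rw [lintegral_const_mul' _ _ c2_ne, lintegral_const_mul' _ _ (by simp)]
    exact mul_ne_top c2_ne (mul_ne_top (by simp) hK)
  · have := ENNReal.Tendsto.const_mul (rr_lim hpq (f t)) (Or.inr (ofReal_ne_top (r := δ t ^ (1 - p))))
    rwa [mul_zero] at this

/-- Integration by parts for the mollified function. -/
lemma cv_parts (hpq : p.HolderConjugate q) (h : LpE d p) {ρ φ : (Fin d → ℝ) → ℝ} (hρ : Ts ρ) (hφ : Ts φ) (i j : Fin d) :
    ∫ z, φ z * cv h (pd i (pd j ρ)) z = ∫ z, pd j (pd i φ) z * cv h ρ z := by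
  rw [cv_fub hpq h ((hρ.pd j).pd i) hφ.nice.int hφ.nice.meas, cv_fub hpq h hρ ((hφ.pd i).pd j).nice.int ((hφ.pd i).pd j).nice.meas]
  refine integral_congr_ae (Filter.Eventually.of_forall fun y => ?_)
  simp only
  congr 1
  have h1 := cos_parts (f := φ) (f' := pd i φ) (i := i) hφ.diff (fun z => rfl) (hφ.pd i).cont ((hρ.pd j).trans y)
  have h2 := cos_parts (f := pd i φ) (f' := pd j (pd i φ)) (i := j) (hφ.pd i).diff (fun z => rfl) ((hφ.pd i).pd j).cont (hρ.trans y)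
  simp only [pd_trans] at h1 h2
  rw [h1, h2, neg_neg]

end

section
variable {d : ℕ} {T p q : ℝ} {A : ℝ → Fin d → Fin d → ℝ} {δ : ℝ → ℝ}

lemma memLp_of (hp : 0 < p) {g : (Fin d → ℝ) → ℝ} (hg : Measurable g) (h : ∫⁻ x, ‖g x‖ₑ ^ p ≠ ⊤) : MemLp g (ENNReal.ofReal p) volume := by
  refine ⟨hg.aestronglyMeasurable, ?_⟩
  rw [← nrm_eq hp]
  exact ENNReal.rpow_lt_top_of_nonneg (by positivity) h

lemma toLp_lint (hp : 0 < p) {g : (Fin d → ℝ) → ℝ} (h : MemLp g (ENNReal.ofReal p) volume) : ‖h.toLp g‖ₑ ^ p = ∫⁻ x, ‖g x‖ₑ ^ p := by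
  rw [← Lp_lint hp]
  refine lintegral_congr_ae ?_
  filter_upwards [h.coeFn_toLp] with x hx
  rw [hx]

variable [Fact (1 ≤ ENNReal.ofReal p)]

lemma pair_le (hpq : p.HolderConjugate q) {g : (Fin d → ℝ) → ℝ} (hg : Measurable g) {φ : (Fin d → ℝ) → ℝ} (hφ : Ts φ) {C : ℝ≥0∞} (h : ∫⁻ x, ‖g x‖ₑ ^ p ≤ C ^ p) :
    ‖∫ x, g x * φ x‖ₑ ≤ C * nrm q φ volume := by
  refine (holder_enorm hpq hg.aestronglyMeasurable hφ.nice.meas.aestronglyMeasurable).trans ?_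
  refine mul_le_mul_left ?_ _
  rw [← nrm_rpow hpq.pos] at h
  exact (ENNReal.rpow_le_rpow_iff hpq.pos).1 h

lemma pair_lim (hpq : p.HolderConjugate q) (L : LpE d p) {g : ℕ → (Fin d → ℝ) → ℝ} (hg : ∀ k, Measurable (g k)) (hgl : ∀ k, MemLp (g k) (ENNReal.ofReal p) volume) {φ : (Fin d → ℝ) → ℝ} (hφ : Ts φ)
    (h : Filter.Tendsto (fun k => ∫⁻ x, ‖g k x - L x‖ₑ ^ p) Filter.atTop (nhds 0)) :
    Filter.Tendsto (fun k => ∫ x, g k x * φ x) Filter.atTop (nhds (∫ x, L x * φ x)) := by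
  rw [tendsto_iff_edist_tendsto_0]
  have hp := hpq.pos
  have h1 : Filter.Tendsto (fun k => (∫⁻ x, ‖g k x - L x‖ₑ ^ p) ^ (1 / p) * nrm q φ volume) Filter.atTop (nhds 0) := by
    have := ENNReal.Tendsto.mul_const (b := nrm q φ volume) (h.ennrpow_const (1 / p)) (Or.inr (hφ.nice.nrm_lt hpq.symm.lt.le).ne)
    rwa [ENNReal.zero_rpow_of_pos (by positivity), zero_mul] at this
  refine tendsto_of_tendsto_of_tendsto_of_le_of_le tendsto_const_nhds h1 (fun _ => zero_le) fun k => ?_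
  have i1 : Integrable fun x => g k x * φ x := by
    refine (Lp_mul_int hpq ((hgl k).toLp _) hφ.nice).congr ?_
    filter_upwards [(hgl k).coeFn_toLp] with x hx
    rw [hx]
  simp only
  rw [edist_eq_enorm_sub, ← integral_sub i1 (Lp_mul_int hpq L hφ.nice)]
  simp only [← sub_mul]
  refine pair_le hpq ((hg k).sub (Lp_meas L)) hφ (le_of_eq ?_)
  rw [← ENNReal.rpow_mul, one_div, inv_mul_cancel₀ hp.ne', ENNReal.rpow_one]
  rfl

lemma lp_lim (hpq : p.HolderConjugate q) {g : ℕ → (Fin d → ℝ) → ℝ} (hg : ∀ k, Measurable (g k)) (hgl : ∀ k, ∫⁻ x, ‖g k x‖ₑ ^ p ≠ ⊤) {C : ℝ≥0∞} (hC : C ≠ ⊤) (h : ∀ k, ∫⁻ x, ‖g k x - g (k + 1) x‖ₑ ^ p ≤ (C / 2 ^ k) ^ p) :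
    ∃ L : LpE d p, Filter.Tendsto (fun k => ∫⁻ x, ‖g k x - L x‖ₑ ^ p) Filter.atTop (nhds 0) ∧ Filter.Tendsto (fun k => ∫⁻ x, ‖g k x‖ₑ ^ p) Filter.atTop (nhds (‖L‖ₑ ^ p)) := by
  have hp := hpq.pos
  have hm : ∀ k, MemLp (g k) (ENNReal.ofReal p) volume := fun k => memLp_of hp (hg k) (hgl k)
  have hc : CauchySeq fun k => (hm k).toLp (g k) := by
    refine cauchySeq_of_edist_le_geometric_two C hC fun k => ?_
    rw [edist_eq_enorm_sub, ← MemLp.toLp_sub, ← ENNReal.rpow_le_rpow_iff hp, toLp_lint hp]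
    exact h k
  obtain ⟨L, hL⟩ := cauchySeq_tendsto_of_complete hc
  refine ⟨L, ?_, ?_⟩
  · have h1 := ((hL.sub_const L).enorm).ennrpow_const p
    rw [sub_self, enorm_zero, ENNReal.zero_rpow_of_pos hp] at h1
    refine h1.congr fun k => ?_
    rw [← Lp_lint hp]
    refine lintegral_congr_ae ?_
    filter_upwards [Lp.coeFn_sub ((hm k).toLp (g k)) L, (hm k).coeFn_toLp] with x h3 h4
    rw [h3, Pi.sub_apply, h4]
  · have h1 := (hL.enorm).ennrpow_const p
    exact h1.congr fun k => toLp_lint hp (hm k)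

/-- Pointwise-in-time identification of the limit. -/
lemma lim_t (hpq : p.HolderConjugate q) (h : LpE d p) (i j : Fin d) {n : ℕ → ℕ} (hn : Filter.Tendsto n Filter.atTop Filter.atTop)
    (hgl : ∀ k, ∫⁻ x, ‖cv h (pd i (pd j (rh d (n k)))) x‖ₑ ^ p ≠ ⊤) {C : ℝ≥0∞} (hC : C ≠ ⊤)
    (hd : ∀ k, ∫⁻ x, ‖cv h (pd i (pd j (rr d (n k, n (k + 1))))) x‖ₑ ^ p ≤ (C / 2 ^ k) ^ p) :
    ∃ L : LpE d p, (∀ φ, Ts φ → ∫ x, h x * pd j (pd i φ) x = ∫ x, L x * φ x) ∧ Filter.Tendsto (fun k => ∫⁻ x, ‖cv h (pd i (pd j (rh d (n k)))) x‖ₑ ^ p) Filter.atTop (nhds (‖L‖ₑ ^ p)) := by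
  have ts : ∀ k, Ts (rh d k) := rh_ts d
  have hp := hpq.pos
  have hm : ∀ k, Measurable (cv h (pd i (pd j (rh d (n k))))) := fun k => cvm hpq h (((ts _).pd j).pd i)
  have e : ∀ k x, cv h (pd i (pd j (rr d (n k, n (k + 1))))) x = cv h (pd i (pd j (rh d (n k)))) x - cv h (pd i (pd j (rh d (n (k + 1))))) x := by
    intro k x
    have e1 : rr d (n k, n (k + 1)) = fun x => rh d (n k) x - rh d (n (k + 1)) x := rfl
    rw [e1, pd_subr (ts _) (ts _), pd_subr ((ts _).pd j) ((ts _).pd j), cv_subr hpq h (((ts _).pd j).pd i) (((ts _).pd j).pd i)]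
  simp only [e] at hd
  obtain ⟨L, h1, h2⟩ := lp_lim hpq hm hgl hC hd
  refine ⟨L, fun φ hφ => ?_, h2⟩
  have h3 := pair_lim hpq L hm (fun k => memLp_of hp (hm k) (hgl k)) hφ h1
  have h4 := pair_lim hpq h (g := fun k => cv h (rh d (n k))) (fun k => cvm hpq h (ts _)) (fun k => memLp_of hp (cvm hpq h (ts _)) ?_) ((hφ.pd i).pd j) ((rh_lim hpq h).comp hn)
  · refine tendsto_nhds_unique h4 (h3.congr fun k => ?_)
    have := cv_parts hpq h (ts (n k)) hφ i j
    simp only [mul_comm] at this ⊢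
    exact this
  · refine ne_top_of_le_ne_top (ENNReal.rpow_ne_top_of_nonneg hp.le ?_) (cv_contr hpq (rh_ts d _) (rh_nonneg d _) (rh_one d _) h)
    exact enorm_ne_top

variable {f u : ℝ → LpE d p}

lemma Sol.lim (h : Sol T p A f u) (hA : Cf T A δ) (hpq : p.HolderConjugate q) (hp2 : 2 ≤ p) (hq2 : q ≤ 2) (hK : ∫⁻ t in Ioc 0 T, ENNReal.ofReal (δ t ^ (1 - p)) * ‖f t‖ₑ ^ p ≠ ⊤) (i j : Fin d) :
    ∃ w : ℝ → LpE d p, (∀ᵐ t ∂(volume.restrict (Ioc 0 T)), ∀ φ, Ts φ → ∫ x, u t x * pd j (pd i φ) x = ∫ x, w t x * φ x) ∧ AEMeasurable (fun t => ‖w t‖ₑ ^ p) (volume.restrict (Ioc 0 T)) ∧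
      ∫⁻ t in Ioc 0 T, ENNReal.ofReal (δ t) * ‖w t‖ₑ ^ p ≤ cM d q ^ p * ∫⁻ t in Ioc 0 T, ENNReal.ofReal (δ t ^ (1 - p)) * ‖f t‖ₑ ^ p := by
  have hp := hpq.pos
  have hdm := hA.dm
  have ts : ∀ k, Ts (rh d k) := rh_ts d
  set K := ∫⁻ t in Ioc 0 T, ENNReal.ofReal (δ t ^ (1 - p)) * ‖f t‖ₑ ^ p with hKd
  have hcM : cM d q ^ p ≠ ⊤ := ENNReal.rpow_ne_top_of_nonneg hp.le (cM_ne_top d hpq.symm.pos)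
  have b1 : ∀ n, ∫⁻ t in Ioc 0 T, ENNReal.ofReal (δ t) * ∫⁻ x, ‖cv (u t) (pd i (pd j (rh d n))) x‖ₑ ^ p ≤ cM d q ^ p * K := fun n =>
    (h.claim2 hA hpq hp2 hq2 (ts n) i j).trans (mul_le_mul_right (lintegral_mono fun t => mul_le_mul_right (cv_contr hpq (rh_ts d n) (rh_nonneg d n) (rh_one d n) (f t)) _) _)
  have hl := ENNReal.Tendsto.const_mul (h.e_lim hA hpq hK) (Or.inr hcM)
  rw [mul_zero] at hl
  have hx : ∀ k : ℕ, ∀ᶠ n in Filter.atTop, ∀ m ≥ n, cM d q ^ p * ∫⁻ t in Ioc 0 T, ENNReal.ofReal (δ t ^ (1 - p)) * ∫⁻ x, ‖cv (f t) (rr d (n, m)) x‖ₑ ^ p ≤ (2⁻¹ ^ k) ^ p * 2⁻¹ ^ k := by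
    intro k
    have hpos : (0 : ℝ≥0∞) < (2⁻¹ ^ k) ^ p * 2⁻¹ ^ k := by
      have h2 : (2⁻¹ : ℝ≥0∞) ^ k ≠ 0 := pow_ne_zero _ (by simp)
      have h3 : (2⁻¹ : ℝ≥0∞) ^ k ≠ ⊤ := ENNReal.pow_ne_top (by simp)
      exact ENNReal.mul_pos (ENNReal.rpow_pos (pos_iff_ne_zero.2 h2) h3).ne' h2
    have h1 := (hl.eventually (Iic_mem_nhds hpos))
    rw [Filter.eventually_atTop_prod_self] at h1
    obtain ⟨N, hN⟩ := h1
    filter_upwards [Filter.eventually_ge_atTop N] with n hn m hm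
    exact hN n m hn (hn.trans hm)
  obtain ⟨n, hn, hnk⟩ := Filter.extraction_forall_of_eventually hx
  have b2 : ∀ k, ∫⁻ t in Ioc 0 T, ENNReal.ofReal (δ t) * ∫⁻ x, ‖cv (u t) (pd i (pd j (rr d (n k, n (k + 1))))) x‖ₑ ^ p ≤ (2⁻¹ ^ k) ^ p * 2⁻¹ ^ k := fun k =>
    (h.claim2 hA hpq hp2 hq2 (rr_ts d _) i j).trans (hnk k _ (hn (Nat.lt_succ_self k)).le)
  have mD : ∀ {ρ : (Fin d → ℝ) → ℝ}, Ts ρ → Measurable fun t => ENNReal.ofReal (δ t) * ∫⁻ x, ‖cv (u t) (pd i (pd j ρ)) x‖ₑ ^ p := fun hρ =>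
    Measurable.mul (by fun_prop) (h.cvu_lint_meas hpq ((hρ.pd j).pd i))
  have a1 : ∀ᵐ t ∂(volume.restrict (Ioc 0 T)), ∀ n, ENNReal.ofReal (δ t) * ∫⁻ x, ‖cv (u t) (pd i (pd j (rh d n))) x‖ₑ ^ p < ⊤ :=
    ae_all_iff.2 fun n => ae_lt_top (mD (ts n)) (ne_top_of_le_ne_top (mul_ne_top hcM hK) (b1 n))
  have c0 : ∀ k : ℕ, ((2:ℝ≥0∞) ^ k) ^ p ≠ ⊤ := fun k => ENNReal.rpow_ne_top_of_nonneg hp.le (ENNReal.pow_ne_top (by simp))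
  have b3 : ∫⁻ t in Ioc 0 T, ∑' k, ((2:ℝ≥0∞) ^ k) ^ p * (ENNReal.ofReal (δ t) * ∫⁻ x, ‖cv (u t) (pd i (pd j (rr d (n k, n (k + 1))))) x‖ₑ ^ p) ≠ ⊤ := by
    rw [lintegral_tsum fun k => ((mD (rr_ts d _)).const_mul _).aemeasurable]
    have : ∑' k : ℕ, (2⁻¹ : ℝ≥0∞) ^ k ≠ ⊤ := by
      rw [ENNReal.tsum_geometric]; simp
    refine ne_top_of_le_ne_top this (ENNReal.tsum_le_tsum fun k => ?_)
    rw [lintegral_const_mul' _ _ (c0 k)]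
    refine (mul_le_mul_right (b2 k) _).trans (le_of_eq ?_)
    rw [← mul_assoc, ← ENNReal.mul_rpow_of_nonneg _ _ hp.le, ← mul_pow, ENNReal.mul_inv_cancel (by simp) (by simp), one_pow, ENNReal.one_rpow, one_mul]
  have a2 := ae_lt_top (Measurable.tsum fun k => (mD (rr_ts d (n k, n (k + 1)))).const_mul _) b3
  have a3 : ∀ᵐ t ∂(volume.restrict (Ioc 0 T)), ∃ L : LpE d p, (∀ φ, Ts φ → ∫ x, u t x * pd j (pd i φ) x = ∫ x, L x * φ x) ∧ Filter.Tendsto (fun k => ∫⁻ x, ‖cv (u t) (pd i (pd j (rh d (n k)))) x‖ₑ ^ p) Filter.atTop (nhds (‖L‖ₑ ^ p)) := by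
    filter_upwards [a1, a2] with t h1 h2
    have hδ : ENNReal.ofReal (δ t) ≠ 0 := (ENNReal.ofReal_pos.2 (hA.dpos t)).ne'
    set S := ∑' k, ((2:ℝ≥0∞) ^ k) ^ p * (ENNReal.ofReal (δ t) * ∫⁻ x, ‖cv (u t) (pd i (pd j (rr d (n k, n (k + 1))))) x‖ₑ ^ p) with hS
    refine lim_t hpq (u t) i j hn.tendsto_atTop (fun k hk => ?_) (C := (S / ENNReal.ofReal (δ t)) ^ (1 / p)) ?_ fun k => ?_
    · have := h1 (n k)
      rw [hk, ENNReal.mul_top hδ] at this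
      exact lt_irrefl _ this
    · exact ENNReal.rpow_ne_top_of_nonneg (by positivity) (ENNReal.div_ne_top h2.ne hδ)
    · have h3 := ENNReal.le_tsum (f := fun k => ((2:ℝ≥0∞) ^ k) ^ p * (ENNReal.ofReal (δ t) * ∫⁻ x, ‖cv (u t) (pd i (pd j (rr d (n k, n (k + 1))))) x‖ₑ ^ p)) k
      rw [← hS] at h3
      have c1 : ((2:ℝ≥0∞) ^ k) ^ p ≠ 0 := (ENNReal.rpow_pos (pos_iff_ne_zero.2 (pow_ne_zero k (by simp))) (ENNReal.pow_ne_top (by simp))).ne'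
      rw [ENNReal.div_rpow_of_nonneg _ _ hp.le, ← ENNReal.rpow_mul, one_div, inv_mul_cancel₀ hp.ne', ENNReal.rpow_one, ENNReal.le_div_iff_mul_le (Or.inl c1) (Or.inl (c0 k)), ENNReal.le_div_iff_mul_le (Or.inl hδ) (Or.inl ofReal_ne_top)]
      refine le_trans (le_of_eq ?_) h3
      ring
  classical
  let w : ℝ → LpE d p := fun t => if ht : ∃ L : LpE d p, (∀ φ, Ts φ → ∫ x, u t x * pd j (pd i φ) x = ∫ x, L x * φ x) ∧ Filter.Tendsto (fun k => ∫⁻ x, ‖cv (u t) (pd i (pd j (rh d (n k)))) x‖ₑ ^ p) Filter.atTop (nhds (‖L‖ₑ ^ p)) then ht.choose else 0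
  have hw : ∀ᵐ t ∂(volume.restrict (Ioc 0 T)), (∀ φ, Ts φ → ∫ x, u t x * pd j (pd i φ) x = ∫ x, w t x * φ x) ∧ Filter.Tendsto (fun k => ∫⁻ x, ‖cv (u t) (pd i (pd j (rh d (n k)))) x‖ₑ ^ p) Filter.atTop (nhds (‖w t‖ₑ ^ p)) := by
    filter_upwards [a3] with t ht
    simp only [w, dif_pos ht]
    exact ht.choose_spec
  refine ⟨w, hw.mono fun t ht => ht.1, aemeasurable_of_tendsto_metrizable_ae Filter.atTop (fun k => (h.cvu_lint_meas hpq (((ts (n k)).pd j).pd i)).aemeasurable) (hw.mono fun t ht => ht.2), ?_⟩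
  calc ∫⁻ t in Ioc 0 T, ENNReal.ofReal (δ t) * ‖w t‖ₑ ^ p = ∫⁻ t in Ioc 0 T, Filter.liminf (fun k => ENNReal.ofReal (δ t) * ∫⁻ x, ‖cv (u t) (pd i (pd j (rh d (n k)))) x‖ₑ ^ p) Filter.atTop := by
        refine lintegral_congr_ae (hw.mono fun t ht => ?_)
        exact (ENNReal.Tendsto.const_mul ht.2 (Or.inr ofReal_ne_top)).liminf_eq.symm
    _ ≤ Filter.liminf (fun k => ∫⁻ t in Ioc 0 T, ENNReal.ofReal (δ t) * ∫⁻ x, ‖cv (u t) (pd i (pd j (rh d (n k)))) x‖ₑ ^ p) Filter.atTop := lintegral_liminf_le fun k => mD (ts _)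
    _ ≤ Filter.liminf (fun _ : ℕ => cM d q ^ p * K) Filter.atTop := Filter.liminf_le_liminf (Filter.Eventually.of_forall fun k => b1 _)
    _ = cM d q ^ p * K := Filter.liminf_const _

end

section
variable {d : ℕ} {T p q : ℝ}

lemma qf_cont (M : Fin d → Fin d → ℝ) : Continuous (qf M) := by unfold qf; fun_prop
lemma n2_cont : Continuous (n2 : (Fin d → ℝ) → ℝ) := by unfold n2; fun_prop

lemma delta_meas {a : ℝ → Fin d → Fin d → ℝ} (ha : ∀ i j, Measurable fun t => a t i j) {δ : ℝ → ℝ}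
    (hδ : ∀ t ∈ Ioc 0 T, (∀ ξ, δ t * n2 ξ ≤ qf (a t) ξ) ∧ ∃ ξ, n2 ξ = 1 ∧ qf (a t) ξ = δ t) :
    Measurable fun t => if t ∈ Ioc 0 T then δ t else 1 := by
  refine measurable_of_Ici fun c => ?_
  obtain ⟨D, hDc, hDd⟩ := TopologicalSpace.exists_countable_dense (Fin d → ℝ)
  have e : (fun t => if t ∈ Ioc 0 T then δ t else 1) ⁻¹' Ici c = (Ioc 0 T ∩ ⋂ ξ ∈ D, {t | c * n2 ξ ≤ qf (a t) ξ}) ∪ ((Ioc 0 T)ᶜ ∩ {_t : ℝ | c ≤ 1}) := by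
    ext t
    by_cases ht : t ∈ Ioc 0 T
    · simp only [mem_preimage, if_pos ht, mem_Ici, mem_union, mem_inter_iff, ht, true_and, mem_compl_iff, not_true_eq_false, false_and, or_false, mem_iInter, Set.mem_ofPred_eq]
      obtain ⟨h1, ξ0, h2, h3⟩ := hδ t ht
      constructor
      · intro hc ξ _
        exact (mul_le_mul_of_nonneg_right hc (n2_nonneg ξ)).trans (h1 ξ)
      · intro hc
        have hcl : IsClosed {ξ : Fin d → ℝ | c * n2 ξ ≤ qf (a t) ξ} := isClosed_le (continuous_const.mul n2_cont) (qf_cont _)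
        have h4 : ξ0 ∈ {ξ : Fin d → ℝ | c * n2 ξ ≤ qf (a t) ξ} := hcl.closure_subset_iff.2 (fun ξ hξ => hc ξ hξ) (hDd ξ0)
        have h5 : c * n2 ξ0 ≤ qf (a t) ξ0 := h4
        rwa [h2, h3, mul_one] at h5
    · simp [-mem_Ioc, ht]
  rw [e]
  refine (measurableSet_Ioc.inter (MeasurableSet.biInter hDc fun ξ _ => measurableSet_le measurable_const ?_)).union (measurableSet_Ioc.compl.inter (MeasurableSet.const _))
  unfold qf
  exact Finset.measurable_sum _ fun i _ => Finset.measurable_sum _ fun j _ => ((ha i j).mul_const _).mul_const _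

open scoped Classical in
/-- Cleaned-up coefficients. -/
def A' (T : ℝ) (a : ℝ → Fin d → Fin d → ℝ) (δ : ℝ → ℝ) (t : ℝ) (i j : Fin d) : ℝ := if t ∈ Ioc 0 T ∧ 0 < δ t then a t i j else if i = j then 1 else 0

open scoped Classical in
/-- Cleaned-up ellipticity. -/
def δ' (T : ℝ) (δ : ℝ → ℝ) (t : ℝ) : ℝ := if t ∈ Ioc 0 T ∧ 0 < δ t then δ t else 1

lemma le_aMax (a : ℝ → Fin d → Fin d → ℝ) (t : ℝ) (i j : Fin d) : |a t i j| ≤ aMax a t := by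
  unfold aMax
  exact (le_ciSup (f := fun j => |a t i j|) (Set.finite_range _).bddAbove j).trans (le_ciSup (f := fun i => ⨆ j, |a t i j|) (Set.finite_range _).bddAbove i)

lemma mk_Cf (hd : 0 < d) (hT : 0 < T) {a : ℝ → Fin d → Fin d → ℝ} (ha : ∀ i j, Measurable fun t => a t i j) (hs : ∀ t ∈ Ioc (0:ℝ) T, ∀ i j, a t i j = a t j i)
    (hI : IntegrableOn (aMax a) (Ioc (0:ℝ) T)) {δ : ℝ → ℝ}
    (hδ : ∀ t ∈ Ioc 0 T, (∀ ξ, δ t * n2 ξ ≤ qf (a t) ξ) ∧ ∃ ξ, n2 ξ = 1 ∧ qf (a t) ξ = δ t) : Cf T (A' T a δ) (δ' T δ) := by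
  have hm := delta_meas ha hδ
  have hG : MeasurableSet {t | t ∈ Ioc 0 T ∧ 0 < δ t} := by
    have : {t | t ∈ Ioc 0 T ∧ 0 < δ t} = Ioc 0 T ∩ (fun t => if t ∈ Ioc 0 T then δ t else 1) ⁻¹' Ioi 0 := by
      ext t
      by_cases ht : t ∈ Ioc 0 T <;> simp [-mem_Ioc, ht]
    rw [this]
    exact measurableSet_Ioc.inter (hm measurableSet_Ioi)
  have dm : Measurable (δ' T δ) := by
    have : δ' T δ = fun t => if t ∈ {t | t ∈ Ioc 0 T ∧ 0 < δ t} then (if t ∈ Ioc 0 T then δ t else 1) else 1 := by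
      funext t
      unfold δ'
      by_cases ht : t ∈ Ioc 0 T <;> simp [-mem_Ioc, ht]
    rw [this]
    exact Measurable.ite hG hm measurable_const
  have dpos : ∀ t, 0 < δ' T δ t := by
    intro t
    unfold δ'
    split_ifs with h
    · exact h.2
    · exact one_pos
  have am : ∀ i j, Measurable fun t => A' T a δ t i j := fun i j => Measurable.ite hG (ha i j) measurable_const
  have aint : ∀ i j, LocallyIntegrable fun t => A' T a δ t i j := by
    intro i j
    have h1 : LocallyIntegrable (fun t => (Ioc 0 T).indicator (aMax a) t + 1) volume := (hI.integrable_indicator measurableSet_Ioc).locallyIntegrable.add (locallyIntegrable_const 1)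
    refine h1.mono (am i j).aestronglyMeasurable (Filter.Eventually.of_forall fun t => ?_)
    have h0 : 0 ≤ (Ioc 0 T).indicator (aMax a) t := indicator_nonneg (fun s _ => (abs_nonneg _).trans (le_aMax a s i j)) t
    rw [Real.norm_eq_abs, Real.norm_eq_abs, abs_of_nonneg (by linarith : (0:ℝ) ≤ (Ioc 0 T).indicator (aMax a) t + 1)]
    unfold A'
    split_ifs with h h'
    · rw [indicator_of_mem h.1]
      linarith [le_aMax a t i j]
    · simp; exact h0
    · simp; linarith
  have low : ∀ t ξ, δ' T δ t * n2 ξ ≤ qf (A' T a δ t) ξ := by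
    intro t ξ
    by_cases h : t ∈ Ioc 0 T ∧ 0 < δ t
    · have e : A' T a δ t = a t := by funext i j; simp only [A', if_pos h]
      rw [e]; simp only [δ', if_pos h]
      exact (hδ t h.1).1 ξ
    · have e : A' T a δ t = fun i j => if i = j then 1 else 0 := by funext i j; simp only [A', if_neg h]
      rw [e]; simp only [δ', if_neg h]
      simp [qf, n2, sq]
  refine ⟨hT, dm, dpos, ?_, ?_, am, aint, ?_, low⟩
  · refine (aint ⟨0, hd⟩ ⟨0, hd⟩).mono dm.aestronglyMeasurable (Filter.Eventually.of_forall fun t => ?_)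
    rw [Real.norm_of_nonneg (dpos t).le]
    refine le_trans ?_ (Real.le_norm_self _)
    have := low t (Pi.single ⟨0, hd⟩ 1)
    simpa [qf, n2, Pi.single_apply] using this
  · intro t ht
    simp only [δ', ht, false_and, if_false]
  · intro t i j
    unfold A'
    split_ifs with h h1 h2 h2
    · exact hs t h.1 i j
    · rfl
    · exact absurd h1.symm h2
    · exact absurd h2.symm h1
    · rfl

lemma young (hp : 2 ≤ p) {a b : ℝ} (ha : 0 ≤ a) (hb : 0 < b) : a ≤ a ^ p * b ^ (1 - p) + b := by
  have h0 : 0 ≤ a ^ p * b ^ (1 - p) := by positivity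
  rcases le_or_gt a b with h | h
  · linarith
  · have ha' : 0 < a := hb.trans h
    have h1 : a ^ (1 - p) ≤ b ^ (1 - p) := Real.rpow_le_rpow_of_nonpos hb h.le (by linarith)
    have h2 : a = a ^ p * a ^ (1 - p) := by
      rw [← Real.rpow_add ha', add_sub_cancel, Real.rpow_one]
    have h3 : a ^ p * a ^ (1 - p) ≤ a ^ p * b ^ (1 - p) := mul_le_mul_of_nonneg_left h1 (by positivity)
    linarith

variable [Fact (1 ≤ ENNReal.ofReal p)]

lemma mk_Sol (hp : 2 ≤ p) (hT : 0 < T) {a : ℝ → Fin d → Fin d → ℝ} {δ : ℝ → ℝ} (hA : Cf T (A' T a δ) (δ' T δ)) (hpos : ∀ᵐ t ∂(volume.restrict (Ioc (0:ℝ) T)), 0 < δ t)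
    {f u : ℝ → LpE d p} (hf : AEStronglyMeasurable f (volume.restrict (Ioc (0:ℝ) T)))
    (hfi : IntegrableOn (fun t => ‖f t‖ ^ p * δ t ^ (1 - p)) (Ioc (0:ℝ) T))
    (hw : IsWeakSolution (ENNReal.ofReal p) T a 0 f u) (hu : ContinuousOn u (Icc (0:ℝ) T)) :
    Sol T p (A' T a δ) ((Ioc 0 T).indicator (hf.mk f)) (IccExtend hT.le ((Icc 0 T).domRestrict u)) := by
  have hue : ∀ t ∈ Icc 0 T, IccExtend hT.le ((Icc 0 T).domRestrict u) t = u t := fun t ht => by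
    rw [IccExtend_of_mem _ _ ht]; rfl
  have hdi : IntegrableOn (δ' T δ) (Ioc 0 T) := (intervalIntegrable_iff_integrableOn_Ioc_of_le hT.le).1 (hA.dii 0 T)
  have hfm : StronglyMeasurable ((Ioc 0 T).indicator (hf.mk f)) := hf.stronglyMeasurable_mk.indicator measurableSet_Ioc
  refine ⟨hfm, ?_, hu.domRestrict.Icc_extend', ?_, ?_⟩
  · have e : (fun t => ‖(Ioc 0 T).indicator (hf.mk f) t‖) = (Ioc 0 T).indicator fun t => ‖hf.mk f t‖ := by
      funext t; exact norm_indicator_eq_indicator_norm _ _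
    rw [e, integrable_indicator_iff measurableSet_Ioc]
    refine (Integrable.add hfi hdi).mono' hf.stronglyMeasurable_mk.norm.aestronglyMeasurable ?_
    filter_upwards [hf.ae_eq_mk, hpos, ae_restrict_mem measurableSet_Ioc] with t h1 h2 h3
    rw [← h1, norm_norm]
    simp only [Pi.add_apply, δ', h3, h2, true_and, if_true]
    exact young hp (norm_nonneg _) h2
  · obtain ⟨M, hM⟩ := isCompact_Icc.exists_bound_of_continuousOn hu
    exact ⟨M, fun t => hM _ (projIcc 0 T hT.le t).2⟩
  · intro φ hφ t ht
    have h1 := hw φ hφ.sm hφ.cs t ht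
    have h0 : ∫ x, (0 : LpE d p) x * φ x = 0 := by
      rw [integral_eq_zero_of_ae]
      filter_upwards [Lp.coeFn_zero ℝ (ENNReal.ofReal p) (volume : Measure (Fin d → ℝ))] with x hx
      rw [hx]; simp
    rw [h0, zero_add] at h1
    rw [hue t ht, h1]
    refine integral_congr_ae (ae_restrict_of_ae_restrict_of_subset (Ioc_subset_Ioc_right ht.2) ?_)
    filter_upwards [hf.ae_eq_mk, hpos, ae_restrict_mem measurableSet_Ioc] with s h2 h3 h4
    rw [indicator_of_mem h4, ← h2, hue s ⟨h4.1.le, h4.2⟩]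
    simp only [A', h3, h4, true_and, if_true]

end

/-- Weighted second-derivative estimate for degenerate coefficients: if `δ(t)` is the smallest
eigenvalue of `A(t)` and `δ(t) > 0` a.e., then a continuous weak solution with zero initial
data has second derivatives in `L_p` for a.e. `t`, and
`∫_0^T Σ ‖u_{x^ix^j}(t)‖_{L_p}^p δ(t) dt ≤ N ∫_0^T ‖f(t)‖_{L_p}^p δ(t)^{1-p} dt`
with `N = N(d,p)`. -/
theorem weighted_second_derivative_estimate (d : ℕ) (hd : 0 < d)
    (p : ℝ) (hp : 2 ≤ p) [Fact (1 ≤ ENNReal.ofReal p)] :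
    ∃ N : ℝ, 0 < N ∧
      ∀ (T : ℝ), 0 < T →
      ∀ (a : ℝ → Fin d → Fin d → ℝ),
        (∀ i j, Measurable fun t => a t i j) →
        (∀ t ∈ Ioc (0:ℝ) T, ∀ i j, a t i j = a t j i) →
        (∀ t ∈ Ioc (0:ℝ) T, ∀ ξ : Fin d → ℝ,
          0 ≤ ∑ i, ∑ j, a t i j * ξ i * ξ j) →
        IntegrableOn (aMax a) (Ioc (0:ℝ) T) →
      ∀ (δ : ℝ → ℝ),
        -- `δ t` is the smallest eigenvalue of the symmetric matrix `A(t)`: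
        (∀ t ∈ Ioc (0:ℝ) T,
          (∀ ξ : Fin d → ℝ, δ t * (∑ k, ξ k ^ 2) ≤ ∑ i, ∑ j, a t i j * ξ i * ξ j) ∧
          (∃ ξ : Fin d → ℝ, (∑ k, ξ k ^ 2) = 1 ∧ (∑ i, ∑ j, a t i j * ξ i * ξ j) = δ t)) →
        (∀ᵐ t ∂(volume.restrict (Ioc (0:ℝ) T)), 0 < δ t) →
      ∀ (f u : ℝ → Lp ℝ (ENNReal.ofReal p) (volume : Measure (Fin d → ℝ))),
        AEStronglyMeasurable f (volume.restrict (Ioc (0:ℝ) T)) →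
        IntegrableOn (fun t => ‖f t‖ ^ p * δ t ^ (1 - p)) (Ioc (0:ℝ) T) →
        IsWeakSolution (ENNReal.ofReal p) T a 0 f u →
        ContinuousOn u (Icc (0:ℝ) T) →
        ∃ w : ℝ → Fin d → Fin d → Lp ℝ (ENNReal.ofReal p) (volume : Measure (Fin d → ℝ)),
          (∀ᵐ t ∂(volume.restrict (Ioc (0:ℝ) T)), ∀ i j : Fin d,
            ∀ φ : (Fin d → ℝ) → ℝ, ContDiff ℝ (⊤ : ℕ∞) φ → HasCompactSupport φ →
              (∫ x, u t x * pd i (pd j φ) x) = ∫ x, w t i j x * φ x) ∧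
          (∫ t in Ioc (0:ℝ) T, (∑ i, ∑ j, ‖w t i j‖ ^ p) * δ t) ≤
            N * ∫ t in Ioc (0:ℝ) T, ‖f t‖ ^ p * δ t ^ (1 - p) := by
  have hpq : p.HolderConjugate p.conjExponent := Real.HolderConjugate.conjExponent (by linarith)
  have hp0 : 0 < p := by linarith
  have hq2 : p.conjExponent ≤ 2 := by
    unfold Real.conjExponent
    rw [div_le_iff₀ (by linarith)]; linarith
  set q := p.conjExponent
  have hcM : cM d q ^ p ≠ ⊤ := ENNReal.rpow_ne_top_of_nonneg hp0.le (cM_ne_top d hpq.symm.pos)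
  refine ⟨d * (d * (cM d q ^ p).toReal) + 1, by positivity, ?_⟩
  intro T hT a ha hs _ hI δ hδ hpos f u hf hfi hw hu
  have hA := mk_Cf hd hT ha hs hI hδ
  have hS := mk_Sol hp hT hA hpos hf hfi hw hu
  have hue : ∀ t ∈ Icc 0 T, IccExtend hT.le ((Icc 0 T).domRestrict u) t = u t := fun t ht => by
    rw [IccExtend_of_mem _ _ ht]; rfl
  have hn0 : ∀ᵐ t ∂(volume.restrict (Ioc (0:ℝ) T)), 0 ≤ ‖f t‖ ^ p * δ t ^ (1 - p) := by
    filter_upwards [hpos] with t ht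
    positivity
  have hKe : ∫⁻ t in Ioc 0 T, ENNReal.ofReal (δ' T δ t ^ (1 - p)) * ‖(Ioc 0 T).indicator (hf.mk f) t‖ₑ ^ p = ENNReal.ofReal (∫ t in Ioc (0:ℝ) T, ‖f t‖ ^ p * δ t ^ (1 - p)) := by
    rw [ofReal_integral_eq_lintegral_ofReal hfi hn0]
    refine lintegral_congr_ae ?_
    filter_upwards [hf.ae_eq_mk, hpos, ae_restrict_mem measurableSet_Ioc] with t h1 h2 h3
    rw [indicator_of_mem h3, ← h1]
    simp only [δ', h2, h3, true_and, if_true]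
    rw [mul_comm, ENNReal.ofReal_mul (by positivity), ← ENNReal.ofReal_rpow_of_nonneg (norm_nonneg _) hp0.le, ofReal_norm]
  have hR0 : 0 ≤ ∫ t in Ioc (0:ℝ) T, ‖f t‖ ^ p * δ t ^ (1 - p) := integral_nonneg_of_ae hn0
  set R := ∫ t in Ioc (0:ℝ) T, ‖f t‖ ^ p * δ t ^ (1 - p) with hR
  have hL := fun i j => hS.lim hA hpq hp hq2 (by rw [hKe]; exact ofReal_ne_top) i j
  rw [hKe] at hL
  choose W hW1 hW2 hW3 using hL
  refine ⟨fun t i j => W j i t, ?_, ?_⟩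
  · have h1 : ∀ᵐ t ∂(volume.restrict (Ioc (0:ℝ) T)), ∀ i j, ∀ φ, Ts φ → ∫ x, IccExtend hT.le ((Icc 0 T).domRestrict u) t x * pd j (pd i φ) x = ∫ x, W i j t x * φ x :=
      ae_all_iff.2 fun i => ae_all_iff.2 fun j => hW1 i j
    filter_upwards [h1, ae_restrict_mem measurableSet_Ioc] with t h2 h3 i j φ hφ1 hφ2
    have h4 := h2 j i φ ⟨hφ1, hφ2⟩
    rwa [hue t ⟨h3.1.le, h3.2⟩] at h4
  · by_cases hi : IntegrableOn (fun t => (∑ i, ∑ j, ‖W j i t‖ ^ p) * δ t) (Ioc (0:ℝ) T)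
    · have hn : ∀ᵐ t ∂(volume.restrict (Ioc (0:ℝ) T)), 0 ≤ (∑ i, ∑ j, ‖W j i t‖ ^ p) * δ t := by
        filter_upwards [hpos] with t ht
        positivity
      have hN0 : 0 ≤ (cM d q ^ p).toReal := toReal_nonneg
      have key : ENNReal.ofReal (∫ t in Ioc (0:ℝ) T, (∑ i, ∑ j, ‖W j i t‖ ^ p) * δ t) ≤ ENNReal.ofReal (d * (d * (cM d q ^ p).toReal) * R) := by
        rw [ofReal_integral_eq_lintegral_ofReal hi hn]
        calc ∫⁻ t in Ioc (0:ℝ) T, ENNReal.ofReal ((∑ i, ∑ j, ‖W j i t‖ ^ p) * δ t) = ∫⁻ t in Ioc (0:ℝ) T, ∑ i, ∑ j, ENNReal.ofReal (δ' T δ t) * ‖W j i t‖ₑ ^ p := by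
              refine lintegral_congr_ae ?_
              filter_upwards [hpos, ae_restrict_mem measurableSet_Ioc] with t h2 h3
              simp only [δ', h2, h3, true_and, if_true]
              rw [mul_comm, ENNReal.ofReal_mul h2.le, ENNReal.ofReal_sum_of_nonneg (fun i _ => by positivity), Finset.mul_sum]
              refine Finset.sum_congr rfl fun i _ => ?_
              rw [ENNReal.ofReal_sum_of_nonneg (fun i _ => by positivity), Finset.mul_sum]
              refine Finset.sum_congr rfl fun j _ => ?_
              rw [← ENNReal.ofReal_rpow_of_nonneg (norm_nonneg _) hp0.le, ofReal_norm]
          _ = ∑ i, ∑ j, ∫⁻ t in Ioc (0:ℝ) T, ENNReal.ofReal (δ' T δ t) * ‖W j i t‖ₑ ^ p := by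
              have hm : ∀ i j, AEMeasurable (fun t => ENNReal.ofReal (δ' T δ t) * ‖W j i t‖ₑ ^ p) (volume.restrict (Ioc (0:ℝ) T)) := fun i j => hA.dm.ennreal_ofReal.aemeasurable.mul (hW2 j i)
              rw [lintegral_finsetSum' _ fun i _ => Finset.aemeasurable_fun_sum _ fun j _ => hm i j]
              exact Finset.sum_congr rfl fun i _ => lintegral_finsetSum' _ fun j _ => hm i j
          _ ≤ ∑ i : Fin d, ∑ j : Fin d, cM d q ^ p * ENNReal.ofReal R := Finset.sum_le_sum fun i _ => Finset.sum_le_sum fun j _ => hW3 j i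
          _ = ENNReal.ofReal (d * (d * (cM d q ^ p).toReal) * R) := by
              simp only [Finset.sum_const, Finset.card_univ, Fintype.card_fin, nsmul_eq_mul]
              rw [ENNReal.ofReal_mul (by positivity), ENNReal.ofReal_mul (by positivity), ENNReal.ofReal_mul (by positivity), ofReal_toReal hcM, ofReal_natCast]
              ring
      have := (ENNReal.ofReal_le_ofReal_iff (by positivity)).1 key
      simp only
      linarith
    · rw [integral_undef hi]
      positivity

end
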